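/- Let K be an algebraically closed field of characteristic 0 and n ≥ 1. Let W ⊆ (Kˣ)ⁿ be a Zariski-closed subset of the torus, i.e. W = {y ∈ (Kˣ)ⁿ : p(y₁,…,yₙ) = 0 for all p ∈ I} for some set I of polynomials over K in n variables. Let Γ ≤ (Kˣ)ⁿ be a subgroup of finite rank, i.e. there is a finitely generated subgroup Γ₀ ≤ Γ such that for every g ∈ Γ there is an integer k ≥ 1 with gᵏ ∈ Γ₀. Then there exist a natural number N, elements γ₁,…,γ_N ∈ Γ, and subgroups Λ₁,…,Λ_N of ℤⁿ such that, writing Hᵢ := {y ∈ (Kˣ)ⁿ : ∏ⱼ yⱼ^{mⱼ} = 1 for all m ∈ Λᵢ} (an algebraic subgroup of the torus), one has γᵢ·Hᵢ ⊆ W for each i ≤ N, and W ∩ Γ = ⋃_{i=1}^{N} (γᵢ·Hᵢ ∩ Γ). -/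

import Mathlib

open Real
open Filter (Tendsto atTop eventually_all_finset)
open Finsupp (cons_zero mapDomain single_eq_of_ne single cons)
open Function (Injective update_of_ne update ne_iff)
open Matrix (det det_apply det_mul det_one map_apply mulVec mulVec_mulVec of of_apply one_mulVec mul_apply)
open Module (Basis Dual finrank finrank_fin_fun)
open LinearMap (ker)
open Int (castRingHom)
open Fintype (piFinset mem_piFinset sum_prod_type)
open Nat (cast_nonneg cast_pos cast_sum)
open Equiv (Perm swap)
open IntermediateField (adjoin)
open RingHom (map_det)
open Submodule (mem_span_singleton smul_mem span span_induction span_le span_mono subset_span)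

namespace TorusML

section

open MvPolynomial Finset

/-! ### Weighted `ℓ¹`-norms of multivariate polynomials -/

section WNorm

variable {σ τ R : Type*} [Fintype σ] [Fintype τ] [CommRing R]

/-- The weighted `ℓ¹`-norm of a polynomial with respect to an absolute value of the
coefficient ring and weights of the variables. -/
noncomputable def wnorm (v : AbsoluteValue R ℝ) (w : σ → ℝ) (p : MvPolynomial σ R) : ℝ :=
  ∑ μ ∈ p.support, v (p.coeff μ) * ∏ i, w i ^ μ i

variable (v : AbsoluteValue R ℝ) {w : σ → ℝ}

theorem wnorm_eq_sum {p : MvPolynomial σ R} {T : Finset (σ →₀ ℕ)} (h : p.support ⊆ T) :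
    wnorm v w p = ∑ μ ∈ T, v (p.coeff μ) * ∏ i, w i ^ μ i :=
  sum_subset h fun μ _ hμ => by
    rw [MvPolynomial.notMem_support_iff.1 hμ, map_zero, zero_mul]

theorem wnorm_nonneg (hw : ∀ i, 0 ≤ w i) (p : MvPolynomial σ R) : 0 ≤ wnorm v w p :=
  sum_nonneg fun _ _ => mul_nonneg (v.nonneg _) (prod_nonneg fun i _ => pow_nonneg (hw i) _)

@[simp] theorem wnorm_zero : wnorm v w (0 : MvPolynomial σ R) = 0 := by simp [wnorm]

theorem wnorm_monomial (μ : σ →₀ ℕ) (c : R) : wnorm v w (monomial μ c) = v c * ∏ i, w i ^ μ i := by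
  classical
  rw [wnorm_eq_sum v (T := {μ}) support_monomial_subset]
  rw [sum_singleton, coeff_monomial, if_pos rfl]

theorem wnorm_C (c : R) : wnorm v w (C c) = v c := by
  have := wnorm_monomial v (w := w) 0 c
  simpa using this

theorem wnorm_add_le (hw : ∀ i, 0 ≤ w i) (p q : MvPolynomial σ R) :
    wnorm v w (p + q) ≤ wnorm v w p + wnorm v w q := by
  classical
  rw [wnorm_eq_sum v (T := p.support ∪ q.support) support_add,
    wnorm_eq_sum v (p := p) (T := p.support ∪ q.support) subset_union_left,
    wnorm_eq_sum v (p := q) (T := p.support ∪ q.support) subset_union_right,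
    ← sum_add_distrib]
  refine sum_le_sum fun μ _ => ?_
  rw [← add_mul, coeff_add]
  exact mul_le_mul_of_nonneg_right (v.add_le _ _) (prod_nonneg fun i _ => pow_nonneg (hw i) _)

theorem wnorm_sum_le (hw : ∀ i, 0 ≤ w i) {κ : Type*} (s : Finset κ) (f : κ → MvPolynomial σ R) :
    wnorm v w (∑ k ∈ s, f k) ≤ ∑ k ∈ s, wnorm v w (f k) := by
  classical
  induction s using Finset.induction_on with
  | empty => simp
  | insert a s ha ih =>
    rw [sum_insert ha, sum_insert ha]
    exact (wnorm_add_le v hw _ _).trans (by gcongr)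

theorem wnorm_mul_le (hw : ∀ i, 0 ≤ w i) (p q : MvPolynomial σ R) :
    wnorm v w (p * q) ≤ wnorm v w p * wnorm v w q := by
  conv_lhs => rw [p.as_sum, q.as_sum, sum_mul_sum]
  refine (wnorm_sum_le v hw _ _).trans ?_
  unfold wnorm
  rw [sum_mul_sum]
  refine sum_le_sum fun μ _ => ?_
  refine (wnorm_sum_le v hw _ _).trans (sum_le_sum fun ν _ => ?_)
  rw [monomial_mul, wnorm_monomial, v.map_mul]
  refine le_of_eq ?_
  simp only [Finsupp.add_apply, pow_add, prod_mul_distrib]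
  ring

variable [IsDomain R]

theorem wnorm_one : wnorm v w (1 : MvPolynomial σ R) = 1 := by
  rw [← C_1, wnorm_C, v.map_one]

theorem wnorm_prod_le (hw : ∀ i, 0 ≤ w i) {κ : Type*} (s : Finset κ) (f : κ → MvPolynomial σ R) :
    wnorm v w (∏ k ∈ s, f k) ≤ ∏ k ∈ s, wnorm v w (f k) := by
  classical
  induction s using Finset.induction_on with
  | empty => simp [wnorm_one]
  | insert a s ha ih =>
    rw [prod_insert ha, prod_insert ha]
    exact (wnorm_mul_le v hw _ _).trans (mul_le_mul_of_nonneg_left ih (wnorm_nonneg v hw _))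

theorem wnorm_pow_le (hw : ∀ i, 0 ≤ w i) (p : MvPolynomial σ R) (n : ℕ) :
    wnorm v w (p ^ n) ≤ wnorm v w p ^ n := by
  simpa using wnorm_prod_le v hw (range n) (fun _ => p)

omit [IsDomain R] in
theorem wnorm_coeff_le (hw : ∀ i, 0 ≤ w i) (p : MvPolynomial σ R) (μ : σ →₀ ℕ) :
    v (p.coeff μ) * ∏ i, w i ^ μ i ≤ wnorm v w p := by
  by_cases h : μ ∈ p.support
  · exact single_le_sum (f := fun μ => v (p.coeff μ) * ∏ i, w i ^ μ i)
      (fun ν _ => mul_nonneg (v.nonneg _) (prod_nonneg fun i _ => pow_nonneg (hw i) _)) h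
  · rw [MvPolynomial.notMem_support_iff.1 h, map_zero, zero_mul]
    exact wnorm_nonneg v hw p

/-- Norm of a substitution, monomial by monomial. -/
theorem wnorm_bind_le {w' : τ → ℝ} (hw' : ∀ i, 0 ≤ w' i) (f : σ → MvPolynomial τ R)
    (p : MvPolynomial σ R) (hw : ∀ i, wnorm v w' (f i) ≤ w i) :
    wnorm v w' (bind₁ f p) ≤ wnorm v w p := by
  rw [bind₁, aeval_def, eval₂_eq']
  refine (wnorm_sum_le v hw' _ _).trans (sum_le_sum fun μ _ => ?_)
  refine (wnorm_mul_le v hw' _ _).trans ?_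
  rw [algebraMap_eq, wnorm_C]
  refine mul_le_mul_of_nonneg_left ?_ (v.nonneg _)
  refine (wnorm_prod_le v hw' _ _).trans (Finset.prod_le_prod
    (fun i _ => wnorm_nonneg v hw' _) fun i _ => ?_)
  exact (wnorm_pow_le v hw' _ _).trans (pow_le_pow_left₀ (wnorm_nonneg v hw' _) (hw i) _)

/-- The determinant of a matrix of polynomials of bounded norm. -/
theorem wnorm_det_le (hw : ∀ i, 0 ≤ w i) {n : ℕ} (M : Matrix (Fin n) (Fin n) (MvPolynomial σ R))
    {B : ℝ} (hB : ∀ i j, wnorm v w (M i j) ≤ B) :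
    wnorm v w M.det ≤ n.factorial * B ^ n := by
  classical
  rw [det_apply]
  refine (wnorm_sum_le v hw _ _).trans ?_
  have key : ∀ g : Perm (Fin n), wnorm v w (Perm.sign g • ∏ i, M (g i) i) ≤ B ^ n := by
    intro g
    have h1 : wnorm v w (∏ i, M (g i) i) ≤ B ^ n :=
      (wnorm_prod_le v hw _ _).trans ((Finset.prod_le_prod
        (fun i _ => wnorm_nonneg v hw _) fun i _ => hB _ _).trans (by simp))
    rcases Int.units_eq_one_or (Perm.sign g) with h | h
    · rwa [h, one_smul]
    · rw [h, Units.neg_smul, one_smul]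
      refine le_trans (le_of_eq ?_) h1
      simp [wnorm, v.map_neg]
  refine (sum_le_card_nsmul _ _ _ fun g _ => key g).trans ?_
  simp [Fintype.card_perm]

end WNorm

/-! ### Hasse derivatives and translations -/

section Hasse

variable {σ R : Type*} [Fintype σ] [CommRing R]

/-- The divided partial derivative of multi-order `α`. -/
noncomputable def hasse (α : σ →₀ ℕ) : MvPolynomial σ R →ₗ[R] MvPolynomial σ R :=
  (basisMonomials σ R).constr R fun μ =>
    monomial (μ - α) ((∏ i, (μ i).choose (α i) : ℕ) : R)

theorem hasse_monomial (α μ : σ →₀ ℕ) (c : R) :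
    hasse α (monomial μ c) = monomial (μ - α) (c * (∏ i, (μ i).choose (α i) : ℕ)) := by
  have h : monomial μ c = c • basisMonomials σ R μ := by
    simp [coe_basisMonomials, smul_monomial]
  rw [h, map_smul, hasse, Basis.constr_basis, smul_monomial, smul_eq_mul]

theorem hasse_zero (p : MvPolynomial σ R) : hasse 0 p = p := by
  induction p using MvPolynomial.induction_on' with
  | monomial u a => rw [hasse_monomial]; simp
  | add p q hp hq => simp only [map_add, hp, hq]

theorem hasse_map {S : Type*} [CommRing S] (f : R →+* S) (α : σ →₀ ℕ) (p : MvPolynomial σ R) :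
    hasse α (map f p) = map f (hasse α p) := by
  induction p using MvPolynomial.induction_on' with
  | monomial u a => rw [map_monomial, hasse_monomial, hasse_monomial, map_monomial, f.map_mul,
      map_natCast]
  | add p q hp hq => simp only [map_add, hp, hq]

omit [CommRing R] in
theorem prod_choose_single (u : σ →₀ ℕ) (h : σ) :
    ∏ i, (u i).choose (single h 1 i) = u h := by
  rw [prod_eq_single h (fun i _ hi => by rw [single_eq_of_ne hi, Nat.choose_zero_right])] <;> simp

theorem hasse_mul_X [DecidableEq σ] (α : σ →₀ ℕ) (h : σ) (p : MvPolynomial σ R) :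
    hasse α (p * X h) = hasse α p * X h +
      if α h = 0 then 0 else hasse (α - single h 1) p := by
  induction p using MvPolynomial.induction_on' with
  | monomial u a =>
    have e1 : ∀ i ∈ univ.erase h, (u + (single h 1 : σ →₀ ℕ)) i = u i := fun i hi => by
      simp [Ne.symm (ne_of_mem_erase hi)]
    have e2 : ∀ i ∈ univ.erase h, (α - (single h 1 : σ →₀ ℕ)) i = α i := fun i hi => by
      simp [Ne.symm (ne_of_mem_erase hi)]
    have p1 : ∏ i, ((u + (single h 1 : σ →₀ ℕ)) i).choose (α i) =
        (u h + 1).choose (α h) * ∏ i ∈ univ.erase h, (u i).choose (α i) := by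
      rw [← mul_prod_erase _ _ (mem_univ h), prod_congr rfl fun i hi => by rw [e1 i hi]]
      simp
    have p2 : ∏ i, (u i).choose ((α - (single h 1 : σ →₀ ℕ)) i) =
        (u h).choose (α h - 1) * ∏ i ∈ univ.erase h, (u i).choose (α i) := by
      rw [← mul_prod_erase _ _ (mem_univ h), prod_congr rfl fun i hi => by rw [e2 i hi]]
      simp
    have p3 : ∏ i, (u i).choose (α i) =
        (u h).choose (α h) * ∏ i ∈ univ.erase h, (u i).choose (α i) :=
      (mul_prod_erase _ _ (mem_univ h)).symm
    rw [X, monomial_mul, mul_one, hasse_monomial, hasse_monomial, monomial_mul, mul_one,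
      hasse_monomial, p1, p2, p3]
    by_cases h0 : α h = 0
    · rw [if_pos h0, add_zero, h0, Nat.choose_zero_right, Nat.choose_zero_right]
      have e0 : u + single h 1 - α = u - α + single h 1 := by
        ext i
        by_cases hi : i = h
        · subst hi; simp [h0]
        · simp [Ne.symm hi]
      rw [e0]
    · rw [if_neg h0]
      obtain ⟨k, hk⟩ := Nat.exists_eq_succ_of_ne_zero h0
      rw [hk, Nat.succ_sub_one, Nat.succ_eq_add_one, Nat.choose_succ_succ']
      have e3 : u + single h 1 - α = u - (α - single h 1) := by
        ext i
        by_cases hi : i = h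
        · subst hi; simp [hk]
        · simp [Ne.symm hi]
      rw [← e3]
      by_cases hc : u h < k + 1
      · rw [Nat.choose_eq_zero_of_lt hc]; simp
      · have e4 : u - α + single h 1 = u + single h 1 - α := by
          ext i
          by_cases hi : i = h
          · subst hi; simp [hk]; omega
          · simp [Ne.symm hi]
        rw [e4, ← map_add]
        congr 1
        push_cast
        ring
  | add p q hp hq =>
    rw [add_mul, map_add, hp, hq, map_add]
    split_ifs <;> simp <;> ring

theorem hasse_hasse_single [DecidableEq σ] (α : σ →₀ ℕ) (h : σ) (p : MvPolynomial σ R) :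
    hasse (single h 1) (hasse α p) = ((α h + 1 : ℕ) : R) • hasse (α + single h 1) p := by
  induction p using MvPolynomial.induction_on' with
  | monomial u a =>
    have p1 : ∏ i, (u i).choose ((α + (single h 1 : σ →₀ ℕ)) i) =
        (u h).choose (α h + 1) * ∏ i ∈ univ.erase h, (u i).choose (α i) := by
      rw [← mul_prod_erase _ _ (mem_univ h), prod_congr rfl fun i hi => by
        rw [Finsupp.add_apply, single_eq_of_ne (ne_of_mem_erase hi), add_zero]]
      simp
    have p3 : ∏ i, (u i).choose (α i) =
        (u h).choose (α h) * ∏ i ∈ univ.erase h, (u i).choose (α i) :=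
      (mul_prod_erase _ _ (mem_univ h)).symm
    rw [hasse_monomial, hasse_monomial, hasse_monomial, smul_monomial, p1,
      prod_choose_single, p3, Finsupp.tsub_apply, tsub_tsub, smul_eq_mul]
    congr 1
    have := Nat.choose_succ_right_eq (u h) (α h)
    rw [mul_assoc, ← Nat.cast_mul, mul_left_comm, ← Nat.cast_mul]
    congr 2
    linear_combination (∏ i ∈ univ.erase h, (u i).choose (α i)) * (-this)
  | add p q hp hq => simp only [map_add, hp, hq, smul_add]

/-- Translation of the variables. -/
noncomputable def mvShift (ξ : σ → R) : MvPolynomial σ R →ₐ[R] MvPolynomial σ R :=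
  bind₁ fun i => X i + C (ξ i)

theorem hasse_mvShift (ξ : σ → R) (α : σ →₀ ℕ) (p : MvPolynomial σ R) :
    hasse α (mvShift ξ p) = mvShift ξ (hasse α p) := by
  classical
  induction p using MvPolynomial.induction_on generalizing α with
  | C a =>
    have h1 : ∀ b : R, mvShift ξ (C b : MvPolynomial σ R) = C b := fun b => by simp [mvShift]
    rw [h1, ← monomial_zero', hasse_monomial, zero_tsub, monomial_zero', h1]
  | add p q hp hq => simp only [map_add, hp, hq]
  | mul_X p i ih =>
    have : mvShift ξ (X i : MvPolynomial σ R) = X i + C (ξ i) := by simp [mvShift]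
    rw [map_mul, this, hasse_mul_X, mul_add, map_add, hasse_mul_X, mul_comm _ (C _),
      ← smul_eq_C_mul, map_smul, map_add, map_mul, this, smul_eq_C_mul]
    split_ifs
    · rw [ih, map_zero]; ring
    · rw [ih, ih]; ring

omit [Fintype σ] in
theorem mvShift_injective (ξ : σ → R) : Injective (mvShift ξ) := by
  refine Function.LeftInverse.injective (g := mvShift (-ξ)) fun p => ?_
  have : (mvShift (-ξ)).comp (mvShift ξ) = AlgHom.id R _ := by
    ext i : 1
    simp [mvShift]
  exact DFunLike.congr_fun this p

theorem exists_of_mem_support_hasse {α ν : σ →₀ ℕ} {p : MvPolynomial σ R}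
    (h : ν ∈ (hasse α p).support) : ∃ μ ∈ p.support, ν = μ - α ∧ α ≤ μ := by
  classical
  rw [p.as_sum, map_sum] at h
  obtain ⟨μ, hμ, h'⟩ := mem_biUnion.1 (support_sum h)
  rw [hasse_monomial, support_monomial] at h'
  split_ifs at h' with h0
  · simp at h'
  · refine ⟨μ, hμ, by simpa using h', fun i => ?_⟩
    by_contra hi
    apply h0
    rw [prod_eq_zero (mem_univ i) (Nat.choose_eq_zero_of_lt (not_le.1 hi))]
    simp

theorem degreeOf_hasse_le (α : σ →₀ ℕ) (p : MvPolynomial σ R) (i : σ) :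
    degreeOf i (hasse α p) ≤ degreeOf i p := by
  rw [degreeOf_le_iff]
  intro ν hν
  obtain ⟨μ, hμ, rfl, -⟩ := exists_of_mem_support_hasse hν
  exact (tsub_le_self (a := μ i)).trans (monomial_le_degreeOf i hμ)

theorem wnorm_hasse_le (v : AbsoluteValue R ℝ) (hv : ∀ n : ℕ, v n ≤ n) (α : σ →₀ ℕ)
    (p : MvPolynomial σ R) {d : ℕ} (hd : ∀ μ ∈ p.support, ∑ i, μ i ≤ d) :
    wnorm v 1 (hasse α p) ≤ 2 ^ d * wnorm v 1 p := by
  conv_lhs => rw [p.as_sum, map_sum]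
  refine (wnorm_sum_le v (fun _ => zero_le_one) _ _).trans ?_
  unfold wnorm
  rw [mul_sum]
  refine sum_le_sum fun μ hμ => ?_
  rw [hasse_monomial]
  refine le_of_eq_of_le (wnorm_monomial v _ _) ?_
  simp only [Pi.one_apply, one_pow, prod_const_one, mul_one, v.map_mul]
  rw [mul_comm]
  refine mul_le_mul_of_nonneg_right ((hv _).trans ?_) (v.nonneg _)
  have : ∏ i, (μ i).choose (α i) ≤ 2 ^ d := by
    calc ∏ i, (μ i).choose (α i) ≤ ∏ i, 2 ^ μ i :=
        prod_le_prod' fun i _ => Nat.choose_le_two_pow _ _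
      _ = 2 ^ ∑ i, μ i := prod_pow_eq_pow_sum _ _ _
      _ ≤ 2 ^ d := Nat.pow_le_pow_right (by norm_num) (hd μ hμ)
  exact_mod_cast this

end Hasse

/-! ### Generalised Wronskians -/

section Wronskian

theorem exists_det_ne_zero_of_mem_span {A : Type*} [CommRing A] {n : ℕ}
    (r : Matrix (Fin n) (Fin n) A) (hr : r.det ≠ 0) (T : Fin n → Set (Fin n → A))
    (hT : ∀ i, r i ∈ span A (T i)) :
    ∃ t : Matrix (Fin n) (Fin n) A, (∀ i, t i ∈ T i) ∧ t.det ≠ 0 := by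
  classical
  let D := (Matrix.detRowAlternating (n := Fin n) (R := A))
  suffices h : ∀ S : Finset (Fin n), ∃ t : Fin n → Fin n → A,
      (∀ i ∈ S, t i ∈ T i) ∧ (∀ i ∉ S, t i = r i) ∧ D t ≠ 0 by
    obtain ⟨t, h1, -, h3⟩ := h univ
    exact ⟨t, fun i => h1 i (mem_univ i), h3⟩
  intro S
  induction S using Finset.induction_on with
  | empty => exact ⟨r, by simp, by simp, hr⟩
  | insert i S hi ih =>
    obtain ⟨t, h1, h2, h3⟩ := ih
    let g := D.toMultilinearMap.toLinearMap t i
    have hg : ∀ x, g x = D (update t i x) := fun x => rfl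
    have h4 : ∃ x ∈ T i, g x ≠ 0 := by
      by_contra! hc
      apply h3
      have : span A (T i) ≤ ker g :=
        span_le.2 fun x hx => hc x hx
      have h5 := this (hT i)
      rw [LinearMap.mem_ker, hg, ← h2 i hi, Function.update_eq_self] at h5
      exact h5
    obtain ⟨x, hx, hx'⟩ := h4
    refine ⟨update t i x, fun j hj => ?_, fun j hj => ?_, by rwa [← hg]⟩
    · rcases mem_insert.1 hj with rfl | hj
      · simpa using hx
      · rw [update_of_ne (ne_of_mem_of_not_mem hj hi)]
        exact h1 j hj
    · rw [mem_insert, not_or] at hj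
      rw [update_of_ne hj.1]
      exact h2 j hj.2

variable {m : ℕ} {K : Type*} [Field K]

/-- The diagonal derivation attached to a linear form on exponents. -/
noncomputable def euler (φ : Dual K (Fin m → K)) :
    MvPolynomial (Fin m) K →ₗ[K] MvPolynomial (Fin m) K :=
  (basisMonomials (Fin m) K).constr K fun μ => monomial μ (φ fun h => (μ h : K))

theorem euler_monomial (φ : Dual K (Fin m → K)) (μ : Fin m →₀ ℕ) (c : K) :
    euler φ (monomial μ c) = monomial μ (c * φ fun h => (μ h : K)) := by
  have h : monomial μ c = c • basisMonomials (Fin m) K μ := by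
    simp [coe_basisMonomials, smul_monomial]
  rw [h, map_smul, euler, Basis.constr_basis, smul_monomial, smul_eq_mul]

theorem coeff_euler (φ : Dual K (Fin m → K)) (μ : Fin m →₀ ℕ) (p : MvPolynomial (Fin m) K) :
    coeff μ (euler φ p) = coeff μ p * φ fun h => (μ h : K) := by
  classical
  induction p using MvPolynomial.induction_on' with
  | monomial u a =>
    rw [euler_monomial, coeff_monomial, coeff_monomial]
    split_ifs with h
    · rw [h]
    · simp
  | add p q hp hq => rw [map_add, coeff_add, hp, hq, coeff_add, add_mul]

theorem coeff_euler_iterate (φ : Dual K (Fin m → K)) (μ : Fin m →₀ ℕ)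
    (p : MvPolynomial (Fin m) K) (k : ℕ) :
    coeff μ ((euler φ ^ k) p) = coeff μ p * (φ fun h => (μ h : K)) ^ k := by
  induction k with
  | zero => simp
  | succ k ih => rw [pow_succ', Module.End.mul_apply, coeff_euler, ih]; ring

theorem euler_mul (φ : Dual K (Fin m → K)) (p q : MvPolynomial (Fin m) K) :
    euler φ (p * q) = euler φ p * q + p * euler φ q := by
  induction p using MvPolynomial.induction_on' with
  | monomial u a =>
    induction q using MvPolynomial.induction_on' with
    | monomial v b =>
      have : (fun h => (((u + v) h : ℕ) : K)) =
          (fun h => (u h : K)) + fun h => (v h : K) := by ext h; simp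
      simp only [monomial_mul, euler_monomial, this, map_add φ]
      rw [← map_add (monomial (u + v))]
      congr 1
      ring
    | add p q hp hq => rw [mul_add, map_add, hp, hq, map_add]; ring
  | add p q hp hq => rw [add_mul, map_add, hp, hq, map_add]; ring

theorem euler_eq_sum (φ : Dual K (Fin m → K)) (p : MvPolynomial (Fin m) K) :
    euler φ p = ∑ h, C (φ (Pi.single h 1)) * X h * hasse (single h 1) p := by
  classical
  induction p using MvPolynomial.induction_on' with
  | monomial u a =>
    rw [euler_monomial, LinearMap.pi_apply_eq_sum_univ φ, mul_sum, map_sum]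
    refine sum_congr rfl fun h _ => ?_
    have hs : (fun j => if h = j then (1 : K) else 0) = Pi.single h 1 := by
      ext j; simp [Pi.single_apply, eq_comm]
    rw [hasse_monomial, prod_choose_single, hs, X, C_mul_monomial, monomial_mul, smul_eq_mul]
    by_cases h0 : u h = 0
    · simp [h0]
    · have : single h 1 + (u - single h 1) = u :=
        add_tsub_cancel_of_le (by simpa using Nat.one_le_iff_ne_zero.2 h0)
      rw [this]
      congr 1
      ring
  | add p q hp hq =>
    rw [map_add, hp, hq, ← sum_add_distrib]
    simp only [map_add, mul_add]

theorem euler_pow_mem_span (φ : Dual K (Fin m → K)) (k : ℕ) :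
    (fun p => (euler φ ^ k) p) ∈ span (MvPolynomial (Fin m) K)
      ((fun (α : Fin m →₀ ℕ) (p : MvPolynomial (Fin m) K) => hasse α p) '' {α | ∑ h, α h ≤ k}) := by
  classical
  induction k with
  | zero =>
    refine subset_span ⟨0, by simp, ?_⟩
    ext1 p
    simp [hasse_zero]
  | succ k ih =>
    suffices h : ∀ F ∈ span (MvPolynomial (Fin m) K)
      ((fun (α : Fin m →₀ ℕ) (p : MvPolynomial (Fin m) K) => hasse α p) ''
        {α | ∑ h, α h ≤ k}), (fun p => euler φ (F p)) ∈
      span (MvPolynomial (Fin m) K)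
        ((fun (α : Fin m →₀ ℕ) (p : MvPolynomial (Fin m) K) => hasse α p) ''
          {α | ∑ h, α h ≤ k + 1}) by
      have := h _ ih
      simpa only [pow_succ', Module.End.mul_apply] using this
    intro F hF
    have mono := span_mono (R := MvPolynomial (Fin m) K) (Set.image_mono
      (f := fun (α : Fin m →₀ ℕ) (p : MvPolynomial (Fin m) K) => hasse α p)
      (show {α : Fin m →₀ ℕ | ∑ h, α h ≤ k} ⊆ {α | ∑ h, α h ≤ k + 1} from
        fun α hα => Nat.le_succ_of_le hα))
    induction hF using span_induction with
    | mem F hF =>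
      obtain ⟨α, hα, rfl⟩ := hF
      have : (fun p : MvPolynomial (Fin m) K => euler φ (hasse α p)) =
          ∑ h, (C (φ (Pi.single h 1)) * X h * C ((α h + 1 : ℕ) : K)) •
            fun p => hasse (α + single h 1) p := by
        ext1 p
        rw [euler_eq_sum, Finset.sum_apply]
        refine sum_congr rfl fun h _ => ?_
        rw [hasse_hasse_single, Pi.smul_apply, smul_eq_mul, smul_eq_C_mul]
        ring
      rw [this]
      refine Submodule.sum_mem _ fun h _ => smul_mem _ _ (subset_span ⟨_, ?_, rfl⟩)
      have h1 : ∑ j, α j ≤ k := hα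
      have h2 : ∑ j, (single h 1 : Fin m →₀ ℕ) j = 1 := by
        simp [Finsupp.single_apply]
      simp only [Set.mem_ofPred_eq, Finsupp.add_apply, sum_add_distrib, h2]
      omega
    | zero =>
      simp only [Pi.zero_apply, map_zero]
      exact Submodule.zero_mem _
    | add F G _ _ hF hG =>
      have := Submodule.add_mem _ hF hG
      convert this using 1
      ext1 p
      simp
    | smul a F hF' hF =>
      have h1 := smul_mem _ a hF
      have h2 := smul_mem _ (euler φ a) (mono hF')
      convert Submodule.add_mem _ h2 h1 using 1
      ext1 p
      simp [euler_mul]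

theorem det_euler_ne_zero [Infinite K] {s : ℕ} (f : Fin s → MvPolynomial (Fin m) K)
    (hf : LinearIndependent K f) (φ : Dual K (Fin m → K))
    (hφ : ∀ μ ∈ univ.biUnion fun j => (f j).support, ∀ ν ∈ univ.biUnion fun j => (f j).support,
      (φ fun h => (μ h : K)) = (φ fun h => (ν h : K)) → μ = ν) :
    (of fun i j : Fin s => (euler φ ^ (i : ℕ)) (f j)).det ≠ 0 := by
  classical
  intro h0
  obtain ⟨v, hv0, hv⟩ := Matrix.exists_vecMul_eq_zero_iff.2 h0
  have hV : ∀ p ∈ span K (Set.range f), ∑ i : Fin s, v i * (euler φ ^ (i : ℕ)) p = 0 := by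
    intro p hp
    induction hp using span_induction with
    | mem p hp =>
      obtain ⟨j, rfl⟩ := hp
      simpa [Matrix.vecMul, dotProduct] using congrFun hv j
    | zero => simp
    | add p q _ _ hp hq => simp only [map_add, mul_add, sum_add_distrib, hp, hq, add_zero]
    | smul a p _ hp => simp only [map_smul, mul_smul_comm, ← Finset.smul_sum, hp, smul_zero]
  have hsupp : ∀ p ∈ span K (Set.range f), p.support ⊆ univ.biUnion fun j => (f j).support := by
    intro p hp
    induction hp using span_induction with
    | mem p hp =>
      obtain ⟨j, rfl⟩ := hp
      exact subset_biUnion_of_mem (fun j => (f j).support) (mem_univ j)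
    | zero => simp
    | add p q _ _ hp hq => exact support_add.trans (union_subset hp hq)
    | smul a p _ hp => exact support_smul.trans hp
  let mo : MonomialOrder (Fin m) := MonomialOrder.lex
  obtain ⟨i₁, hi₁⟩ := ne_iff.1 hv0
  obtain ⟨i₀, hi₀, hmax⟩ := exists_max_image (univ.filter fun i => v i ≠ 0)
    (fun i => mo.toSyn (mo.degree (v i))) ⟨i₁, by simpa using hi₁⟩
  have hi₀' : v i₀ ≠ 0 := (mem_filter.1 hi₀).2
  have hmax' : ∀ i, mo.toSyn (mo.degree (v i)) ≤ mo.toSyn (mo.degree (v i₀)) := by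
    intro i
    by_cases hi : v i = 0
    · rw [hi, MonomialOrder.degree_zero, map_zero]
      exact mo.zero_le _
    · exact hmax i (by simpa using hi)
  set M := mo.degree (v i₀) with hM
  let b : Polynomial K := ∑ i : Fin s, Polynomial.monomial (i : ℕ) (coeff M (v i))
  have hb : ∀ i : Fin s, b.coeff i = coeff M (v i) := by
    intro i
    simp only [b, Polynomial.finsetSum_coeff, Polynomial.coeff_monomial]
    rw [sum_eq_single i]
    · simp
    · intro j _ hj
      rw [if_neg (fun h => hj (Fin.ext h))]
    · simp
  have hb0 : b ≠ 0 := by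
    intro h
    have := hb i₀
    rw [h, Polynomial.coeff_zero] at this
    exact (mo.coeff_degree_ne_zero_iff.2 hi₀') this.symm
  have hbdeg : b.natDegree < s := by
    refine (Polynomial.natDegree_lt_iff_degree_lt hb0).2 ?_
    refine (Polynomial.degree_sum_le _ _).trans_lt ?_
    refine (Finset.sup_lt_iff (WithBot.bot_lt_coe s)).2 fun i _ => ?_
    exact (Polynomial.degree_monomial_le _ _).trans_lt (WithBot.coe_lt_coe.2 i.2)
  have hroot : ∀ p ∈ span K (Set.range f), p ≠ 0 →
      (φ fun h => (mo.degree p h : K)) ∈ b.roots.toFinset := by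
    intro p hp hp0
    rw [Multiset.mem_toFinset, Polynomial.mem_roots hb0, Polynomial.IsRoot.def]
    have h1 := congrArg (coeff (M + mo.degree p)) (hV p hp)
    rw [coeff_sum, coeff_zero] at h1
    have h2 : ∀ i : Fin s, coeff (M + mo.degree p) (v i * (euler φ ^ (i : ℕ)) p) =
        coeff M (v i) * (coeff (mo.degree p) p * (φ fun h => (mo.degree p h : K)) ^ (i : ℕ)) := by
      intro i
      rw [MonomialOrder.coeff_mul_of_add_of_degree_le (hmax' i), coeff_euler_iterate]
      rw [MonomialOrder.degree_le_iff]
      intro c hc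
      apply MonomialOrder.le_degree
      rw [mem_support_iff, coeff_euler_iterate] at hc
      exact mem_support_iff.2 (left_ne_zero_of_mul hc)
    simp only [h2] at h1
    have h3 : coeff (mo.degree p) p * b.eval (φ fun h => (mo.degree p h : K)) = 0 := by
      rw [← h1, Polynomial.eval_finsetSum, mul_sum]
      refine sum_congr rfl fun i _ => ?_
      rw [Polynomial.eval_monomial]
      ring
    exact (mul_eq_zero.1 h3).resolve_left (mo.coeff_degree_ne_zero_iff.2 hp0)
  let L : Finset (Fin m →₀ ℕ) := (univ.biUnion fun j => (f j).support).filter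
    fun μ => (φ fun h => (μ h : K)) ∈ b.roots.toFinset
  have hL : L.card < s := by
    refine lt_of_le_of_lt ?_ hbdeg
    refine le_trans ?_ ((Multiset.toFinset_card_le _).trans b.card_roots')
    refine card_le_card_of_injOn (fun μ => φ fun h => (μ h : K))
      (fun μ hμ => (mem_filter.1 hμ).2) fun μ hμ ν hν h => ?_
    exact hφ μ (mem_filter.1 hμ).1 ν (mem_filter.1 hν).1 h
  let g : span K (Set.range f) →ₗ[K] (L → K) :=
    LinearMap.pi fun μ => (lcoeff K μ.1).comp (Submodule.subtype _)
  have hg : Injective g := by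
    rw [← LinearMap.ker_eq_bot, LinearMap.ker_eq_bot']
    rintro ⟨p, hp⟩ hgp
    by_contra hne
    have hp0 : p ≠ 0 := fun h => hne (by simp [h])
    have hmem : mo.degree p ∈ L := mem_filter.2
      ⟨hsupp p hp (mo.degree_mem_support hp0), hroot p hp hp0⟩
    have := congrFun hgp ⟨_, hmem⟩
    exact mo.coeff_degree_ne_zero_iff.2 hp0 (by simpa [g] using this)
  have := LinearMap.finrank_le_finrank_of_injective hg
  rw [finrank_span_eq_card hf, Module.finrank_fintype_fun_eq_card, Fintype.card_fin,
    Fintype.card_coe] at this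
  omega

/-- Linearly independent polynomials have a nonvanishing generalised Wronskian. -/
theorem exists_wronskian_ne_zero [CharZero K] {s : ℕ} (f : Fin s → MvPolynomial (Fin m) K)
    (hf : LinearIndependent K f) :
    ∃ α : Fin s → (Fin m →₀ ℕ), (∀ i, ∑ h, α i h ≤ (i : ℕ)) ∧
      (of fun i j => hasse (α i) (f j)).det ≠ 0 := by
  classical
  obtain ⟨φ, hφ⟩ := Module.exists_dual_forall_apply_ne_zero (K := K)
    (fun x : {x : (univ.biUnion fun j => (f j).support) × (univ.biUnion fun j => (f j).support) //
      x.1 ≠ x.2} => ((fun h => (x.1.1.1 h : K)) - fun h => (x.1.2.1 h : K) : Fin m → K)) (by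
      rintro ⟨⟨μ, ν⟩, hne⟩ h0
      apply hne
      ext h
      have := congrFun (sub_eq_zero.1 h0) h
      exact_mod_cast this)
  have hdet := det_euler_ne_zero f hf φ (by
    intro μ hμ ν hν h
    by_contra hne
    refine hφ ⟨(⟨μ, hμ⟩, ⟨ν, hν⟩), fun h => hne (congrArg Subtype.val h)⟩ ?_
    rw [map_sub]
    exact sub_eq_zero.2 h)
  obtain ⟨t, ht, hdet'⟩ := exists_det_ne_zero_of_mem_span _ hdet
    (fun i => (fun (α : Fin m →₀ ℕ) j => hasse α (f j)) '' {α | ∑ h, α h ≤ (i : ℕ)}) (by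
      intro i
      let ev : (MvPolynomial (Fin m) K → MvPolynomial (Fin m) K) →ₗ[MvPolynomial (Fin m) K]
        (Fin s → MvPolynomial (Fin m) K) := LinearMap.funLeft _ _ f
      have h1 := Submodule.mem_map_of_mem (f := ev) (euler_pow_mem_span φ (i : ℕ))
      rw [Submodule.map_span, Set.image_image] at h1
      exact h1)
  choose α hα hα' using ht
  refine ⟨α, hα, ?_⟩
  convert hdet' using 2
  ext i j : 2
  rw [← hα' i]
  rfl

end Wronskian

/-! ### Products of polynomials in disjoint variables -/

section Disjoint

variable {m : ℕ} {R : Type*} [CommRing R]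

/-- The product of a polynomial in the variables `1, …, m` and one in the variable `0`. -/
noncomputable def dprod (f : MvPolynomial (Fin m) R) (g : MvPolynomial (Fin 1) R) :
    MvPolynomial (Fin (m + 1)) R :=
  rename Fin.succ f * rename (fun _ => 0) g

theorem dprod_add_left (f f' : MvPolynomial (Fin m) R) (g : MvPolynomial (Fin 1) R) :
    dprod (f + f') g = dprod f g + dprod f' g := by simp [dprod, add_mul]

theorem dprod_add_right (f : MvPolynomial (Fin m) R) (g g' : MvPolynomial (Fin 1) R) :
    dprod f (g + g') = dprod f g + dprod f g' := by simp [dprod, mul_add]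

theorem dprod_monomial (α : Fin m →₀ ℕ) (β : Fin 1 →₀ ℕ) (a b : R) :
    dprod (monomial α a) (monomial β b) = monomial (cons (β 0) α) (a * b) := by
  have hβ : mapDomain (fun _ : Fin 1 => (0 : Fin (m + 1))) β = single 0 (β 0) := by
    rw [mapDomain, Finsupp.sum_fintype _ _ (by simp)]
    simp
  have e : mapDomain Fin.succ α +
      mapDomain (fun _ : Fin 1 => (0 : Fin (m + 1))) β = cons (β 0) α := by
    refine Finsupp.ext fun i => ?_
    rw [hβ]
    refine Fin.cases ?_ (fun j => ?_) i
    · rw [Finsupp.add_apply, Finsupp.mapDomain_of_notMem_range _ _ (by simp)]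
      simp
    · rw [Finsupp.add_apply, Finsupp.mapDomain_apply (Fin.succ_injective m)]
      simp
  rw [dprod, rename_monomial, rename_monomial, monomial_mul, e]

theorem coeff_dprod (f : MvPolynomial (Fin m) R) (g : MvPolynomial (Fin 1) R)
    (ν : Fin (m + 1) →₀ ℕ) :
    coeff ν (dprod f g) = coeff ν.tail f * coeff (single 0 (ν 0)) g := by
  classical
  induction f using MvPolynomial.induction_on' with
  | monomial α a =>
    induction g using MvPolynomial.induction_on' with
    | monomial β b =>
      rw [dprod_monomial, coeff_monomial, coeff_monomial, coeff_monomial]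
      have hβ : β = single 0 (ν 0) ↔ β 0 = ν 0 := by
        constructor
        · intro h; rw [h]; simp
        · intro h
          refine Finsupp.ext fun i => ?_
          rw [Subsingleton.elim i 0, h]
          simp
      have : cons (β 0) α = ν ↔ α = ν.tail ∧ β = single 0 (ν 0) := by
        rw [hβ]
        constructor
        · rintro rfl; simp
        · rintro ⟨rfl, h⟩; rw [h, Finsupp.cons_tail]
      rw [if_congr this rfl rfl, ite_and, ite_mul, zero_mul, mul_ite, mul_zero]
    | add p q hp hq => rw [dprod_add_right, coeff_add, hp, hq, coeff_add, mul_add]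
  | add p q hp hq => rw [dprod_add_left, coeff_add, hp, hq, coeff_add, add_mul]

theorem hasse_dprod (α : Fin m →₀ ℕ) (β : Fin 1 →₀ ℕ) (f : MvPolynomial (Fin m) R)
    (g : MvPolynomial (Fin 1) R) :
    hasse (cons (β 0) α) (dprod f g) = dprod (hasse α f) (hasse β g) := by
  induction f using MvPolynomial.induction_on' with
  | monomial u a =>
    induction g using MvPolynomial.induction_on' with
    | monomial v b =>
      rw [dprod_monomial, hasse_monomial, hasse_monomial, hasse_monomial, dprod_monomial]
      have e : cons (v 0) u - cons (β 0) α = cons ((v - β) 0) (u - α) := by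
        refine Finsupp.ext fun i => ?_
        refine Fin.cases ?_ (fun j => ?_) i <;> simp
      rw [e]
      congr 1
      rw [Fin.prod_univ_succ]
      simp
      ring
    | add p q hp hq => simp only [dprod_add_right, map_add, hp, hq]
  | add p q hp hq => simp only [dprod_add_left, map_add, hp, hq]

theorem mvShift_dprod (ξ : Fin m → R) (η : R) (f : MvPolynomial (Fin m) R)
    (g : MvPolynomial (Fin 1) R) :
    mvShift (Fin.cons η ξ) (dprod f g) = dprod (mvShift ξ f) (mvShift (fun _ => η) g) := by
  rw [dprod, map_mul, dprod]
  congr 1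
  · simp only [mvShift, bind₁_rename, rename_bind₁]
    congr 2
    ext1 i
    simp
  · simp only [mvShift, bind₁_rename, rename_bind₁]
    congr 2
    ext1 i
    simp

theorem map_dprod {S : Type*} [CommRing S] (φ : R →+* S) (f : MvPolynomial (Fin m) R)
    (g : MvPolynomial (Fin 1) R) : map φ (dprod f g) = dprod (map φ f) (map φ g) := by
  simp [dprod, map_rename]

theorem det_dprod {s : ℕ} (f : Fin s → Fin s → MvPolynomial (Fin m) R)
    (g : Fin s → Fin s → MvPolynomial (Fin 1) R) :
    (of fun i j => ∑ l, dprod (f i l) (g j l)).det = dprod (of f).det (of g).det := by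
  rw [dprod, ← AlgHom.coe_toRingHom, ← AlgHom.coe_toRingHom, map_det, map_det,
    ← Matrix.det_transpose (RingHom.mapMatrix _ (of g)), ← det_mul]
  congr 1

theorem dprod_ne_zero_iff [IsDomain R] {f : MvPolynomial (Fin m) R}
    {g : MvPolynomial (Fin 1) R} {ν : Fin (m + 1) →₀ ℕ} :
    ν ∈ (dprod f g).support ↔ ν.tail ∈ f.support ∧ single 0 (ν 0) ∈ g.support := by
  simp [coeff_dprod]

/-- A polynomial over a field is a sum of products of linearly independent families. -/
theorem exists_dprod_decomposition {F : Type*} [Field F] (P : MvPolynomial (Fin (m + 1)) F)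
    (hP : P ≠ 0) :
    ∃ (s : ℕ) (f : Fin s → MvPolynomial (Fin m) F) (g : Fin s → MvPolynomial (Fin 1) F),
      0 < s ∧ s ≤ degreeOf 0 P + 1 ∧ LinearIndependent F f ∧ LinearIndependent F g ∧
      P = ∑ l, dprod (f l) (g l) := by
  classical
  set d := degreeOf 0 P with hd
  let pc : Fin (d + 1) → MvPolynomial (Fin m) F := fun j => (finSuccEquiv F m P).coeff j
  set V := span F (Set.range pc) with hV
  have : FiniteDimensional F V := FiniteDimensional.span_of_finite F (Set.finite_range pc)
  let b := Module.finBasis F V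
  have hpc : ∀ j, pc j ∈ V := fun j => subset_span ⟨j, rfl⟩
  let c : Fin (d + 1) → Fin (finrank F V) → F := fun j l => b.repr ⟨pc j, hpc j⟩ l
  have hc : ∀ j, pc j = ∑ l, c j l • (b l : MvPolynomial (Fin m) F) := fun j => by
    have := congrArg V.subtype (b.sum_repr ⟨pc j, hpc j⟩)
    rw [map_sum] at this
    exact this.symm
  have hcoef : ∀ ν, coeff ν P = if h : ν 0 < d + 1 then coeff ν.tail (pc ⟨ν 0, h⟩) else 0 := by
    intro ν
    split_ifs with h
    · rw [finSuccEquiv_coeff_coeff, Finsupp.cons_tail]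
    · by_contra hne
      exact h (Nat.lt_succ_of_le (monomial_le_degreeOf 0 (mem_support_iff.2 hne)))
  let g : Fin (finrank F V) → MvPolynomial (Fin 1) F := fun l =>
    ∑ j : Fin (d + 1), monomial (single 0 (j : ℕ)) (c j l)
  have hsing : ∀ a b : ℕ, (single (0 : Fin 1) a = single 0 b) ↔ a = b :=
    fun a b => (Finsupp.single_injective 0).eq_iff
  have hg : ∀ l (k : ℕ), coeff (single 0 k) (g l) =
      if h : k < d + 1 then c ⟨k, h⟩ l else 0 := by
    intro l k
    simp only [g, coeff_sum, coeff_monomial, hsing]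
    split_ifs with h
    · rw [sum_eq_single ⟨k, h⟩]
      · simp
      · intro j _ hj
        rw [if_neg]
        rintro rfl
        exact hj rfl
      · simp
    · refine sum_eq_zero fun j _ => if_neg ?_
      rintro rfl
      exact h j.2
  refine ⟨_, fun l => (b l : MvPolynomial (Fin m) F), g, ?_, ?_, ?_, ?_, ?_⟩
  · rw [Module.finrank_pos_iff]
    by_contra h
    rw [not_nontrivial_iff_subsingleton] at h
    apply hP
    ext ν
    rw [hcoef, coeff_zero]
    split_ifs with h'
    · have : pc ⟨ν 0, h'⟩ = 0 := congrArg Subtype.val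
        (Subsingleton.elim (⟨pc ⟨ν 0, h'⟩, hpc _⟩ : V) 0)
      rw [this, coeff_zero]
    · rfl
  · refine (finrank_range_le_card pc).trans ?_
    simp
  · exact b.linearIndependent.map' V.subtype (Submodule.ker_subtype V)
  · rw [Fintype.linearIndependent_iff]
    intro a ha
    have h1 : ∀ j, ∑ l, a l * c j l = 0 := by
      intro j
      have := congrArg (coeff (single 0 (j : ℕ))) ha
      simp only [coeff_sum, coeff_smul, hg, dif_pos j.2, coeff_zero, smul_eq_mul] at this
      exact this
    let φ : V →ₗ[F] F := b.constr F a
    have hφ : ∀ x : V, φ x = ∑ l, a l * b.repr x l := fun x => by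
      simp only [φ, Basis.constr_apply_fintype, smul_eq_mul, b.equivFun_apply]
      exact sum_congr rfl fun l _ => mul_comm _ _
    have h2 : ∀ x (hx : x ∈ V), φ ⟨x, hx⟩ = 0 := by
      intro x hx
      induction hx using span_induction with
      | mem x hx => obtain ⟨j, rfl⟩ := hx; rw [hφ]; exact h1 j
      | zero => exact map_zero φ
      | add x y hx hy h h' =>
        have := φ.map_add ⟨x, hx⟩ ⟨y, hy⟩
        rw [h, h', add_zero] at this
        exact this
      | smul r x hx h =>
        have := φ.map_smul r ⟨x, hx⟩
        rw [h, smul_zero] at this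
        exact this
    intro l
    have := h2 (b l) (b l).2
    simpa [φ] using this
  · ext ν
    rw [hcoef, coeff_sum]
    simp only [coeff_dprod, hg]
    split_ifs with h
    · rw [hc, coeff_sum]
      refine sum_congr rfl fun l _ => ?_
      rw [coeff_smul, smul_eq_mul, mul_comm]
    · simp

end Disjoint

/-! ### Weighted orders of vanishing -/

section Order

variable {σ R : Type*} [Fintype σ] [CommRing R]

/-- Every monomial of `p` has weight at least `c`. -/
def OrdGE (w : σ → ℝ) (c : ℝ) (p : MvPolynomial σ R) : Prop :=
  ∀ μ ∈ p.support, c ≤ ∑ i, μ i * w i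

variable {w : σ → ℝ}

theorem OrdGE.sum {κ : Type*} {s : Finset κ} {c : ℝ} {f : κ → MvPolynomial σ R}
    (h : ∀ k ∈ s, OrdGE w c (f k)) : OrdGE w c (∑ k ∈ s, f k) := by
  classical
  intro μ hμ
  obtain ⟨k, hk, h'⟩ := mem_biUnion.1 (support_sum hμ)
  exact h k hk μ h'

theorem OrdGE.mul {c d : ℝ} {p q : MvPolynomial σ R} (hp : OrdGE w c p) (hq : OrdGE w d q) :
    OrdGE w (c + d) (p * q) := by
  classical
  intro μ hμ
  obtain ⟨a, ha, b, hb, rfl⟩ := Finset.mem_add.1 (support_mul p q hμ)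
  have := add_le_add (hp a ha) (hq b hb)
  rw [← sum_add_distrib] at this
  refine this.trans (le_of_eq (sum_congr rfl fun i _ => ?_))
  rw [Finsupp.add_apply]
  push_cast
  ring

theorem OrdGE.one : OrdGE w 0 (1 : MvPolynomial σ R) := by
  classical
  intro μ hμ
  have h0 : μ = 0 := by
    by_contra h
    rw [mem_support_iff, coeff_one, if_neg (Ne.symm h)] at hμ
    exact hμ rfl
  simp [h0]

theorem OrdGE.prod {κ : Type*} {s : Finset κ} {c : κ → ℝ} {f : κ → MvPolynomial σ R}
    (h : ∀ k ∈ s, OrdGE w (c k) (f k)) : OrdGE w (∑ k ∈ s, c k) (∏ k ∈ s, f k) := by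
  classical
  induction s using Finset.induction_on with
  | empty => simpa using OrdGE.one
  | insert a s ha ih =>
    rw [sum_insert ha, prod_insert ha]
    exact (h a (mem_insert_self _ _)).mul (ih fun k hk => h k (mem_insert_of_mem hk))

theorem OrdGE.smul {c : ℝ} {p : MvPolynomial σ R} (hp : OrdGE w c p) {S : Type*}
    [SMulZeroClass S R] (a : S) : OrdGE w c (a • p) :=
  fun μ hμ => hp μ (support_smul hμ)

theorem OrdGE.det {n : ℕ} {M : Matrix (Fin n) (Fin n) (MvPolynomial σ R)} {c : Fin n → ℝ}
    (h : ∀ i j, OrdGE w (c j) (M i j)) : OrdGE w (∑ j, c j) M.det := by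
  rw [det_apply]
  refine OrdGE.sum fun τ _ => ?_
  have := OrdGE.prod (s := univ) (c := c) (f := fun j => M (τ j) j) fun j _ => h _ j
  rw [Units.smul_def]
  exact this.smul _

theorem degreeOf_det_le {n : ℕ} (M : Matrix (Fin n) (Fin n) (MvPolynomial σ R)) (i : σ) {d : ℕ}
    (h : ∀ a b, degreeOf i (M a b) ≤ d) : degreeOf i M.det ≤ n * d := by
  classical
  rw [det_apply]
  refine (degreeOf_sum_le i _ _).trans (Finset.sup_le fun τ _ => ?_)
  have h1 : degreeOf i (∏ j, M (τ j) j) ≤ n * d := by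
    refine (degreeOf_prod_le i _ _).trans ?_
    refine (sum_le_card_nsmul _ _ d fun j _ => h _ _).trans ?_
    simp
  rw [Units.smul_def, degreeOf_le_iff]
  exact fun μ hμ => (monomial_le_degreeOf i (support_smul hμ)).trans h1

end Order

/-! ### The length of an integer polynomial -/

section Length

/-- The usual absolute value on the integers. -/
noncomputable def vZ : AbsoluteValue ℤ ℝ :=
  (AbsoluteValue.abs : AbsoluteValue ℝ ℝ).comp (f := castRingHom ℝ) Int.cast_injective

theorem vZ_apply (n : ℤ) : vZ n = |(n : ℝ)| := rfl

variable {σ τ : Type*} [Fintype σ] [Fintype τ]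

/-- The sum of the absolute values of the coefficients. -/
noncomputable def l1 (p : MvPolynomial σ ℤ) : ℝ := wnorm vZ 1 p

theorem l1_eq (p : MvPolynomial σ ℤ) : l1 p = ∑ μ ∈ p.support, vZ (p.coeff μ) := by
  simp [l1, wnorm]

theorem l1_le_of_coeff {p : MvPolynomial σ ℤ} {q : MvPolynomial τ ℤ} (e : (σ →₀ ℕ) → (τ →₀ ℕ))
    (he : Injective e) (h : ∀ μ, coeff μ p = coeff (e μ) q) : l1 p ≤ l1 q := by
  classical
  rw [l1_eq, l1_eq]
  calc ∑ μ ∈ p.support, vZ (p.coeff μ) = ∑ ν ∈ p.support.image e, vZ (q.coeff ν) := by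
        rw [sum_image fun a _ b _ hab => he hab]
        exact sum_congr rfl fun μ _ => by rw [h]
    _ ≤ _ := by
        refine sum_le_sum_of_subset_of_nonneg ?_ fun _ _ _ => vZ.nonneg _
        intro ν hν
        obtain ⟨μ, hμ, rfl⟩ := mem_image.1 hν
        rw [mem_support_iff] at hμ ⊢
        rwa [← h]

theorem l1_hasse_le (α : σ →₀ ℕ) (p : MvPolynomial σ ℤ) {d : ℕ}
    (hd : ∀ μ ∈ p.support, ∑ i, μ i ≤ d) : l1 (hasse α p) ≤ 2 ^ d * l1 p :=
  wnorm_hasse_le vZ (fun n => by simp [vZ_apply]) α p hd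

end Length

theorem sum_max_ge {s d : ℕ} (hd : 0 < d) (hs : s ≤ d + 1) {I : ℝ} (hI : 0 ≤ I) (hI1 : I ≤ 1) :
    s * I ^ 2 / 8 ≤ ∑ j : Fin s, max 0 (I - j / d) := by
  have hd' : (0 : ℝ) < d := cast_pos.2 hd
  set N := ⌊I * d / 2⌋₊ + 1 with hN
  have hN1 : I * d / 2 ≤ N := by rw [hN]; push_cast; exact (Nat.lt_floor_add_one _).le
  rw [Fin.sum_univ_eq_sum_range (fun j : ℕ => max 0 (I - j / d)) s]
  calc (s : ℝ) * I ^ 2 / 8 ≤ (min s N : ℕ) * (I / 2) := by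
        have hs' : (s : ℝ) ≤ d + 1 := by exact_mod_cast hs
        have hd1 : (1 : ℝ) ≤ d := by exact_mod_cast hd
        have : (s : ℝ) * I / 4 ≤ (min s N : ℕ) := by
          rcases le_total s N with h | h
          · rw [min_eq_left h]
            have : (0 : ℝ) ≤ s := cast_nonneg s
            nlinarith
          · rw [min_eq_right h]
            refine le_trans ?_ hN1
            nlinarith
        nlinarith
    _ = ∑ j ∈ range (min s N), I / 2 := by simp
    _ ≤ ∑ j ∈ range (min s N), max 0 (I - j / d) := by
        refine sum_le_sum fun j hj => le_max_of_le_right ?_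
        have hj' : j < N := lt_of_lt_of_le (mem_range.1 hj) (min_le_right _ _)
        have : (j : ℝ) ≤ I * d / 2 := by
          refine le_trans ?_ (Nat.floor_le (by positivity))
          exact_mod_cast Nat.le_of_lt_succ hj'
        have h2 : (j : ℝ) / d ≤ I / 2 := by
          rw [div_le_iff₀ hd']
          linarith
        linarith
    _ ≤ _ := sum_le_sum_of_subset_of_nonneg
        (range_subset_range.2 (min_le_left _ _)) fun _ _ _ => le_max_left _ _

section Roth

variable {K : Type*} [Field K]

/-- High multiplicity of a root `ξ` of an integer polynomial forces large coefficients. -/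
def LargeHeight (ξ : K) (h : ℝ) : Prop :=
  ∀ U : MvPolynomial (Fin 1) ℤ, U ≠ 0 → ∀ k : ℕ,
    (∀ μ ∈ (mvShift (fun _ => ξ) (map (castRingHom K) U)).support, k ≤ μ 0) →
    exp (h * k) ≤ l1 U

theorem Finsupp_cons_injective_right {m : ℕ} (k : ℕ) :
    Injective fun α : Fin m →₀ ℕ => cons k α := fun a b h => by
  have := congrArg Finsupp.tail h
  simpa using this

theorem Finsupp_cons_injective_left {m : ℕ} (α : Fin m →₀ ℕ) :
    Injective fun k : Fin 1 →₀ ℕ => cons (k 0) α := fun a b h => by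
  have := DFunLike.congr_fun h 0
  refine Finsupp.ext fun i => ?_
  rw [Subsingleton.elim i 0]
  simpa using this

/-- The coefficient of a power of the variable `0`. -/
theorem exists_coeff_left {m : ℕ} (V : MvPolynomial (Fin (m + 1)) ℤ) (k : ℕ) :
    ∃ W : MvPolynomial (Fin m) ℤ, ∀ α, coeff α W = coeff (cons k α) V :=
  ⟨(finSuccEquiv ℤ m V).coeff k, fun _ => finSuccEquiv_coeff_coeff _ _ _⟩

theorem exists_coeff_right {m : ℕ} (V : MvPolynomial (Fin (m + 1)) ℤ) (α : Fin m →₀ ℕ) :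
    ∃ U : MvPolynomial (Fin 1) ℤ, ∀ k, coeff k U = coeff (cons (k 0) α) V := by
  classical
  refine ⟨∑ j ∈ range (degreeOf 0 V + 1), monomial (single 0 j) (coeff (cons j α) V), fun k => ?_⟩
  have hk : ∀ j, single 0 j = k ↔ j = k 0 := fun j => by
    constructor
    · rintro rfl; simp
    · rintro rfl
      refine Finsupp.ext fun i => ?_
      rw [Subsingleton.elim i 0]
      simp
  simp only [coeff_sum, coeff_monomial, hk]
  rw [sum_ite_eq' (range (degreeOf 0 V + 1)) (k 0) (fun j => coeff (cons j α) V)]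
  split_ifs with h
  · rfl
  · by_contra hne
    refine h (mem_range.2 (Nat.lt_succ_of_le ?_))
    have := monomial_le_degreeOf 0 (mem_support_iff.2 (Ne.symm hne))
    simpa using this

/-- The Wronskian of a bihomogeneous decomposition of `p`. -/
theorem exists_wronskian_int {m : ℕ} {p : MvPolynomial (Fin (m + 1)) ℤ} (hp : p ≠ 0) :
    ∃ (s : ℕ) (α : Fin s → Fin m →₀ ℕ) (β : Fin s → ℕ) (f : MvPolynomial (Fin m) ℚ)
      (g : MvPolynomial (Fin 1) ℚ), 0 < s ∧ s ≤ degreeOf 0 p + 1 ∧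
      (∀ i, ∑ h, α i h ≤ (i : ℕ)) ∧ (∀ j, β j ≤ (j : ℕ)) ∧ f ≠ 0 ∧ g ≠ 0 ∧
      map (castRingHom ℚ) (of fun i j : Fin s =>
        hasse (cons (β j) (α i)) p).det = dprod f g := by
  have hinj : Injective (castRingHom ℚ) := Int.cast_injective
  have hP : map (castRingHom ℚ) p ≠ 0 := fun h => hp (map_injective _ hinj (by simpa using h))
  obtain ⟨s, f, g, hs, hs', hf, hg, hfg⟩ := exists_dprod_decomposition _ hP
  obtain ⟨α, hα, hα'⟩ := exists_wronskian_ne_zero f hf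
  obtain ⟨β, hβ, hβ'⟩ := exists_wronskian_ne_zero g hg
  refine ⟨s, α, fun j => β j 0, _, _, hs, ?_, hα, fun j => by simpa using hβ j, hα', hβ', ?_⟩
  · refine hs'.trans (Nat.succ_le_succ ?_)
    rw [degreeOf_le_iff]
    intro ν hν
    exact monomial_le_degreeOf 0 (support_map_subset _ _ hν)
  · rw [← det_dprod, map_det]
    refine congrArg det (Matrix.ext fun i j => ?_)
    simp only [RingHom.mapMatrix_apply, map_apply, of_apply]
    rw [← hasse_map, hfg, _root_.map_sum]
    exact sum_congr rfl fun l _ => hasse_dprod (α i) (β j) (f l) (g l)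

variable [CharZero K]

/-- If `V` is a product over `ℚ`, its slices are proportional to the factors. -/
theorem support_shift_dprod {m : ℕ} {V : MvPolynomial (Fin (m + 1)) ℤ}
    {f : MvPolynomial (Fin m) ℚ} {g : MvPolynomial (Fin 1) ℚ}
    (hf : f ≠ 0) (hg : g ≠ 0)
    (hV : map (castRingHom ℚ) V = dprod f g) (ξ : Fin (m + 1) → K) :
    ∃ (W : MvPolynomial (Fin m) ℤ) (U : MvPolynomial (Fin 1) ℤ) (k : ℕ) (α : Fin m →₀ ℕ),
      W ≠ 0 ∧ U ≠ 0 ∧ (∀ β, coeff β W = coeff (cons k β) V) ∧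
      (∀ l, coeff l U = coeff (cons (l 0) α) V) ∧
      ∀ μ ∈ (mvShift (fun i => ξ i.succ) (map (castRingHom K) W)).support,
        ∀ ν ∈ (mvShift (fun _ => ξ 0) (map (castRingHom K) U)).support,
          cons (ν 0) μ ∈ (mvShift ξ (map (castRingHom K) V)).support := by
  obtain ⟨k, hk⟩ := ne_zero_iff.1 hg
  obtain ⟨α, hα⟩ := ne_zero_iff.1 hf
  obtain ⟨W, hW⟩ := exists_coeff_left V (k 0)
  obtain ⟨U, hU⟩ := exists_coeff_right V α
  have hk0 : single 0 (k 0) = k := Finsupp.ext fun i => by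
    rw [Subsingleton.elim i 0]; simp
  have hl0 : ∀ l : Fin 1 →₀ ℕ, single 0 (l 0) = l := fun l => Finsupp.ext fun i => by
    rw [Subsingleton.elim i 0]; simp
  have hcV : ∀ ν, ((coeff ν V : ℤ) : ℚ) = coeff ν.tail f * coeff (single 0 (ν 0)) g := by
    intro ν
    rw [← coeff_dprod, ← hV, coeff_map]
    rfl
  have hmW : map (castRingHom ℚ) W = C (coeff k g) * f := by
    ext β
    rw [coeff_map, hW, coeff_C_mul, eq_intCast, hcV, Finsupp.tail_cons, cons_zero, hk0, mul_comm]
  have hmU : map (castRingHom ℚ) U = C (coeff α f) * g := by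
    ext l
    rw [coeff_map, hU, coeff_C_mul, eq_intCast, hcV, Finsupp.tail_cons, cons_zero, hl0]
  have hcomp : (algebraMap ℚ K).comp (castRingHom ℚ) = castRingHom K :=
    RingHom.ext_int _ _
  have hKW : map (castRingHom K) W = C (algebraMap ℚ K (coeff k g)) * map (algebraMap ℚ K) f := by
    rw [← hcomp, ← MvPolynomial.map_map, hmW, map_mul, map_C]
  have hKU : map (castRingHom K) U = C (algebraMap ℚ K (coeff α f)) * map (algebraMap ℚ K) g := by
    rw [← hcomp, ← MvPolynomial.map_map, hmU, map_mul, map_C]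
  have hKV : map (castRingHom K) V = dprod (map (algebraMap ℚ K) f) (map (algebraMap ℚ K) g) := by
    rw [← hcomp, ← MvPolynomial.map_map, hV, map_dprod]
  have hC : ∀ {τ : Type} [Fintype τ] (η : τ → K) (a : K) (q : MvPolynomial τ K) (μ : τ →₀ ℕ),
      μ ∈ (mvShift η (C a * q)).support → μ ∈ (mvShift η q).support := by
    intro τ _ η a q μ h
    have h1 : mvShift η (C a * q) = C a * mvShift η q := by simp [mvShift]
    rw [h1, mem_support_iff, coeff_C_mul] at h
    exact mem_support_iff.2 (right_ne_zero_of_mul h)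
  have hne : ∀ {τ : Type} (q : MvPolynomial τ ℤ) (q' : MvPolynomial τ ℚ) (a : ℚ), a ≠ 0 →
      q' ≠ 0 → map (castRingHom ℚ) q = C a * q' → q ≠ 0 := by
    rintro τ q q' a ha hq' h rfl
    rw [map_zero] at h
    exact mul_ne_zero (by simpa using ha) hq' h.symm
  refine ⟨W, U, k 0, α, hne _ _ _ hk hf hmW, hne _ _ _ hα hg hmU, hW, hU, ?_⟩
  intro μ hμ ν hν
  rw [hKW] at hμ
  rw [hKU] at hν
  have hξ : ξ = Fin.cons (ξ 0) (fun i => ξ i.succ) := (Fin.cons_self_tail ξ).symm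
  rw [hKV, hξ, mvShift_dprod, dprod_ne_zero_iff, Finsupp.tail_cons, cons_zero, hl0]
  exact ⟨hC _ _ _ _ hμ, by simpa using hC _ _ _ _ hν⟩

/-- **Roth's lemma**: an integer polynomial with small coefficients cannot vanish to high
weighted order at a point whose coordinates have large heights. -/
theorem roth_lemma (m : ℕ) : ∀ σ : ℝ, 0 < σ → ∃ ω : ℝ, 0 < ω ∧
    ∀ (d : Fin m → ℕ) (ξ : Fin m → K) (h : Fin m → ℝ) (L : ℝ) (p : MvPolynomial (Fin m) ℤ),
    (∀ i, 0 < d i) → (∀ i j, i < j → (d i : ℝ) ≤ ω * d j) → (∀ i, 0 < h i) →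
    (∀ i, LargeHeight (ξ i) (h i)) → (∀ i, (d i : ℝ) ≤ L) → (∀ i, L ≤ ω * d i * h i) →
    p ≠ 0 → (∀ i, degreeOf i p ≤ d i) → l1 p ≤ exp L →
    ¬ OrdGE (fun i => (1 / d i : ℝ)) σ (mvShift ξ (map (castRingHom K) p)) := by
  have hinj : Injective (castRingHom K) := Int.cast_injective
  have hsh : ∀ {τ : Type} [Fintype τ] (η : τ → K) (q : MvPolynomial τ ℤ), q ≠ 0 →
      (mvShift η (map (castRingHom K) q)).support.Nonempty := by
    intro τ _ η q hq
    rw [support_nonempty]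
    intro h0
    rw [← _root_.map_zero (mvShift η)] at h0
    exact hq (map_injective _ hinj ((mvShift_injective η h0).trans (map_zero _).symm))
  induction m with
  | zero =>
    intro σ hσ
    refine ⟨1, one_pos, ?_⟩
    intro d ξ h L p _ _ _ _ _ _ hp _ _ hord
    obtain ⟨μ, hμ⟩ := hsh ξ p hp
    have := hord μ hμ
    simp at this
    linarith
  | succ m ih =>
    intro σ₀ hσ₀
    set σ := min σ₀ 1 with hσdef
    have hσ : 0 < σ := lt_min hσ₀ one_pos
    have hσ1 : σ ≤ 1 := min_le_right _ _
    obtain ⟨ω', hω', H⟩ := ih (σ ^ 2 / 64) (by positivity)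
    set ω := min (min (σ / 2) (σ ^ 2 / 64 / (m + 3))) (ω' / (m + 3)) with hω
    have hm3 : (0 : ℝ) < m + 3 := by positivity
    have hω0 : 0 < ω := lt_min (lt_min (by positivity) (by positivity)) (by positivity)
    have hω1 : ω ≤ σ / 2 := (min_le_left _ _).trans (min_le_left _ _)
    have hω2 : ω * (m + 3) ≤ σ ^ 2 / 64 :=
      (le_div_iff₀ hm3).1 ((min_le_left _ _).trans (min_le_right _ _))
    have hω3 : ω * (m + 3) ≤ ω' := (le_div_iff₀ hm3).1 (min_le_right _ _)
    have hω4 : ω ≤ ω' := le_trans (by nlinarith) hω3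
    refine ⟨ω, hω0, ?_⟩
    intro d ξ h L p hd hdd hh hHH hdL hL hp hdeg hl1 hord₀
    have hord : OrdGE (fun i => (1 / d i : ℝ)) σ (mvShift ξ (map (castRingHom K) p)) :=
      fun μ hμ => (min_le_left _ _).trans (hord₀ μ hμ)
    have hd' : ∀ i, (0 : ℝ) < d i := fun i => cast_pos.2 (hd i)
    have hL0 : 0 < L := (hd' 0).trans_le (hdL 0)
    obtain ⟨s, α, β, f, g, hs, hsd, hα, hβ, hf, hg, hV⟩ := exists_wronskian_int hp
    have hsd' : s ≤ d 0 + 1 := hsd.trans (Nat.succ_le_succ (hdeg 0))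
    have hs0 : (0 : ℝ) < s := cast_pos.2 hs
    have hs1 : (1 : ℝ) ≤ s := by exact_mod_cast hs
    set M : Matrix (Fin s) (Fin s) (MvPolynomial (Fin (m + 1)) ℤ) :=
      of fun i j : Fin s => hasse (cons (β j) (α i)) p with hM
    obtain ⟨W, U, k, α₀, hW, hU, hWc, hUc, hWU⟩ := support_shift_dprod hf hg hV ξ
    -- the height of the Wronskian
    have hVl1 : l1 M.det ≤ exp (s * (m + 3) * L) := by
      have hsum : ∀ μ ∈ p.support, ∑ i, μ i ≤ ∑ i, d i := fun μ hμ =>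
        sum_le_sum fun i _ => (monomial_le_degreeOf i hμ).trans (hdeg i)
      have h2e : (2 : ℝ) ≤ exp 1 := by
        have := add_one_le_exp (1 : ℝ)
        linarith
      have hB : ∀ i j, l1 (M i j) ≤ exp ((m + 2) * L) := fun i j => by
        refine (l1_hasse_le _ _ hsum).trans ?_
        have h1 : (2 : ℝ) ^ (∑ i, d i) ≤ exp ((m + 1) * L) := by
          refine (pow_le_pow_left₀ (by norm_num) h2e _).trans ?_
          rw [← exp_nat_mul, mul_one, exp_le_exp]
          push_cast
          refine (sum_le_sum fun i _ => hdL i).trans ?_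
          simp
        refine (mul_le_mul h1 hl1 (wnorm_nonneg _ (fun _ => zero_le_one) _) (exp_pos _).le).trans ?_
        rw [← exp_add, exp_le_exp]
        linarith
      refine (wnorm_det_le vZ (fun _ => zero_le_one) M hB).trans ?_
      have h1 : (s.factorial : ℝ) ≤ exp (s * L) := by
        have h2 : (s.factorial : ℝ) ≤ (s : ℝ) ^ s := by exact_mod_cast s.factorial_le_pow
        refine h2.trans ?_
        rw [exp_nat_mul]
        refine pow_le_pow_left₀ hs0.le ?_ _
        have h3 : (s : ℝ) ≤ d 0 + 1 := by exact_mod_cast hsd'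
        exact h3.trans ((add_le_add_left (hdL 0) 1).trans (add_one_le_exp L))
      rw [← exp_nat_mul]
      refine (mul_le_mul_of_nonneg_right h1 (exp_pos _).le).trans ?_
      rw [← exp_add, exp_le_exp]
      linarith
    have hVdeg : ∀ i, degreeOf i M.det ≤ s * d i := fun i =>
      degreeOf_det_le M i fun a b => (degreeOf_hasse_le _ _ _).trans (hdeg i)
    -- the induction hypothesis
    have hWl1 : l1 W ≤ exp (s * (m + 3) * L) :=
      (l1_le_of_coeff _ (Finsupp_cons_injective_right k) hWc).trans hVl1
    have hUl1 : l1 U ≤ exp (s * (m + 3) * L) :=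
      (l1_le_of_coeff _ (Finsupp_cons_injective_left α₀) hUc).trans hVl1
    have hWord := H (fun i => s * d i.succ) (fun i => ξ i.succ) (fun i => h i.succ)
      (s * (m + 3) * L) W (fun i => Nat.mul_pos hs (hd _))
      (fun i j hij => by
        have := hdd i.succ j.succ (Fin.succ_lt_succ_iff.2 hij)
        push_cast
        have h2 : ω * d j.succ ≤ ω' * d j.succ := mul_le_mul_of_nonneg_right hω4 (hd' _).le
        nlinarith)
      (fun i => hh _) (fun i => hHH _)
      (fun i => by
        push_cast
        have := hdL i.succ
        have h2 : (0 : ℝ) ≤ m := cast_nonneg m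
        have h3 : L ≤ (m + 3) * L := by nlinarith
        rw [mul_assoc]
        exact mul_le_mul_of_nonneg_left (this.trans h3) hs0.le)
      (fun i => by
        push_cast
        have h1 := mul_le_mul_of_nonneg_left (hL i.succ) hm3.le
        have h2 : (m + 3) * (ω * d i.succ * h i.succ) ≤ ω' * (d i.succ * h i.succ) := by
          have := mul_le_mul_of_nonneg_right hω3 (mul_nonneg (hd' i.succ).le (hh i.succ).le)
          linarith
        have := mul_le_mul_of_nonneg_left (h1.trans h2) hs0.le
        linarith)
      hW
      (fun i => by
        rw [degreeOf_le_iff]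
        intro μ hμ
        have h1 : cons k μ ∈ M.det.support := by
          rw [mem_support_iff] at hμ ⊢
          rwa [← hWc]
        have := (monomial_le_degreeOf i.succ h1).trans (hVdeg _)
        simpa using this)
      hWl1
    unfold OrdGE at hWord
    push Not at hWord
    obtain ⟨μ, hμ, hμw⟩ := hWord
    -- the polynomial in one variable
    obtain ⟨ν, hν, hνmin⟩ := exists_min_image _ (fun ν => ν 0) (hsh (fun _ => ξ 0) U hU)
    have hν0 : (ν 0 : ℝ) ≤ s * (σ ^ 2 / 64) * d 0 := by
      have h1 := (hHH 0 U hU (ν 0) hνmin).trans hUl1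
      rw [exp_le_exp] at h1
      have h2 := mul_le_mul_of_nonneg_left (hL 0) (mul_pos hs0 hm3).le
      have h3 : s * (ω * (m + 3)) * (d 0 * h 0) ≤ s * (σ ^ 2 / 64) * (d 0 * h 0) :=
        mul_le_mul_of_nonneg_right (mul_le_mul_of_nonneg_left hω2 hs0.le)
          (mul_pos (hd' 0) (hh 0)).le
      have h4 : h 0 * ν 0 ≤ h 0 * (s * (σ ^ 2 / 64) * d 0) := by linarith
      exact le_of_mul_le_mul_left h4 (hh 0)
    have hmem := hWU μ hμ ν hν
    -- the order of vanishing of the Wronskian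
    have hVord : OrdGE (fun i => (1 / d i : ℝ)) (∑ j : Fin s, max 0 (σ / 2 - j / d 0))
        (mvShift ξ (map (castRingHom K) M.det)) := by
      rw [map_det, ← AlgHom.coe_toRingHom, map_det]
      refine OrdGE.det fun i j => ?_
      simp only [RingHom.mapMatrix_apply, map_apply, hM, of_apply]
      rw [AlgHom.coe_toRingHom, ← hasse_map, ← hasse_mvShift]
      intro κ hκ
      obtain ⟨ρ, hρ, rfl, hle⟩ := exists_of_mem_support_hasse hκ
      refine max_le (sum_nonneg fun i _ => by positivity) ?_
      have h1 := hord ρ hρ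
      have h2 : ∑ l, (cons (β j) (α i) l : ℝ) * (1 / d l : ℝ) ≤ j / d 0 + σ / 2 := by
        rw [Fin.sum_univ_succ]
        simp only [cons_zero, Finsupp.cons_succ]
        refine add_le_add ?_ ?_
        · rw [mul_one_div]
          exact div_le_div_of_nonneg_right (by exact_mod_cast hβ j) (hd' 0).le
        · refine le_trans ?_ hω1
          have h3 : ∀ l : Fin m, (α i l : ℝ) * (1 / d l.succ) ≤ α i l * (ω / d 0) := fun l => by
            refine mul_le_mul_of_nonneg_left ?_ (cast_nonneg _)
            rw [div_le_div_iff₀ (hd' _) (hd' _), one_mul]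
            exact hdd 0 l.succ (Fin.succ_pos l)
          refine (sum_le_sum fun l _ => h3 l).trans ?_
          rw [← sum_mul]
          have h4 : (∑ l, (α i l : ℝ)) ≤ d 0 := by
            have := (hα i).trans (Nat.le_of_lt_succ (i.2.trans_le hsd'))
            exact_mod_cast this
          rw [← mul_div_assoc, div_le_iff₀ (hd' 0), mul_comm ω]
          exact mul_le_mul_of_nonneg_right h4 hω0.le
      have h3 : ∑ l, ((ρ - cons (β j) (α i)) l : ℝ) * (1 / d l : ℝ) =
          ∑ l, (ρ l : ℝ) * (1 / d l : ℝ) - ∑ l, (cons (β j) (α i) l : ℝ) * (1 / d l : ℝ) := by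
        rw [← sum_sub_distrib]
        refine sum_congr rfl fun l _ => ?_
        rw [Finsupp.tsub_apply, Nat.cast_sub (hle l), sub_mul]
      rw [h3]
      linarith
    have hlow := hVord _ hmem
    have hsum := sum_max_ge (hd 0) hsd' (by positivity : 0 ≤ σ / 2) (by linarith)
    rw [Fin.sum_univ_succ] at hlow
    simp only [cons_zero, Finsupp.cons_succ] at hlow
    have hA : (ν 0 : ℝ) * (1 / d 0) ≤ s * (σ ^ 2 / 64) := by
      rw [mul_one_div, div_le_iff₀ (hd' 0)]
      exact hν0
    have hB : ∑ i, (μ i : ℝ) * (1 / d i.succ) < s * (σ ^ 2 / 64) := by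
      have h1 := mul_lt_mul_of_pos_left hμw hs0
      rw [mul_sum] at h1
      refine lt_of_eq_of_lt (sum_congr rfl fun l _ => ?_) h1
      have := (hd' l.succ).ne'
      push_cast
      field_simp
    linarith

end Roth

end

section Mahler

open Polynomial

theorem one_le_mahlerMeasure_map_int {p : ℤ[X]} (hp : p ≠ 0) :
    1 ≤ (p.map (castRingHom ℂ)).mahlerMeasure := by
  refine one_le_mahlerMeasure_of_one_le_norm_leadingCoeff ?_
  rw [leadingCoeff_map_of_injective (RingHom.injective_int _)]
  have h1 : (1 : ℝ) ≤ |((p.leadingCoeff : ℤ) : ℝ)| := by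
    rw [← Int.cast_abs]
    exact_mod_cast Int.one_le_abs (leadingCoeff_ne_zero.2 hp)
  simpa using h1

theorem mahlerMeasure_pow' (p : ℂ[X]) (n : ℕ) : (p ^ n).mahlerMeasure = p.mahlerMeasure ^ n := by
  induction n with
  | zero => simp
  | succ n ih => rw [pow_succ, mahlerMeasure_mul, ih, pow_succ]

/-- A primitive integer multiple of a nonzero rational polynomial. -/
theorem exists_primitive_map_eq {q : ℚ[X]} (hq : q ≠ 0) :
    ∃ (A : ℤ[X]) (c : ℚ), c ≠ 0 ∧ A.IsPrimitive ∧ A.map (castRingHom ℚ) = C c * q := by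
  obtain ⟨b, hb, h⟩ := IsLocalization.integerNormalization_spec (nonZeroDivisors ℤ) q
  set B := IsLocalization.integerNormalization (nonZeroDivisors ℤ) q
  have hb0 : (b : ℚ) ≠ 0 := Int.cast_ne_zero.2 (nonZeroDivisors.ne_zero hb)
  have hBq : B.map (castRingHom ℚ) = C (b : ℚ) * q := by
    rw [← algebraMap_int_eq, h, zsmul_eq_mul]
    simp
  have hB : B ≠ 0 := by
    intro h0
    rw [h0, Polynomial.map_zero] at hBq
    exact mul_ne_zero (C_ne_zero.2 hb0) hq hBq.symm
  have hc : (B.content : ℚ) ≠ 0 := Int.cast_ne_zero.2 (content_eq_zero_iff.not.2 hB)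
  refine ⟨B.primPart, (b : ℚ) / B.content, div_ne_zero hb0 hc, B.isPrimitive_primPart, ?_⟩
  have h1 : C (B.content : ℚ) * B.primPart.map (castRingHom ℚ) = C (b : ℚ) * q := by
    rw [← hBq]
    conv_rhs => rw [B.eq_C_content_mul_primPart]
    simp
  have h2 : C (B.content : ℚ) ≠ 0 := C_ne_zero.2 hc
  apply mul_left_cancel₀ h2
  rw [h1, ← mul_assoc, ← C_mul, mul_div_cancel₀ _ hc]

variable {K : Type*} [Field K] [CharZero K] [Algebra ℚ K] [FiniteDimensional ℚ K]

theorem exp_le_of_primitive_minpoly {ξ : K} {h : ℝ}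
    (hξ : ∀ A : ℤ[X], A ≠ 0 → A.natDegree ≤ finrank ℚ K → aeval ξ A = 0 →
      ∃ i, 2 ^ finrank ℚ K * exp h ≤ |(A.coeff i : ℝ)|)
    {U : ℤ[X]} (hU : U ≠ 0) {k : ℕ} (hk : (X - C ξ) ^ k ∣ U.map (castRingHom K)) :
    exp (h * k) ≤ (U.map (castRingHom ℂ)).mahlerMeasure := by
  classical
  have hint : IsIntegral ℚ ξ := Algebra.IsIntegral.isIntegral ξ
  obtain ⟨A, c, hc, hA, hAq⟩ := exists_primitive_map_eq (minpoly.ne_zero hint)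
  have hA0 : A ≠ 0 := hA.ne_zero
  have hcomp : (algebraMap ℚ K).comp (castRingHom ℚ) = castRingHom K :=
    RingHom.ext_int _ _
  have hKA : ∀ p : ℤ[X], p.map (castRingHom K) =
      (p.map (castRingHom ℚ)).map (algebraMap ℚ K) := fun p => by
    rw [Polynomial.map_map, hcomp]
  have haev : ∀ p : ℤ[X], aeval ξ p = aeval ξ (p.map (castRingHom ℚ)) := fun p => by
    rw [aeval_def, aeval_def, eval₂_map]
    congr 1
    exact RingHom.ext_int _ _
  have hAdeg : A.natDegree ≤ finrank ℚ K := by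
    rw [← natDegree_map_eq_of_injective (RingHom.injective_int (castRingHom ℚ)), hAq,
      natDegree_C_mul hc]
    exact minpoly.natDegree_le ξ
  have hAξ : aeval ξ A = 0 := by rw [haev, hAq]; simp
  have hM : exp h ≤ (A.map (castRingHom ℂ)).mahlerMeasure := by
    obtain ⟨i, hi⟩ := hξ A hA0 hAdeg hAξ
    have h1 := norm_coeff_le_choose_mul_mahlerMeasure i (A.map (castRingHom ℂ))
    rw [coeff_map, natDegree_map_eq_of_injective (RingHom.injective_int (castRingHom ℂ))] at h1
    have h2 : ‖(castRingHom ℂ) (A.coeff i)‖ = |(A.coeff i : ℝ)| := by simp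
    rw [h2] at h1
    have h3 : ((A.natDegree.choose i : ℕ) : ℝ) ≤ 2 ^ finrank ℚ K := by
      have : A.natDegree.choose i ≤ 2 ^ finrank ℚ K :=
        (Nat.choose_le_two_pow _ _).trans (Nat.pow_le_pow_right (by norm_num) hAdeg)
      exact_mod_cast this
    have h4 := hi.trans (h1.trans (mul_le_mul_of_nonneg_right h3 (mahlerMeasure_nonneg _)))
    exact le_of_mul_le_mul_left h4 (by positivity)
  have hunit : ¬ IsUnit A := by
    intro hu
    have h1 : IsUnit (A.map (castRingHom ℚ)) := hu.map (mapRingHom (castRingHom ℚ))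
    rw [hAq] at h1
    exact minpoly.not_isUnit ℚ ξ (isUnit_of_mul_isUnit_right h1)
  obtain ⟨V, hV, hAV⟩ :=
    (FiniteMultiplicity.of_not_isUnit hunit hU).exists_eq_pow_mul_and_not_dvd
  set j := multiplicity A U
  have hV0 : V ≠ 0 := by rintro rfl; simp at hAV
  have hVξ : ¬ (V.map (castRingHom K)).IsRoot ξ := by
    intro hr
    apply hAV
    rw [IsPrimitive.Int.dvd_iff_map_cast_dvd_map_cast _ _ hA, hAq]
    have h1 : minpoly ℚ ξ ∣ V.map (castRingHom ℚ) := by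
      refine minpoly.dvd ℚ ξ ?_
      rw [aeval_def, ← eval_map, ← hKA]
      exact hr
    exact (C_mul_dvd hc).2 h1
  have hinjK : Injective (castRingHom K) := RingHom.injective_int _
  have hkj : k ≤ j := by
    have hUK : U.map (castRingHom K) ≠ 0 := (Polynomial.map_ne_zero_iff hinjK).2 hU
    have hAK : A.map (castRingHom K) ≠ 0 := (Polynomial.map_ne_zero_iff hinjK).2 hA0
    have h1 := (le_rootMultiplicity_iff hUK).2 hk
    rw [hV, Polynomial.map_mul, Polynomial.map_pow, rootMultiplicity_mul, ← count_roots,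
      roots_pow, Multiset.count_nsmul, count_roots, rootMultiplicity_eq_zero hVξ, add_zero] at h1
    · have h2 : rootMultiplicity ξ (A.map (castRingHom K)) ≤ 1 := by
        refine rootMultiplicity_le_one_of_separable ?_ ξ
        rw [hKA, hAq]
        refine Separable.map ?_
        have h3 : IsUnit (C c) := isUnit_C.2 hc.isUnit
        exact (minpoly.irreducible hint).separable.unit_mul h3
      exact h1.trans (by nlinarith)
    · rw [← Polynomial.map_pow, ← Polynomial.map_mul, ← hV]
      exact hUK
  rw [hV, Polynomial.map_mul, Polynomial.map_pow, mahlerMeasure_mul, mahlerMeasure_pow']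
  have hA1 := one_le_mahlerMeasure_map_int hA0
  calc exp (h * k) = exp h ^ k := by rw [← exp_nat_mul, mul_comm]
    _ ≤ (A.map (castRingHom ℂ)).mahlerMeasure ^ k :=
        pow_le_pow_left₀ (exp_pos _).le hM _
    _ ≤ (A.map (castRingHom ℂ)).mahlerMeasure ^ j := pow_le_pow_right₀ hA1 hkj
    _ ≤ _ := le_mul_of_one_le_right (by positivity) (one_le_mahlerMeasure_map_int hV0)

theorem largeHeight_of_coeff {ξ : K} {h : ℝ}
    (hξ : ∀ A : ℤ[X], A ≠ 0 → A.natDegree ≤ finrank ℚ K → aeval ξ A = 0 →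
      ∃ i, 2 ^ finrank ℚ K * exp h ≤ |(A.coeff i : ℝ)|) : LargeHeight ξ h := by
  classical
  intro U hU k hk
  let e := MvPolynomial.uniqueAlgEquiv ℤ (Fin 1)
  have hcoef : ∀ n, (e U).coeff n = U.coeff (single 0 n) := fun n =>
    MvPolynomial.coeff_uniqueAlgEquiv ℤ U n
  have heU : e U ≠ 0 := fun h0 => hU (e.injective (h0.trans (map_zero e).symm))
  have hdvd : (X - C ξ) ^ k ∣ (e U).map (castRingHom K) := by
    have h1 : (e U).map (castRingHom K) = MvPolynomial.aeval (fun _ => X - C ξ)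
        (mvShift (fun _ => ξ) (MvPolynomial.map (castRingHom K) U)) := by
      rw [mvShift, MvPolynomial.aeval_bind₁]
      have h2 : (fun i : Fin 1 => (MvPolynomial.aeval fun _ : Fin 1 => (X - C ξ : K[X]))
          (MvPolynomial.X i + MvPolynomial.C ξ : MvPolynomial (Fin 1) K)) = fun _ => X := by
        funext i
        simp
      rw [h2]
      have h3 : ∀ p : MvPolynomial (Fin 1) ℤ, (e p).map (castRingHom K) =
          MvPolynomial.aeval (fun _ => X) (MvPolynomial.map (castRingHom K) p) := fun p => by
        induction p using MvPolynomial.induction_on' with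
        | monomial u a =>
          simp only [e, MvPolynomial.uniqueAlgEquiv_monomial, MvPolynomial.map_monomial,
            Polynomial.map_monomial, MvPolynomial.aeval_monomial]
          rw [Finsupp.prod_fintype _ _ (by simp)]
          simp [← C_mul_X_pow_eq_monomial]
        | add p q hp hq => rw [map_add, Polynomial.map_add, hp, hq, map_add, map_add]
      exact h3 U
    rw [h1, MvPolynomial.aeval_def, MvPolynomial.eval₂_eq']
    refine Finset.dvd_sum fun μ hμ => Dvd.dvd.mul_left ?_ _
    rw [Fin.prod_univ_one]
    exact pow_dvd_pow _ (hk μ hμ)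
  refine (exp_le_of_primitive_minpoly hξ heU hdvd).trans ?_
  refine (mahlerMeasure_le_sum_norm_coeff _).trans ?_
  rw [Polynomial.sum_over_range' _ (by simp) ((e U).natDegree + 1)
    (Nat.lt_succ_of_le natDegree_map_le), l1_eq]
  have h2 : ∀ n, ‖((e U).map (castRingHom ℂ)).coeff n‖ = vZ (U.coeff (single 0 n)) := fun n => by
    rw [coeff_map, hcoef, vZ_apply]
    simp
  simp only [h2]
  rw [← Finset.sum_image (s := Finset.range ((e U).natDegree + 1))
    (g := fun n => (single 0 n : Fin 1 →₀ ℕ)) (f := fun μ => vZ (U.coeff μ))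
    fun a _ b _ hab => Finsupp.single_injective 0 hab]
  rw [← Finset.sum_filter_ne_zero]
  refine Finset.sum_le_sum_of_subset_of_nonneg (fun μ hμ => ?_) fun _ _ _ => vZ.nonneg _
  rw [MvPolynomial.mem_support_iff]
  rintro h0
  exact (Finset.mem_filter.1 hμ).2 (by rw [h0, map_zero])

end Mahler

section

open Finset

/-- A ring of `S`-integers `O` in a field `K`, with the absolute values in `S` and the two
quantitative facts (existence of many points in boxes, small entropy) used by the geometry of
numbers. -/
structure SInt (K : Type*) [Field K] (S : Type*) [Fintype S] where
  abv : S → AbsoluteValue K ℝ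
  wt : S → ℕ
  wt_pos : ∀ v, 0 < wt v
  O : Subring K
  mem_of_isIntegral : ∀ x, IsIntegral ℤ x → x ∈ O
  sum_log_nonneg : ∀ x ∈ O, x ≠ 0 → 0 ≤ ∑ v, (wt v : ℝ) * log (abv v x)
  exists_points : ∃ c : ℝ, 0 < c ∧ ∀ R : S → ℝ, (∀ v, 0 < R v) → ∃ F : Finset K,
    (∀ x ∈ F, x ∈ O ∧ ∀ v, abv v x ≤ R v) ∧ c * ∏ v, R v ^ wt v ≤ F.card
  exists_coloring : ∃ C : ℝ, 0 < C ∧ ∀ v (r R : ℝ), 0 < r → r ≤ R → ∃ (k : ℕ) (f : K → Fin k),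
    (k : ℝ) ≤ C * (R / r) ^ wt v ∧ ∀ x y, abv v x ≤ R → abv v y ≤ R → f x = f y → abv v (x - y) ≤ r

namespace SInt

variable {K : Type*} [Field K] {S : Type*} [Fintype S] (s : SInt K S)

/-- The total weight of the places. -/
def deg : ℕ := ∑ v, s.wt v

lemma deg_pos [Nonempty S] : 0 < s.deg :=
  sum_pos (fun v _ => s.wt_pos v) univ_nonempty

lemma int_mem (n : ℤ) : (n : K) ∈ s.O := intCast_mem s.O n

lemma sum_nonneg_of_le_exp {x : K} (hx : x ∈ s.O) (h0 : x ≠ 0) {E : S → ℝ}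
    (hE : ∀ v, s.abv v x ≤ exp (E v)) : 0 ≤ ∑ v, (s.wt v : ℝ) * E v := by
  refine (s.sum_log_nonneg x hx h0).trans (sum_le_sum fun v _ => ?_)
  refine mul_le_mul_of_nonneg_left ?_ (cast_nonneg _)
  exact (log_le_iff_le_exp ((s.abv v).pos h0)).2 (hE v)

lemma eq_zero_of_le {x : K} (hx : x ∈ s.O) {ρ : S → ℝ} (hρ : ∀ v, 0 < ρ v)
    (hle : ∀ v, s.abv v x ≤ ρ v) (h1 : ∏ v, ρ v ^ s.wt v < 1) : x = 0 := by
  by_contra h0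
  have := s.sum_nonneg_of_le_exp hx h0 (E := fun v => log (ρ v))
    (fun v => by rw [exp_log (hρ v)]; exact hle v)
  have h2 : log (∏ v, ρ v ^ s.wt v) < 0 :=
    log_neg (prod_pos fun v _ => pow_pos (hρ v) _) h1
  rw [log_prod (fun v _ => (pow_pos (hρ v) _).ne')] at h2
  simp only [log_pow] at h2
  linarith

lemma abv_intCast_le (v : S) (n : ℤ) : s.abv v (n : K) ≤ |(n : ℝ)| := by
  have hn : ∀ k : ℕ, s.abv v (k : K) ≤ k := by
    intro k
    induction k with
    | zero => simp
    | succ k ih =>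
      push_cast
      refine ((s.abv v).add_le _ _).trans ?_
      rw [(s.abv v).map_one]
      linarith
  obtain ⟨k, rfl | rfl⟩ := n.eq_nat_or_neg
  · simpa using hn k
  · simpa using hn k

lemma sum_nonneg_of_eventually {𝒰 : Filter ℕ} [𝒰.NeBot] {q : ℕ → ℝ}
    (hq : Tendsto q 𝒰 atTop) (e : S → ℝ) (C M : ℝ)
    (h : ∀ ε > 0, ∀ᶠ j in 𝒰, ∃ x ∈ s.O, x ≠ 0 ∧ ∀ v, s.abv v x ≤ C * exp ((e v + M * ε) * q j)) :
    0 ≤ ∑ v, (s.wt v : ℝ) * e v := by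
  by_contra! hneg
  set E₀ := ∑ v, (s.wt v : ℝ) * e v with hS
  set D : ℝ := (s.deg : ℝ) with hD
  have hD0 : 0 ≤ D := cast_nonneg _
  set C' := max C 1
  have hC' : 0 < C' := lt_of_lt_of_le one_pos (le_max_right _ _)
  obtain ⟨ε, hε, hε'⟩ : ∃ ε > 0, D * (|M| * ε) < -E₀ / 2 := by
    refine ⟨(-E₀ / 2) / (D * |M| + 1), div_pos (by linarith) (by positivity), ?_⟩
    rw [← mul_assoc, mul_div_assoc', div_lt_iff₀ (by positivity)]
    nlinarith
  have hlarge : ∀ᶠ j in 𝒰, D * log C' / (-E₀ / 2) + 1 ≤ q j ∧ 1 ≤ q j :=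
    (hq.eventually_ge_atTop _).and (hq.eventually_ge_atTop _)
  obtain ⟨j, ⟨x, hxO, hx0, hx⟩, hj, hj1⟩ := ((h ε hε).and hlarge).exists
  have h1 := s.sum_nonneg_of_le_exp hxO hx0
    (E := fun v => log C' + (e v + M * ε) * q j) (fun v => by
      rw [exp_add, exp_log hC']
      exact (hx v).trans (by gcongr; exact le_max_left _ _))
  have h2 : ∑ v, (s.wt v : ℝ) * (log C' + (e v + M * ε) * q j)
      = D * log C' + E₀ * q j + D * (M * ε) * q j := by
    simp only [hD, hS, deg, cast_sum, sum_mul, ← sum_add_distrib]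
    exact sum_congr rfl fun v _ => by ring
  rw [h2] at h1
  have h3 : D * (M * ε) ≤ D * (|M| * ε) := by gcongr; exact le_abs_self M
  have h4 : D * log C' / (-E₀ / 2) < q j := by linarith
  rw [div_lt_iff₀ (by linarith)] at h4
  nlinarith

/-- A simultaneous Dirichlet approximation statement. -/
lemma exists_dirichlet [DecidableEq S] : ∃ C : ℝ, 0 < C ∧ ∀ (Q : ℝ) (ρ : S → ℝ) (β : K) (v₀ : S),
    0 < Q → (∀ v, 0 < ρ v) → ∏ v, ρ v ^ s.wt v < 1 → C < Q ^ s.deg * ∏ v, ρ v ^ s.wt v →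
    ∃ A ∈ s.O, ∃ a ∈ s.O, A ≠ 0 ∧ (∀ v, s.abv v A ≤ Q) ∧ s.abv v₀ (a + A * β) ≤ ρ v₀ ∧
      ∀ v, v ≠ v₀ → s.abv v a ≤ ρ v := by
  obtain ⟨c, hc, hpts⟩ := s.exists_points
  obtain ⟨C, hC, hcol⟩ := s.exists_coloring
  refine ⟨C * 2 ^ s.deg * 2 ^ s.deg * 2 ^ s.deg / c ^ 2, by positivity, ?_⟩
  intro Q ρ β v₀ hQ hρ hρ1 hlt
  set R₀ : ℝ := Q * s.abv v₀ β + ρ v₀ + 1 with hR₀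
  have hβ : 0 ≤ s.abv v₀ β := (s.abv v₀).nonneg _
  have hQβ : 0 ≤ Q * s.abv v₀ β := by positivity
  have hR₀p : 0 < R₀ := by have := hρ v₀; linarith
  obtain ⟨F₁, hF₁, hc₁⟩ := hpts (fun _ => Q / 2) (fun _ => by positivity)
  obtain ⟨F₂, hF₂, hc₂⟩ := hpts (fun v => if v = v₀ then R₀ else ρ v / 2) (fun v => by
    split_ifs; exacts [hR₀p, half_pos (hρ v)])
  obtain ⟨k, f, hk, hf⟩ := hcol v₀ (ρ v₀) (2 * R₀) (hρ v₀) (by linarith [hρ v₀])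
  have hprod : R₀ ^ s.wt v₀ * ∏ v, ρ v ^ s.wt v ≤
      (∏ v, (if v = v₀ then R₀ else ρ v / 2) ^ s.wt v) * ρ v₀ ^ s.wt v₀ * 2 ^ s.deg := by
    have e1 : ∏ v, ρ v ^ s.wt v = ρ v₀ ^ s.wt v₀ * ∏ v ∈ univ.erase v₀, ρ v ^ s.wt v :=
      (mul_prod_erase univ _ (mem_univ v₀)).symm
    have e2 : ∏ v, (if v = v₀ then R₀ else ρ v / 2) ^ s.wt v
        = R₀ ^ s.wt v₀ * ∏ v ∈ univ.erase v₀, (ρ v / 2) ^ s.wt v := by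
      rw [← mul_prod_erase univ _ (mem_univ v₀), if_pos rfl]
      congr 1
      exact prod_congr rfl fun v hv => by rw [if_neg (ne_of_mem_erase hv)]
    have e3 : ∏ v ∈ univ.erase v₀, ρ v ^ s.wt v ≤
        (∏ v ∈ univ.erase v₀, (ρ v / 2) ^ s.wt v) * 2 ^ s.deg := by
      have : ∏ v ∈ univ.erase v₀, ρ v ^ s.wt v =
          (∏ v ∈ univ.erase v₀, (ρ v / 2) ^ s.wt v) * ∏ v ∈ univ.erase v₀, (2 : ℝ) ^ s.wt v := by
        rw [← prod_mul_distrib]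
        exact prod_congr rfl fun v _ => by rw [← mul_pow]; ring
      rw [this, prod_pow_eq_pow_sum]
      refine mul_le_mul_of_nonneg_left ?_ (prod_nonneg fun v _ =>
        pow_nonneg (half_pos (hρ v)).le _)
      exact pow_le_pow_right₀ one_le_two (sum_le_sum_of_subset (erase_subset _ _))
    rw [e1, e2]
    have := mul_le_mul_of_nonneg_left e3
      (mul_nonneg (pow_pos hR₀p (s.wt v₀)).le (pow_pos (hρ v₀) (s.wt v₀)).le)
    calc _ = R₀ ^ s.wt v₀ * ρ v₀ ^ s.wt v₀ * ∏ v ∈ univ.erase v₀, ρ v ^ s.wt v := by ring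
      _ ≤ _ := this
      _ = _ := by ring
  have hcard : k < #(F₁ ×ˢ F₂) := by
    rw [card_product]
    have hpr2 : 0 ≤ ∏ v, (if v = v₀ then R₀ else ρ v / 2) ^ s.wt v :=
      prod_nonneg fun v _ => by split_ifs <;> have := hρ v <;> positivity
    have h1 : (c * ∏ v : S, (Q / 2) ^ s.wt v) *
        (c * ∏ v, (if v = v₀ then R₀ else ρ v / 2) ^ s.wt v) ≤ #F₁ * #F₂ := by
      gcongr
    rw [prod_pow_eq_pow_sum] at h1
    have h2 : (k : ℝ) < (#F₁ * #F₂ : ℝ) := by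
      refine lt_of_le_of_lt hk (lt_of_lt_of_le ?_ h1)
      rw [div_lt_iff₀ (by positivity)] at hlt
      have hw : (2 : ℝ) ^ s.wt v₀ ≤ 2 ^ s.deg := pow_le_pow_right₀ one_le_two
        (single_le_sum (f := s.wt) (fun _ _ => Nat.zero_le _) (mem_univ v₀))
      rw [div_pow, mul_pow, mul_div_assoc', div_lt_iff₀ (pow_pos (hρ v₀) _)]
      rw [show ∑ v, s.wt v = s.deg from rfl, div_pow]
      set P := ∏ v, (if v = v₀ then R₀ else ρ v / 2) ^ s.wt v
      set p := ∏ v, ρ v ^ s.wt v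
      have hRw : 0 < R₀ ^ s.wt v₀ := pow_pos hR₀p _
      have hD : (0 : ℝ) < 2 ^ s.deg := by positivity
      have h5 : c * (Q ^ s.deg / 2 ^ s.deg) * (c * P) * ρ v₀ ^ s.wt v₀ * (2 ^ s.deg * 2 ^ s.deg)
          ≥ c ^ 2 * (Q ^ s.deg * (R₀ ^ s.wt v₀ * p)) := by
        have := mul_le_mul_of_nonneg_left hprod (by positivity : 0 ≤ c ^ 2 * Q ^ s.deg)
        calc _ = c ^ 2 * Q ^ s.deg * (P * ρ v₀ ^ s.wt v₀ * 2 ^ s.deg) := by field_simp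
          _ ≥ _ := by rw [ge_iff_le]; refine le_trans (le_of_eq ?_) this; ring
      have h6 : C * 2 ^ s.deg * 2 ^ s.deg * 2 ^ s.deg * R₀ ^ s.wt v₀
          < c ^ 2 * (Q ^ s.deg * (R₀ ^ s.wt v₀ * p)) := by
        have := mul_lt_mul_of_pos_right hlt hRw
        calc _ < _ := this
          _ = _ := by ring
      have h7 : C * (2 ^ s.wt v₀ * R₀ ^ s.wt v₀) * (2 ^ s.deg * 2 ^ s.deg) ≤
          C * 2 ^ s.deg * 2 ^ s.deg * 2 ^ s.deg * R₀ ^ s.wt v₀ := by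
        have : C * (2 ^ s.wt v₀ * R₀ ^ s.wt v₀) ≤ C * (2 ^ s.deg * R₀ ^ s.wt v₀) := by gcongr
        nlinarith [mul_pos hD hD]
      exact lt_of_mul_lt_mul_right (h7.trans_lt (h6.trans_le h5)) (by positivity)
    exact_mod_cast h2
  obtain ⟨⟨A₁, a₁⟩, h₁, ⟨A₂, a₂⟩, h₂, hne, hfe⟩ :=
    exists_ne_map_eq_of_card_lt_of_maps_to (s := F₁ ×ˢ F₂) (t := (univ : Finset (Fin k)))
      (by simpa using hcard) (f := fun p => f (p.2 + p.1 * β)) (fun _ _ => mem_univ _)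
  rw [mem_product] at h₁ h₂
  have hA₁ := hF₁ _ h₁.1
  have hA₂ := hF₁ _ h₂.1
  have ha₁ := hF₂ _ h₁.2
  have ha₂ := hF₂ _ h₂.2
  dsimp only at hA₁ hA₂ ha₁ ha₂ hfe
  have hsub : ∀ v x y, s.abv v (x - y) ≤ s.abv v x + s.abv v y := fun v x y => by
    rw [sub_eq_add_neg]
    exact ((s.abv v).add_le _ _).trans_eq (by rw [(s.abv v).map_neg])
  have hA : ∀ v, s.abv v (A₁ - A₂) ≤ Q := fun v =>
    (hsub v _ _).trans (by linarith [hA₁.2 v, hA₂.2 v])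
  have ha : ∀ v, v ≠ v₀ → s.abv v (a₁ - a₂) ≤ ρ v := fun v hv => by
    have h1 := ha₁.2 v
    have h2 := ha₂.2 v
    rw [if_neg hv] at h1 h2
    exact (hsub v _ _).trans (by linarith)
  have hbd : ∀ A a, (∀ v, s.abv v A ≤ Q / 2) → s.abv v₀ a ≤ R₀ →
      s.abv v₀ (a + A * β) ≤ 2 * R₀ := fun A a h1 h2 => by
    refine ((s.abv v₀).add_le _ _).trans ?_
    rw [(s.abv v₀).map_mul]
    have := mul_le_mul_of_nonneg_right (h1 v₀) hβ
    have := hρ v₀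
    linarith
  have hx := hf _ _ (hbd A₁ a₁ hA₁.2 (by simpa using ha₁.2 v₀))
    (hbd A₂ a₂ hA₂.2 (by simpa using ha₂.2 v₀)) hfe
  have hx' : s.abv v₀ ((a₁ - a₂) + (A₁ - A₂) * β) ≤ ρ v₀ := by
    convert hx using 2; ring
  refine ⟨A₁ - A₂, s.O.sub_mem hA₁.1 hA₂.1, a₁ - a₂, s.O.sub_mem ha₁.1 ha₂.1, ?_, hA, hx', ha⟩
  intro h0
  refine hne ?_
  rw [h0, zero_mul, add_zero] at hx'
  have : a₁ - a₂ = 0 := s.eq_zero_of_le (s.O.sub_mem ha₁.1 ha₂.1) hρ (fun v => by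
    by_cases hv : v = v₀
    · rw [hv]; exact hx'
    · exact ha v hv) hρ1
  rw [sub_eq_zero.1 h0, sub_eq_zero.1 this]

end SInt

/-- The linear form with integer coefficients `a`. -/
def form {K ι : Type*} [Field K] [Fintype ι] (a : ι → ℤ) : (ι → K) →ₗ[K] K :=
  ∑ k, (a k : K) • LinearMap.proj k

section form
variable {K ι : Type*} [Field K] [Fintype ι]

lemma form_apply (a : ι → ℤ) (y : ι → K) : form a y = ∑ k, (a k : K) * y k := by
  simp [form]

lemma form_eq_mulVec (A : Matrix ι ι ℤ) (i : ι) (y : ι → K) :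
    form (A i) y = (A.map (Int.cast : ℤ → K)).mulVec y i := by
  simp [form_apply, mulVec, dotProduct]

lemma map_intCast_mul [DecidableEq ι] {A B : Matrix ι ι ℤ} (h : B * A = 1) :
    (B.map (Int.cast : ℤ → K)) * (A.map (Int.cast : ℤ → K)) = 1 := by
  have := congrArg (castRingHom K).mapMatrix h
  rwa [map_mul, map_one] at this

lemma eq_zero_of_forall_form [DecidableEq ι] {A B : Matrix ι ι ℤ} (h : B * A = 1) {y : ι → K}
    (hy : ∀ i, form (A i) y = 0) : y = 0 := by
  have h1 : (A.map (Int.cast : ℤ → K)).mulVec y = 0 := by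
    funext i; rw [← form_eq_mulVec]; exact hy i
  rw [← one_mulVec y, ← map_intCast_mul h, ← mulVec_mulVec, h1, Matrix.mulVec_zero]

end form

namespace SInt

variable {K : Type*} [Field K] {S : Type*} [Fintype S] (s : SInt K S)
variable {ι : Type*} [Fintype ι]

/-- The integral points of the parallelepiped with exponents `c` and parameter `t`. -/
def Box (A : S → Matrix ι ι ℤ) (c : S → ι → ℝ) (t : ℝ) : Set (ι → K) :=
  {y | (∀ i, y i ∈ s.O) ∧ ∀ v i, s.abv v (form (A v i) y) ≤ exp (c v i * t)}

/-- `W j` is spanned by its points in the boxes with exponents `c + o(1)`. -/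
def SpannedBy (𝒰 : Filter ℕ) (q : ℕ → ℝ) (A : S → Matrix ι ι ℤ) (W : ℕ → Submodule K (ι → K))
    (c : S → ι → ℝ) : Prop :=
  ∀ ε > 0, ∀ᶠ j in 𝒰, W j ≤ span K {y | y ∈ W j ∧ y ∈ s.Box A (fun v i => c v i + ε) (q j)}

variable {s}

lemma Box_mono {A : S → Matrix ι ι ℤ} {c c' : S → ι → ℝ} {t : ℝ} (ht : 0 ≤ t)
    (h : ∀ v i, c v i ≤ c' v i) : s.Box A c t ⊆ s.Box A c' t := fun _ hy =>
  ⟨hy.1, fun v i => (hy.2 v i).trans (exp_le_exp.2 (mul_le_mul_of_nonneg_right (h v i) ht))⟩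

lemma abv_sub_le (v : S) (x y : K) : s.abv v (x - y) ≤ s.abv v x + s.abv v y := by
  rw [sub_eq_add_neg]
  exact ((s.abv v).add_le _ _).trans_eq (by rw [(s.abv v).map_neg])

variable [DecidableEq S]

lemma exists_combination [Nonempty S] (s : SInt K S) : ∃ C : ℝ, 0 < C ∧
    ∀ (A : S → Matrix ι ι ℤ) (c : S → ι → ℝ) (t δ ε γ : ℝ) (y₁ y : ι → K) (i₀ : S → ι) (v₀ : S),
    0 < t → 0 < δ → 0 ≤ ε → 0 ≤ γ → C < exp (s.deg * (δ / 8 * t)) →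
    3 ≤ exp (δ / 4 * t) →
    (∀ v, form (A v (i₀ v)) y₁ ≠ 0) →
    (∀ v i, s.abv v (form (A v i) y₁) * exp (-(c v i * t)) ≤
      s.abv v (form (A v (i₀ v)) y₁) * exp (-(c v (i₀ v) * t))) →
    y₁ ∈ s.Box A (fun v i => c v i - ε) t → y ∈ s.Box A (fun v i => c v i + γ + δ / 2) t →
    ∃ b ∈ s.O, ∃ a ∈ s.O, b ≠ 0 ∧ b • y + a • y₁ ∈ s.Box A (fun v i => c v i + γ + δ) t ∧
      s.abv v₀ (form (A v₀ (i₀ v₀)) (b • y + a • y₁)) ≤ exp ((c v₀ (i₀ v₀) - ε) * t) := by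
  obtain ⟨C, hC, hdir⟩ := s.exists_dirichlet
  refine ⟨C, hC, ?_⟩
  intro A c t δ ε γ y₁ y i₀ v₀ ht hδ hε hγ hCt h3 hne hmax hy₁ hy
  set m : S → ℝ := fun v => s.abv v (form (A v (i₀ v)) y₁) * exp (-(c v (i₀ v) * t)) with hm
  have hm0 : ∀ v, 0 < m v := fun v => mul_pos ((s.abv v).pos (hne v)) (exp_pos _)
  have hmle : ∀ v, log (m v) ≤ -(ε * t) := fun v => by
    rw [log_le_iff_le_exp (hm0 v)]
    have := mul_le_mul_of_nonneg_right (hy₁.2 v (i₀ v)) (exp_pos (-(c v (i₀ v) * t))).le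
    rw [← exp_add] at this
    refine this.trans_eq ?_
    congr 1; ring
  have hD : (0 : ℝ) < s.deg := cast_pos.2 s.deg_pos
  set lam : ℝ := δ / 8 * t + (∑ v, (s.wt v : ℝ) * (-log (m v))) / s.deg with hlam
  have hlamge : ε * t ≤ lam := by
    have h1 : (s.deg : ℝ) * (ε * t) ≤ ∑ v, (s.wt v : ℝ) * (-log (m v)) := by
      rw [deg, cast_sum, sum_mul]
      refine sum_le_sum fun v _ => mul_le_mul_of_nonneg_left ?_ (cast_nonneg _)
      linarith [hmle v]
    have h2 : ε * t ≤ (∑ v, (s.wt v : ℝ) * (-log (m v))) / s.deg := by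
      rw [le_div_iff₀ hD]; linarith
    have : 0 < δ / 8 * t := by positivity
    linarith
  set ρ : S → ℝ := fun v => exp (-log (m v) - lam) with hρ
  have hρprod : ∏ v, ρ v ^ s.wt v = exp (-(s.deg * (δ / 8 * t))) := by
    have : ∀ v, ρ v ^ s.wt v = exp ((s.wt v : ℝ) * (-log (m v) - lam)) := fun v => by
      rw [exp_nat_mul]
    rw [prod_congr rfl fun v _ => this v, ← exp_sum]
    congr 1
    have h1 : ∑ v, (s.wt v : ℝ) * (-log (m v) - lam)
        = ∑ v, (s.wt v : ℝ) * (-log (m v)) - s.deg * lam := by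
      rw [deg, cast_sum, sum_mul, ← sum_sub_distrib]
      exact sum_congr rfl fun v _ => by ring
    rw [h1, hlam]; field_simp; ring
  have hρm : ∀ v i, ρ v * s.abv v (form (A v i) y₁) ≤ exp ((c v i - ε) * t) := fun v i => by
    have h1 : s.abv v (form (A v i) y₁) ≤ m v * exp (c v i * t) := by
      have := mul_le_mul_of_nonneg_right (hmax v i) (exp_pos (c v i * t)).le
      rwa [mul_assoc, ← exp_add, neg_add_cancel, exp_zero, mul_one] at this
    calc ρ v * s.abv v (form (A v i) y₁) ≤ ρ v * (m v * exp (c v i * t)) :=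
          mul_le_mul_of_nonneg_left h1 (exp_pos _).le
      _ = exp (-lam + c v i * t) := by
          simp only [hρ]
          nth_rewrite 2 [← exp_log (hm0 v)]
          rw [← exp_add, ← exp_add]; congr 1; ring
      _ ≤ _ := exp_le_exp.2 (by nlinarith)
  set β : K := form (A v₀ (i₀ v₀)) y / form (A v₀ (i₀ v₀)) y₁ with hβ
  obtain ⟨b, hb, a, ha, hb0, hbQ, hab, hav⟩ := hdir (exp (δ / 4 * t)) ρ β v₀ (exp_pos _)
    (fun v => exp_pos _) (by
      rw [hρprod, exp_lt_one_iff]; have : 0 < s.deg * (δ / 8 * t) := by positivity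
      linarith) (by
      rw [hρprod, ← exp_nat_mul, ← exp_add]
      convert hCt using 2; ring)
  have hLz : ∀ v i, form (A v i) (b • y + a • y₁)
      = b * form (A v i) y + a * form (A v i) y₁ := fun v i => by
    rw [map_add, map_smul, map_smul, smul_eq_mul, smul_eq_mul]
  have hβy : β * form (A v₀ (i₀ v₀)) y₁ = form (A v₀ (i₀ v₀)) y := div_mul_cancel₀ _ (hne v₀)
  have hLz₀ : ∀ i, form (A v₀ i) (b • y + a • y₁) = b * (form (A v₀ i) y - β * form (A v₀ i) y₁)
      + (a + b * β) * form (A v₀ i) y₁ := fun i => by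
    rw [hLz]; ring
  have hv0i0 : s.abv v₀ (form (A v₀ (i₀ v₀)) (b • y + a • y₁)) ≤ exp ((c v₀ (i₀ v₀) - ε) * t) := by
    rw [hLz₀, hβy, sub_self, mul_zero, zero_add, (s.abv v₀).map_mul]
    exact (mul_le_mul_of_nonneg_right hab ((s.abv v₀).nonneg _)).trans (hρm _ _)
  have hsmall : ∀ v i, exp ((c v i - ε) * t) ≤
      exp (δ / 4 * t) * exp ((c v i + γ + δ / 2) * t) := fun v i => by
    rw [← exp_add]
    refine exp_le_exp.2 ?_
    have : 0 ≤ (γ + δ / 2 + δ / 4 + ε) * t := by positivity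
    nlinarith
  have hbig : ∀ v i, 3 * (exp (δ / 4 * t) * exp ((c v i + γ + δ / 2) * t)) ≤
      exp ((c v i + γ + δ) * t) := fun v i => by
    calc _ ≤ exp (δ / 4 * t) * (exp (δ / 4 * t) * exp ((c v i + γ + δ / 2) * t)) :=
          mul_le_mul_of_nonneg_right h3 (by positivity)
      _ = _ := by rw [← exp_add, ← exp_add]; congr 1; ring
  refine ⟨b, hb, a, ha, hb0, ⟨fun i => s.O.add_mem (s.O.mul_mem hb (hy.1 i))
    (s.O.mul_mem ha (hy₁.1 i)), fun v i => ?_⟩, hv0i0⟩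
  refine le_trans ?_ (hbig v i)
  have hE := (s.abv v).nonneg (form (A v i) y)
  have hE₁ := (s.abv v).nonneg (form (A v i) y₁)
  have hby : s.abv v b * s.abv v (form (A v i) y) ≤
      exp (δ / 4 * t) * exp ((c v i + γ + δ / 2) * t) :=
    mul_le_mul (hbQ v) (hy.2 v i) hE (exp_pos _).le
  have hpos : 0 < exp (δ / 4 * t) * exp ((c v i + γ + δ / 2) * t) := by positivity
  by_cases hv : v = v₀
  · subst hv
    rw [hLz₀]
    refine ((s.abv v).add_le _ _).trans ?_
    rw [(s.abv v).map_mul, (s.abv v).map_mul]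
    have h1 : s.abv v (a + b * β) * s.abv v (form (A v i) y₁) ≤ exp ((c v i - ε) * t) :=
      (mul_le_mul_of_nonneg_right hab hE₁).trans (hρm _ _)
    have h2 : s.abv v (β * form (A v i) y₁) ≤ exp ((c v i + γ + δ / 2) * t) := by
      have e1 := mul_le_mul_of_nonneg_left (hmax v i) ((s.abv v).nonneg β)
      rw [← mul_assoc, ← mul_assoc, ← (s.abv v).map_mul, ← (s.abv v).map_mul, hβy] at e1
      have e2 : s.abv v (form (A v (i₀ v)) y) * exp (-(c v (i₀ v) * t)) ≤
          exp ((γ + δ / 2) * t) := by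
        have := mul_le_mul_of_nonneg_right (hy.2 v (i₀ v)) (exp_pos (-(c v (i₀ v) * t))).le
        refine this.trans_eq ?_
        rw [← exp_add]; congr 1; ring
      have e3 := mul_le_mul_of_nonneg_right (e1.trans e2) (exp_pos (c v i * t)).le
      rw [mul_assoc, ← exp_add, neg_add_cancel, exp_zero, mul_one, ← exp_add] at e3
      refine e3.trans_eq ?_
      congr 1; ring
    have h3 : s.abv v b * s.abv v (form (A v i) y - β * form (A v i) y₁) ≤
        exp (δ / 4 * t) * (2 * exp ((c v i + γ + δ / 2) * t)) := by
      refine mul_le_mul (hbQ v) ((abv_sub_le v _ _).trans ?_) ((s.abv v).nonneg _) (exp_pos _).le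
      have := hy.2 v i
      dsimp only at this
      linarith
    have := hsmall v i
    linarith
  · rw [hLz]
    refine ((s.abv v).add_le _ _).trans ?_
    rw [(s.abv v).map_mul, (s.abv v).map_mul]
    have h1 : s.abv v a * s.abv v (form (A v i) y₁) ≤ exp ((c v i - ε) * t) :=
      (mul_le_mul_of_nonneg_right (hav v hv) hE₁).trans (hρm _ _)
    have := hsmall v i
    linarith

variable [DecidableEq ι]

/-- One exponent of a box can be lowered if the boxes contain points which are too small. -/
lemma SpannedBy.lower [Nonempty S] {𝒰 : Filter ℕ} {q : ℕ → ℝ}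
    (hq : Tendsto q 𝒰 atTop) {A B : S → Matrix ι ι ℤ} (hBA : ∀ v, B v * A v = 1)
    {W : ℕ → Submodule K (ι → K)} {c : S → ι → ℝ} {γ ε κ : ℝ} (hγ : 0 ≤ γ) (hε : 0 ≤ ε)
    (hκ : κ ≤ ε)
    (h : s.SpannedBy 𝒰 q A W (fun v i => c v i + γ)) (v₀ : S) (i₀ : ι)
    (hy : ∀ᶠ j in 𝒰, ∃ y ∈ W j, y ≠ 0 ∧ y ∈ s.Box A (fun v i => c v i - ε) (q j) ∧
      ∀ i, s.abv v₀ (form (A v₀ i) y) * exp (-(c v₀ i * q j)) ≤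
        s.abv v₀ (form (A v₀ i₀) y) * exp (-(c v₀ i₀ * q j))) :
    s.SpannedBy 𝒰 q A W (fun v i => update c v₀ (update (c v₀) i₀ (c v₀ i₀ - κ)) v i + γ) := by
  intro δ hδ
  obtain ⟨C, hC, hcomb⟩ := exists_combination (ι := ι) s
  have hD : (0 : ℝ) < s.deg := cast_pos.2 s.deg_pos
  have e1 : ∀ᶠ j in 𝒰, C < exp (s.deg * (δ / 8 * q j)) := by
    filter_upwards [hq.eventually_gt_atTop (log C / (s.deg * (δ / 8)))] with j hj
    rw [div_lt_iff₀ (by positivity)] at hj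
    rw [← log_lt_iff_lt_exp hC]; linarith
  have e2 : ∀ᶠ j in 𝒰, 3 ≤ exp (δ / 4 * q j) := by
    filter_upwards [hq.eventually_gt_atTop (log 3 / (δ / 4))] with j hj
    rw [div_lt_iff₀ (by positivity)] at hj
    rw [← log_le_iff_le_exp (by norm_num)]; linarith
  filter_upwards [e1, e2, hy, hq.eventually_gt_atTop 0, h (δ / 2) (half_pos hδ)]
    with j h1 h2 ⟨y₁, hy₁W, hy₁0, hy₁B, hmax₀⟩ hj0 hsp
  have hex : ∀ v, ∃ i, ∀ k, s.abv v (form (A v k) y₁) * exp (-(c v k * q j)) ≤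
      s.abv v (form (A v i) y₁) * exp (-(c v i * q j)) := fun v => by
    have : Nonempty ι := ⟨i₀⟩
    exact Finite.exists_max fun k => s.abv v (form (A v k) y₁) * exp (-(c v k * q j))
  choose i₁ hi₁ using hex
  set i₂ : S → ι := update i₁ v₀ i₀ with hi₂
  have hmax : ∀ v i, s.abv v (form (A v i) y₁) * exp (-(c v i * q j)) ≤
      s.abv v (form (A v (i₂ v)) y₁) * exp (-(c v (i₂ v) * q j)) := fun v i => by
    by_cases hv : v = v₀
    · subst hv; simpa [hi₂] using hmax₀ i
    · simpa [hi₂, hv] using hi₁ v i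
  have hne : ∀ v, form (A v (i₂ v)) y₁ ≠ 0 := fun v h0 => hy₁0 <|
    eq_zero_of_forall_form (hBA v) fun i => by
      have := hmax v i
      rw [h0, (s.abv v).map_zero, zero_mul] at this
      by_contra hne
      exact absurd this (not_le.2 (mul_pos ((s.abv v).pos hne) (exp_pos _)))
  have hi₂v : i₂ v₀ = i₀ := by simp [hi₂]
  set c' : S → ι → ℝ := update c v₀ (update (c v₀) i₀ (c v₀ i₀ - κ)) with hc'
  have hbox : ∀ (z : ι → K) (e : ℝ), 0 ≤ e → z ∈ s.Box A (fun v i => c v i + e) (q j) →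
      s.abv v₀ (form (A v₀ i₀) z) ≤ exp ((c v₀ i₀ - ε) * q j) →
      z ∈ s.Box A (fun v i => c' v i + e) (q j) := fun z e he hz hz0 => by
    refine ⟨hz.1, fun v i => ?_⟩
    by_cases hv : v = v₀
    · subst hv
      by_cases hi : i = i₀
      · subst hi
        refine hz0.trans (exp_le_exp.2 ?_)
        simp only [hc', Function.update_self]
        nlinarith
      · simpa [hc', hi] using hz.2 v i
    · simpa [hc', hv] using hz.2 v i
  have hy₁mem : y₁ ∈ {y | y ∈ W j ∧ y ∈ s.Box A (fun v i => c' v i + γ + δ) (q j)} := by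
    refine ⟨hy₁W, ?_⟩
    have := hbox y₁ (γ + δ) (by positivity) (Box_mono hj0.le (fun v i => by linarith) hy₁B)
      (hy₁B.2 v₀ i₀)
    simpa only [← add_assoc] using this
  refine hsp.trans (span_le.2 ?_)
  rintro y ⟨hyW, hyB⟩
  obtain ⟨b, hb, a, ha, hb0, hz, hz0⟩ := hcomb A c (q j) δ ε γ y₁ y i₂ v₀ hj0 hδ hε hγ h1 h2 hne
    hmax hy₁B hyB
  rw [hi₂v] at hz0
  have hzmem : b • y + a • y₁ ∈ {y | y ∈ W j ∧ y ∈ s.Box A (fun v i => c' v i + γ + δ) (q j)} := by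
    refine ⟨(W j).add_mem ((W j).smul_mem _ hyW) ((W j).smul_mem _ hy₁W), ?_⟩
    simp only [add_assoc] at hz ⊢
    exact hbox _ _ (by positivity) hz hz0
  have hby : b • y ∈ span K {y | y ∈ W j ∧ y ∈ s.Box A (fun v i => c' v i + γ + δ) (q j)} := by
    have := Submodule.sub_mem _ (subset_span hzmem) (smul_mem _ a (subset_span hy₁mem))
    simpa using this
  exact (Submodule.smul_mem_iff _ hb0).1 hby

lemma flatten [Nonempty S] {𝒰 : Ultrafilter ℕ} {q : ℕ → ℝ}
    (hq : Tendsto q 𝒰 atTop) {A B : S → Matrix ι ι ℤ} (hBA : ∀ v, B v * A v = 1)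
    {W₁ W₂ : ℕ → Submodule K (ι → K)} (hW : ∀ᶠ j in 𝒰, W₁ j ≤ W₂ j) {c₁ : S → ι → ℝ} {γ G : ℝ}
    (hγ : 0 ≤ γ) (hG : 0 < G) (h₁ : s.SpannedBy 𝒰 q A W₁ c₁)
    (h₂ : s.SpannedBy 𝒰 q A W₂ (fun v i => c₁ v i + γ)) :
    ∃ c₂ : S → ι → ℝ, (∀ v i, c₂ v i ≤ c₁ v i) ∧ (∀ v i, c₁ v i - G ≤ c₂ v i) ∧
      s.SpannedBy 𝒰 q A W₁ c₂ ∧ s.SpannedBy 𝒰 q A W₂ (fun v i => c₂ v i + γ) ∧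
      ((∃ v i, c₂ v i = c₁ v i - G) ∨ ∀ ε > 0, ∀ᶠ j in 𝒰, ∀ y ∈ W₁ j,
        y ∈ s.Box A (fun v i => c₂ v i - ε) (q j) → y = 0) := by
  set Z : Set (S → ι → ℝ) := {c | s.SpannedBy 𝒰 q A W₁ c ∧
    s.SpannedBy 𝒰 q A W₂ (fun v i => c v i + γ)} with hZ
  have hclosed : IsClosed Z := by
    refine isClosed_of_closure_subset fun c hc => ?_
    rw [Metric.mem_closure_iff] at hc
    have key : ∀ (W : ℕ → Submodule K (ι → K)) (e : ℝ),
        (∀ δ > 0, ∃ c' : S → ι → ℝ, dist c c' < δ ∧ s.SpannedBy 𝒰 q A W (fun v i => c' v i + e)) →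
        s.SpannedBy 𝒰 q A W (fun v i => c v i + e) := by
      intro W e h ε hε
      obtain ⟨c', hc', h'⟩ := h (ε / 2) (half_pos hε)
      filter_upwards [h' (ε / 2) (half_pos hε), hq.eventually_ge_atTop 0] with j hj hj0
      refine hj.trans (span_mono fun y hy => ⟨hy.1, Box_mono hj0 (fun v i => ?_) hy.2⟩)
      have h1 : dist (c v i) (c' v i) ≤ dist c c' :=
        (dist_le_pi_dist (c v) (c' v) i).trans (dist_le_pi_dist c c' v)
      rw [dist_eq] at h1
      have := (abs_le.1 h1).1
      linarith
    constructor
    · have := key W₁ 0 (fun δ hδ => by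
        obtain ⟨c', hc', hd⟩ := hc δ hδ
        exact ⟨c', hd, by simpa using hc'.1⟩)
      simpa using this
    · exact key W₂ γ (fun δ hδ => by
        obtain ⟨c', hc', hd⟩ := hc δ hδ
        exact ⟨c', hd, hc'.2⟩)
  have hcomp : IsCompact (Z ∩ Set.Icc (fun v i => c₁ v i - G) c₁) :=
    isCompact_Icc.inter_left hclosed
  have hne : (Z ∩ Set.Icc (fun v i => c₁ v i - G) c₁).Nonempty :=
    ⟨c₁, ⟨h₁, h₂⟩, fun v i => by simp only; linarith, le_rfl⟩
  obtain ⟨c, ⟨hcZ, hcI⟩, hmin⟩ := hcomp.exists_isMinOn hne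
    (f := fun c : S → ι → ℝ => ∑ v, ∑ i, c v i)
    (by fun_prop)
  refine ⟨c, fun v i => hcI.2 v i, fun v i => hcI.1 v i, hcZ.1, hcZ.2, ?_⟩
  by_contra! hcon
  obtain ⟨hfloor, ε, hε, hbad⟩ := hcon
  obtain ⟨v₀⟩ := ‹Nonempty S›
  have hmax : ∃ i₀, ∀ᶠ j in 𝒰, ∃ y ∈ W₁ j, y ≠ 0 ∧ y ∈ s.Box A (fun v i => c v i - ε) (q j) ∧
      ∀ i, s.abv v₀ (form (A v₀ i) y) * exp (-(c v₀ i * q j)) ≤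
        s.abv v₀ (form (A v₀ i₀) y) * exp (-(c v₀ i₀ * q j)) := by
    rw [← Ultrafilter.eventually_exists_iff]
    filter_upwards [hbad] with j ⟨y, hyW, hyB, hy0⟩
    have : Nonempty ι := by
      by_contra h
      rw [not_nonempty_iff] at h
      exact hy0 (Subsingleton.elim _ _)
    obtain ⟨i, hi⟩ := Finite.exists_max fun i => s.abv v₀ (form (A v₀ i) y) * exp (-(c v₀ i * q j))
    exact ⟨i, y, hyW, hy0, hyB, hi⟩
  obtain ⟨i₀, hi₀⟩ := hmax
  have hgap : 0 < c v₀ i₀ - (c₁ v₀ i₀ - G) :=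
    sub_pos.2 (lt_of_le_of_ne (hcI.1 v₀ i₀) (hfloor v₀ i₀).symm)
  set κ := min ε (c v₀ i₀ - (c₁ v₀ i₀ - G)) with hκ
  have hκ0 : 0 < κ := lt_min hε hgap
  have : Nonempty S := ⟨v₀⟩
  set c' : S → ι → ℝ := update c v₀ (update (c v₀) i₀ (c v₀ i₀ - κ)) with hc'
  have hc'Z : c' ∈ Z := by
    constructor
    · have := SpannedBy.lower (κ := κ) hq hBA le_rfl hε.le (min_le_left _ _)
        (by simpa using hcZ.1 : s.SpannedBy 𝒰 q A W₁ (fun v i => c v i + 0)) v₀ i₀ hi₀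
      simpa using this
    · refine SpannedBy.lower hq hBA hγ hε.le (min_le_left _ _) hcZ.2 v₀ i₀ ?_
      filter_upwards [hi₀, hW] with j ⟨y, hy, h⟩ hj
      exact ⟨y, hj hy, h⟩
  have hle : ∀ v i, c' v i ≤ c v i := fun v i => by
    by_cases hv : v = v₀
    · subst hv
      by_cases hi : i = i₀
      · subst hi; simp [hc', hκ0.le]
      · simp [hc', hi]
    · simp [hc', hv]
  have hlt : c' v₀ i₀ < c v₀ i₀ := by simp [hc', hκ0]
  have hmem : c' ∈ Z ∩ Set.Icc (fun v i => c₁ v i - G) c₁ := by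
    refine ⟨hc'Z, fun v i => ?_, fun v i => (hle v i).trans (hcI.2 v i)⟩
    by_cases hv : v = v₀
    · subst hv
      by_cases hi : i = i₀
      · subst hi
        have := min_le_right ε (c v i - (c₁ v i - G))
        simp only [hc', Function.update_self]
        linarith
      · simpa [hc', hi] using hcI.1 v i
    · simpa [hc', hv] using hcI.1 v i
  have h1 := hmin hmem
  simp only [Set.mem_ofPred_eq] at h1
  have h2 : ∑ v, ∑ i, c' v i < ∑ v, ∑ i, c v i :=
    sum_lt_sum (fun v _ => sum_le_sum fun i _ => hle v i)
      ⟨v₀, mem_univ _, sum_lt_sum (fun i _ => hle v₀ i) ⟨i₀, mem_univ _, hlt⟩⟩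
  linarith

end SInt

section select
variable {K ι : Type*} [Field K] [Fintype ι]

/-- Auerbach-type selection of coordinates on a subspace. -/
lemma exists_select {V : Type*} [AddCommGroup V] [Module K V] [FiniteDimensional K V]
    (abv : AbsoluteValue K ℝ) (φ : ι → V →ₗ[K] K)
    (hφ : ∀ x, (∀ i, φ i x = 0) → x = 0) (w : ι → ℝ) (hw : ∀ i, 0 < w i) {τ : ℕ}
    (hτ : finrank K V = τ) :
    ∃ I : Fin τ → ι, ∀ k, ∃ lam : Fin τ → K, (∀ z, φ k z = ∑ l, lam l * φ (I l) z) ∧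
      ∀ l, abv (lam l) * w k ≤ w (I l) := by
  classical
  let b := Module.finBasisOfFinrankEq K V hτ
  set Φ : ι → Fin τ → K := fun k m => φ k (b m) with hΦ
  have hφb : ∀ k z, φ k z = ∑ m, Φ k m * b.repr z m := fun k z => by
    conv_lhs => rw [← b.sum_repr z]
    simp only [map_sum, map_smul, smul_eq_mul, hΦ]
    exact sum_congr rfl fun m _ => mul_comm _ _
  have hspan : span K (Set.range Φ) = ⊤ := by
    by_contra h
    obtain ⟨f, hf0, hf⟩ := Submodule.exists_le_ker_of_lt_top _ (lt_top_iff_ne_top.2 h)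
    refine hf0 (LinearMap.pi_ext' fun m => LinearMap.ext_ring ?_)
    have hx := hφ (∑ m, f (Pi.single m 1) • b m) fun k => by
      have h1 : f (Φ k) = 0 := hf (subset_span ⟨k, rfl⟩)
      rw [← LinearMap.sum_single_apply (fun _ => K) (Φ k), map_sum] at h1
      rw [map_sum, ← h1]
      refine sum_congr rfl fun m _ => ?_
      rw [map_smul, smul_eq_mul]
      have : (Pi.single m (Φ k m) : Fin τ → K) = Φ k m • Pi.single m 1 := by
        rw [← Pi.single_smul, smul_eq_mul, mul_one]
      exact (mul_comm _ _).trans ((congrArg f this).trans (map_smul f _ _)).symm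
    have := Fintype.linearIndependent_iff.1 b.linearIndependent _ hx m
    simpa using this
  obtain ⟨I₀, hI₀⟩ : ∃ I : Fin τ → ι, (of fun l => Φ (I l)).det ≠ 0 := by
    obtain ⟨f, hf, -, hli⟩ := Submodule.exists_fun_fin_finrank_span_eq K (Set.range Φ)
    have hfr : finrank K (span K (Set.range Φ)) = τ := by
      rw [hspan, finrank_top]; simp
    choose g hg using hf
    refine ⟨fun l => g (Fin.cast hfr.symm l), ?_⟩
    have : LinearIndependent K (fun l => Φ (g (Fin.cast hfr.symm l))) := by
      have h1 := hli.comp _ (Fin.cast_injective hfr.symm)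
      have h2 : f ∘ Fin.cast hfr.symm = fun l => Φ (g (Fin.cast hfr.symm l)) :=
        funext fun l => (hg _).symm
      rwa [h2] at h1
    have := (Matrix.linearIndependent_rows_iff_isUnit
      (A := of fun l => Φ (g (Fin.cast hfr.symm l)))).1 this
    exact (Matrix.isUnit_iff_isUnit_det _).1 this |>.ne_zero
  have : Nonempty (Fin τ → ι) := ⟨I₀⟩
  obtain ⟨I, hI⟩ := Finite.exists_max
    fun I : Fin τ → ι => abv (of fun l => Φ (I l)).det * ∏ l, w (I l)
  have hwI : ∀ I : Fin τ → ι, 0 < ∏ l, w (I l) := fun I => prod_pos fun l _ => hw _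
  have hdet : (of fun l => Φ (I l)).det ≠ 0 := fun h0 => by
    have := hI I₀
    rw [h0, abv.map_zero, zero_mul] at this
    exact absurd this (not_le.2 (mul_pos (abv.pos hI₀) (hwI _)))
  refine ⟨I, fun k => ⟨fun l => ((of fun l => Φ (I l)).updateRow l (Φ k)).det /
    (of fun l => Φ (I l)).det, fun z => ?_, fun l => ?_⟩⟩
  · have h1 := Matrix.mulVec_cramer (of fun l => Φ (I l)).transpose (Φ k)
    have h2 : ∀ m, ∑ l, ((of fun l => Φ (I l)).updateRow l (Φ k)).det / (of fun l => Φ (I l)).det *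
        Φ (I l) m = Φ k m := fun m => by
      have := congrFun h1 m
      simp only [mulVec, dotProduct, Matrix.cramer_transpose_apply, Matrix.transpose_apply,
        Matrix.det_transpose, Pi.smul_apply, smul_eq_mul, of_apply] at this
      rw [← mul_right_inj' hdet, ← this, mul_sum]
      refine sum_congr rfl fun l _ => ?_
      field_simp
    rw [hφb k z]
    simp only [hφb, mul_sum]
    rw [sum_comm]
    refine sum_congr rfl fun m _ => ?_
    rw [← h2 m, sum_mul]
    exact sum_congr rfl fun l _ => by ring
  · have h1 := hI (update I l k)
    have h2 : (of fun a => Φ (update I l k a)) = (of fun l => Φ (I l)).updateRow l (Φ k) := by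
      ext a m
      by_cases ha : a = l
      · subst ha; simp
      · simp [ha]
    have h3 : ∏ a, w (update I l k a) = w k * ∏ a ∈ univ.erase l, w (I a) := by
      rw [← mul_prod_erase univ _ (mem_univ l), Function.update_self]
      congr 1
      exact prod_congr rfl fun a ha => by
        rw [update_of_ne (ne_of_mem_erase ha)]
    have h4 : ∏ a, w (I a) = w (I l) * ∏ a ∈ univ.erase l, w (I a) :=
      (mul_prod_erase univ _ (mem_univ l)).symm
    rw [h2, h3, h4, ← mul_assoc, ← mul_assoc] at h1
    have h5 := le_of_mul_le_mul_right h1 (prod_pos fun a _ => hw _)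
    rw [map_div₀, div_mul_eq_mul_div, div_le_iff₀ (abv.pos hdet)]
    linarith

end select

namespace SInt

variable {K : Type*} [Field K] {S : Type*} [Fintype S] {s : SInt K S}
variable {ι : Type*} [Fintype ι]

/-- Comparison of the number of points in a box with the number of points in a subspace. -/
lemma exists_count (s : SInt K S) {A B : S → Matrix ι ι ℤ} [DecidableEq ι]
    (hBA : ∀ v, B v * A v = 1) (τ : ℕ) : ∃ C : ℝ, 0 < C ∧
    ∀ (T : Submodule K (ι → K)) (c : S → ι → ℝ) (t η ε : ℝ),
    finrank K T = τ → 0 < t → 0 ≤ η → 0 ≤ ε →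
    (∀ y ∈ T, y ∈ s.Box A (fun v i => c v i - ε) t → y = 0) →
    s.Box A (fun v i => c v i + η) t ⊆ T →
    exp ((∑ v, (s.wt v : ℝ) * ∑ i, c v i) * t + Fintype.card ι * (η * t) * s.deg) ≤
      C * exp (τ * ((η + ε) * t) * s.deg) := by
  classical
  obtain ⟨c₀, hc₀, hpts⟩ := s.exists_points
  obtain ⟨C, hC, hcol⟩ := s.exists_coloring
  obtain ⟨M, hM, hMle⟩ : ∃ M : ℝ, 0 < M ∧ ∀ v i, ∑ k, |(A v i k : ℝ)| ≤ M := by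
    refine ⟨1 + ∑ v, ∑ i, ∑ k, |(A v i k : ℝ)|, by positivity, fun v i => ?_⟩
    have h1 : ∑ k, |(A v i k : ℝ)| ≤ ∑ i, ∑ k, |(A v i k : ℝ)| :=
      single_le_sum (f := fun i => ∑ k, |(A v i k : ℝ)|) (fun _ _ => by positivity) (mem_univ i)
    have h2 : ∑ i, ∑ k, |(A v i k : ℝ)| ≤ ∑ v, ∑ i, ∑ k, |(A v i k : ℝ)| :=
      single_le_sum (f := fun v => ∑ i, ∑ k, |(A v i k : ℝ)|) (fun _ _ => by positivity)
        (mem_univ v)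
    linarith
  set N := Fintype.card ι with hN
  set D := s.deg with hD
  refine ⟨(∏ v : S, ∏ i : ι, (C * M ^ s.wt v)) * (∏ v : S, ∏ l : Fin τ, (C * (τ + 1) ^ s.wt v)) /
    c₀ ^ N, by positivity, ?_⟩
  intro T c t η ε hT ht hη hε hsmall hbox
  obtain ⟨R, hR0, hRle⟩ : ∃ R : ℝ, 0 < R ∧ ∀ v i, exp ((c v i + η) * t) ≤ M * R := by
    refine ⟨(1 + ∑ v, ∑ i, exp ((c v i + η) * t)) / M, by positivity, fun v i => ?_⟩
    rw [mul_div_cancel₀ _ hM.ne']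
    have h1 : exp ((c v i + η) * t) ≤ ∑ i, exp ((c v i + η) * t) :=
      single_le_sum (f := fun i => exp ((c v i + η) * t)) (fun _ _ => by positivity) (mem_univ i)
    have h2 : ∑ i, exp ((c v i + η) * t) ≤ ∑ v, ∑ i, exp ((c v i + η) * t) :=
      single_le_sum (f := fun v => ∑ i, exp ((c v i + η) * t))
        (fun _ _ => by positivity) (mem_univ v)
    linarith
  obtain ⟨F, hF, hFc⟩ := hpts (fun _ => R) (fun _ => hR0)
  have hsel : ∀ v, ∃ I : Fin τ → ι, ∀ k, ∃ lam : Fin τ → K,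
      (∀ z : T, form (A v k) (z : ι → K) = ∑ l, lam l * form (A v (I l)) (z : ι → K)) ∧
      ∀ l, s.abv v (lam l) * exp (-(c v k * t)) ≤ exp (-(c v (I l) * t)) := fun v =>
    exists_select (s.abv v) (fun i => (form (A v i)).comp T.subtype)
      (fun x hx => Subtype.ext (eq_zero_of_forall_form (hBA v) hx)) (fun i => exp (-(c v i * t)))
      (fun i => exp_pos _) hT
  choose I hI using hsel
  have hcol₁ : ∀ v i, ∃ (k : ℕ) (f : K → Fin k),
      (k : ℝ) ≤ C * (M * R / exp ((c v i + η) * t)) ^ s.wt v ∧ ∀ x y,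
      s.abv v x ≤ M * R → s.abv v y ≤ M * R → f x = f y →
        s.abv v (x - y) ≤ exp ((c v i + η) * t) := fun v i =>
    hcol v _ _ (exp_pos _) (hRle v i)
  choose k₁ f₁ hk₁ hf₁ using hcol₁
  have hτ1 : (0 : ℝ) < τ + 1 := by positivity
  have hcol₂ : ∀ v (l : Fin τ), ∃ (k : ℕ) (f : K → Fin k),
      (k : ℝ) ≤ C * (exp ((c v (I v l) + η) * t) /
        (exp ((c v (I v l) - ε) * t) / (τ + 1))) ^ s.wt v ∧ ∀ x y,
      s.abv v x ≤ exp ((c v (I v l) + η) * t) →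
      s.abv v y ≤ exp ((c v (I v l) + η) * t) → f x = f y →
        s.abv v (x - y) ≤ exp ((c v (I v l) - ε) * t) / (τ + 1) := fun v l =>
    hcol v _ _ (by positivity) (by
      rw [div_le_iff₀ hτ1]
      calc exp ((c v (I v l) - ε) * t) ≤ exp ((c v (I v l) + η) * t) :=
            exp_le_exp.2 (by nlinarith)
        _ ≤ _ := le_mul_of_one_le_right (exp_pos _).le (by
          have : (0 : ℝ) ≤ τ := cast_nonneg _
          linarith))
  choose k₂ f₂ hk₂ hf₂ using hcol₂
  set P : Finset (ι → K) := piFinset fun _ => F with hP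
  have hPmem : ∀ y ∈ P, (∀ i, y i ∈ s.O) ∧ ∀ v i, s.abv v (form (A v i) y) ≤ M * R := by
    intro y hy
    rw [hP, mem_piFinset] at hy
    refine ⟨fun i => (hF _ (hy i)).1, fun v i => ?_⟩
    rw [form_apply]
    refine ((s.abv v).sum_le _ _).trans ?_
    calc ∑ k, s.abv v ((A v i k : K) * y k) ≤ ∑ k, |(A v i k : ℝ)| * R := by
          refine sum_le_sum fun k _ => ?_
          rw [(s.abv v).map_mul]
          exact mul_le_mul (s.abv_intCast_le v _) ((hF _ (hy k)).2 v) ((s.abv v).nonneg _)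
            (abs_nonneg _)
      _ = (∑ k, |(A v i k : ℝ)|) * R := by rw [sum_mul]
      _ ≤ _ := mul_le_mul_of_nonneg_right (hMle v i) hR0.le
  set g₁ : (ι → K) → (∀ v i, Fin (k₁ v i)) := fun y v i => f₁ v i (form (A v i) y) with hg₁
  have hbase : ∀ y, ∃ b, y ∈ P → b ∈ P ∧ g₁ b = g₁ y := fun y => ⟨y, fun h => ⟨h, rfl⟩⟩
  obtain ⟨r, hr⟩ : ∃ r : (∀ v i, Fin (k₁ v i)) → (ι → K),
      ∀ y ∈ P, r (g₁ y) ∈ P ∧ g₁ (r (g₁ y)) = g₁ y := by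
    refine ⟨fun κ => if h : ∃ y ∈ P, g₁ y = κ then h.choose else 0, fun y hy => ?_⟩
    have h : ∃ z ∈ P, g₁ z = g₁ y := ⟨y, hy, rfl⟩
    simp only [dif_pos h]
    exact h.choose_spec
  have hT' : ∀ y ∈ P, y - r (g₁ y) ∈ s.Box A (fun v i => c v i + η) t := fun y hy => by
    obtain ⟨hr1, hr2⟩ := hr y hy
    refine ⟨fun i => s.O.sub_mem ((hPmem y hy).1 i) ((hPmem _ hr1).1 i), fun v i => ?_⟩
    rw [map_sub]
    exact hf₁ v i _ _ ((hPmem y hy).2 v i) ((hPmem _ hr1).2 v i) (congrFun (congrFun hr2 v) i).symm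
  set g₂ : (ι → K) → (∀ v l, Fin (k₂ v l)) := fun y v l =>
    f₂ v l (form (A v (I v l)) (y - r (g₁ y))) with hg₂
  have hinj : Set.InjOn (fun y => (g₁ y, g₂ y)) (P : Set (ι → K)) := by
    intro y hy y' hy' heq
    simp only [Prod.mk.injEq] at heq
    obtain ⟨h1, h2⟩ := heq
    have hz : y - y' ∈ T := by
      have := T.sub_mem (hbox (hT' y hy)) (hbox (hT' y' hy'))
      rw [h1] at this
      simpa using this
    refine sub_eq_zero.1 (hsmall _ hz ⟨fun i => s.O.sub_mem ((hPmem y hy).1 i)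
      ((hPmem y' hy').1 i), fun v k => ?_⟩)
    have hsub : ∀ l, s.abv v (form (A v (I v l)) (y - y')) ≤
        exp ((c v (I v l) - ε) * t) / (τ + 1) := fun l => by
      have h3 := hf₂ v l _ _ ((hT' y hy).2 v (I v l)) ((hT' y' hy').2 v (I v l))
        (congrFun (congrFun h2 v) l)
      rw [← map_sub, h1] at h3
      simpa using h3
    obtain ⟨lam, hlam, hle⟩ := hI v k
    rw [hlam ⟨_, hz⟩]
    refine ((s.abv v).sum_le _ _).trans ?_
    have : ∀ l ∈ (univ : Finset (Fin τ)), s.abv v (lam l * form (A v (I v l)) (y - y')) ≤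
        exp ((c v k - ε) * t) / (τ + 1) := fun l _ => by
      rw [(s.abv v).map_mul]
      have h4 : s.abv v (lam l) ≤ exp (c v k * t - c v (I v l) * t) := by
        have := mul_le_mul_of_nonneg_right (hle l) (exp_pos (c v k * t)).le
        rw [mul_assoc, ← exp_add, neg_add_cancel, exp_zero, mul_one, ← exp_add] at this
        refine this.trans_eq ?_
        congr 1; ring
      refine (mul_le_mul h4 (hsub l) ((s.abv v).nonneg _) (exp_pos _).le).trans_eq ?_
      rw [← mul_div_assoc, ← exp_add]
      congr 2; ring
    refine (sum_le_card_nsmul _ _ _ this).trans ?_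
    rw [card_univ, Fintype.card_fin, nsmul_eq_mul, mul_div_assoc', div_le_iff₀ hτ1]
    nlinarith [exp_pos ((c v k - ε) * t)]
  have hcard := card_le_card_of_injOn (fun y => (g₁ y, g₂ y))
    (t := (univ : Finset ((∀ v i, Fin (k₁ v i)) × (∀ v l, Fin (k₂ v l)))))
    (fun _ _ => mem_univ _) hinj
  rw [card_univ, Fintype.card_prod, hP, Fintype.card_piFinset] at hcard
  simp only [Fintype.card_pi, Fintype.card_fin, prod_const, card_univ] at hcard
  have hcard' : ((#F : ℝ)) ^ N ≤ (∏ v, ∏ i, (k₁ v i : ℝ)) * ∏ v, ∏ l, (k₂ v l : ℝ) := by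
    exact_mod_cast hcard
  have hlow : (c₀ * R ^ D) ^ N ≤ (#F : ℝ) ^ N := by
    refine pow_le_pow_left₀ (by positivity) ?_ _
    rw [prod_pow_eq_pow_sum] at hFc
    exact hFc
  have hup₁ : (∏ v, ∏ i, (k₁ v i : ℝ)) ≤ (∏ v : S, ∏ i : ι, (C * M ^ s.wt v)) * (R ^ D) ^ N *
      exp (-((∑ v, (s.wt v : ℝ) * ∑ i, c v i) * t + N * (η * t) * D)) := by
    calc (∏ v, ∏ i, (k₁ v i : ℝ)) ≤ ∏ v, ∏ i, (C * (M * R / exp ((c v i + η) * t)) ^ s.wt v) :=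
          Finset.prod_le_prod (fun _ _ => by positivity) fun v _ =>
            Finset.prod_le_prod (fun _ _ => by positivity) fun i _ => hk₁ v i
      _ = ∏ v, ∏ i, ((C * M ^ s.wt v) * R ^ s.wt v *
            exp (-((s.wt v : ℝ) * (c v i * t + η * t)))) := by
          refine prod_congr rfl fun v _ => prod_congr rfl fun i _ => ?_
          rw [div_pow, mul_pow, ← exp_nat_mul, exp_neg]
          rw [show (c v i + η) * t = c v i * t + η * t by ring]
          field_simp
      _ = _ := by
          simp only [prod_mul_distrib, ← exp_sum, prod_const, card_univ, ← hN]
          have hRD : ∏ v, (R ^ s.wt v) ^ N = (R ^ D) ^ N := by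
            rw [prod_pow, prod_pow_eq_pow_sum, hD, deg]
          rw [hRD]
          congr 1
          rw [exp_eq_exp]
          simp only [sum_neg_distrib, sum_mul, mul_sum, mul_add,
            sum_add_distrib, sum_const, card_univ, nsmul_eq_mul, hD, deg,
            cast_sum]
          rw [neg_add, neg_add]
          congr 2
          · exact sum_congr rfl fun v _ => sum_congr rfl fun i _ => by ring
          · exact sum_congr rfl fun v _ => by rw [hN]; ring
  have hup₂ : (∏ v, ∏ l, (k₂ v l : ℝ)) ≤ (∏ v : S, ∏ l : Fin τ, (C * ((τ : ℝ) + 1) ^ s.wt v)) *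
      exp (τ * ((η + ε) * t) * D) := by
    calc (∏ v, ∏ l, (k₂ v l : ℝ)) ≤ ∏ v, ∏ l : Fin τ, (C * (exp ((c v (I v l) + η) * t) /
        (exp ((c v (I v l) - ε) * t) / (τ + 1))) ^ s.wt v) :=
          Finset.prod_le_prod (fun _ _ => by positivity) fun v _ =>
            Finset.prod_le_prod (fun _ _ => by positivity) fun l _ => hk₂ v l
      _ = ∏ v, ∏ l : Fin τ, ((C * ((τ : ℝ) + 1) ^ s.wt v) *
            exp ((s.wt v : ℝ) * ((η + ε) * t))) := by
          refine prod_congr rfl fun v _ => prod_congr rfl fun l _ => ?_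
          rw [exp_nat_mul, mul_assoc, ← mul_pow]
          congr 2
          rw [div_div_eq_mul_div, mul_div_right_comm, ← exp_sub, mul_comm]
          congr 2; ring
      _ = _ := by
          simp only [prod_mul_distrib, prod_const, card_univ, ← exp_nat_mul,
            ← exp_sum, Fintype.card_fin, hD, deg, cast_sum, mul_sum]
          congr 2
          exact sum_congr rfl fun v _ => by ring
  set P₁ := ∏ v : S, ∏ i : ι, (C * M ^ s.wt v)
  set P₂ := ∏ v : S, ∏ l : Fin τ, (C * ((τ : ℝ) + 1) ^ s.wt v)
  set E := (∑ v, (s.wt v : ℝ) * ∑ i, c v i) * t + N * (η * t) * D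
  set E₂ := τ * ((η + ε) * t) * D
  have hP₁ : 0 ≤ P₁ := by positivity
  have htot : (c₀ * R ^ D) ^ N ≤ (P₁ * (R ^ D) ^ N * exp (-E)) * (P₂ * exp E₂) :=
    (hlow.trans hcard').trans (mul_le_mul hup₁ hup₂ (by positivity) (by positivity))
  rw [mul_pow, exp_neg] at htot
  have hRD : 0 < (R ^ D) ^ N := by positivity
  have h1 : c₀ ^ N ≤ P₁ * P₂ * exp E₂ / exp E := by
    refine le_of_mul_le_mul_right (htot.trans_eq ?_) hRD
    field_simp
  rw [le_div_iff₀ (exp_pos _)] at h1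
  rw [div_mul_eq_mul_div, le_div_iff₀ (by positivity)]
  linarith

lemma count_le [DecidableEq ι] {𝒰 : Filter ℕ} [𝒰.NeBot] {q : ℕ → ℝ}
    (hq : Tendsto q 𝒰 atTop) {A B : S → Matrix ι ι ℤ} (hBA : ∀ v, B v * A v = 1)
    {T : ℕ → Submodule K (ι → K)} {τ : ℕ} (hT : ∀ᶠ j in 𝒰, finrank K (T j) = τ)
    {c : S → ι → ℝ} {η : ℝ} (hη : 0 ≤ η)
    (hsmall : ∀ ε > 0, ∀ᶠ j in 𝒰, ∀ y ∈ T j, y ∈ s.Box A (fun v i => c v i - ε) (q j) → y = 0)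
    (hbox : ∀ᶠ j in 𝒰, s.Box A (fun v i => c v i + η) (q j) ⊆ T j) :
    ∑ v, (s.wt v : ℝ) * ∑ i, c v i ≤ -((Fintype.card ι : ℝ) - τ) * η * s.deg := by
  obtain ⟨C, hC, hcount⟩ := s.exists_count hBA τ
  set E := ∑ v, (s.wt v : ℝ) * ∑ i, c v i + Fintype.card ι * η * s.deg - τ * η * s.deg with hE
  suffices E ≤ 0 by linarith
  by_contra! hpos
  set ε := E / (2 * (τ * s.deg + 1)) with hε
  have hε0 : 0 < ε := by positivity
  have hε1 : τ * ε * s.deg ≤ E / 2 := by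
    rw [hε, mul_div_assoc', div_mul_eq_mul_div, div_le_iff₀ (by positivity)]
    nlinarith
  obtain ⟨j, h1, h2, h3, h4, h5⟩ := (hT.and ((hsmall ε hε0).and (hbox.and
    ((hq.eventually_gt_atTop 0).and (hq.eventually_gt_atTop (log C / (E / 2))))))).exists
  have h := hcount (T j) c (q j) η ε h1 h4 hη hε0.le h2 h3
  rw [← exp_log hC, ← exp_add, exp_le_exp] at h
  rw [div_lt_iff₀ (half_pos hpos)] at h5
  have h6 : E * q j ≤ log C + τ * ε * s.deg * q j := by
    rw [hE]; linarith
  have := mul_le_mul_of_nonneg_right hε1 h4.le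
  linarith

end SInt

end

section

open MvPolynomial Finset

/-! ### Blockwise linear substitutions and Roth's lemma along hyperplanes -/

section LinSubst

variable {m : ℕ} {ι R : Type*} [Fintype ι] [CommRing R]

/-- The substitution `X_{h,i} ↦ ∑ k, (M h)_{i,k} X_{h,k}`. -/
noncomputable def linSubst (M : Fin m → Matrix ι ι R) :
    MvPolynomial (Fin m × ι) R →ₐ[R] MvPolynomial (Fin m × ι) R :=
  bind₁ fun p => ∑ k, C (M p.1 p.2 k) * X (p.1, k)

theorem linSubst_X (M : Fin m → Matrix ι ι R) (p : Fin m × ι) :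
    linSubst M (X p) = ∑ k, C (M p.1 p.2 k) * X (p.1, k) := by
  rw [linSubst, bind₁_X_right]

theorem linSubst_linSubst (M N : Fin m → Matrix ι ι R) (Q : MvPolynomial (Fin m × ι) R) :
    linSubst N (linSubst M Q) = linSubst (fun h => M h * N h) Q := by
  suffices h : (linSubst N).comp (linSubst M) = linSubst (fun h => M h * N h) from
    DFunLike.congr_fun h Q
  refine MvPolynomial.algHom_ext fun p => ?_
  rw [AlgHom.comp_apply, linSubst_X, linSubst_X, _root_.map_sum]
  simp only [_root_.map_mul, linSubst_X, algHom_C, algebraMap_eq, mul_apply, mul_sum,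
    _root_.map_sum, sum_mul]
  rw [sum_comm]
  exact sum_congr rfl fun k _ => sum_congr rfl fun l _ => by ring

theorem linSubst_map {R' : Type*} [CommRing R'] (f : R →+* R') (M : Fin m → Matrix ι ι R)
    (Q : MvPolynomial (Fin m × ι) R) :
    map f (linSubst M Q) = linSubst (fun h => (M h).map f) (map f Q) := by
  rw [linSubst, linSubst, map_bind₁]
  congr 2
  funext p
  simp [_root_.map_sum]

theorem OrdGE.of_le {σ : Type*} [Fintype σ] {w : σ → ℝ} {c d : ℝ} {p : MvPolynomial σ R}
    (h : OrdGE w c p) (hd : d ≤ c) : OrdGE w d p := fun μ hμ => hd.trans (h μ hμ)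

theorem ordGE_C {σ : Type*} [Fintype σ] {w : σ → ℝ} (r : R) : OrdGE w 0 (C r) := by
  have := (OrdGE.one (R := R) (w := w)).smul r
  rwa [smul_eq_C_mul, mul_one] at this

theorem ordGE_X {σ : Type*} [Fintype σ] {w : σ → ℝ} (i : σ) : OrdGE w (w i) (X i : MvPolynomial σ R) := by
  classical
  intro μ hμ
  have : μ = single i 1 := by
    by_contra h
    rw [mem_support_iff, coeff_X, if_neg (Ne.symm h)] at hμ
    exact hμ rfl
  subst this
  rw [sum_eq_single i] <;> simp +contextual [eq_comm]

theorem OrdGE.bind₁ {σ τ : Type*} [Fintype σ] [Fintype τ] {w : σ → ℝ} {w' : τ → ℝ} {c : ℝ}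
    {f : σ → MvPolynomial τ R} (hf : ∀ i, OrdGE w' (w i) (f i)) {p : MvPolynomial σ R}
    (hp : OrdGE w c p) : OrdGE w' c (MvPolynomial.bind₁ f p) := by
  conv => rw [p.as_sum]
  rw [_root_.map_sum]
  refine OrdGE.sum fun μ hμ => ?_
  rw [bind₁_monomial]
  refine OrdGE.of_le ?_ (hp μ hμ)
  have h1 : OrdGE w' (∑ i, μ i * w i) (∏ i ∈ μ.support, f i ^ μ i) := by
    rw [prod_subset (subset_univ μ.support) (f := fun i => f i ^ μ i) (fun i _ hi => by
      rw [Finsupp.notMem_support_iff.1 hi, pow_zero])]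
    refine OrdGE.prod fun i _ => ?_
    have := OrdGE.prod (s := range (μ i)) (c := fun _ => w i) (f := fun _ => f i) fun _ _ => hf i
    simpa using this
  have := (ordGE_C (w := w') (coeff μ p)).mul h1
  rwa [zero_add] at this

theorem OrdGE.linSubst {a : ι} {d : Fin m → ℝ} (hd : ∀ h, 0 ≤ d h) {c : ℝ} [DecidableEq ι]
    {T : Fin m → Matrix ι ι R} (hT : ∀ h k, T h a k = if k = a then 1 else 0)
    {Q : MvPolynomial (Fin m × ι) R}
    (hQ : OrdGE (fun p : Fin m × ι => if p.2 = a then d p.1 else 0) c Q) :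
    OrdGE (fun p : Fin m × ι => if p.2 = a then d p.1 else 0) c (linSubst T Q) := by
  refine hQ.bind₁ fun p => ?_
  by_cases hp : p.2 = a
  · rw [if_pos hp]
    have : ∑ k, C (T p.1 p.2 k) * X (p.1, k) = (X p : MvPolynomial (Fin m × ι) R) := by
      rw [hp, sum_eq_single a]
      · rw [hT, if_pos rfl, C_1, one_mul, ← hp]
      · intro k _ hk
        rw [hT, if_neg hk, C_0, zero_mul]
      · simp
    rw [this]
    have := ordGE_X (R := R) (w := fun p : Fin m × ι => if p.2 = a then d p.1 else 0) p
    rwa [if_pos hp] at this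
  · rw [if_neg hp]
    refine OrdGE.sum fun k _ => ?_
    have := (ordGE_C (R := R) (T p.1 p.2 k)).mul
      (ordGE_X (R := R) (w := fun p : Fin m × ι => if p.2 = a then d p.1 else 0) (p.1, k))
    refine this.of_le ?_
    simp only [zero_add]
    split_ifs
    · exact hd _
    · exact le_rfl

end LinSubst

section Dehomog

variable {m : ℕ} {ι : Type*} [Fintype ι] [DecidableEq ι]

/-- Exponents of the inner variables under `dehomog`. -/
noncomputable def innerExp (a : ι) (e : Fin m × ι →₀ ℕ) : Fin m →₀ ℕ :=
  Finsupp.equivFunOnFinite.symm fun h => e (h, a)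

/-- Exponents of the outer variables under `dehomog`. -/
noncomputable def outerExp (a b : ι) (e : Fin m × ι →₀ ℕ) : Fin m × ι →₀ ℕ :=
  e.filter fun p => p.2 ≠ a ∧ p.2 ≠ b

variable (R : Type*) [CommRing R]

/-- Put `X_{h,b} = 1`, and view `X_{h,a}` as an inner variable. -/
noncomputable def dehomog (a b : ι) :
    MvPolynomial (Fin m × ι) R →ₐ[R] MvPolynomial (Fin m × ι) (MvPolynomial (Fin m) R) :=
  aeval fun p => if p.2 = a then C (X p.1) else if p.2 = b then 1 else X p

variable {R}

theorem dehomog_monomial {a b : ι} (hab : a ≠ b) (e : Fin m × ι →₀ ℕ) (c : R) :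
    dehomog R a b (monomial e c) = monomial (outerExp a b e) (monomial (innerExp a e) c) := by
  classical
  induction e using Finsupp.induction generalizing c with
  | zero =>
    have h1 : outerExp (m := m) a b 0 = 0 := Finsupp.filter_zero _
    have h2 : innerExp (m := m) a 0 = 0 := by ext; simp [innerExp]
    rw [h1, h2]
    change dehomog R a b (C c) = C (C c)
    rw [algHom_C]
    rfl
  | single_add p n e _ _ ih =>
    have h0 : monomial (single p n + e) c = (X p ^ n * monomial e c :
        MvPolynomial (Fin m × ι) R) := by
      rw [X_pow_eq_monomial, monomial_mul, one_mul]
    have h1 : outerExp a b (single p n + e) =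
        outerExp a b (single p n) + outerExp a b e := Finsupp.filter_add
    have h2 : innerExp a (single p n + e) = innerExp a (single p n) + innerExp a e := by
      ext; simp [innerExp]
    rw [h0, _root_.map_mul, ih, h1, h2, _root_.map_pow]
    have h3 : dehomog R a b (X p) ^ n =
        monomial (outerExp a b (single p n)) (monomial (innerExp a (single p n)) 1) := by
      rw [dehomog, aeval_X]
      obtain ⟨h, k⟩ := p
      by_cases hka : k = a
      · subst hka
        have e1 : outerExp k b (single (h, k) n) = 0 :=
          (Finsupp.filter_single_of_neg _ (by simp))
        have e2 : innerExp k (single (h, k) n) = single h n := by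
          ext h'
          simp [innerExp, Finsupp.single_apply]
        rw [e1, e2, if_pos rfl, ← X_pow_eq_monomial, ← C_pow]
        rfl
      · have e2 : innerExp a (single (h, k) n) = 0 := by
          ext h'
          simp [innerExp, hka]
        rw [e2, if_neg hka]
        by_cases hkb : k = b
        · subst hkb
          have e1 : outerExp a k (single (h, k) n) = 0 :=
            (Finsupp.filter_single_of_neg _ (by simp))
          rw [e1, if_pos rfl, one_pow]
          rfl
        · have e1 : outerExp a b (single (h, k) n) = single (h, k) n :=
            (Finsupp.filter_single_of_pos _ ⟨hka, hkb⟩)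
          rw [e1, if_neg hkb, X_pow_eq_monomial]
          rfl
    rw [h3, monomial_mul, monomial_mul, one_mul]

theorem dehomog_eq_sum {a b : ι} (hab : a ≠ b) (P : MvPolynomial (Fin m × ι) R) :
    dehomog R a b P = ∑ e ∈ P.support,
      monomial (outerExp a b e) (monomial (innerExp a e) (coeff e P)) := by
  conv_lhs => rw [P.as_sum]
  rw [_root_.map_sum]
  exact sum_congr rfl fun e _ => dehomog_monomial hab e _

theorem coeff_dehomog {a b : ι} (hab : a ≠ b) (P : MvPolynomial (Fin m × ι) R)
    (ν : Fin m × ι →₀ ℕ) :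
    coeff ν (dehomog R a b P) = ∑ e ∈ P.support with outerExp a b e = ν,
      monomial (innerExp a e) (coeff e P) := by
  classical
  rw [dehomog_eq_sum hab, coeff_sum, sum_filter]
  exact sum_congr rfl fun e _ => by rw [coeff_monomial]

theorem exp_ext {a b : ι} {d : Fin m → ℕ} {e e' : Fin m × ι →₀ ℕ}
    (he : ∀ h, ∑ i, e (h, i) = d h) (he' : ∀ h, ∑ i, e' (h, i) = d h)
    (h1 : outerExp a b e = outerExp a b e') (h2 : innerExp a e = innerExp a e') : e = e' := by
  have hb : ∀ h i, i ≠ b → e (h, i) = e' (h, i) := by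
    intro h i hi
    by_cases hia : i = a
    · subst hia
      exact DFunLike.congr_fun h2 h
    · have := DFunLike.congr_fun h1 (h, i)
      rwa [outerExp, outerExp, Finsupp.filter_apply_pos _ _ ⟨hia, hi⟩,
        Finsupp.filter_apply_pos _ _ ⟨hia, hi⟩] at this
  ext ⟨h, i⟩
  by_cases hi : i = b
  · subst hi
    have h3 := (he h).trans (he' h).symm
    rw [← add_sum_erase _ _ (mem_univ i), ← add_sum_erase _ (fun k => e' (h, k)) (mem_univ i),
      sum_congr rfl fun k hk => hb h k (ne_of_mem_erase hk)] at h3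
    exact Nat.add_right_cancel h3
  · exact hb h i hi

theorem dehomog_ne_zero {a b : ι} (hab : a ≠ b) {P : MvPolynomial (Fin m × ι) R} (hP : P ≠ 0)
    {d : Fin m → ℕ} (hd : ∀ e ∈ P.support, ∀ h, ∑ i, e (h, i) = d h) :
    dehomog R a b P ≠ 0 := by
  classical
  obtain ⟨e, he⟩ := support_nonempty.2 hP
  intro h0
  have h1 := coeff_dehomog hab P (outerExp a b e)
  rw [h0, coeff_zero] at h1
  have h2 := congrArg (coeff (innerExp a e)) h1
  rw [coeff_zero, coeff_sum, sum_eq_single e] at h2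
  · rw [coeff_monomial, if_pos rfl] at h2
    exact mem_support_iff.1 he h2.symm
  · intro e' he' hne
    rw [coeff_monomial, if_neg]
    intro h
    exact hne (exp_ext (hd e' (mem_filter.1 he').1) (hd e he) (mem_filter.1 he').2 h)
  · intro h
    exact (h (mem_filter.2 ⟨he, rfl⟩)).elim

theorem OrdGE.coeff_dehomog {a b : ι} (hab : a ≠ b) {d : Fin m → ℝ} {c : ℝ}
    {Q : MvPolynomial (Fin m × ι) R}
    (hQ : OrdGE (fun p : Fin m × ι => if p.2 = a then d p.1 else 0) c Q) (ν : Fin m × ι →₀ ℕ) :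
    OrdGE d c (coeff ν (dehomog R a b Q)) := by
  classical
  rw [TorusML.coeff_dehomog hab]
  refine OrdGE.sum fun e he => ?_
  intro μ hμ
  have : μ = innerExp a e := by
    have := support_monomial_subset hμ
    simpa using this
  subst this
  refine (hQ e (mem_filter.1 he).1).trans (le_of_eq ?_)
  rw [sum_prod_type]
  refine sum_congr rfl fun h _ => ?_
  rw [sum_eq_single a] <;> simp +contextual [innerExp]

/-- Lifting an inner shift together with admixtures of positive degree outer variables does not
change the coefficients of minimal outer degree. -/
theorem coeff_lowest {κ : Type*} [Fintype κ] (ξ : Fin m → R)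
    (g : Fin m → MvPolynomial κ (MvPolynomial (Fin m) R)) (hg : ∀ h, constantCoeff (g h) = 0)
    (F : MvPolynomial κ (MvPolynomial (Fin m) R)) (ν : κ →₀ ℕ)
    (hν : ∀ ν' ∈ F.support, ν.degree ≤ ν'.degree) :
    coeff ν (eval₂Hom ((aeval fun h => C (X h + C (ξ h)) + g h :
      MvPolynomial (Fin m) R →ₐ[R] MvPolynomial κ (MvPolynomial (Fin m) R)) : _ →+* _) X F) =
      mvShift ξ (coeff ν F) := by
  classical
  set Θ : MvPolynomial (Fin m) R →ₐ[R] MvPolynomial κ (MvPolynomial (Fin m) R) :=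
    aeval fun h => C (X h + C (ξ h)) + g h with hΘ
  have hc : ∀ p, constantCoeff (Θ p) = mvShift ξ p := by
    intro p
    have : ((constantCoeff : MvPolynomial κ (MvPolynomial (Fin m) R) →+* _).comp
        (Θ : _ →+* _)) = (mvShift ξ).toRingHom := by
      refine MvPolynomial.ringHom_ext (fun r => ?_) fun h => ?_
      · simp only [RingHom.comp_apply, RingHom.coe_coe, algHom_C]
        rw [show algebraMap R (MvPolynomial κ (MvPolynomial (Fin m) R)) r = C (C r) from rfl,
          constantCoeff_C]
        exact (algHom_C _ _).symm
      · simp [hΘ, mvShift, hg]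
    exact DFunLike.congr_fun this p
  have h1 : eval₂Hom (Θ : MvPolynomial (Fin m) R →+* _) X F =
      ∑ ν' ∈ F.support, Θ (coeff ν' F) * monomial ν' 1 := by
    conv_lhs => rw [F.as_sum]
    rw [_root_.map_sum]
    refine sum_congr rfl fun ν' _ => ?_
    rw [coe_eval₂Hom, eval₂_monomial, monomial_eq, C_1, one_mul]
    rfl
  rw [h1, coeff_sum]
  have h2 : ∀ ν' ∈ F.support, coeff ν (Θ (coeff ν' F) * monomial ν' 1) =
      if ν' = ν then mvShift ξ (coeff ν' F) else 0 := by
    intro ν' hν'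
    rw [coeff_mul_monomial', mul_one]
    by_cases h : ν' = ν
    · subst h
      rw [if_pos le_rfl, if_pos rfl, tsub_self, ← hc]
      rfl
    · rw [if_neg h, if_neg]
      intro hle
      apply h
      refine le_antisymm hle ?_
      obtain ⟨δ, rfl⟩ := le_iff_exists_add.1 hle
      have := hν ν' hν'
      rw [map_add] at this
      have hδ : δ.degree = 0 := by omega
      rw [Finsupp.degree_eq_zero_iff] at hδ
      rw [hδ, add_zero]
  rw [sum_congr rfl h2, sum_ite_eq']
  split_ifs with h
  · rfl
  · rw [notMem_support_iff.1 h, _root_.map_zero]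

end Dehomog

section Hyperplane

variable {K : Type*} [Field K] {m : ℕ} {ι : Type*} [Fintype ι] [DecidableEq ι]

theorem dual_apply_eq_sum (φ : (ι → K) →ₗ[K] K) (x : ι → K) :
    φ x = ∑ l, x l * φ (Pi.single l 1) := by
  rw [LinearMap.pi_apply_eq_sum_univ φ x]
  refine sum_congr rfl fun l _ => ?_
  rw [smul_eq_mul]
  congr 2
  ext j
  simp [Pi.single_apply, eq_comm]

/-- The elementary frame of a hyperplane. -/
def elemFrame (a : ι) (ξ : ι → K) : Matrix ι ι K :=
  of fun i k => (if i = k then 1 else 0) + if i = a ∧ k ≠ a then ξ k else 0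

theorem dehomog_linSubst_elemFrame {a b : ι} (hab : a ≠ b) (ξ : Fin m → ι → K)
    (Q : MvPolynomial (Fin m × ι) K) :
    ∃ g : Fin m → MvPolynomial (Fin m × ι) (MvPolynomial (Fin m) K),
      (∀ h, constantCoeff (g h) = 0) ∧
      dehomog K a b (linSubst (fun h => elemFrame a (ξ h)) Q) =
        eval₂Hom ((aeval fun h => C (X h + C (ξ h b)) + g h :
          MvPolynomial (Fin m) K →ₐ[K] MvPolynomial (Fin m × ι) (MvPolynomial (Fin m) K)) : _ →+* _)
          X (dehomog K a b Q) := by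
  obtain ⟨g, hg⟩ : ∃ g : Fin m → MvPolynomial (Fin m × ι) (MvPolynomial (Fin m) K),
    g = fun h => ∑ k ∈ (univ.erase a).erase b, C (C (ξ h k)) * X (h, k) := ⟨_, rfl⟩
  refine ⟨g, fun h => by simp [hg], ?_⟩
  obtain ⟨Θ, hΘ⟩ : ∃ Θ : MvPolynomial (Fin m) K →ₐ[K]
      MvPolynomial (Fin m × ι) (MvPolynomial (Fin m) K),
    Θ = aeval fun h => C (X h + C (ξ h b)) + g h := ⟨_, rfl⟩
  rw [← hΘ]
  have hC : ∀ r : K, dehomog (m := m) K a b (C r) = C (C r) := fun r => algHom_C _ _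
  induction Q using MvPolynomial.induction_on with
  | C r =>
    rw [hC, algHom_C, algebraMap_eq, hC, coe_eval₂Hom, eval₂_C]
    exact (algHom_C Θ r).symm
  | add p q hp hq => rw [_root_.map_add, _root_.map_add, hp, hq, _root_.map_add, _root_.map_add]
  | mul_X p P hP =>
    rw [_root_.map_mul, _root_.map_mul, hP, _root_.map_mul (dehomog K a b) p, _root_.map_mul]
    refine congrArg₂ _ rfl ?_
    have hX : ∀ p : Fin m × ι, dehomog K a b (X p) =
        if p.2 = a then C (X p.1) else if p.2 = b then 1 else X p := fun p => aeval_X _ p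
    have hL : dehomog K a b (linSubst (fun h => elemFrame a (ξ h)) (X P)) =
        ∑ k, C (C (elemFrame a (ξ P.1) P.2 k)) * dehomog K a b (X (P.1, k)) := by
      rw [linSubst_X, _root_.map_sum]
      exact sum_congr rfl fun k _ => by rw [_root_.map_mul, hC]
    rw [hL]
    obtain ⟨h, i⟩ := P
    simp only [hX]
    by_cases hi : i = a
    · subst hi
      rw [if_pos rfl, coe_eval₂Hom, eval₂_C, RingHom.coe_coe, hΘ, aeval_X,
        ← add_sum_erase _ _ (mem_univ i),
        ← add_sum_erase _ _ (mem_erase.2 ⟨hab.symm, mem_univ b⟩)]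
      have : ∀ k ∈ (univ.erase i).erase b,
          (C (C (elemFrame i (ξ h) i k)) * if k = i then C (X h) else if k = b then 1 else
            X (h, k) : MvPolynomial (Fin m × ι) (MvPolynomial (Fin m) K)) =
            C (C (ξ h k)) * X (h, k) := by
        intro k hk
        simp only [mem_erase, mem_univ, and_true] at hk
        rw [if_neg hk.2, if_neg hk.1]
        simp [elemFrame, hk.2, Ne.symm hk.2]
      rw [sum_congr rfl this]
      simp [elemFrame, hab, hab.symm, hg, add_assoc]
    · rw [if_neg hi, sum_eq_single i]
      · rw [if_neg hi]
        simp only [elemFrame, of_apply, hi, false_and, if_true, if_false, add_zero, C_1,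
          one_mul, coe_eval₂Hom]
        split_ifs
        · simp
        · simp
      · intro k _ hk
        simp [elemFrame, hi, Ne.symm hk]
      · simp

/-- An integral multihomogeneous polynomial cannot vanish to high order along a product of
hyperplanes of large height. -/
theorem roth_hyperplane [CharZero K] (m : ℕ) {σ : ℝ} (hσ : 0 < σ) : ∃ ω : ℝ, 0 < ω ∧
    ∀ (a b : ι) (d : Fin m → ℕ) (φ : Fin m → (ι → K) →ₗ[K] K) (Y : Fin m → Matrix ι ι K)
      (h : Fin m → ℝ) (L : ℝ) (P : MvPolynomial (Fin m × ι) ℤ), a ≠ b →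
      (∀ i, 0 < d i) → (∀ i j, i < j → (d i : ℝ) ≤ ω * d j) → (∀ i, 0 < h i) →
      (∀ i, LargeHeight (-φ i (Pi.single b 1) / φ i (Pi.single a 1)) (h i)) →
      (∀ i, (d i : ℝ) ≤ L) → (∀ i, L ≤ ω * d i * h i) →
      P ≠ 0 → (∀ e ∈ P.support, ∀ i, ∑ k, e (i, k) = d i) → l1 P ≤ exp L →
      (∀ i, φ i (Pi.single a 1) ≠ 0) → (∀ i k, Y i k a = if k = a then 1 else 0) →
      (∀ i, ∀ k ≠ a, φ i (fun l => Y i l k) = 0) → (∀ i, IsUnit (Y i).det) →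
      ∃ e ∈ (linSubst Y (map (castRingHom K) P)).support, ∑ i, e (i, a) * (1 / d i : ℝ) < σ := by
  obtain ⟨ω, hω, H⟩ := roth_lemma (K := K) m σ hσ
  refine ⟨ω, hω, fun a b d φ Y h L P hab hd hdd hh hφ hdL hL hP hPd hl hφa hYa hYk hY => ?_⟩
  by_contra! hcon
  set Q := map (castRingHom K) P with hQ
  have hord : OrdGE (fun p : Fin m × ι => if p.2 = a then (1 / d p.1 : ℝ) else 0) σ
      (linSubst Y Q) := by
    intro e he
    refine (hcon e he).trans (le_of_eq ?_)
    rw [sum_prod_type]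
    refine sum_congr rfl fun i _ => ?_
    rw [sum_eq_single a] <;> simp +contextual
  set ξ : Fin m → ι → K := fun i k => -φ i (Pi.single k 1) / φ i (Pi.single a 1) with hξ
  set Z : Fin m → Matrix ι ι K := fun i => elemFrame a (ξ i) with hZ
  have hφs : ∀ i (x : ι → K), φ i x = ∑ l, x l * φ i (Pi.single l 1) := fun i x =>
    dual_apply_eq_sum (φ i) x
  have hZφ : ∀ i k, φ i (fun l => Z i l k) = if k = a then φ i (Pi.single a 1) else 0 := by
    intro i k
    rw [hφs]
    by_cases hk : k = a
    · subst hk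
      simp [hZ, elemFrame]
    · have h0 := hφa i
      simp only [hZ, elemFrame, of_apply, add_mul, sum_add_distrib, ite_mul, one_mul,
        zero_mul, sum_ite_eq', mem_univ, if_true, hk, ne_eq, not_false_eq_true, and_true,
        if_false, hξ]
      field_simp
      ring
  set T : Fin m → Matrix ι ι K := fun i => (Y i)⁻¹ * Z i with hT
  have hYT : ∀ i, Y i * T i = Z i := fun i => by
    rw [hT, ← Matrix.mul_assoc, Matrix.mul_nonsing_inv _ (hY i), Matrix.one_mul]
  have hTa : ∀ i k, T i a k = if k = a then 1 else 0 := by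
    intro i k
    have h1 := hZφ i k
    have h2 : (fun l => Z i l k) = ∑ j, T i j k • fun l => Y i l j := by
      ext l
      rw [← hYT, mul_apply, Finset.sum_apply]
      exact sum_congr rfl fun j _ => by simp [mul_comm]
    have h3 : φ i (fun l => Y i l a) = φ i (Pi.single a 1) := by
      congr 1
      ext l
      rw [hYa, Pi.single_apply]
    rw [h2, _root_.map_sum, sum_eq_single a, LinearMap.map_smul, smul_eq_mul, h3] at h1
    · refine mul_right_cancel₀ (hφa i) (h1.trans ?_)
      split_ifs <;> simp
    · intro j _ hj
      rw [LinearMap.map_smul, hYk i j hj, smul_zero]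
    · simp
  have hordZ : OrdGE (fun p : Fin m × ι => if p.2 = a then (1 / d p.1 : ℝ) else 0) σ
      (linSubst Z Q) := by
    have := OrdGE.linSubst (d := fun i => (1 / d i : ℝ)) (fun i => by positivity) hTa hord
    rwa [linSubst_linSubst, funext hYT] at this
  set F := dehomog ℤ a b P with hF
  have hF0 : F ≠ 0 := dehomog_ne_zero hab hP hPd
  obtain ⟨ν, hν, hmin⟩ := exists_min_image F.support (fun ν => ν.degree) (support_nonempty.2 hF0)
  have hmap : ∀ ν, coeff ν (dehomog K a b Q) = map (castRingHom K) (coeff ν F) := by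
    intro ν
    rw [coeff_dehomog hab, coeff_dehomog hab, _root_.map_sum]
    have hs : Q.support = P.support :=
      support_map_of_injective P (f := castRingHom K) (castRingHom K).injective_int
    rw [hs]
    refine sum_congr rfl fun e _ => ?_
    rw [map_monomial, coeff_map]
  obtain ⟨g, hg, hgE⟩ := dehomog_linSubst_elemFrame hab ξ Q
  have h1 := coeff_lowest (fun i => ξ i b) g hg (dehomog K a b Q) ν (by
    intro ν' hν'
    refine hmin ν' ?_
    rw [mem_support_iff] at hν' ⊢
    intro h0
    rw [hmap, h0, _root_.map_zero] at hν'
    exact hν' rfl)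
  rw [← hgE, hmap] at h1
  have h2 := OrdGE.coeff_dehomog (d := fun i => (1 / d i : ℝ)) hab hordZ ν
  rw [h1] at h2
  refine H d (fun i => ξ i b) h L (coeff ν F) hd hdd hh hφ hdL hL (mem_support_iff.1 hν) ?_ ?_ h2
  · intro i
    rw [degreeOf_le_iff]
    intro μ hμ
    rw [coeff_dehomog hab] at hμ
    obtain ⟨e, he, hμ⟩ := mem_biUnion.1 (support_sum hμ)
    have : μ = innerExp a e := by simpa using support_monomial_subset hμ
    rw [this, ← hPd e (mem_filter.1 he).1 i]
    exact single_le_sum (f := fun k => e (i, k)) (fun _ _ => Nat.zero_le _) (mem_univ a)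
  · refine le_trans ?_ hl
    rw [coeff_dehomog hab]
    have h0 : ∀ i : Fin m, (0 : ℝ) ≤ (1 : Fin m → ℝ) i := fun _ => zero_le_one
    refine (wnorm_sum_le _ h0 _ _).trans ?_
    refine (sum_le_sum fun e _ => (wnorm_monomial (v := vZ) _ _).le).trans ?_
    refine (sum_le_sum_of_subset_of_nonneg (filter_subset _ _) fun e _ _ => ?_).trans (le_of_eq ?_)
    · simp
    · rw [l1, wnorm]
      exact sum_congr rfl fun e _ => by simp

end Hyperplane

end

section

open Finset

section Frame

variable {K ι : Type*} [Field K] [Fintype ι] [DecidableEq ι]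

/-- A spanning set of a hyperplane contains a basis of it, completed here by `e_b`. -/
theorem exists_frame {φ : (ι → K) →ₗ[K] K} {b : ι} (hb : φ (Pi.single b 1) ≠ 0)
    {s : Set (ι → K)} (hs : ker φ ≤ span K s) (hsφ : ∀ y ∈ s, φ y = 0) :
    ∃ Y : Matrix ι ι K, (∀ k, Y k b = if k = b then 1 else 0) ∧
      (∀ k ≠ b, (fun l => Y l k) ∈ s) ∧ IsUnit Y.det := by
  have hker : span K s = ker φ :=
    le_antisymm (span_le.2 fun y hy => hsφ y hy) hs
  obtain ⟨f, hf, -, hlin⟩ := Submodule.exists_fun_fin_finrank_span_eq K s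
  have hφ0 : φ ≠ 0 := fun h => hb (by rw [h, LinearMap.zero_apply])
  have hdim := Dual.finrank_ker_add_one_of_ne_zero (f := φ) hφ0
  rw [Module.finrank_fintype_fun_eq_card] at hdim
  have hcard : Fintype.card {k // k ≠ b} = Fintype.card (Fin (finrank K (span K s))) := by
    rw [Fintype.card_fin, hker, Fintype.card_subtype_compl, Fintype.card_subtype_eq]
    omega
  let τ := Fintype.equivOfCardEq hcard
  let Y : Matrix ι ι K := of fun l k =>
    if hk : k ≠ b then f (τ ⟨k, hk⟩) l else if l = b then 1 else 0
  have hYb : ∀ l, Y l b = if l = b then 1 else 0 := fun l => by simp [Y]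
  have hYk : ∀ k (hk : k ≠ b), (fun l => Y l k) = f (τ ⟨k, hk⟩) := fun k hk => by
    ext l
    simp [Y, hk]
  refine ⟨Y, hYb, fun k hk => hYk k hk ▸ hf _, ?_⟩
  rw [isUnit_iff_ne_zero]
  intro hdet
  obtain ⟨x, hx, hYx⟩ := Matrix.exists_mulVec_eq_zero_iff.2 hdet
  have h1 : x b • (Pi.single b 1 : ι → K) + ∑ k : {k // k ≠ b}, x k • f (τ k) = 0 := by
    rw [← hYx]
    ext l
    rw [mulVec, dotProduct, ← add_sum_erase _ _ (mem_univ b), Pi.add_apply, hYb]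
    congr 1
    · simp [Pi.single_apply]
    · rw [Finset.sum_apply, sum_subtype (univ.erase b) (p := fun k => k ≠ b)
        (fun k => by simp) (fun k => Y l k * x k)]
      refine sum_congr rfl fun k _ => ?_
      rw [Pi.smul_apply, smul_eq_mul, ← congrFun (hYk k.1 k.2) l, mul_comm]
  have hxb : x b = 0 := by
    have := congrArg φ h1
    rw [map_add, map_smul, map_sum, map_zero, sum_eq_zero, add_zero, smul_eq_mul] at this
    · exact (mul_eq_zero.1 this).resolve_right hb
    · intro k _
      rw [map_smul, hsφ _ (hf _), smul_zero]
  rw [hxb, zero_smul, zero_add] at h1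
  have hlin' : LinearIndependent K (f ∘ τ) := hlin.comp τ τ.injective
  have h2 := Fintype.linearIndependent_iff.1 hlin' (fun k => x k) h1
  refine hx (funext fun k => ?_)
  by_cases hk : k = b
  · rw [hk, hxb]; rfl
  · exact h2 ⟨k, hk⟩

theorem eq_sum_form {A B : Matrix ι ι ℤ} (h : B * A = 1) (y : ι → K) :
    y = ∑ i, form (A i) y • fun l => (B l i : K) := by
  conv_lhs => rw [← one_mulVec y, ← map_intCast_mul h, ← mulVec_mulVec]
  ext l
  rw [Finset.sum_apply, mulVec, dotProduct]
  refine sum_congr rfl fun i _ => ?_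
  rw [← form_eq_mulVec, Pi.smul_apply, smul_eq_mul, map_apply, mul_comm]

theorem abv_det_le_of_row (v : AbsoluteValue K ℝ) {M : Matrix ι ι K} {i₀ b : ι} {r : ι → ℝ}
    (hr : ∀ i, 0 ≤ r i) (h0 : ∀ k ≠ b, M i₀ k = 0) (hb : v (M i₀ b) ≤ r i₀)
    (h : ∀ i ≠ i₀, ∀ k ≠ b, v (M i k) ≤ r i) :
    v M.det ≤ (Fintype.card ι).factorial * ∏ i, r i := by
  rw [det_apply]
  refine (v.sum_le _ _).trans ?_
  refine (sum_le_card_nsmul _ _ (∏ i, r i) fun σ _ => ?_).trans (le_of_eq ?_)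
  · rcases Int.units_eq_one_or (Perm.sign σ) with hs | hs
    all_goals
      rw [hs]
      simp only [one_smul, Units.neg_smul, v.map_neg, map_prod]
      rw [← Equiv.prod_comp σ r]
      by_cases hσ : σ b = i₀
      · refine Finset.prod_le_prod (fun _ _ => v.nonneg _) fun k _ => ?_
        by_cases hk : k = b
        · rw [hk, hσ]; exact hb
        · exact h _ (fun h' => hk (σ.injective (h'.trans hσ.symm))) k hk
      · obtain ⟨k, hk⟩ := σ.surjective i₀
        have hkb : k ≠ b := fun h' => hσ (h' ▸ hk)
        rw [prod_eq_zero (mem_univ k)]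
        · exact prod_nonneg fun _ _ => hr _
        · rw [hk, h0 k hkb, v.map_zero]
  · rw [card_univ, Fintype.card_perm, nsmul_eq_mul]

end Frame

namespace SInt

variable {K : Type*} [Field K] {S : Type*} [Fintype S] {s : SInt K S}
variable {ι : Type*} [Fintype ι] [DecidableEq ι]

lemma exists_minimal_dual {𝒰 : Ultrafilter ℕ} {φ : ℕ → (ι → K) →ₗ[K] K} (hφ : ∀ j, φ j ≠ 0)
    (hconst : ¬ ∃ T, ∀ᶠ j in 𝒰, ker (φ j) = T) :
    ∃ M : Submodule K ((ι → K) →ₗ[K] K), (∀ᶠ j in 𝒰, φ j ∈ M) ∧ (∀ M' < M, ∀ᶠ j in 𝒰, φ j ∉ M') ∧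
      ∀ h ∈ M, h ≠ 0 → ∀ᶠ j in 𝒰, ¬ ker (φ j) ≤ ker h := by
  obtain ⟨M, hM, hmin⟩ := wellFounded_lt.has_min
    {M : Submodule K ((ι → K) →ₗ[K] K) | ∀ᶠ j in 𝒰, φ j ∈ M}
    ⟨⊤, Filter.Eventually.of_forall fun _ => Submodule.mem_top⟩
  have hprop : ∀ M' < M, ∀ᶠ j in 𝒰, φ j ∉ M' := fun M' hM' =>
    Ultrafilter.eventually_not.2 fun h => hmin M' h hM'
  refine ⟨M, hM, hprop, fun h hh h0 => ?_⟩
  have key : ∀ j, ker (φ j) ≤ ker h → φ j ∈ K ∙ h := by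
    intro j hj
    have := mem_span_of_iInf_ker_le_ker (ι := Unit) (L := fun _ => φ j) (K := h) (by simpa using hj)
    rw [Set.range_const, mem_span_singleton] at this
    obtain ⟨a, rfl⟩ := this
    have ha : a ≠ 0 := fun ha => h0 (by rw [ha, zero_smul])
    exact mem_span_singleton.2 ⟨a⁻¹, by rw [smul_smul, inv_mul_cancel₀ ha, one_smul]⟩
  rcases (show K ∙ h ≤ M by rwa [Submodule.span_singleton_le_iff_mem]).lt_or_eq with hlt | heq
  · filter_upwards [hprop _ hlt] with j hj hle using hj (key j hle)
  · refine absurd ⟨ker h, ?_⟩ hconst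
    filter_upwards [hM] with j hj
    rw [← heq, mem_span_singleton] at hj
    obtain ⟨a, ha⟩ := hj
    have ha0 : a ≠ 0 := fun h' => hφ j (by rw [← ha, h', zero_smul])
    rw [← ha, LinearMap.ker_smul _ _ ha0]

/-- A hyperplane spanned by small points either is eventually constant or has large height. -/
lemma height_dichotomy {𝒰 : Ultrafilter ℕ} {q : ℕ → ℝ} (hq : Tendsto q 𝒰 atTop)
    {A B : S → Matrix ι ι ℤ} (hBA : ∀ v, B v * A v = 1) {c : S → ι → ℝ}
    (hc : ∑ v, (s.wt v : ℝ) * ∑ i, c v i < 0) {φ : ℕ → (ι → K) →ₗ[K] K} (hφ : ∀ j, φ j ≠ 0)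
    (hsp : s.SpannedBy 𝒰 q A (fun j => ker (φ j)) c)
    (hconst : ¬ ∃ T, ∀ᶠ j in 𝒰, ker (φ j) = T) :
    ∃ β > 0, ∀ᶠ j in 𝒰, ∀ g : ι → K, g ≠ 0 → (∀ i, g i ∈ s.O) →
      (∃ a, ∀ k, g k = a * φ j (Pi.single k 1)) → ∃ v i, exp (β * q j) < s.abv v (g i) := by
  classical
  by_contra! hcon
  obtain ⟨M, hM, hprop, hker⟩ := exists_minimal_dual hφ hconst
  set I : S → Finset ι := fun v => univ.filter fun i => ∃ ψ ∈ M, ψ (fun l => (B v l i : K)) ≠ 0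
    with hI
  have hIne : ∀ v, (I v).Nonempty := by
    intro v
    obtain ⟨j, hj⟩ := hM.exists
    by_contra! hemp
    refine hφ j (LinearMap.ext fun y => ?_)
    rw [eq_sum_form (hBA v) y, map_sum, LinearMap.zero_apply]
    refine sum_eq_zero fun i _ => ?_
    have hi : i ∉ I v := by rw [hemp]; exact notMem_empty i
    rw [hI, mem_filter] at hi
    push Not at hi
    rw [map_smul, hi (mem_univ _) _ hj, smul_zero]
  choose iv hiv hmax using fun v => exists_max_image (I v) (c v) (hIne v)
  have h1 : 0 ≤ ∑ v, (s.wt v : ℝ) * c v (iv v) := by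
    obtain ⟨j₀, hj₀, g, hg0, hgO, ⟨a, hga⟩, -⟩ := (hM.and (hcon 1 one_pos)).exists
    set h := a • φ j₀ with hh
    have hhM : h ∈ M := M.smul_mem _ hj₀
    have hhg : ∀ k, h (Pi.single k 1) = g k := fun k => (hga k).symm
    have hh0 : h ≠ 0 := by
      intro h'
      refine hg0 (funext fun k => ?_)
      rw [← hhg, h']; rfl
    refine s.sum_nonneg_of_eventually hq (fun v => c v (iv v))
      (∑ v, ∑ i, s.abv v (h fun l => (B v l i : K))) 1 fun ε hε => ?_
    filter_upwards [hsp ε hε, hker h hhM hh0, hq.eventually_ge_atTop 0] with j hj hjker hj0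
    obtain ⟨y, ⟨hyker, hyO, hy⟩, hhy⟩ : ∃ y ∈ {y | y ∈ ker (φ j) ∧
        y ∈ s.Box A (fun v i => c v i + ε) (q j)}, h y ≠ 0 := by
      by_contra! hall
      exact hjker (hj.trans (span_le.2 fun y hy => hall y hy))
    refine ⟨h y, ?_, hhy, fun v => ?_⟩
    · rw [dual_apply_eq_sum]
      exact s.O.sum_mem fun k _ => s.O.mul_mem (hyO k) (hhg k ▸ hgO k)
    · have e1 : h y = ∑ i, form (A v i) y * h (fun l => (B v l i : K)) := by
        conv_lhs => rw [eq_sum_form (hBA v) y]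
        rw [map_sum]
        exact sum_congr rfl fun i _ => by rw [map_smul, smul_eq_mul]
      rw [e1]
      calc s.abv v (∑ i, form (A v i) y * h (fun l => (B v l i : K)))
          ≤ ∑ i, s.abv v (form (A v i) y * h (fun l => (B v l i : K))) := (s.abv v).sum_le _ _
        _ ≤ ∑ i, s.abv v (h fun l => (B v l i : K)) * exp ((c v (iv v) + 1 * ε) * q j) := by
            refine sum_le_sum fun i _ => ?_
            rw [map_mul, mul_comm]
            by_cases hi : i ∈ I v
            · refine mul_le_mul_of_nonneg_left ((hy v i).trans (exp_le_exp.2 ?_))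
                ((s.abv v).nonneg _)
              have := hmax v i hi
              exact mul_le_mul_of_nonneg_right (by linarith) hj0
            · rw [hI, mem_filter] at hi
              push Not at hi
              rw [hi (mem_univ _) h hhM, map_zero, zero_mul, zero_mul]
        _ ≤ _ := by
            rw [← sum_mul]
            refine mul_le_mul_of_nonneg_right ?_ (exp_pos _).le
            exact single_le_sum (f := fun v => ∑ i, s.abv v (h fun l => (B v l i : K)))
              (fun v _ => sum_nonneg fun i _ => (s.abv v).nonneg _) (mem_univ v)
  have h2 : 0 ≤ ∑ v, (s.wt v : ℝ) * ∑ i ∈ univ.erase (iv v), c v i := by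
    set C₀ : ℝ := 1 + ∑ v, ∑ i, ∑ k, |(B v k i : ℝ)| with hC₀
    have hC₀1 : 1 ≤ C₀ := le_add_of_nonneg_right (sum_nonneg fun _ _ =>
      sum_nonneg fun _ _ => sum_nonneg fun _ _ => abs_nonneg _)
    have hC₀B : ∀ v i, ∑ k, |(B v k i : ℝ)| ≤ C₀ := by
      intro v i
      refine le_trans ?_ (le_add_of_nonneg_left zero_le_one)
      refine le_trans ?_ (single_le_sum (f := fun v => ∑ i, ∑ k, |(B v k i : ℝ)|)
        (fun _ _ => sum_nonneg fun _ _ => sum_nonneg fun _ _ => abs_nonneg _)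
        (mem_univ v))
      exact single_le_sum (f := fun i => ∑ k, |(B v k i : ℝ)|)
        (fun _ _ => sum_nonneg fun _ _ => abs_nonneg _) (mem_univ i)
    have hne : ∀ᶠ j in 𝒰, ∀ v, φ j (fun l => (B v l (iv v) : K)) ≠ 0 := by
      rw [Filter.eventually_all]
      intro v
      obtain ⟨-, ψ, hψ, hψ0⟩ := mem_filter.1 (hiv v)
      have hlt : M ⊓ ker (LinearMap.applyₗ (R := K) (M₂ := K)
          (fun l => (B v l (iv v) : K))) < M := by
        refine lt_of_le_of_ne inf_le_left fun h' => hψ0 ?_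
        have := h'.symm ▸ hψ
        exact this.2
      filter_upwards [hprop _ hlt, hM] with j hj hjM h0
      exact hj ⟨hjM, h0⟩
    refine s.sum_nonneg_of_eventually hq (fun v => ∑ i ∈ univ.erase (iv v), c v i)
      ((Fintype.card ι).factorial * C₀ ^ Fintype.card S)
      (1 + Fintype.card ι + Fintype.card S) fun ε hε => ?_
    filter_upwards [hsp ε hε, hne, hcon ε hε, hq.eventually_ge_atTop 0] with j hj hjne hjg hj0
    obtain ⟨g, hg0, hgO, ⟨a, hga⟩, hgle⟩ := hjg
    obtain ⟨b, hb⟩ : ∃ b, g b ≠ 0 := ne_iff.1 hg0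
    have ha : a ≠ 0 := fun h' => hb (by rw [hga, h', zero_mul])
    have hφb : φ j (Pi.single b 1) ≠ 0 := fun h' => hb (by rw [hga, h', mul_zero])
    obtain ⟨Y, hYb, hYk, hYdet⟩ := exists_frame hφb hj fun y hy => hy.1
    set h := a • φ j with hh
    have hhg : ∀ y, h y = ∑ k, y k * g k := fun y => by
      rw [dual_apply_eq_sum]
      exact sum_congr rfl fun k _ => by rw [hga]; rfl
    have hform : ∀ v y, h y = ∑ i, h (fun l => (B v l i : K)) * form (A v i) y := by
      intro v y
      conv_lhs => rw [eq_sum_form (hBA v) y]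
      rw [map_sum]
      exact sum_congr rfl fun i _ => by rw [map_smul, smul_eq_mul, mul_comm]
    set γ : S → K := fun v => h (fun l => (B v l (iv v) : K)) with hγ
    have hγg : ∀ v, γ v = ∑ k, (B v k (iv v) : K) * g k := fun v => hhg _
    have hγO : ∀ v, γ v ∈ s.O := fun v => by
      rw [hγg]
      exact s.O.sum_mem fun k _ => s.O.mul_mem (s.int_mem _) (hgO k)
    have hγ0 : ∀ v, γ v ≠ 0 := fun v => mul_ne_zero ha (hjne v)
    have hγle : ∀ w v, s.abv w (γ v) ≤ C₀ * exp (ε * q j) := by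
      intro w v
      rw [hγg]
      refine ((s.abv w).sum_le _ _).trans ?_
      refine (sum_le_sum fun k _ => ?_).trans
        ((sum_mul univ (fun k => |(B v k (iv v) : ℝ)|) _).symm.le.trans
          (mul_le_mul_of_nonneg_right (hC₀B v _) (exp_pos (ε * q j)).le))
      rw [map_mul]
      exact mul_le_mul (s.abv_intCast_le w _) (hgle w k) ((s.abv w).nonneg _) (abs_nonneg _)
    have hYO : ∀ l k, Y l k ∈ s.O := by
      intro l k
      by_cases hk : k = b
      · rw [hk, hYb]
        split_ifs
        exacts [s.O.one_mem, s.O.zero_mem]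
      · exact (hYk k hk).2.1 l
    refine ⟨Y.det * ∏ v, γ v, s.O.mul_mem ?_ (s.O.prod_mem fun v _ => hγO v),
      mul_ne_zero hYdet.ne_zero (prod_ne_zero_iff.2 fun v _ => hγ0 v), fun v => ?_⟩
    · rw [det_apply]
      refine s.O.sum_mem fun σ _ => ?_
      rw [Units.smul_def]
      exact s.O.zsmul_mem (s.O.prod_mem fun i _ => hYO _ _) _
    set AY : Matrix ι ι K := (A v).map (Int.cast : ℤ → K) * Y with hAY
    have hAYe : ∀ i k, AY i k = form (A v i) fun l => Y l k := fun i k => by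
      rw [form_eq_mulVec, hAY, mul_apply]; rfl
    have hD : s.abv v Y.det ≤ s.abv v AY.det := by
      have h2 : (B v).map (Int.cast : ℤ → K) * (A v).map (Int.cast : ℤ → K) = 1 := by
        have := congrArg (castRingHom K).mapMatrix (hBA v)
        rw [map_mul, map_one] at this
        exact this
      have h3 : Y.det = ((B v).det : K) * AY.det := by
        rw [Int.cast_det, ← det_mul, hAY, ← Matrix.mul_assoc]
        have : (B v).map (fun x : ℤ => (x : K)) * (A v).map (Int.cast : ℤ → K) = 1 := h2
        rw [this, Matrix.one_mul]
      rw [h3, map_mul]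
      refine mul_le_of_le_one_left ((s.abv v).nonneg _) ((s.abv_intCast_le v _).trans ?_)
      have hu : IsUnit (B v).det := IsUnit.of_mul_eq_one (A v).det (by
        rw [← det_mul, hBA, det_one])
      rcases Int.isUnit_iff.1 hu with h' | h' <;> simp [h']
    have hrow : ∀ k, (∑ i, h (fun l => (B v l i : K)) • AY i) k = h fun l => Y l k := by
      intro k
      rw [hform v, Finset.sum_apply]
      exact sum_congr rfl fun i _ => by rw [Pi.smul_apply, smul_eq_mul, hAYe]
    have hdet := Matrix.det_updateRow_sum AY (iv v) fun i => h (fun l => (B v l i : K))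
    have hbound := abv_det_le_of_row (s.abv v)
      (M := AY.updateRow (iv v) (∑ i, h (fun l => (B v l i : K)) • AY i)) (i₀ := iv v) (b := b)
      (r := fun i => exp (((if i = iv v then 0 else c v i) + ε) * q j))
      (fun i => (exp_pos _).le) (fun k hk => by
        rw [Matrix.updateRow_self, hrow, hh, LinearMap.smul_apply, (hYk k hk).1, smul_zero])
      (by
        rw [Matrix.updateRow_self, hrow, hhg, sum_eq_single b, hYb, if_pos rfl, one_mul]
        · simpa using hgle v b
        · intro k _ hk
          rw [hYb, if_neg hk, zero_mul]
        · simp)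
      (fun i hi k hk => by
        rw [Matrix.updateRow_ne hi, hAYe, if_neg hi]
        exact (hYk k hk).2.2 v i)
    rw [hdet, smul_eq_mul, map_mul, ← exp_sum] at hbound
    have hexp : ∑ i, ((if i = iv v then 0 else c v i) + ε) * q j =
        (∑ i ∈ univ.erase (iv v), c v i + Fintype.card ι * ε) * q j := by
      rw [← sum_mul, sum_add_distrib, ← add_sum_erase _ _ (mem_univ (iv v)),
        if_pos rfl, zero_add, sum_congr rfl fun i hi => if_neg (ne_of_mem_erase hi)]
      simp
    rw [hexp] at hbound
    have hprod : ∏ w ∈ univ.erase v, s.abv v (γ w) ≤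
        C₀ ^ Fintype.card S * exp (Fintype.card S * ε * q j) := by
      calc ∏ w ∈ univ.erase v, s.abv v (γ w) ≤ ∏ w ∈ univ.erase v, (C₀ * exp (ε * q j)) :=
            Finset.prod_le_prod (fun _ _ => (s.abv v).nonneg _) fun w _ => hγle v w
        _ = (C₀ * exp (ε * q j)) ^ (univ.erase v).card := prod_const _
        _ ≤ (C₀ * exp (ε * q j)) ^ Fintype.card S :=
            pow_le_pow_right₀ (one_le_mul_of_one_le_of_one_le hC₀1 (one_le_exp (by positivity)))
              (card_le_univ _)
        _ = _ := by rw [mul_pow, ← exp_nat_mul, mul_assoc]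
    rw [map_mul, map_prod, ← mul_prod_erase _ _ (mem_univ v)]
    calc s.abv v Y.det * (s.abv v (γ v) * ∏ w ∈ univ.erase v, s.abv v (γ w))
        ≤ s.abv v AY.det * (s.abv v (γ v) * ∏ w ∈ univ.erase v, s.abv v (γ w)) :=
          mul_le_mul_of_nonneg_right hD (mul_nonneg ((s.abv v).nonneg _)
            (prod_nonneg fun _ _ => (s.abv v).nonneg _))
      _ = (s.abv v (γ v) * s.abv v AY.det) * ∏ w ∈ univ.erase v, s.abv v (γ w) := by ring
      _ ≤ _ := mul_le_mul hbound hprod (prod_nonneg fun _ _ => (s.abv v).nonneg _) (by positivity)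
      _ ≤ _ := by
        have e1 : ∀ a b x y : ℝ, a * exp x * (b * exp y) = a * b * exp (x + y) :=
          fun a b x y => by rw [exp_add]; ring
        rw [e1]
        refine mul_le_mul_of_nonneg_left (exp_le_exp.2 ?_) (by positivity)
        have := mul_nonneg hε.le hj0
        linarith
  have h3 : ∑ v, (s.wt v : ℝ) * ∑ i, c v i = ∑ v, (s.wt v : ℝ) * c v (iv v) +
      ∑ v, (s.wt v : ℝ) * ∑ i ∈ univ.erase (iv v), c v i := by
    rw [← sum_add_distrib]
    exact sum_congr rfl fun v _ => by
      rw [← mul_add, add_sum_erase _ _ (mem_univ _)]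
  linarith

lemma abv_leadingCoeff_mul_le (v : S) {A : Polynomial ℤ} {ξ : K}
    (hξ : Polynomial.aeval ξ A = 0) {D : ℕ} (hD : A.natDegree ≤ D) {H : ℝ}
    (hH : ∀ i, |(A.coeff i : ℝ)| ≤ H) : s.abv v (A.leadingCoeff * ξ) ≤ (D + 1) * H := by
  have hH0 : 0 ≤ H := (abs_nonneg _).trans (hH 0)
  have hc : ∀ i, s.abv v (A.coeff i : K) ≤ H := fun i => (s.abv_intCast_le v _).trans (hH i)
  rw [map_mul]
  rcases le_total (s.abv v ξ) 1 with h1 | h1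
  · calc s.abv v (A.leadingCoeff : K) * s.abv v ξ ≤ H * 1 :=
          mul_le_mul (hc _) h1 ((s.abv v).nonneg _) hH0
      _ ≤ (D + 1) * H := by nlinarith [(cast_nonneg D : (0 : ℝ) ≤ D)]
  · have hpos : 0 < s.abv v ξ := by linarith
    rw [Polynomial.aeval_eq_sum_range, sum_range_succ] at hξ
    set d := A.natDegree with hd
    have hlead : (A.leadingCoeff : K) * ξ ^ d = -∑ i ∈ range d, (A.coeff i : K) * ξ ^ i := by
      rw [eq_neg_iff_add_eq_zero, add_comm, ← hξ]
      simp [Polynomial.leadingCoeff, ← hd]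
    have h2 : s.abv v (A.leadingCoeff : K) * s.abv v ξ ^ d ≤ d * (H * s.abv v ξ ^ (d - 1)) := by
      rw [← map_pow, ← map_mul, hlead, (s.abv v).map_neg]
      refine ((s.abv v).sum_le _ _).trans ?_
      refine (sum_le_card_nsmul _ _ (H * s.abv v ξ ^ (d - 1)) fun i hi => ?_).trans ?_
      · rw [map_mul, map_pow]
        have := mem_range.1 hi
        exact mul_le_mul (hc i) (pow_le_pow_right₀ h1 (by omega)) (by positivity) hH0
      · rw [card_range, nsmul_eq_mul]
    have hDd : (d : ℝ) ≤ D + 1 := by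
      have : (d : ℝ) ≤ D := by exact_mod_cast hD
      linarith
    rcases Nat.eq_zero_or_pos d with h0 | h0
    · rw [h0] at h2
      simp only [pow_zero, mul_one, Nat.cast_zero, zero_mul] at h2
      have : s.abv v (A.leadingCoeff : K) = 0 := le_antisymm h2 ((s.abv v).nonneg _)
      rw [this, zero_mul]
      positivity
    · have h3 : s.abv v ξ ^ d = s.abv v ξ * s.abv v ξ ^ (d - 1) := by
        rw [← pow_succ']; congr 1; omega
      rw [h3, ← mul_assoc, ← mul_assoc] at h2
      exact (le_of_mul_le_mul_right h2 (by positivity)).trans (mul_le_mul_of_nonneg_right hDd hH0)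

variable [CharZero K] [Algebra ℚ K] [FiniteDimensional ℚ K]

/-- If no integral multiple of `φ` has small entries then some ratio of its entries has large
height. -/
lemma exists_largeHeight {𝒰 : Ultrafilter ℕ} {q : ℕ → ℝ} (hq : Tendsto q 𝒰 atTop)
    {φ : ℕ → (ι → K) →ₗ[K] K} (hφ : ∀ j, φ j ≠ 0) {β : ℝ} (hβ : 0 < β)
    (h : ∀ᶠ j in 𝒰, ∀ g : ι → K, g ≠ 0 → (∀ i, g i ∈ s.O) →
      (∃ a, ∀ k, g k = a * φ j (Pi.single k 1)) → ∃ v i, exp (β * q j) < s.abv v (g i)) :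
    ∃ a b : ι, a ≠ b ∧ ∃ β' > 0, ∀ᶠ j in 𝒰, φ j (Pi.single a 1) ≠ 0 ∧
      LargeHeight (-φ j (Pi.single b 1) / φ j (Pi.single a 1)) (β' * q j) := by
  classical
  obtain ⟨a, ha⟩ : ∃ a, ∀ᶠ j in 𝒰, φ j (Pi.single a 1) ≠ 0 := by
    rw [← Ultrafilter.eventually_exists_iff]
    refine Filter.Eventually.of_forall fun j => ?_
    by_contra! h0
    refine hφ j (LinearMap.ext fun y => ?_)
    rw [dual_apply_eq_sum]
    simp [h0]
  by_contra! hcon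
  set N := Fintype.card ι
  set D := finrank ℚ K
  have hN : 0 < N := Fintype.card_pos_iff.2 ⟨a⟩
  set β' := β / (2 * N) with hβ'
  have hβ'0 : 0 < β' := by positivity
  have hnot : ∀ᶠ j in 𝒰, ∀ b, b ≠ a →
      ¬ LargeHeight (-φ j (Pi.single b 1) / φ j (Pi.single a 1)) (β' * q j) := by
    rw [Filter.eventually_all]
    intro b
    by_cases hb : b = a
    · exact Filter.Eventually.of_forall fun j h => absurd hb h
    · have := hcon a b (Ne.symm hb) β' hβ'0
      filter_upwards [this, ha] with j hj hja _ using hj hja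
  set C : ℝ := (D + 1) * 2 ^ D with hC
  have hC1 : 1 ≤ C := one_le_mul_of_one_le_of_one_le
    (le_add_of_nonneg_left (cast_nonneg _)) (one_le_pow₀ one_le_two)
  obtain ⟨j, ⟨hj, hja⟩, hjn, hjq, hj0⟩ := ((h.and ha).and (hnot.and
    ((hq.eventually_ge_atTop (2 * (N * log C) / β)).and (hq.eventually_ge_atTop 0)))).exists
  set ξ : ι → K := fun b => -φ j (Pi.single b 1) / φ j (Pi.single a 1) with hξ
  have hH1 : 1 ≤ C * exp (β' * q j) :=
    one_le_mul_of_one_le_of_one_le hC1 (one_le_exp (by positivity))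
  have hl : ∀ b, ∃ l : ℤ, l ≠ 0 ∧ (b ≠ a → (l : K) * ξ b ∈ s.O) ∧
      (∀ v, s.abv v (l : K) ≤ C * exp (β' * q j)) ∧
      (b ≠ a → ∀ v, s.abv v (l * ξ b) ≤ C * exp (β' * q j)) := by
    intro b
    by_cases hb : b = a
    · exact ⟨1, one_ne_zero, fun h => absurd hb h, fun v => by simpa using hH1,
        fun h => absurd hb h⟩
    · have := mt largeHeight_of_coeff (hjn b hb)
      push Not at this
      obtain ⟨A, hA0, hAd, hA, hAc⟩ := this
      have hAc' : ∀ i, |(A.coeff i : ℝ)| ≤ 2 ^ D * exp (β' * q j) := fun i => (hAc i).le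
      refine ⟨A.leadingCoeff, Polynomial.leadingCoeff_ne_zero.2 hA0, fun _ => ?_, fun v => ?_,
        fun _ v => ?_⟩
      · have := isIntegral_leadingCoeff_smul A (ξ b) hA
        rw [zsmul_eq_mul] at this
        exact s.mem_of_isIntegral _ this
      · refine (s.abv_intCast_le v _).trans ((hAc' _).trans ?_)
        rw [hC, mul_assoc]
        exact le_mul_of_one_le_left (by positivity) (le_add_of_nonneg_left (cast_nonneg _))
      · refine (abv_leadingCoeff_mul_le v hA hAd hAc').trans ?_
        rw [hC, mul_assoc]
  choose l hl0 hlO hlv hlξ using hl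
  have hφξ : ∀ k, φ j (Pi.single k 1) = -ξ k * φ j (Pi.single a 1) := fun k => by
    rw [hξ]; field_simp
  set g : ι → K := fun k => -ξ k * ∏ b, (l b : K) with hg
  have hξa : ξ a = -1 := by rw [hξ]; field_simp
  have hga : ∀ k, k ≠ a → g k = -(l k * ξ k) * ∏ b ∈ univ.erase k, (l b : K) := fun k _ => by
    rw [hg, ← mul_prod_erase _ _ (mem_univ k)]; ring
  have hgO : ∀ k, g k ∈ s.O := by
    intro k
    by_cases hk : k = a
    · rw [hk, hg]
      simp only [hξa, neg_neg, one_mul]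
      exact s.O.prod_mem fun b _ => s.int_mem _
    · rw [hga k hk]
      exact s.O.mul_mem (s.O.neg_mem (hlO k hk)) (s.O.prod_mem fun b _ => s.int_mem _)
  have hprod0 : ∏ b, (l b : K) ≠ 0 :=
    prod_ne_zero_iff.2 fun b _ => Int.cast_ne_zero.2 (hl0 b)
  obtain ⟨v, k, hvk⟩ := hj g (ne_iff.2 ⟨a, by simpa [hg, hξa] using hprod0⟩) hgO
    ⟨(∏ b, (l b : K)) * (φ j (Pi.single a 1))⁻¹, fun k => by
      rw [hφξ k, hg]; field_simp⟩
  refine absurd hvk (not_lt.2 ?_)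
  have hle : s.abv v (g k) ≤ (C * exp (β' * q j)) ^ N := by
    by_cases hk : k = a
    · rw [hk, hg]
      simp only [hξa, neg_neg, one_mul, map_prod]
      exact (Finset.prod_le_prod (fun _ _ => (s.abv v).nonneg _) fun b _ => hlv b v).trans
        (le_of_eq (prod_const _))
    · rw [hga k hk, map_mul, (s.abv v).map_neg, map_prod]
      refine (mul_le_mul (hlξ k hk v)
        (Finset.prod_le_prod (fun _ _ => (s.abv v).nonneg _) fun b _ => hlv b v)
        (prod_nonneg fun _ _ => (s.abv v).nonneg _) (by positivity)).trans (le_of_eq ?_)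
      exact mul_prod_erase univ (fun _ => C * exp (β' * q j)) (mem_univ k) |>.trans (prod_const _)
  refine hle.trans ?_
  rw [mul_pow, ← exp_nat_mul, ← exp_log (show 0 < C by linarith), ← exp_nat_mul,
    ← exp_add, exp_le_exp]
  have e1 : (N : ℝ) * (β' * q j) = β * q j / 2 := by rw [hβ']; field_simp
  rw [div_le_iff₀ hβ] at hjq
  rw [e1]
  linarith

end SInt

end

section

open MvPolynomial Finset

/-! ### An auxiliary form with balanced monomials -/

section SecondMoment

theorem sum_piFinset_sq_le {m : ℕ} {α : Type*} (Ω : Fin m → Finset α) (f : Fin m → α → ℝ)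
    (hf : ∀ h, ∑ x ∈ Ω h, f h x = 0) (hb : ∀ h, ∀ x ∈ Ω h, |f h x| ≤ 1) :
    ∑ e ∈ piFinset Ω, (∑ h, f h (e h)) ^ 2 ≤ m * (piFinset Ω).card := by
  classical
  have h1 : ∀ e : Fin m → α, (∑ h, f h (e h)) ^ 2 = ∑ h, ∑ k, f h (e h) * f k (e k) := fun e => by
    rw [sq, sum_mul_sum]
  have h2 : ∀ h k, ∑ e ∈ piFinset Ω, f h (e h) * f k (e k) ≤
      if h = k then ((piFinset Ω).card : ℝ) else 0 := by
    intro h k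
    by_cases hk : h = k
    · subst hk
      rw [if_pos rfl, ← nsmul_one, ← sum_const]
      refine sum_le_sum fun e he => ?_
      have := hb h _ (mem_piFinset.1 he h)
      nlinarith [abs_mul_abs_self (f h (e h)), abs_nonneg (f h (e h))]
    · rw [if_neg hk]
      have h3 := prod_univ_sum (t := Ω)
        (f := fun l x => if l = h then f h x else if l = k then f k x else (1 : ℝ))
      have h4 : ∏ l, ∑ x ∈ Ω l, (if l = h then f h x else if l = k then f k x else (1 : ℝ)) = 0 := by
        refine prod_eq_zero (mem_univ h) ?_
        simp [hf]
      rw [h4] at h3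
      refine le_of_eq (Eq.trans (sum_congr rfl fun e _ => ?_) h3.symm)
      rw [← mul_prod_erase univ _ (mem_univ h), if_pos rfl,
        ← mul_prod_erase (univ.erase h) _ (mem_erase.2 ⟨Ne.symm hk, mem_univ k⟩),
        if_neg (Ne.symm hk), if_pos rfl, prod_eq_one, mul_one]
      intro l hl
      rw [mem_erase, mem_erase] at hl
      rw [if_neg hl.2.1, if_neg hl.1]
  simp only [h1]
  rw [sum_comm]
  calc _ ≤ ∑ _h : Fin m, ((piFinset Ω).card : ℝ) := by
        refine sum_le_sum fun h _ => ?_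
        rw [sum_comm]
        refine (sum_le_sum fun k _ => h2 h k).trans ?_
        simp
    _ = _ := by simp

theorem sum_piAntidiag_eq_zero {ι : Type*} [Fintype ι] [DecidableEq ι] [Nonempty ι] {d : ℕ} (hd : 0 < d) (i : ι) :
    ∑ x ∈ piAntidiag (univ : Finset ι) d, ((x i : ℝ) / d - 1 / Fintype.card ι) = 0 := by
  have hsw : ∀ k, ∑ x ∈ piAntidiag (univ : Finset ι) d, (x k : ℝ) =
      ∑ x ∈ piAntidiag (univ : Finset ι) d, (x i : ℝ) := by
    intro k
    refine sum_bij' (fun x _ => x ∘ swap i k) (fun x _ => x ∘ swap i k) ?_ ?_ ?_ ?_ ?_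
    · intro x hx
      rw [mem_piAntidiag] at hx ⊢
      exact ⟨by simpa using (Equiv.sum_comp (swap i k) x).trans hx.1, by simp⟩
    · intro x hx
      rw [mem_piAntidiag] at hx ⊢
      exact ⟨by simpa using (Equiv.sum_comp (swap i k) x).trans hx.1, by simp⟩
    · intro x _; funext l; simp
    · intro x _; funext l; simp
    · intro x _; simp
  have htot : ∑ k, ∑ x ∈ piAntidiag (univ : Finset ι) d, (x k : ℝ) =
      d * (piAntidiag (univ : Finset ι) d).card := by
    rw [sum_comm]
    rw [sum_congr rfl (g := fun _ => (d : ℝ))]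
    · simp [mul_comm]
    · intro x hx
      rw [mem_piAntidiag] at hx
      exact_mod_cast hx.1
  simp only [hsw, sum_const, card_univ, nsmul_eq_mul] at htot
  have hN : (0 : ℝ) < Fintype.card ι := by exact_mod_cast Fintype.card_pos
  have hd' : (0 : ℝ) < d := by exact_mod_cast hd
  rw [sum_sub_distrib, ← sum_div, sum_const, nsmul_eq_mul]
  field_simp
  linarith

theorem card_unbalanced_le {m : ℕ} {ι : Type*} [Fintype ι] [DecidableEq ι] [Nonempty ι] {θ : ℝ}
    (hθ : 0 ≤ θ * m) {d : Fin m → ℕ} (hd : ∀ h, 0 < d h) (i : ι) :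
    (((piFinset fun h => piAntidiag (univ : Finset ι) (d h)).filter fun e =>
      ¬ |∑ h, (e h i : ℝ) / d h - m / Fintype.card ι| ≤ θ * m).card : ℝ) * (θ * m) ^ 2 ≤
      m * (piFinset fun h => piAntidiag (univ : Finset ι) (d h)).card := by
  have hN : (1 : ℝ) ≤ Fintype.card ι := by exact_mod_cast Fintype.card_pos
  refine le_trans ?_ (sum_piFinset_sq_le (fun h => piAntidiag (univ : Finset ι) (d h))
    (fun h x => (x i : ℝ) / d h - 1 / Fintype.card ι)
    (fun h => sum_piAntidiag_eq_zero (hd h) i) ?_)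
  · refine le_trans ?_ (sum_le_sum_of_subset_of_nonneg (filter_subset
      (fun e => ¬ |∑ h, (e h i : ℝ) / d h - m / Fintype.card ι| ≤ θ * m) _)
      fun _ _ _ => sq_nonneg _)
    rw [← nsmul_eq_mul, ← sum_const]
    refine sum_le_sum fun e he => ?_
    have := (mem_filter.1 he).2
    push Not at this
    rw [sum_sub_distrib, sum_const, card_univ, Fintype.card_fin, nsmul_eq_mul,
      mul_one_div, ← sq_abs (∑ h, (e h i : ℝ) / d h - m / Fintype.card ι)]
    exact pow_le_pow_left₀ hθ this.le 2
  · intro h x hx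
    rw [mem_piAntidiag] at hx
    have h1 : x i ≤ d h := by
      rw [← hx.1]
      exact single_le_sum (f := x) (fun _ _ => Nat.zero_le _) (mem_univ i)
    have hd' : (0 : ℝ) < d h := by exact_mod_cast hd h
    have h2 : (x i : ℝ) / d h ≤ 1 := (div_le_one hd').2 (by exact_mod_cast h1)
    have h3 : 0 ≤ (x i : ℝ) / d h := by positivity
    have h4 : 1 / (Fintype.card ι : ℝ) ≤ 1 := (div_le_one (by linarith)).2 hN
    have h5 : 0 ≤ 1 / (Fintype.card ι : ℝ) := by positivity
    rw [abs_le]; constructor <;> linarith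

end SecondMoment

section Homog

variable {m : ℕ} {ι R : Type*} [Fintype ι] [CommRing R]

theorem linSubst_homogeneous {M : Fin m → Matrix ι ι R} {Q : MvPolynomial (Fin m × ι) R} {h : Fin m}
    {d : ℕ} (hQ : ∀ e ∈ Q.support, ∑ k, e (h, k) = d) :
    ∀ e ∈ (linSubst M Q).support, ∑ k, e (h, k) = d := by
  have key : ∀ c : ℝ, ∀ {P : MvPolynomial (Fin m × ι) R}, (OrdGE (fun p : Fin m × ι => if p.1 = h then c else 0) (c * d) P ↔
      ∀ e ∈ P.support, c * d ≤ c * ((∑ k, e (h, k) : ℕ) : ℝ)) := by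
    intro c P
    refine forall₂_congr fun e _ => ?_
    rw [sum_prod_type, sum_eq_single h]
    · simp [sum_mul, mul_comm c]
    · intro k _ hk
      simp [hk]
    · simp
  have hb : ∀ c : ℝ, OrdGE (fun p : Fin m × ι => if p.1 = h then c else 0) (c * d) (linSubst M Q) := by
    intro c
    refine OrdGE.bind₁ (w := fun p : Fin m × ι => if p.1 = h then c else 0) (fun p => ?_)
      ((key c).2 fun e he => by rw [hQ e he])
    refine OrdGE.sum fun k _ => ?_
    have := (ordGE_C (R := R) (M p.1 p.2 k)).mul
      (ordGE_X (R := R) (w := fun p : Fin m × ι => if p.1 = h then c else 0) (p.1, k))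
    rwa [zero_add] at this
  intro e he
  have h1 := (key 1).1 (hb 1) e he
  have h2 := (key (-1)).1 (hb (-1)) e he
  have : ((∑ k, e (h, k) : ℕ) : ℝ) = d := by linarith
  exact_mod_cast this

end Homog

section Siegel

variable {S : Type*} [Fintype S] {ι : Type*} [Fintype ι] [DecidableEq ι] [Nonempty ι]

/-- Package blockwise exponents as a single exponent vector. -/
noncomputable def toExp {m : ℕ} (x : Fin m → ι → ℕ) : Fin m × ι →₀ ℕ :=
  Finsupp.equivFunOnFinite.symm fun p => x p.1 p.2

theorem toExp_apply {m : ℕ} (x : Fin m → ι → ℕ) (h : Fin m) (k : ι) : toExp x (h, k) = x h k := rfl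

theorem toExp_injective {m : ℕ} : Injective (toExp : (Fin m → ι → ℕ) → Fin m × ι →₀ ℕ) := by
  intro x y h
  funext l k
  rw [← toExp_apply x, h, toExp_apply]

theorem l1_linSubst_le {m : ℕ} {b : ℝ} {M : Fin m → Matrix ι ι ℤ}
    (hM : ∀ h i k, |(M h i k : ℝ)| ≤ b) {d : Fin m → ℕ} {P : MvPolynomial (Fin m × ι) ℤ}
    (hP : ∀ e ∈ P.support, ∀ h, ∑ k, e (h, k) = d h) :
    l1 (linSubst M P) ≤ (Fintype.card ι * b) ^ (∑ h, d h) * l1 P := by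
  have h1 := wnorm_bind_le vZ (w := fun _ : Fin m × ι => (Fintype.card ι * b : ℝ)) (w' := fun _ : Fin m × ι => (1 : ℝ))
    (fun _ => zero_le_one) (fun p : Fin m × ι => ∑ k, C (M p.1 p.2 k) * X (p.1, k))
    P (fun p => ?_)
  · refine h1.trans (le_of_eq ?_)
    rw [l1_eq, wnorm, mul_sum]
    refine sum_congr rfl fun e he => ?_
    rw [prod_pow_eq_pow_sum, sum_prod_type, sum_congr rfl fun h _ => hP e he h, mul_comm]
  · refine (wnorm_sum_le vZ (fun _ => zero_le_one) _ _).trans ?_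
    refine (sum_le_sum (g := fun _ => b) fun k _ => ?_).trans (by simp)
    rw [X, C_mul_monomial, wnorm_monomial]
    simpa [vZ_apply] using hM p.1 p.2 k

theorem exists_balanced_form (B : S → Matrix ι ι ℤ) {θ : ℝ} (hθ : 0 < θ) {m : ℕ} (hm0 : 0 < m)
    (hm : 2 * (Fintype.card S : ℝ) * Fintype.card ι ≤ θ ^ 2 * m) :
    ∃ C : ℝ, 1 ≤ C ∧ ∀ d : Fin m → ℕ, (∀ h, 0 < d h) → ∃ P : MvPolynomial (Fin m × ι) ℤ, P ≠ 0 ∧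
      (∀ e ∈ P.support, ∀ h, ∑ k, e (h, k) = d h) ∧ l1 P ≤ C ^ ∑ h, d h ∧
      ∀ v, ∀ e ∈ (linSubst (fun _ => B v) P).support, (∀ h, ∑ k, e (h, k) = d h) ∧
        ∀ i, |∑ h, (e (h, i) : ℝ) / d h - m / Fintype.card ι| ≤ θ * m := by
  classical
  have hN : (1 : ℝ) ≤ Fintype.card ι := by exact_mod_cast Fintype.card_pos
  have hm' : (0 : ℝ) < m := by exact_mod_cast hm0
  obtain ⟨b, hb1, hb⟩ : ∃ b : ℝ, 1 ≤ b ∧ ∀ v i k, |(B v i k : ℝ)| ≤ b := by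
    refine ⟨1 + ∑ v, ∑ i, ∑ k, |(B v i k : ℝ)|, ?_, fun v i k => ?_⟩
    · have : 0 ≤ ∑ v, ∑ i, ∑ k, |(B v i k : ℝ)| := by positivity
      linarith
    · have h1 := single_le_sum (f := fun k => |(B v i k : ℝ)|) (fun _ _ => abs_nonneg _) (mem_univ k)
      have h2 := single_le_sum (f := fun i => ∑ k, |(B v i k : ℝ)|)
        (fun _ _ => by positivity) (mem_univ i)
      have h3 := single_le_sum (f := fun v => ∑ i, ∑ k, |(B v i k : ℝ)|)
        (fun _ _ => by positivity) (mem_univ v)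
      exact h1.trans (h2.trans (h3.trans (by linarith)))
  set N := Fintype.card ι with hNdef
  have hNb : 1 ≤ N * b := by nlinarith
  refine ⟨2 ^ N * (2 ^ N * (N * b)), ?_, fun d hd => ?_⟩
  · have : (1 : ℝ) ≤ 2 ^ N := one_le_pow₀ (by norm_num)
    nlinarith [mul_nonneg (sub_nonneg.2 this) (sub_nonneg.2 hNb)]
  set E : Finset (Fin m → ι → ℕ) := piFinset fun h => piAntidiag (univ : Finset ι) (d h) with hE
  have memE : ∀ x, x ∈ E ↔ ∀ h, ∑ k, x h k = d h := fun x => by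
    simp [hE, mem_piFinset, mem_piAntidiag]
  have cardE : (E.card : ℝ) ≤ (2 ^ N) ^ ∑ h, d h := by
    have h1 : E ⊆ piFinset fun h => piFinset fun _ : ι => range (d h + 1) := by
      intro x hx
      rw [memE] at hx
      simp only [mem_piFinset, mem_range]
      intro h k
      have := single_le_sum (f := x h) (fun _ _ => Nat.zero_le _) (mem_univ k)
      have := hx h
      omega
    have h2 := card_le_card h1
    simp only [Fintype.card_piFinset, card_range, prod_const, card_univ] at h2
    calc (E.card : ℝ) ≤ ((∏ h, (d h + 1) ^ N : ℕ) : ℝ) := by exact_mod_cast h2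
      _ ≤ ((∏ h, (2 ^ d h) ^ N : ℕ) : ℝ) := by
        exact_mod_cast prod_le_prod' fun h _ => Nat.pow_le_pow_left Nat.lt_two_pow_self N
      _ = _ := by
        push_cast
        rw [← prod_pow_eq_pow_sum]
        exact prod_congr rfl fun h _ => by rw [← pow_mul, ← pow_mul, mul_comm]
  have Ene : E.Nonempty := by
    refine ⟨fun h => Pi.single (Classical.arbitrary ι) (d h), (memE _).2 fun h => ?_⟩
    simp
  have Epos : (0 : ℝ) < E.card := by exact_mod_cast card_pos.2 Ene
  obtain ⟨bad, hbad⟩ : ∃ bad : Finset (Fin m → ι → ℕ), bad = E.filter fun e =>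
      ∃ i, ¬ |∑ h, (e h i : ℝ) / d h - m / N| ≤ θ * m := ⟨_, rfl⟩
  have cbad : 2 * (Fintype.card S * bad.card : ℝ) ≤ E.card := by
    have h1 : bad ⊆ univ.biUnion fun i => E.filter fun e =>
      ¬ |∑ h, (e h i : ℝ) / d h - m / N| ≤ θ * m := by
      intro e he
      rw [hbad, mem_filter] at he
      obtain ⟨he, i, hi⟩ := he
      exact mem_biUnion.2 ⟨i, mem_univ _, mem_filter.2 ⟨he, hi⟩⟩
    have h2 : (bad.card : ℝ) ≤ ∑ i, ((E.filter fun e =>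
      ¬ |∑ h, (e h i : ℝ) / d h - m / N| ≤ θ * m).card : ℝ) := by
      exact_mod_cast (card_le_card h1).trans card_biUnion_le
    have h3 : (bad.card : ℝ) * (θ * m) ^ 2 ≤ N * (m * E.card) := by
      refine (mul_le_mul_of_nonneg_right h2 (sq_nonneg _)).trans ?_
      rw [sum_mul]
      refine (sum_le_sum fun i _ => card_unbalanced_le (by positivity) hd i).trans ?_
      simp [hNdef, hE]
    have h4 : (bad.card : ℝ) * (θ ^ 2 * m) ≤ N * E.card := by
      have : (m : ℝ) * ((bad.card : ℝ) * (θ ^ 2 * m)) ≤ m * (N * E.card) := by linarith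
      exact le_of_mul_le_mul_left this hm'
    have h5 : (N : ℝ) * (2 * (Fintype.card S * bad.card : ℝ)) ≤ N * E.card := by
      have := mul_le_mul_of_nonneg_right hm (cast_nonneg (α := ℝ) bad.card)
      linarith
    exact le_of_mul_le_mul_left h5 (by linarith)
  obtain ⟨A, hA⟩ : ∃ A : Matrix (S × bad) E ℤ, ∀ p e, A p e =
    coeff (toExp p.2.1) (linSubst (fun _ : Fin m => B p.1) (monomial (toExp e.1) 1)) :=
      ⟨_, fun _ _ => rfl⟩
  have hent : ∀ p e, |(A p e : ℝ)| ≤ (N * b) ^ ∑ h, d h := by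
    intro p e
    rw [hA]
    have hl := l1_linSubst_le (fun _ : Fin m => hb p.1) (d := d) (P := monomial (toExp e.1) 1)
      fun e' he' => by
        rw [mem_singleton.1 (support_monomial_subset he')]
        exact (memE _).1 e.2
    have hl1 : l1 (monomial (toExp e.1) 1 : MvPolynomial (Fin m × ι) ℤ) = 1 := by
      rw [l1, wnorm_monomial]; simp
    rw [hl1, mul_one] at hl
    refine le_trans ?_ hl
    have := wnorm_coeff_le vZ (w := 1) (fun _ => zero_le_one)
      (linSubst (fun _ : Fin m => B p.1) (monomial (toExp e.1) 1)) (toExp p.2.1)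
    simpa [vZ_apply, l1] using this
  obtain ⟨t, ht0, hAt, htb⟩ : ∃ t : E → ℤ, t ≠ 0 ∧ A.mulVec t = 0 ∧
      ∀ e, |(t e : ℝ)| ≤ E.card * (N * b) ^ ∑ h, d h := by
    have hpow : 1 ≤ (N * b) ^ ∑ h, d h := one_le_pow₀ hNb
    have hE1 : (1 : ℝ) ≤ E.card := by exact_mod_cast card_pos.2 Ene
    have hprod : 1 ≤ E.card * (N * b) ^ ∑ h, d h := by
      nlinarith [mul_nonneg (sub_nonneg.2 hE1) (sub_nonneg.2 hpow)]
    rcases Nat.eq_zero_or_pos (Fintype.card (S × bad)) with h0 | h0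
    · have := Fintype.card_eq_zero_iff.1 h0
      refine ⟨fun _ => 1, ?_, by ext p; exact this.elim p, fun e => by simpa using hprod⟩
      intro h
      have := congrFun h ⟨_, Ene.choose_spec⟩
      simp at this
    · have hc : (Fintype.card (S × bad) : ℝ) = Fintype.card S * bad.card := by simp
      have hce : (Fintype.card E : ℝ) = E.card := by simp
      have h0' : (0 : ℝ) < Fintype.card (S × bad) := by exact_mod_cast h0
      have hlt : Fintype.card (S × bad) < Fintype.card E := by
        have : (Fintype.card (S × bad) : ℝ) < Fintype.card E := by rw [hce]; linarith
        exact_mod_cast this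
      let _ := Matrix.seminormedAddCommGroup (m := S × bad) (n := E) (α := ℤ)
      obtain ⟨t, ht0, hAt, htb⟩ := Int.Matrix.exists_ne_zero_int_vec_norm_le A hlt h0
      refine ⟨t, ht0, hAt, fun e => ?_⟩
      have h1 : |(t e : ℝ)| ≤ ‖t‖ := norm_le_pi_norm t e
      have h2 : ‖A‖ ≤ (N * b) ^ ∑ h, d h := by
        refine (Matrix.norm_le_iff (by positivity)).2 fun p e => hent p e
      refine (h1.trans htb).trans ?_
      have hmx : max 1 ‖A‖ ≤ (N * b) ^ ∑ h, d h := max_le hpow h2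
      refine (rpow_le_rpow_of_exponent_le (y := ((Fintype.card (S × bad) : ℝ) / (Fintype.card E - Fintype.card (S × bad)))) (z := 1) ?_ ?_).trans ?_
      · have : 1 ≤ max 1 ‖A‖ := le_max_left _ _
        rw [hce]
        nlinarith
      · rw [div_le_one] <;> rw [hce, hc] <;> linarith
      · rw [rpow_one, hce]
        exact mul_le_mul_of_nonneg_left hmx (by positivity)
  obtain ⟨P, hP⟩ : ∃ P : MvPolynomial (Fin m × ι) ℤ, P = ∑ e : E, monomial (toExp e.1) (t e) := ⟨_, rfl⟩
  have hPc : ∀ e : E, coeff (toExp e.1) P = t e := by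
    intro e
    rw [hP, coeff_sum, sum_eq_single e]
    · rw [coeff_monomial, if_pos rfl]
    · intro e' _ he'
      rw [coeff_monomial, if_neg]
      exact fun h => he' (Subtype.ext (toExp_injective h))
    · simp
  have hPs : ∀ e ∈ P.support, ∃ x : E, e = toExp x.1 := by
    intro e he
    by_contra hne
    push Not at hne
    refine mem_support_iff.1 he ?_
    rw [hP, coeff_sum, sum_eq_zero]
    intro x _
    rw [coeff_monomial, if_neg (hne x).symm]
  have hPh : ∀ e ∈ P.support, ∀ h, ∑ k, e (h, k) = d h := by
    intro e he h
    obtain ⟨x, rfl⟩ := hPs e he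
    exact (memE _).1 x.2 h
  refine ⟨P, ?_, hPh, ?_, fun v e he => ?_⟩
  · obtain ⟨e, he⟩ := ne_iff.1 ht0
    intro h
    rw [← hPc, h] at he
    exact he (by simp)
  · have h1 : l1 P ≤ ∑ e : E, |(t e : ℝ)| := by
      rw [hP]
      refine (wnorm_sum_le vZ (fun _ => zero_le_one) _ _).trans (sum_le_sum fun e _ => ?_)
      rw [wnorm_monomial]
      simp [vZ_apply]
    refine h1.trans ((sum_le_sum fun e _ => htb e).trans ?_)
    rw [sum_const, card_univ, Fintype.card_coe, nsmul_eq_mul, mul_pow (2 ^ N : ℝ) (2 ^ N * (N * b)),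
      mul_pow (2 ^ N : ℝ) (N * b)]
    gcongr
  · have hh : ∀ h, ∑ k, e (h, k) = d h := fun h =>
      linSubst_homogeneous (fun e he => hPh e he h) e he
    refine ⟨hh, ?_⟩
    by_contra hne
    push Not at hne
    obtain ⟨i, hi⟩ := hne
    have hex : e = toExp fun h k => e (h, k) := by
      ext p; rfl
    have hb' : (fun h k => e (h, k)) ∈ bad := by
      rw [hbad, mem_filter, memE]
      exact ⟨hh, i, not_le.2 hi⟩
    refine mem_support_iff.1 he ?_
    have := congrFun hAt (v, ⟨_, hb'⟩)
    rw [mulVec, dotProduct, Pi.zero_apply] at this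
    simp only [hA] at this
    rw [← hex] at this
    rw [hP, _root_.map_sum, coeff_sum, ← this]
    refine sum_congr rfl fun x _ => ?_
    have : (monomial (toExp x.1) (t x) : MvPolynomial (Fin m × ι) ℤ) = t x • monomial (toExp x.1) 1 := by
      rw [smul_monomial, smul_eq_mul, mul_one]
    rw [this, map_zsmul, coeff_smul, smul_eq_mul, mul_comm]

end Siegel

/-! ### Hyperplanes spanned by points of small boxes are eventually constant -/

namespace SInt

variable {K : Type*} [Field K] {ι : Type*} [Fintype ι] [DecidableEq ι]

theorem prod_weights_le {m : ℕ} {c : ι → ℝ} {ε C₀ M θ D : ℝ} {q : Fin m → ℝ} {d : Fin m → ℕ}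
    (hε : 0 ≤ ε) (hc : ∀ i, |c i| ≤ C₀) (hM : 1 ≤ M) (hD : 0 ≤ D)
    (hd : ∀ h, 0 < d h) (hdq : ∀ h, d h * q h ≤ D) (hdq' : ∀ h, D ≤ d h * q h + q h)
    {μ : Fin m × ι →₀ ℕ} (hμ : ∀ h, ∑ k, μ (h, k) = d h)
    (hb : ∀ i, |∑ h, (μ (h, i) : ℝ) / d h - m / Fintype.card ι| ≤ θ * m) :
    ∏ p : Fin m × ι, (M * exp ((c p.2 + ε) * q p.1)) ^ μ p ≤
      M ^ (∑ h, d h) * exp (D * m * ((∑ i, c i) / Fintype.card ι + Fintype.card ι * C₀ * θ + ε)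
        + Fintype.card ι * C₀ * ∑ h, q h) := by
  simp only [mul_pow, prod_mul_distrib]
  rw [prod_pow_eq_pow_sum, sum_prod_type, sum_congr rfl fun h _ => hμ h]
  refine mul_le_mul_of_nonneg_left ?_ (by positivity)
  simp only [← exp_nat_mul]
  rw [← exp_sum]
  refine exp_le_exp.2 ?_
  have hd' : ∀ h, (0 : ℝ) < d h := fun h => by exact_mod_cast hd h
  have hC₀ : ∀ i : ι, 0 ≤ C₀ := fun i => (abs_nonneg _).trans (hc i)
  have e1 : ∑ p : Fin m × ι, (μ p : ℝ) * ((c p.2 + ε) * q p.1) =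
      ∑ i, c i * ∑ h, μ (h, i) * q h + ε * ∑ h, d h * q h := by
    rw [sum_prod_type, mul_sum]
    simp only [mul_sum]
    rw [sum_comm (s := (univ : Finset ι)), ← sum_add_distrib]
    refine sum_congr rfl fun h _ => ?_
    have : (d h : ℝ) = ∑ k, (μ (h, k) : ℝ) := by exact_mod_cast (hμ h).symm
    rw [this, sum_mul, mul_sum, ← sum_add_distrib]
    exact sum_congr rfl fun i _ => by ring
  have e2 : ε * ∑ h, d h * q h ≤ ε * (D * m) := by
    refine mul_le_mul_of_nonneg_left ?_ hε
    refine (sum_le_sum fun h _ => hdq h).trans (by simp [mul_comm])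
  have e3 : ∀ i, c i * ∑ h, μ (h, i) * q h ≤
      D * m * (c i / Fintype.card ι) + D * m * (C₀ * θ) + C₀ * ∑ h, q h := by
    intro i
    have f1 : |∑ h, μ (h, i) * q h - D * (m / Fintype.card ι)| ≤ D * (θ * m) + ∑ h, q h := by
      have g1 : ∑ h, μ (h, i) * q h - D * (m / Fintype.card ι) =
        D * (∑ h, (μ (h, i) : ℝ) / d h - m / Fintype.card ι) -
          ∑ h, (μ (h, i) : ℝ) / d h * (D - d h * q h) := by
        rw [mul_sub, mul_sum, sub_right_comm, ← sum_sub_distrib]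
        congr 1
        refine sum_congr rfl fun h _ => ?_
        have := (hd' h).ne'
        field_simp
        ring
      rw [g1]
      refine (abs_sub _ _).trans (add_le_add ?_ ?_)
      · rw [abs_mul, abs_of_nonneg hD]
        exact mul_le_mul_of_nonneg_left (hb i) hD
      · refine (abs_sum_le_sum_abs _ _).trans (sum_le_sum fun h _ => ?_)
        have g2 : (μ (h, i) : ℝ) / d h ≤ 1 := by
          rw [div_le_one (hd' h), ← hμ h]
          exact_mod_cast single_le_sum (f := fun k => μ (h, k)) (fun _ _ => Nat.zero_le _)
            (mem_univ i)
        have g3 : 0 ≤ D - d h * q h := sub_nonneg.2 (hdq h)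
        rw [abs_of_nonneg (mul_nonneg (by positivity) g3)]
        have g4 := hdq' h
        have g5 : 0 ≤ (μ (h, i) : ℝ) / d h := by positivity
        nlinarith [(mul_nonneg g5 g3)]
    have f2 : c i * (∑ h, μ (h, i) * q h - D * (m / Fintype.card ι)) ≤
        C₀ * (D * (θ * m) + ∑ h, q h) := by
      refine (le_abs_self _).trans ?_
      rw [abs_mul]
      exact mul_le_mul (hc i) f1 (abs_nonneg _) (hC₀ i)
    have f3 : c i * (D * (m / Fintype.card ι)) = D * m * (c i / Fintype.card ι) := by ring
    nlinarith
  rw [e1]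
  have e4 := sum_le_sum fun i (_ : i ∈ (univ : Finset ι)) => e3 i
  rw [sum_add_distrib, sum_add_distrib, ← mul_sum, ← sum_div,
    sum_const, sum_const, card_univ, nsmul_eq_mul, nsmul_eq_mul] at e4
  nlinarith

section

variable (v : AbsoluteValue K ℝ) (hv : ∀ n : ℤ, v n ≤ |(n : ℝ)|) {m : ℕ}
  {A : Matrix ι ι ℤ} {c : ι → ℝ} {ε C₀ B₀ : ℝ} {q : Fin m → ℝ}
  (hq : ∀ h, 0 ≤ q h) (hε : 0 ≤ ε) (hc : ∀ i, |c i| ≤ C₀) (hB₀ : 1 ≤ B₀)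
  (hA : ∀ i k, |(A i k : ℝ)| ≤ B₀) {Y : Fin m → Matrix ι ι K} {a : ι}
  (hYa : ∀ h k, Y h k a = if k = a then 1 else 0)
  (hY : ∀ h, ∀ k ≠ a, ∀ i, v (form (A i) fun l => Y h l k) ≤ exp ((c i + ε) * q h))
include hv hq hε hc hB₀ hA hYa hY

theorem wnorm_form_le (h : Fin m) (i : ι) :
    wnorm v (fun p : Fin m × ι => if p.2 = a then exp (-(C₀ * q p.1)) else 1)
      (∑ k, C (((A.map (Int.cast : ℤ → K)) * Y h) i k) * X (h, k)) ≤
      Fintype.card ι * B₀ * exp ((c i + ε) * q h) := by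
  have hw : ∀ p : Fin m × ι, 0 ≤ (if p.2 = a then exp (-(C₀ * q p.1)) else 1) := fun p => by
    split_ifs <;> positivity
  refine (wnorm_sum_le v hw _ _).trans ?_
  refine (sum_le_sum (g := fun _ => B₀ * exp ((c i + ε) * q h)) fun k _ => ?_).trans
    (by simp [mul_assoc])
  have hent : ((A.map (Int.cast : ℤ → K)) * Y h) i k = form (A i) fun l => Y h l k := by
    rw [form_eq_mulVec]; rfl
  rw [X, C_mul_monomial, wnorm_monomial, hent, mul_one, prod_eq_single (h, k)]
  · rw [Finsupp.single_eq_same, pow_one]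
    simp only
    split_ifs with hk
    · have h1 : form (A i) (fun l => Y h l k) = (A i a : K) := by
        rw [form_apply, hk]; simp [hYa]
      rw [h1]
      refine mul_le_mul ((hv _).trans (hA i a)) (exp_le_exp.2 ?_) (exp_pos _).le (by linarith)
      have := (abs_le.1 (hc i)).1
      nlinarith [hq h, mul_nonneg (sub_nonneg.2 this) (hq h), mul_nonneg hε (hq h)]
    · rw [mul_one]
      refine (hY h k hk i).trans ?_
      nlinarith [exp_pos ((c i + ε) * q h)]
  · intro p _ hp
    rw [single_eq_of_ne hp, pow_zero]
  · simp

theorem coeff_linSubst_le {B : Matrix ι ι ℤ} (hBA : B * A = 1)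
    (P : MvPolynomial (Fin m × ι) ℤ) (e : Fin m × ι →₀ ℕ) :
    v (coeff e (linSubst Y (map (castRingHom K) P))) * ∏ h, exp (-(C₀ * q h)) ^ e (h, a) ≤
      ∑ μ ∈ (linSubst (fun _ => B) P).support, vZ (coeff μ (linSubst (fun _ => B) P)) *
        ∏ p : Fin m × ι, (Fintype.card ι * B₀ * exp ((c p.2 + ε) * q p.1)) ^ μ p := by
  obtain ⟨G, hG⟩ : ∃ G, G = linSubst (fun _ : Fin m => B) P := ⟨_, rfl⟩
  have h1 : linSubst Y (map (castRingHom K) P) =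
      linSubst (fun h => (A.map (Int.cast : ℤ → K)) * Y h) (map (castRingHom K) G) := by
    rw [hG, linSubst_map, linSubst_linSubst]
    congr 2
    funext h
    rw [← mul_assoc]
    exact ((congrArg (· * Y h) (map_intCast_mul hBA)).trans (Matrix.one_mul _)).symm
  have hw : ∀ p : Fin m × ι, 0 ≤ (if p.2 = a then exp (-(C₀ * q p.1)) else 1) := fun p => by
    split_ifs <;> positivity
  have h3 := wnorm_coeff_le v hw (linSubst Y (map (castRingHom K) P)) e
  have h4 : ∏ p : Fin m × ι, (if p.2 = a then exp (-(C₀ * q p.1)) else 1) ^ e p =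
      ∏ h, exp (-(C₀ * q h)) ^ e (h, a) := by
    rw [Fintype.prod_prod_type]
    refine prod_congr rfl fun h _ => ?_
    rw [prod_eq_single a] <;> simp +contextual
  rw [h4] at h3
  refine h3.trans ?_
  have h5 := wnorm_bind_le v hw (fun p : Fin m × ι =>
      ∑ k, C (((A.map (Int.cast : ℤ → K)) * Y p.1) p.2 k) * X (p.1, k)) (map (castRingHom K) G)
    (w := fun p => Fintype.card ι * B₀ * exp ((c p.2 + ε) * q p.1))
    fun p => wnorm_form_le v hv hq hε hc hB₀ hA hYa hY p.1 p.2
  rw [h1]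
  refine h5.trans ?_
  rw [← hG, wnorm_eq_sum (v := v) (support_map_subset (castRingHom K) G)]
  refine sum_le_sum fun μ _ => ?_
  refine mul_le_mul_of_nonneg_right ?_ (prod_nonneg fun p _ => by positivity)
  rw [coeff_map]
  exact hv _

theorem abv_coeff_linSubst_le {B : Matrix ι ι ℤ} (hBA : B * A = 1)
    {C₁ θ D σ : ℝ} {d : Fin m → ℕ} (hB : ∀ i k, |(B i k : ℝ)| ≤ B₀) (hC₁ : 1 ≤ C₁)
    (hD : 0 ≤ D) (hd : ∀ h, 0 < d h) (hdq : ∀ h, d h * q h ≤ D) (hdq' : ∀ h, D ≤ d h * q h + q h)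
    {P : MvPolynomial (Fin m × ι) ℤ} (hP : ∀ e ∈ P.support, ∀ h, ∑ k, e (h, k) = d h)
    (hPl : l1 P ≤ C₁ ^ ∑ h, d h)
    (hb : ∀ e ∈ (linSubst (fun _ => B) P).support,
      ∀ i, |∑ h, (e (h, i) : ℝ) / d h - m / Fintype.card ι| ≤ θ * m)
    {e : Fin m × ι →₀ ℕ} (he : ∑ h, e (h, a) * (1 / d h : ℝ) < σ) :
    v (coeff e (linSubst Y (map (castRingHom K) P))) ≤
      exp (C₀ * σ * D + (∑ h, d h : ℕ) * log ((Fintype.card ι * B₀) ^ 2 * C₁) +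
        (D * m * ((∑ i, c i) / Fintype.card ι + Fintype.card ι * C₀ * θ + ε)
        + Fintype.card ι * C₀ * ∑ h, q h)) := by
  have hN : (1 : ℝ) ≤ Fintype.card ι := by exact_mod_cast Fintype.card_pos_iff.2 ⟨a⟩
  have hM : 1 ≤ Fintype.card ι * B₀ := by nlinarith
  have hC₀ : 0 ≤ C₀ := (abs_nonneg _).trans (hc a)
  obtain ⟨X₀, hX₀⟩ : ∃ X₀, X₀ = D * m * ((∑ i, c i) / Fintype.card ι + Fintype.card ι * C₀ * θ + ε)
        + Fintype.card ι * C₀ * ∑ h, q h := ⟨_, rfl⟩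
  rw [← hX₀]
  have h1 := coeff_linSubst_le v hv hq hε hc hB₀ hA hYa hY hBA P e
  have h2 : ∑ μ ∈ (linSubst (fun _ => B) P).support, vZ (coeff μ (linSubst (fun _ => B) P)) *
        ∏ p : Fin m × ι, (Fintype.card ι * B₀ * exp ((c p.2 + ε) * q p.1)) ^ μ p ≤
      l1 (linSubst (fun _ => B) P) * ((Fintype.card ι * B₀) ^ (∑ h, d h) * exp X₀) := by
    rw [l1_eq, sum_mul]
    refine sum_le_sum fun μ hμ => mul_le_mul_of_nonneg_left ?_ (vZ.nonneg _)
    rw [hX₀]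
    exact prod_weights_le hε hc hM hD hd hdq hdq'
      (fun h => linSubst_homogeneous (fun e he => hP e he h) μ hμ) (hb μ hμ)
  have : Nonempty ι := ⟨a⟩
  have h3 := l1_linSubst_le (fun _ : Fin m => hB) hP
  have hMp : (0 : ℝ) < Fintype.card ι * B₀ := by linarith
  have h4 : ∏ h, exp (-(C₀ * q h)) ^ e (h, a) ≥ exp (-(C₀ * σ * D)) := by
    simp only [← exp_nat_mul]
    rw [← exp_sum]
    refine exp_le_exp.2 ?_
    have h5 : ∑ h, (e (h, a) : ℝ) * q h ≤ σ * D := by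
      refine le_trans ?_ (mul_le_mul_of_nonneg_right he.le hD)
      rw [sum_mul]
      refine sum_le_sum fun h _ => ?_
      have hd' : (0 : ℝ) < d h := by exact_mod_cast hd h
      have : q h ≤ 1 / d h * D := by
        rw [one_div, inv_mul_eq_div, le_div_iff₀ hd', mul_comm]
        exact hdq h
      calc _ ≤ (e (h, a) : ℝ) * (1 / d h * D) := mul_le_mul_of_nonneg_left this (cast_nonneg _)
        _ = _ := by ring
    have h6 : ∑ h, (e (h, a) : ℝ) * -(C₀ * q h) = -(C₀ * ∑ h, (e (h, a) : ℝ) * q h) := by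
      rw [mul_sum, ← sum_neg_distrib]
      exact sum_congr rfl fun h _ => by ring
    rw [h6]
    nlinarith
  have h7 : v (coeff e (linSubst Y (map (castRingHom K) P))) * exp (-(C₀ * σ * D)) ≤
      ((Fintype.card ι * B₀) ^ 2 * C₁) ^ (∑ h, d h) * exp X₀ := by
    refine (mul_le_mul_of_nonneg_left h4 (v.nonneg _)).trans (h1.trans (h2.trans ?_))
    have h8 : ((Fintype.card ι * B₀) ^ 2 * C₁) ^ (∑ h, d h) * exp X₀ =
      ((Fintype.card ι * B₀) ^ (∑ h, d h) * C₁ ^ ∑ h, d h) *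
        ((Fintype.card ι * B₀) ^ (∑ h, d h) * exp X₀) := by
      rw [mul_pow, sq, mul_pow]; ring
    rw [h8]
    refine mul_le_mul_of_nonneg_right (h3.trans ?_) (by positivity)
    exact mul_le_mul_of_nonneg_left hPl (by positivity)
  have h9 : ((Fintype.card ι * B₀) ^ 2 * C₁) ^ (∑ h, d h) =
      exp ((∑ h, d h : ℕ) * log ((Fintype.card ι * B₀) ^ 2 * C₁)) := by
    rw [exp_nat_mul, exp_log (by positivity)]
  rw [h9, exp_neg, ← div_eq_mul_inv, div_le_iff₀ (exp_pos _), ← exp_add, ← exp_add] at h7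
  refine h7.trans (exp_le_exp.2 (by linarith))

end

variable {S : Type*} [Fintype S] {s : SInt K S}

theorem coeff_linSubst_mem {m : ℕ} {Y : Fin m → Matrix ι ι K} (hY : ∀ h i k, Y h i k ∈ s.O)
    (P : MvPolynomial (Fin m × ι) ℤ) (e : Fin m × ι →₀ ℕ) :
    coeff e (linSubst Y (map (castRingHom K) P)) ∈ s.O := by
  have h1 : linSubst Y (map (castRingHom K) P) = map s.O.subtype
      (linSubst (fun h => of fun i k => (⟨Y h i k, hY h i k⟩ : s.O)) (map (castRingHom s.O) P)) := by
    rw [linSubst_map, MvPolynomial.map_map]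
    congr 1
  rw [h1, coeff_map]
  exact Subtype.property _

theorem exists_separated {𝒰 : Ultrafilter ℕ} {q : ℕ → ℝ} (hq : Tendsto q 𝒰 atTop)
    {p : ℕ → Prop} (hp : ∀ᶠ j in 𝒰, p j) {ω : ℝ} (hω : 0 < ω) (m : ℕ) :
    ∃ J : Fin m → ℕ, (∀ h, p (J h)) ∧ ∀ h k, h < k → 2 * q (J k) ≤ ω * q (J h) := by
  obtain ⟨f, hf, hff⟩ := exists_seq_of_forall_finset_exists p (fun i j => 2 * q i ≤ ω * q j) (by
    intro F _
    have h1 : ∀ᶠ j in 𝒰, ∀ i ∈ F, 2 * q i ≤ ω * q j := by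
      rw [eventually_all_finset]
      intro i _
      filter_upwards [hq.eventually_ge_atTop (2 * q i / ω)] with j hj
      rwa [div_le_iff₀' hω] at hj
    exact (hp.and h1).exists)
  exact ⟨fun h => f (Fin.rev h : Fin m), fun h => hf _, fun h k hk => hff _ _ (Fin.rev_lt_rev.2 hk)⟩

theorem exists_intMatrix_bound (A B : S → Matrix ι ι ℤ) : ∃ b : ℝ, 1 ≤ b ∧
    (∀ v i k, |(A v i k : ℝ)| ≤ b) ∧ ∀ v i k, |(B v i k : ℝ)| ≤ b := by
  obtain ⟨b, hb⟩ := Finite.bddAbove_range fun p : S × ι × ι => |(A p.1 p.2.1 p.2.2 : ℝ)|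
  obtain ⟨b', hb'⟩ := Finite.bddAbove_range fun p : S × ι × ι => |(B p.1 p.2.1 p.2.2 : ℝ)|
  refine ⟨max 1 (max b b'), le_max_left _ _, fun v i k => ?_, fun v i k => ?_⟩
  · exact (hb ⟨(v, i, k), rfl⟩).trans ((le_max_left _ _).trans (le_max_right _ _))
  · exact (hb' ⟨(v, i, k), rfl⟩).trans ((le_max_right _ _).trans (le_max_right _ _))

variable [CharZero K] [Algebra ℚ K] [FiniteDimensional ℚ K]

set_option maxHeartbeats 1000000 in
theorem eventually_const_ker {𝒰 : Ultrafilter ℕ} {q : ℕ → ℝ} (hq : Tendsto q 𝒰 atTop)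
    {A B : S → Matrix ι ι ℤ} (hBA : ∀ v, B v * A v = 1) {c : S → ι → ℝ}
    (hc : ∑ v, (s.wt v : ℝ) * ∑ i, c v i < 0) {φ : ℕ → (ι → K) →ₗ[K] K} (hφ : ∀ j, φ j ≠ 0)
    (hsp : s.SpannedBy 𝒰 q A (fun j => ker (φ j)) c) :
    ∃ T, ∀ᶠ j in 𝒰, ker (φ j) = T := by
  by_contra hconst
  obtain ⟨β, hβ, hdich⟩ := height_dichotomy hq hBA hc hφ hsp hconst
  obtain ⟨a, b, hab, β', hβ', hlarge⟩ := exists_largeHeight hq hφ hβ hdich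
  have : Nonempty ι := ⟨a⟩
  have : Nonempty S := by
    by_contra h
    rw [not_nonempty_iff] at h
    simp at hc
  obtain ⟨t, ht⟩ : ∃ t : ℝ, t = s.deg := ⟨_, rfl⟩
  have ht0 : 0 < t := by rw [ht]; exact_mod_cast s.deg_pos
  have hwt : ∑ v, (s.wt v : ℝ) = t := by rw [ht, deg]; push_cast; rfl
  obtain ⟨N, hN⟩ : ∃ N : ℝ, N = Fintype.card ι := ⟨_, rfl⟩
  have hN0 : 0 < N := by rw [hN]; exact_mod_cast Fintype.card_pos
  obtain ⟨κ, hκ⟩ : ∃ κ : ℝ, κ = -∑ v, (s.wt v : ℝ) * ∑ i, c v i := ⟨_, rfl⟩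
  have hκ0 : 0 < κ := by linarith
  obtain ⟨C₀, hC₀1, hC₀⟩ : ∃ C₀ : ℝ, 0 < C₀ ∧ ∀ v i, |c v i| ≤ C₀ := by
    obtain ⟨b, hb⟩ := Finite.bddAbove_range fun p : S × ι => |c p.1 p.2|
    exact ⟨max 1 b, by positivity, fun v i => (hb ⟨(v, i), rfl⟩).trans (le_max_right _ _)⟩
  obtain ⟨θ, hθ⟩ : ∃ θ : ℝ, θ = κ / (8 * N ^ 2 * t * C₀) := ⟨_, rfl⟩
  have hθ0 : 0 < θ := by rw [hθ]; positivity
  have hθ1 : t * (N * C₀ * θ) = κ / (8 * N) := by rw [hθ]; field_simp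
  obtain ⟨ε, hε⟩ : ∃ ε : ℝ, ε = κ / (16 * N * t) := ⟨_, rfl⟩
  have hε0 : 0 < ε := by rw [hε]; positivity
  have hε1 : t * ε = κ / (16 * N) := by rw [hε]; field_simp
  obtain ⟨m, hm⟩ := exists_nat_ge (1 + 2 * (Fintype.card S : ℝ) * Fintype.card ι / θ ^ 2)
  have hm0' : (1 : ℝ) ≤ m := by
    have : 0 ≤ 2 * (Fintype.card S : ℝ) * Fintype.card ι / θ ^ 2 := by positivity
    linarith
  have hm0 : 0 < m := by exact_mod_cast (lt_of_lt_of_le one_pos hm0')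
  have hm1 : 2 * (Fintype.card S : ℝ) * Fintype.card ι ≤ θ ^ 2 * m := by
    have : 2 * (Fintype.card S : ℝ) * Fintype.card ι / θ ^ 2 ≤ m := by linarith
    rwa [div_le_iff₀' (by positivity)] at this
  obtain ⟨σ, hσ⟩ : ∃ σ : ℝ, σ = m * κ / (8 * N * t * C₀) := ⟨_, rfl⟩
  have hσ0 : 0 < σ := by rw [hσ]; positivity
  have hσ1 : t * (C₀ * σ) = m * κ / (8 * N) := by rw [hσ]; field_simp
  obtain ⟨ω, hω, hroth⟩ := roth_hyperplane (K := K) (ι := ι) m hσ0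
  obtain ⟨C₁, hC₁, hsiegel⟩ := exists_balanced_form B hθ0 hm0 hm1
  obtain ⟨B₀, hB₀, hA, hB⟩ := exists_intMatrix_bound A B
  obtain ⟨lM, hlM⟩ : ∃ lM : ℝ, lM = log ((Fintype.card ι * B₀) ^ 2 * C₁) := ⟨_, rfl⟩
  have hgood := (((hsp ε hε0).and hlarge).and ((hq.eventually_ge_atTop 1).and
    (hq.eventually_ge_atTop (lM / ε)))).and ((hq.eventually_ge_atTop
      (2 * m * log C₁ / (ω * β'))).and (hq.eventually_ge_atTop (2 / (ω * β'))))
  obtain ⟨J, hJ, hJq⟩ := exists_separated hq hgood hω m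
  have hq1 : ∀ h, 1 ≤ q (J h) := fun h => (hJ h).1.2.1
  have hq0 : ∀ h, 0 < q (J h) := fun h => one_pos.trans_le (hq1 h)
  have hqM : ∀ h, lM ≤ ε * q (J h) := fun h => by
    have := (hJ h).1.2.2
    rwa [div_le_iff₀' hε0] at this
  have hqC : ∀ h, 2 * m * log C₁ ≤ ω * β' * q (J h) := fun h => by
    have := (hJ h).2.1
    rwa [div_le_iff₀' (by positivity)] at this
  have hq2 : ∀ h, 2 ≤ ω * β' * q (J h) := fun h => by
    have := (hJ h).2.2
    rwa [div_le_iff₀' (by positivity)] at this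
  obtain ⟨D, hD⟩ : ∃ D : ℝ, D = 2 * (∑ h, q (J h)) + 8 * N / (m * κ) * (t * (N * C₀ * ∑ h, q (J h))) :=
    ⟨_, rfl⟩
  have hsum0 : 0 ≤ ∑ h, q (J h) := sum_nonneg fun h _ => (hq0 h).le
  have hqD : ∀ h, 2 * q (J h) ≤ D := fun h => by
    have h1 := single_le_sum (f := fun h => q (J h)) (fun h _ => (hq0 h).le) (mem_univ h)
    have h2 : 0 ≤ 8 * N / (m * κ) * (t * (N * C₀ * ∑ h, q (J h))) := by positivity
    exact (mul_le_mul_of_nonneg_left h1 zero_le_two).trans (by linarith)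
  have hD0 : 0 < D := by have := hqD ⟨0, hm0⟩; have := hq0 ⟨0, hm0⟩; linarith
  have hDbig : t * (N * C₀ * ∑ h, q (J h)) ≤ D * (m * κ / (8 * N)) := by
    have h1 : 8 * N / (m * κ) * (t * (N * C₀ * ∑ h, q (J h))) * (m * κ / (8 * N)) =
      t * (N * C₀ * ∑ h, q (J h)) := by
      have : (m : ℝ) ≠ 0 := by positivity
      field_simp
    rw [hD, add_mul, h1]
    have : 0 ≤ 2 * (∑ h, q (J h)) * (m * κ / (8 * N)) := by positivity
    linarith
  obtain ⟨d, hd⟩ : ∃ d : Fin m → ℕ, ∀ h, d h = ⌊D / q (J h)⌋₊ := ⟨_, fun _ => rfl⟩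
  have hdq : ∀ h, d h * q (J h) ≤ D := fun h => by
    have := Nat.floor_le (div_nonneg hD0.le (hq0 h).le)
    rw [← hd, le_div_iff₀ (hq0 h)] at this
    exact this
  have hdq' : ∀ h, D ≤ d h * q (J h) + q (J h) := fun h => by
    have := Nat.lt_floor_add_one (D / q (J h))
    rw [← hd, div_lt_iff₀ (hq0 h)] at this
    linarith
  have hd2 : ∀ h, D ≤ 2 * (d h * q (J h)) := fun h => by linarith [hqD h, hdq' h]
  have hd0 : ∀ h, 0 < d h := fun h => by
    rw [Nat.pos_iff_ne_zero]
    intro h0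
    have := hd2 h
    rw [h0] at this
    simp at this
    linarith
  obtain ⟨P, hP0, hPh, hPl, hPb⟩ := hsiegel d hd0
  choose! Y hYa hYk hYdet using fun h => exists_frame (hJ h).1.1.2.1 (hJ h).1.1.1 fun y hy => hy.1
  obtain ⟨e, he, heσ⟩ := hroth a b d (fun h => φ (J h)) Y (fun h => β' * q (J h)) (ω * β' * D / 2) P
    hab hd0 (fun i j hij => by
      have h1 := hJq i j hij
      have h2 := hdq i
      have h3 := hd2 j
      refine le_of_mul_le_mul_right ?_ (hq0 i)
      have h5 : 2 * (d j * q (J j)) ≤ ω * d j * q (J i) := by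
        have := mul_le_mul_of_nonneg_left h1 (cast_nonneg (α := ℝ) (d j))
        linarith
      linarith)
    (fun h => mul_pos hβ' (hq0 h)) (fun h => (hJ h).1.1.2.2)
    (fun h => by
      have h1 := hq2 h
      have h2 := hdq h
      have h3 := mul_le_mul_of_nonneg_left h1 (cast_nonneg (α := ℝ) (d h))
      linarith [mul_le_mul_of_nonneg_left h2 (mul_pos hω hβ').le])
    (fun h => by
      linarith [mul_le_mul_of_nonneg_left (hd2 h) (mul_pos hω hβ').le])
    hP0 hPh
    (by
      refine hPl.trans ?_
      rw [← exp_log (show 0 < C₁ by linarith), ← exp_nat_mul]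
      refine exp_le_exp.2 ?_
      push_cast
      rw [sum_mul]
      have h0 := log_nonneg hC₁
      refine (sum_le_sum (g := fun _ => ω * β' * D / (2 * m)) fun h _ => ?_).trans (le_of_eq ?_)
      · rw [le_div_iff₀ (by positivity)]
        have h3 := mul_le_mul_of_nonneg_left (hqC h) (cast_nonneg (α := ℝ) (d h))
        linarith [mul_le_mul_of_nonneg_left (hdq h) (mul_pos hω hβ').le]
      · rw [sum_const, card_univ, Fintype.card_fin, nsmul_eq_mul]
        have : (m : ℝ) ≠ 0 := by positivity
        field_simp)
    (fun h => (hJ h).1.1.2.1) hYa (fun h k hk => (hYk h k hk).1) hYdet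
  have hYO : ∀ h i k, Y h i k ∈ s.O := by
    intro h i k
    by_cases hk : k = a
    · rw [hk, hYa]
      split_ifs
      exacts [s.O.one_mem, s.O.zero_mem]
    · exact (hYk h k hk).2.1 i
  have hfin := s.sum_nonneg_of_le_exp (coeff_linSubst_mem hYO P e) (mem_support_iff.1 he) fun v =>
    abv_coeff_linSubst_le (s.abv v) (s.abv_intCast_le v) (fun h => (hq0 h).le) hε0.le (hC₀ v)
      hB₀ (hA v) hYa (fun h k hk i => (hYk h k hk).2.2 v i) (hBA v) (hB v) hC₁ hD0.le hd0 hdq hdq' hPh hPl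
      (fun e he => (hPb v e he).2) heσ
  rw [← hlM, ← hN] at hfin
  have hdl : ((∑ h, d h : ℕ) : ℝ) * lM ≤ ε * (D * m) := by
    push_cast
    rw [sum_mul]
    refine (sum_le_sum (g := fun _ => ε * D) fun h _ => ?_).trans (le_of_eq ?_)
    · have h3 := mul_le_mul_of_nonneg_left (hqM h) (cast_nonneg (α := ℝ) (d h))
      linarith [mul_le_mul_of_nonneg_left (hdq h) hε0.le]
    · simp; ring
  have hexp : ∑ v, (s.wt v : ℝ) * (C₀ * σ * D + (∑ h, d h : ℕ) * lM +
        (D * m * ((∑ i, c v i) / N + N * C₀ * θ + ε) + N * C₀ * ∑ h, q (J h))) =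
      D * (t * (C₀ * σ)) + t * ((∑ h, d h : ℕ) * lM) + (D * m * (-κ / N + t * (N * C₀ * θ) + t * ε)
        + t * (N * C₀ * ∑ h, q (J h))) := by
    have hg : ∀ (x y : ℝ) (g : S → ℝ), ∑ v, (s.wt v : ℝ) * (x + y * g v) =
        t * x + y * ∑ v, (s.wt v : ℝ) * g v := fun x y g => by
      rw [← hwt, sum_mul, mul_sum, ← sum_add_distrib]
      exact sum_congr rfl fun v _ => by ring
    have := hg (C₀ * σ * D + (∑ h, d h : ℕ) * lM + (D * m * (N * C₀ * θ + ε) + N * C₀ * ∑ h, q (J h)))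
      (D * m / N) fun v => ∑ i, c v i
    rw [hκ, neg_neg]
    calc _ = _ := sum_congr rfl fun v _ => by ring
      _ = _ := this
      _ = _ := by ring
  rw [hexp, hθ1, hε1, hσ1] at hfin
  have h1 : t * (((∑ h, d h : ℕ) : ℝ) * lM) ≤ D * m * (κ / (16 * N)) := by
    rw [← hε1]
    have := mul_le_mul_of_nonneg_left hdl ht0.le
    linarith
  have h2 : D * (m * κ / (8 * N)) = D * m * κ / N * (1 / 8) := by ring
  have h3 : D * m * (-κ / N + κ / (8 * N) + κ / (16 * N)) = D * m * κ / N * (-1 + 1 / 8 + 1 / 16) := by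
    ring
  have h4 : D * m * (κ / (16 * N)) = D * m * κ / N * (1 / 16) := by ring
  have h5 : 0 < D * m * κ / N := by positivity
  linarith

end SInt

end

section

open Finset

/-! ### The Cauchy–Binet formula and compound matrices -/

section CauchyBinet

variable {n p : ℕ} {R : Type*} [CommRing R]

/-- Sets of `p` indices. -/
abbrev MinorIdx (n p : ℕ) := {I : Finset (Fin n) // I.card = p}

/-- The increasing enumeration of an index set. -/
def sel (I : MinorIdx n p) : Fin p ↪o Fin n := I.1.orderEmbOfFin I.2

theorem sel_mem (I : MinorIdx n p) (k : Fin p) : sel I k ∈ I.1 := orderEmbOfFin_mem _ _ _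

theorem exists_sel_eq (I : MinorIdx n p) {i : Fin n} (hi : i ∈ I.1) : ∃ k, sel I k = i := by
  have : i ∈ Set.range (I.1.orderEmbOfFin I.2) := by rw [range_orderEmbOfFin]; exact hi
  exact this

theorem sum_sel {M : Type*} [AddCommMonoid M] (I : MinorIdx n p) (f : Fin n → M) :
    ∑ k, f (sel I k) = ∑ i ∈ I.1, f i := by
  refine sum_bij (fun k _ => sel I k) (fun k _ => sel_mem I k)
    (fun a _ b _ h => (sel I).injective h) (fun i hi => ?_) fun _ _ => rfl
  obtain ⟨k, hk⟩ := exists_sel_eq I hi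
  exact ⟨k, mem_univ _, hk⟩

theorem eq_of_subset {I J : MinorIdx n p} (h : I.1 ⊆ J.1) : I = J :=
  Subtype.ext (eq_of_subset_of_card_le h (by rw [I.2, J.2]))

theorem alternatingMap_sum_apply {α : Type*} (s : Finset α)
    (f : α → (Fin n → R) [⋀^Fin p]→ₗ[R] R) (v : Fin p → Fin n → R) :
    (∑ a ∈ s, f a) v = ∑ a ∈ s, f a v := by
  classical
  induction s using Finset.induction_on with
  | empty => simp
  | insert a s ha ih => rw [sum_insert ha, sum_insert ha, AlternatingMap.add_apply, ih]

theorem cauchyBinet (A : Matrix (Fin p) (Fin n) R) (B : Matrix (Fin n) (Fin p) R) :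
    (A * B).det = ∑ I : MinorIdx n p, (A.submatrix id (sel I)).det * (B.submatrix (sel I) id).det := by
  let φ₁ : (Fin n → R) [⋀^Fin p]→ₗ[R] R := Matrix.detRowAlternating.compLinearMap (Matrix.vecMulLinear B)
  let φ₂ : (Fin n → R) [⋀^Fin p]→ₗ[R] R := ∑ I : MinorIdx n p, (B.submatrix (sel I) id).det •
    Matrix.detRowAlternating.compLinearMap (LinearMap.funLeft R R (sel I))
  have key : φ₁ = φ₂ := by
    refine Basis.ext_alternating (Pi.basisFun R (Fin n)) fun f hf => ?_
    have h1 : φ₁ (fun k => Pi.basisFun R (Fin n) (f k)) = (B.submatrix f id).det := by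
      change det _ = _
      congr 1
      ext k l
      simp [Pi.basisFun_apply]
    have h2 : φ₂ (fun k => Pi.basisFun R (Fin n) (f k)) = ∑ I : MinorIdx n p,
        (B.submatrix (sel I) id).det * ((1 : Matrix (Fin n) (Fin n) R).submatrix f (sel I)).det := by
      simp only [φ₂, alternatingMap_sum_apply, AlternatingMap.smul_apply, smul_eq_mul]
      refine sum_congr rfl fun I _ => ?_
      congr 1
      change det _ = _
      congr 1
      ext k l
      simp [Pi.basisFun_apply, LinearMap.funLeft_apply, Matrix.one_apply, Pi.single_apply, eq_comm]
    let I₀ : MinorIdx n p := ⟨univ.image f, by rw [card_image_of_injective _ hf]; simp⟩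
    have h3 : ∀ k, ∃ l, sel I₀ l = f k := fun k =>
      exists_sel_eq I₀ (mem_image_of_mem f (mem_univ k))
    choose τ hτ using h3
    have hτi : Injective τ := fun a b h => hf (by rw [← hτ, ← hτ, h])
    let e : Perm (Fin p) := Equiv.ofBijective τ (Finite.injective_iff_bijective.1 hτi)
    have he : ∀ k, sel I₀ (e k) = f k := hτ
    rw [h1, h2, sum_eq_single I₀]
    · have h4 : B.submatrix f id = (B.submatrix (sel I₀) id).submatrix e id := by
        ext k l; simp [he]
      have h5 : (1 : Matrix (Fin n) (Fin n) R).submatrix f (sel I₀) =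
          (1 : Matrix (Fin p) (Fin p) R).submatrix e id := by
        ext k l
        simp [← he, Matrix.one_apply]
      rw [h4, h5, Matrix.det_permute, Matrix.det_permute, det_one, mul_one, mul_comm]
    · intro I _ hI
      have : ∃ k, f k ∉ I.1 := by
        by_contra! h
        refine hI (eq_of_subset (I := I₀) fun i hi => ?_).symm
        obtain ⟨k, -, rfl⟩ := mem_image.1 hi
        exact h k
      obtain ⟨k, hk⟩ := this
      refine mul_eq_zero_of_right _ (Matrix.det_eq_zero_of_row_eq_zero k fun l => ?_)
      rw [Matrix.submatrix_apply, Matrix.one_apply_ne]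
      exact fun h => hk (h ▸ sel_mem I l)
    · simp
  have h1 := DFunLike.congr_fun key A
  have h2 : φ₁ A = (A * B).det := by
    change det _ = _
    congr 1
  have h3 : φ₂ A = ∑ I : MinorIdx n p, (A.submatrix id (sel I)).det * (B.submatrix (sel I) id).det :=
    (alternatingMap_sum_apply _ _ _).trans (sum_congr rfl fun I _ => mul_comm _ _)
  exact h2.symm.trans (h1.trans h3)

/-- The matrix of `p`-minors. -/
def compound (p : ℕ) (M : Matrix (Fin n) (Fin n) R) : Matrix (MinorIdx n p) (MinorIdx n p) R :=
  of fun I J => (M.submatrix (sel I) (sel J)).det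

/-- The vector of maximal minors. -/
def wedge (Z : Matrix (Fin n) (Fin p) R) : MinorIdx n p → R := fun I => (Z.submatrix (sel I) id).det

theorem compound_mulVec_wedge (M : Matrix (Fin n) (Fin n) R) (Z : Matrix (Fin n) (Fin p) R) :
    (compound p M).mulVec (wedge Z) = wedge (M * Z) := by
  funext I
  have := cauchyBinet (M.submatrix (sel I) id) Z
  rw [wedge, Matrix.submatrix_mul _ _ _ id _ Function.bijective_id]
  simp only [Matrix.submatrix_id_id]
  rw [this]
  rfl

theorem compound_mul (M N : Matrix (Fin n) (Fin n) R) :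
    compound p (M * N) = compound p M * compound p N := by
  ext I J
  have := congrFun (compound_mulVec_wedge M (N.submatrix id (sel J))) I
  rw [wedge] at this
  rw [mul_apply]
  refine Eq.trans ?_ (Eq.trans this.symm rfl)
  rfl

theorem compound_one : compound p (1 : Matrix (Fin n) (Fin n) R) = 1 := by
  ext I J
  rw [compound, of_apply]
  by_cases h : I = J
  · subst h
    rw [Matrix.one_apply_eq, Matrix.submatrix_one _ (sel I).injective, det_one]
  · rw [Matrix.one_apply_ne h]
    have : ∃ k, sel I k ∉ J.1 := by
      by_contra! h'
      refine h (eq_of_subset fun i hi => ?_)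
      obtain ⟨k, rfl⟩ := exists_sel_eq I hi
      exact h' k
    obtain ⟨k, hk⟩ := this
    refine Matrix.det_eq_zero_of_row_eq_zero k fun l => ?_
    rw [Matrix.submatrix_apply, Matrix.one_apply_ne]
    exact fun h => hk (h ▸ sel_mem J l)

theorem compound_map {R' : Type*} [CommRing R'] (f : R →+* R') (M : Matrix (Fin n) (Fin n) R) :
    compound p (M.map f) = (compound p M).map f := by
  ext I J
  rw [compound, compound, map_apply, of_apply, of_apply, map_det]
  rfl

/-- Every index lies in the same number of index sets. -/
theorem exists_sum_minorIdx (n p : ℕ) : ∃ r : ℕ, ∀ x : Fin n → ℝ,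
    ∑ I : MinorIdx n p, ∑ i ∈ I.1, x i = r * ∑ i, x i := by
  rcases Nat.eq_zero_or_pos n with rfl | hn
  · exact ⟨0, fun x => by
      rw [Nat.cast_zero, zero_mul]
      exact sum_eq_zero fun I _ => sum_eq_zero fun i _ => i.elim0⟩
  refine ⟨(univ.filter fun I : MinorIdx n p => (⟨0, hn⟩ : Fin n) ∈ I.1).card, fun x => ?_⟩
  have h1 : ∀ i : Fin n, (univ.filter fun I : MinorIdx n p => i ∈ I.1).card =
      (univ.filter fun I : MinorIdx n p => (⟨0, hn⟩ : Fin n) ∈ I.1).card := by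
    intro i
    let e := swap i (⟨0, hn⟩ : Fin n)
    have hee : ∀ j, e (e j) = j := fun j => by simp [e]
    have hmm : ∀ (T : Finset (Fin n)), (T.map e.toEmbedding).map e.toEmbedding = T := by
      intro T
      rw [Finset.map_map]
      have : e.toEmbedding.trans e.toEmbedding = Function.Embedding.refl _ := by
        ext j : 1; exact hee j
      rw [this, map_refl]
    refine card_bij' (fun I _ => ⟨I.1.map e.toEmbedding, by rw [card_map]; exact I.2⟩)
      (fun I _ => ⟨I.1.map e.toEmbedding, by rw [card_map]; exact I.2⟩) ?_ ?_ ?_ ?_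
    · intro I hI
      rw [mem_filter] at hI ⊢
      refine ⟨mem_univ _, mem_map.2 ⟨i, hI.2, by simp [e]⟩⟩
    · intro I hI
      rw [mem_filter] at hI ⊢
      refine ⟨mem_univ _, mem_map.2 ⟨_, hI.2, by simp [e]⟩⟩
    · intro I _; exact Subtype.ext (hmm _)
    · intro I _; exact Subtype.ext (hmm _)
  calc ∑ I : MinorIdx n p, ∑ i ∈ I.1, x i = ∑ I : MinorIdx n p, ∑ i, if i ∈ I.1 then x i else 0 := by
        refine sum_congr rfl fun I _ => ?_
        rw [sum_ite_mem, univ_inter]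
    _ = ∑ i, ∑ I : MinorIdx n p, if i ∈ I.1 then x i else 0 := sum_comm
    _ = _ := by
        rw [mul_sum]
        refine sum_congr rfl fun i _ => ?_
        rw [← sum_filter, sum_const, h1, nsmul_eq_mul]

end CauchyBinet

section LinAlg

variable {K : Type*} [Field K] {n p : ℕ}

/-- A subspace of codimension `p` is the kernel of a `p × n` matrix with a right inverse. -/
theorem exists_matrix_ker {U : Submodule K (Fin n → K)} (hU : finrank K U + p = n) :
    ∃ (Λ : Matrix (Fin p) (Fin n) K) (R : Matrix (Fin n) (Fin p) K), Λ * R = 1 ∧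
      ∀ u, u ∈ U ↔ Λ.mulVec u = 0 := by
  have h1 : finrank K ((Fin n → K) ⧸ U) = p := by
    have := U.finrank_quotient_add_finrank
    rw [finrank_fin_fun] at this
    omega
  let e : ((Fin n → K) ⧸ U) ≃ₗ[K] (Fin p → K) :=
    LinearEquiv.ofFinrankEq _ _ (by rw [h1, finrank_fin_fun])
  let g : (Fin n → K) →ₗ[K] (Fin p → K) := e.toLinearMap ∘ₗ U.mkQ
  have hg : LinearMap.range g = ⊤ := by
    rw [LinearMap.range_eq_top]
    exact e.surjective.comp U.mkQ_surjective
  obtain ⟨r, hr⟩ := g.exists_rightInverse_of_surjective hg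
  refine ⟨LinearMap.toMatrix' g, LinearMap.toMatrix' r, ?_, fun u => ?_⟩
  · rw [← LinearMap.toMatrix'_comp, hr, LinearMap.toMatrix'_id]
  · rw [LinearMap.toMatrix'_mulVec]
    simp [g]

/-- A basis adapted to a subspace, with vectors taken in given spanning sets. -/
theorem exists_adapted_matrix {U : Submodule K (Fin n → K)} (hU : finrank K U + p = n)
    {s t : Set (Fin n → K)} (hsU : s ⊆ U) (hs : U ≤ span K s)
    (ht : ⊤ ≤ span K t) :
    ∃ (M : Matrix (Fin n) (Fin n) K) (I₀ : MinorIdx n p), IsUnit M.det ∧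
      (∀ k, k ∉ I₀.1 → (fun i => M i k) ∈ s) ∧ ∀ k ∈ I₀.1, (fun i => M i k) ∈ t := by
  classical
  obtain ⟨b, hbs, hb, hbi⟩ := exists_linearIndependent K s
  have hbi' : LinearIndepOn K id b := hbi
  obtain ⟨b', hb't, hbb', hspan, hb'i⟩ :=
    exists_linearIndepOn_id_extension hbi' (Set.subset_union_left (s := b) (t := t))
  have htop : ⊤ ≤ span K b' :=
    ht.trans (span_le.2 (Set.subset_union_right.trans hspan))
  let Bb : Basis b' K (Fin n → K) := Basis.mk (v := fun x : b' => (x : Fin n → K)) hb'i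
    (by rw [Subtype.range_coe]; exact htop)
  have : Fintype b' := Basis.fintypeIndexOfRankLtAleph0 Bb (by
    rw [rank_fun']; exact Cardinal.natCast_lt_aleph0)
  have hcard : Fintype.card b' = n := by
    rw [← Module.finrank_eq_card_basis Bb, finrank_fin_fun]
  let e : Fin n ≃ b' := (finCongr hcard.symm).trans (Fintype.equivFin b').symm
  have hbfin : Fintype b := (Set.Finite.subset (Set.toFinite b') hbb').fintype
  have hbcard : Fintype.card b = finrank K U := by
    have h1 : span K b = U := le_antisymm (span_le.2 (hbs.trans hsU)) (hs.trans hb.ge)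
    have := finrank_span_eq_card (R := K) hbi
    rw [Subtype.range_coe, h1] at this
    exact this.symm
  have hI : (univ.filter fun k => (e k : Fin n → K) ∉ b).card = p := by
    have h1 : (univ.filter fun k => (e k : Fin n → K) ∈ b).card = Fintype.card b := by
      rw [← Fintype.card_subtype]
      exact Fintype.card_congr
        { toFun := fun k => ⟨e k.1, k.2⟩
          invFun := fun x => ⟨e.symm ⟨x.1, hbb' x.2⟩, by rw [e.apply_symm_apply]; exact x.2⟩
          left_inv := fun k => Subtype.ext (by simp)
          right_inv := fun x => Subtype.ext (by simp) }
    have h2 := card_filter_add_card_filter_not (s := (univ : Finset (Fin n)))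
      (fun k => (e k : Fin n → K) ∈ b)
    rw [card_univ, Fintype.card_fin] at h2
    omega
  refine ⟨of fun i k => (e k : Fin n → K) i, ⟨_, hI⟩, ?_, fun k hk => ?_, fun k hk => ?_⟩
  · rw [← Matrix.isUnit_iff_isUnit_det, ← Matrix.linearIndependent_cols_iff_isUnit]
    exact (LinearIndependent.comp hb'i e e.injective)
  · have : (e k : Fin n → K) ∈ b := by simpa using hk
    exact hbs this
  · have : (e k : Fin n → K) ∉ b := by simpa using hk
    exact (hb't (e k).2).resolve_left this

theorem abv_det_le {ι : Type*} [Fintype ι] [DecidableEq ι] (v : AbsoluteValue K ℝ)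
    {M : Matrix ι ι K} {r t : ι → ℝ} (h : ∀ i k, v (M i k) ≤ r i * t k) :
    v M.det ≤ (Fintype.card ι).factorial * ((∏ i, r i) * ∏ i, t i) := by
  rw [det_apply]
  refine (v.sum_le _ _).trans ?_
  refine (sum_le_card_nsmul _ _ ((∏ i, r i) * ∏ i, t i) fun σ _ => ?_).trans (le_of_eq ?_)
  · rw [← Equiv.prod_comp σ r, ← prod_mul_distrib]
    rcases Int.units_eq_one_or (Perm.sign σ) with hs | hs
    all_goals
      rw [hs]
      simp only [one_smul, Units.neg_smul, v.map_neg, map_prod]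
      exact Finset.prod_le_prod (fun _ _ => v.nonneg _) fun k _ => h _ _
  · rw [card_univ, Fintype.card_perm, nsmul_eq_mul]

/-- Multiplication by a unimodular integer matrix does not change the size of a determinant. -/
theorem abv_det_map_mul {ι : Type*} [Fintype ι] [DecidableEq ι] (v : AbsoluteValue K ℝ)
    {A B : Matrix ι ι ℤ} (h : B * A = 1) (M : Matrix ι ι K) :
    v (A.map (Int.cast : ℤ → K) * M).det = v M.det := by
  have h3 : (A.map (Int.cast : ℤ → K)).det = (A.det : K) :=
    (map_det (castRingHom K) _).symm
  have h4 : IsUnit A.det := Matrix.isUnit_det_of_left_inverse h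
  rw [det_mul, map_mul, h3]
  rcases Int.isUnit_iff.1 h4 with h | h <;> rw [h] <;> simp

theorem det_mem {ι : Type*} [Fintype ι] [DecidableEq ι] {O : Subring K} {M : Matrix ι ι K}
    (h : ∀ i k, M i k ∈ O) : M.det ∈ O := by
  rw [det_apply]
  exact O.sum_mem fun σ _ => Subring.zsmul_mem O (O.prod_mem fun k _ => h _ _) _

/-- The linear form on the exterior power given by the maximal minors of `Λ`. -/
def minorForm (Λ : Matrix (Fin p) (Fin n) K) : (MinorIdx n p → K) →ₗ[K] K :=
  ∑ I, (Λ.submatrix id (sel I)).det • LinearMap.proj I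

theorem minorForm_wedge (Λ : Matrix (Fin p) (Fin n) K) (Z : Matrix (Fin n) (Fin p) K) :
    minorForm Λ (wedge Z) = (Λ * Z).det := by
  rw [cauchyBinet]
  simp [minorForm, wedge]

theorem mem_iff_of_minorForm {Λ : Matrix (Fin p) (Fin n) K} {R : Matrix (Fin n) (Fin p) K}
    (hR : Λ * R = 1) (u : Fin n → K) : Λ.mulVec u = 0 ↔
      ∀ (Z : Matrix (Fin n) (Fin p) K) k, wedge (Z.updateCol k u) ∈ ker (minorForm Λ) := by
  have h : ∀ (Z : Matrix (Fin n) (Fin p) K) k,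
      Λ * Z.updateCol k u = (Λ * Z).updateCol k (Λ.mulVec u) := by
    intro Z k
    ext i l
    by_cases hl : l = k
    · subst hl; simp [mul_apply, mulVec, dotProduct]
    · simp [mul_apply, hl]
  simp only [LinearMap.mem_ker, minorForm_wedge, h]
  constructor
  · intro h0 Z k
    exact Matrix.det_eq_zero_of_column_eq_zero k fun i => by simp [h0]
  · intro h0
    funext k
    have := h0 R k
    rw [hR, ← Matrix.cramer_apply, Matrix.cramer_one] at this
    exact this

end LinAlg

namespace SInt

variable {K : Type*} [Field K] {S : Type*} [Fintype S] {s : SInt K S} {n p : ℕ}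

theorem form_compound (A : Matrix (Fin n) (Fin n) ℤ) (Z : Matrix (Fin n) (Fin p) K)
    (I : MinorIdx n p) : form (compound p A I) (wedge Z) =
      (of fun k l => form (A (sel I k)) fun i => Z i l).det := by
  rw [form_eq_mulVec]
  have h : (compound p A).map (Int.cast : ℤ → K) = compound p (A.map (Int.cast : ℤ → K)) :=
    (compound_map (castRingHom K) A).symm
  rw [h, compound_mulVec_wedge]
  change det _ = _
  congr 1
  ext k l
  simp [form_apply, mul_apply]

theorem abv_form_compound_le (v : S) {A : Matrix (Fin n) (Fin n) ℤ} {Z : Matrix (Fin n) (Fin p) K}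
    {c : Fin n → ℝ} {d : Fin p → ℝ} {t : ℝ}
    (h : ∀ i k, s.abv v (form (A i) fun l => Z l k) ≤ exp ((c i + d k) * t))
    (I : MinorIdx n p) : s.abv v (form (compound p A I) (wedge Z)) ≤
      p.factorial * exp ((∑ i ∈ I.1, c i + ∑ k, d k) * t) := by
  rw [form_compound]
  refine (abv_det_le (s.abv v) (r := fun k => exp (c (sel I k) * t))
    (t := fun k => exp (d k * t)) fun k l => ?_).trans (le_of_eq ?_)
  · rw [← exp_add, ← add_mul]
    exact h _ _
  · rw [Fintype.card_fin, ← exp_sum, ← exp_sum, ← exp_add, ← sum_mul,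
      ← sum_mul, ← add_mul, sum_sel I c]

/-- The exponents on the exterior power. -/
def extExp (p : ℕ) (c : S → Fin n → ℝ) (γ : ℝ) (v : S) (I : MinorIdx n p) : ℝ :=
  ∑ i ∈ I.1, c v i + (p - 1) * γ

theorem isUnit_det_compound {M : Matrix (Fin n) (Fin n) K} (h : IsUnit M.det) :
    IsUnit (compound p M).det := by
  have h1 : compound p M * compound p M⁻¹ = 1 := by
    rw [← compound_mul, Matrix.mul_nonsing_inv _ h, compound_one]
  exact Matrix.isUnit_det_of_right_inverse h1

section adapted

variable {Λ : Matrix (Fin p) (Fin n) K} {M : Matrix (Fin n) (Fin n) K} {I₀ : MinorIdx n p}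
  (hM : IsUnit M.det) (hΛ : ∀ k, k ∉ I₀.1 → Λ.mulVec (fun i => M i k) = 0)

include hΛ in
theorem minorForm_col_eq_zero {J : MinorIdx n p} (hJ : J ≠ I₀) :
    minorForm Λ (fun I => compound p M I J) = 0 := by
  have : ∃ k, sel J k ∉ I₀.1 := by
    by_contra! h
    refine hJ (eq_of_subset fun i hi => ?_)
    obtain ⟨k, rfl⟩ := exists_sel_eq J hi
    exact h k
  obtain ⟨k, hk⟩ := this
  refine (minorForm_wedge Λ (M.submatrix id (sel J))).trans ?_
  exact Matrix.det_eq_zero_of_column_eq_zero k fun i => congrFun (hΛ _ hk) i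

include hM hΛ in
theorem exists_coords (ω : MinorIdx n p → K) : ∃ x : MinorIdx n p → K,
    ω = (compound p M).mulVec x ∧ ω = ∑ J, x J • (fun I => compound p M I J) ∧
      minorForm Λ ω = x I₀ * minorForm Λ (fun I => compound p M I I₀) := by
  have h1 : compound p M * (compound p M)⁻¹ = 1 :=
    Matrix.mul_nonsing_inv _ (isUnit_det_compound hM)
  have h2 : ω = (compound p M).mulVec ((compound p M)⁻¹.mulVec ω) := by
    rw [mulVec_mulVec, h1, one_mulVec]
  generalize (compound p M)⁻¹.mulVec ω = x at h2
  have h3 : ω = ∑ J, x J • (fun I => compound p M I J) := by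
    rw [h2]
    funext I
    simp [mulVec, dotProduct, mul_comm]
  refine ⟨x, h2, h3, ?_⟩
  conv_lhs => rw [h3]
  rw [map_sum, sum_eq_single I₀]
  · rw [map_smul, smul_eq_mul]
  · intro J _ hJ
    rw [map_smul, minorForm_col_eq_zero hΛ hJ, smul_zero]
  · simp

include hM hΛ in
theorem ker_minorForm_le (h0 : minorForm Λ ≠ 0) : ker (minorForm Λ) ≤
    span K {y | ∃ J, J ≠ I₀ ∧ y = fun I => compound p M I J} := by
  intro ω hω
  obtain ⟨x, -, h3, h4⟩ := exists_coords hM hΛ ω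
  rw [LinearMap.mem_ker.1 hω] at h4
  have h5 : minorForm Λ (fun I => compound p M I I₀) ≠ 0 := by
    intro h
    refine h0 (LinearMap.ext fun y => ?_)
    obtain ⟨x, -, -, h⟩ := exists_coords hM hΛ y
    rw [h, ‹minorForm Λ (fun I => compound p M I I₀) = 0›, mul_zero, LinearMap.zero_apply]
  have h6 : x I₀ = 0 := (mul_eq_zero.1 h4.symm).resolve_right h5
  rw [h3]
  refine Submodule.sum_mem _ fun J _ => ?_
  by_cases hJ : J = I₀
  · rw [hJ, h6, zero_smul]; exact Submodule.zero_mem _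
  · exact smul_mem _ _ (subset_span ⟨J, hJ, rfl⟩)

include hM hΛ in
theorem det_updateCol_ne_zero {ω : MinorIdx n p → K} (h : minorForm Λ ω ≠ 0) :
    ((compound p M).updateCol I₀ ω).det ≠ 0 := by
  obtain ⟨x, h2, -, h4⟩ := exists_coords hM hΛ ω
  rw [← Matrix.cramer_apply, h2, Matrix.cramer_eq_adjugate_mulVec, mulVec_mulVec,
    Matrix.adjugate_mul, Matrix.smul_mulVec, one_mulVec, Pi.smul_apply, smul_eq_mul]
  refine mul_ne_zero (isUnit_det_compound hM).ne_zero fun h0 => h ?_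
  rw [h4, h0, zero_mul]

variable {A : S → Matrix (Fin n) (Fin n) ℤ} {c : S → Fin n → ℝ} {γ ε t : ℝ}
  (h₁ : ∀ k, k ∉ I₀.1 → (fun i => M i k) ∈ s.Box A (fun v i => c v i + ε) t)
  (h₂ : ∀ k ∈ I₀.1, (fun i => M i k) ∈ s.Box A (fun v i => c v i + γ + ε) t)

include h₁ h₂ in
theorem adapted_mem (i k : Fin n) : M i k ∈ s.O := by
  by_cases hk : k ∈ I₀.1
  · exact (h₂ k hk).1 i
  · exact (h₁ k hk).1 i

include h₁ h₂ in
theorem abv_form_col_le (v : S) (I J : MinorIdx n p) :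
    s.abv v (form (compound p (A v) I) (fun I => compound p M I J)) ≤ p.factorial *
      exp ((∑ i ∈ I.1, c v i + (p * ε + γ * ∑ k ∈ J.1, if k ∈ I₀.1 then 1 else 0)) * t) := by
  have := abv_form_compound_le (s := s) v (A := A v) (Z := M.submatrix id (sel J)) (c := c v)
    (d := fun k => (if sel J k ∈ I₀.1 then γ else 0) + ε) (t := t) (fun i k => by
      by_cases hk : sel J k ∈ I₀.1
      · rw [if_pos hk]
        refine ((h₂ _ hk).2 v i).trans (le_of_eq ?_)
        ring_nf
      · rw [if_neg hk]
        refine ((h₁ _ hk).2 v i).trans (le_of_eq ?_)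
        ring_nf) I
  refine this.trans (le_of_eq ?_)
  congr 4
  rw [sum_sel J fun k => (if k ∈ I₀.1 then γ else 0) + ε, sum_add_distrib, sum_const,
    J.2, nsmul_eq_mul, add_comm, mul_sum]
  congr 1
  exact sum_congr rfl fun k _ => by split_ifs <;> simp

include h₁ h₂ in
theorem col_mem_box (hγ : 0 ≤ γ) (ht : 0 ≤ t) (hf : (p.factorial : ℝ) ≤ exp (ε * t))
    {J : MinorIdx n p} (hJ : J ≠ I₀) : (fun I => compound p M I J) ∈
      s.Box (fun v => compound p (A v)) (fun v I => extExp p c γ v I + (p + 1) * ε) t := by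
  refine ⟨fun I => det_mem fun i k => adapted_mem h₁ h₂ _ _, fun v I => ?_⟩
  refine (abv_form_col_le h₁ h₂ v I J).trans ?_
  refine (mul_le_mul_of_nonneg_right hf (exp_pos _).le).trans ?_
  rw [← exp_add, exp_le_exp, ← add_mul]
  refine mul_le_mul_of_nonneg_right ?_ ht
  have h3 : (∑ k ∈ J.1, if k ∈ I₀.1 then (1 : ℝ) else 0) ≤ p - 1 := by
    rw [sum_ite_mem, sum_const, nsmul_eq_mul, mul_one]
    have : (J.1 ∩ I₀.1).card < p := by
      by_contra! h
      refine hJ (eq_of_subset ?_)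
      rw [← eq_of_subset_of_card_le (inter_subset_left (s₁ := J.1) (s₂ := I₀.1))
        (by rw [J.2]; exact h)]
      exact inter_subset_right
    have : ((J.1 ∩ I₀.1).card : ℝ) + 1 ≤ p := by exact_mod_cast this
    linarith
  have := mul_le_mul_of_nonneg_left h3 hγ
  simp only [extExp]
  linarith

include h₁ h₂ in
theorem abv_det_updateCol_le {B : S → Matrix (Fin n) (Fin n) ℤ} (hBA : ∀ v, B v * A v = 1)
    {r : ℕ} (hr : ∀ x : Fin n → ℝ, ∑ I : MinorIdx n p, ∑ i ∈ I.1, x i = r * ∑ i, x i)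
    {ω : MinorIdx n p → K} {η : ℝ} (hε : 0 ≤ ε) (ht : 0 ≤ t)
    (hω : ω ∈ s.Box (fun v => compound p (A v)) (fun v I => extExp p c γ v I + η) t) (v : S) :
    s.abv v ((compound p M).updateCol I₀ ω).det ≤
      (Fintype.card (MinorIdx n p)).factorial * (p.factorial : ℝ) ^ Fintype.card (MinorIdx n p) *
      exp ((r * (∑ i, c v i + p * γ) + (η - γ) + (Fintype.card (MinorIdx n p) * p) * ε) * t) := by
  have hu : compound p (B v) * compound p (A v) = 1 := by
    rw [← compound_mul, hBA, compound_one]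
  let g : MinorIdx n p → ℝ := fun J => if J = I₀ then (p - 1) * γ + η else
    γ * ∑ k ∈ J.1, if k ∈ I₀.1 then 1 else 0
  have hg : ∑ J, g J = r * (p * γ) + (η - γ) := by
    have h3 := hr fun k => if k ∈ I₀.1 then 1 else 0
    rw [sum_ite_mem, univ_inter, sum_const, I₀.2, nsmul_eq_mul, mul_one,
      ← add_sum_erase _ _ (mem_univ I₀)] at h3
    have h4 : (∑ k ∈ I₀.1, if k ∈ I₀.1 then (1 : ℝ) else 0) = p := by
      rw [sum_ite_mem, inter_self, sum_const, I₀.2, nsmul_eq_mul, mul_one]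
    rw [h4] at h3
    rw [← add_sum_erase _ _ (mem_univ I₀)]
    have h5 : ∑ J ∈ univ.erase I₀, g J = γ * ∑ J ∈ univ.erase I₀,
        ∑ k ∈ J.1, (if k ∈ I₀.1 then (1 : ℝ) else 0) := by
      rw [mul_sum]
      exact sum_congr rfl fun J hJ => if_neg (ne_of_mem_erase hJ)
    rw [h5, eq_sub_of_add_eq' h3]
    simp only [g, if_pos]
    ring
  have hp1 : (1 : ℝ) ≤ p.factorial := by exact_mod_cast Nat.one_le_iff_ne_zero.2 p.factorial_ne_zero
  rw [← abv_det_map_mul (s.abv v) hu]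
  refine (abv_det_le (s.abv v) (r := fun I => p.factorial * exp ((∑ i ∈ I.1, c v i + p * ε) * t))
    (t := fun J => exp (g J * t)) fun I J => ?_).trans (le_of_eq ?_)
  · rw [mul_assoc, ← exp_add, ← add_mul]
    by_cases hJ : J = I₀
    · have h3 : (((compound p (A v)).map (Int.cast : ℤ → K)) * (compound p M).updateCol I₀ ω) I J =
          form (compound p (A v) I) ω := by
        rw [hJ, mul_apply, form_apply]
        simp
      rw [h3]
      refine (hω.2 v I).trans ((le_mul_of_one_le_left (exp_pos _).le hp1).trans' ?_)
      rw [exp_le_exp]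
      refine mul_le_mul_of_nonneg_right ?_ ht
      simp only [extExp, g, if_pos hJ]
      have := mul_nonneg (cast_nonneg (α := ℝ) p) hε
      linarith
    · have h3 : (((compound p (A v)).map (Int.cast : ℤ → K)) * (compound p M).updateCol I₀ ω) I J =
          form (compound p (A v) I) (fun I => compound p M I J) := by
        rw [mul_apply, form_apply]
        simp [hJ]
      rw [h3]
      refine (abv_form_col_le h₁ h₂ v I J).trans (le_of_eq ?_)
      simp only [g, if_neg hJ, add_assoc]
  · rw [prod_mul_distrib, prod_const, card_univ, ← exp_sum, ← exp_sum,
      mul_assoc, mul_assoc, mul_assoc, ← exp_add, ← sum_mul, ← sum_mul,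
      ← add_mul, hg, sum_add_distrib, hr, sum_const, card_univ, nsmul_eq_mul]
    ring_nf

end adapted

theorem eventually_adapted {𝒰 : Ultrafilter ℕ} {q : ℕ → ℝ} {A : S → Matrix (Fin n) (Fin n) ℤ}
    {c : S → Fin n → ℝ} {γ : ℝ} {U : ℕ → Submodule K (Fin n → K)}
    {Λ : ℕ → Matrix (Fin p) (Fin n) K}
    (hΛ : ∀ᶠ j in 𝒰, ∀ u, u ∈ U j ↔ (Λ j).mulVec u = 0)
    (hU : ∀ᶠ j in 𝒰, finrank K (U j) + p = n) (h₁ : s.SpannedBy 𝒰 q A U c)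
    (h₂ : s.SpannedBy 𝒰 q A (fun _ => ⊤) fun v i => c v i + γ) {ε : ℝ} (hε : 0 < ε) :
    ∀ᶠ j in 𝒰, ∃ (M : Matrix (Fin n) (Fin n) K) (I₀ : MinorIdx n p), IsUnit M.det ∧
      (∀ k, k ∉ I₀.1 → (Λ j).mulVec (fun i => M i k) = 0) ∧
      (∀ k, k ∉ I₀.1 → (fun i => M i k) ∈ s.Box A (fun v i => c v i + ε) (q j)) ∧
      ∀ k ∈ I₀.1, (fun i => M i k) ∈ s.Box A (fun v i => c v i + γ + ε) (q j) := by
  filter_upwards [hΛ, hU, h₁ ε hε, h₂ ε hε] with j hΛ hU h₁ h₂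
  obtain ⟨M, I₀, hM, h3, h4⟩ := exists_adapted_matrix hU (fun y hy => hy.1) h₁ h₂
  exact ⟨M, I₀, hM, fun k hk => (hΛ _).1 (h3 k hk).1, fun k hk => (h3 k hk).2, fun k hk => (h4 k hk).2⟩

/-- A subspace spanned by much smaller points than the rest of the space is constant along
the ultrafilter. -/
theorem eventually_const_of_gap [Nonempty S] [CharZero K] [Algebra ℚ K] [FiniteDimensional ℚ K]
    {𝒰 : Ultrafilter ℕ} {q : ℕ → ℝ} (hq : Tendsto q 𝒰 atTop)
    {A B : S → Matrix (Fin n) (Fin n) ℤ} (hBA : ∀ v, B v * A v = 1)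
    {c : S → Fin n → ℝ} {γ : ℝ} (hγ : 0 < γ) {U : ℕ → Submodule K (Fin n → K)}
    (hU : ∀ᶠ j in 𝒰, finrank K (U j) + p = n) (h₁ : s.SpannedBy 𝒰 q A U c)
    (h₂ : s.SpannedBy 𝒰 q A (fun _ => ⊤) fun v i => c v i + γ)
    (hsum : ∑ v, (s.wt v : ℝ) * ∑ i, c v i ≤ -(p * γ * s.deg)) :
    ∃ T, ∀ᶠ j in 𝒰, U j = T := by
  classical
  have hex : ∀ j, ∃ (Λ : Matrix (Fin p) (Fin n) K) (R : Matrix (Fin n) (Fin p) K),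
      finrank K (U j) + p = n → Λ * R = 1 ∧ ∀ u, u ∈ U j ↔ Λ.mulVec u = 0 := by
    intro j
    by_cases h : finrank K (U j) + p = n
    · obtain ⟨Λ, R, h⟩ := exists_matrix_ker h
      exact ⟨Λ, R, fun _ => h⟩
    · exact ⟨0, 0, fun h' => absurd h' h⟩
  choose Λ R hΛR using hex
  have hΛ : ∀ᶠ j in 𝒰, ∀ u, u ∈ U j ↔ (Λ j).mulVec u = 0 := hU.mono fun j hj => (hΛR j hj).2
  have hR : ∀ᶠ j in 𝒰, Λ j * R j = 1 := hU.mono fun j hj => (hΛR j hj).1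
  have hne : ∀ᶠ j in 𝒰, minorForm (Λ j) ≠ 0 := hR.mono fun j hj h0 => by
    have := minorForm_wedge (Λ j) (R j)
    rw [hj, h0, det_one] at this
    exact one_ne_zero this.symm
  obtain ⟨r, hr⟩ := exists_sum_minorIdx n p
  have hcA : ∀ v, compound p (B v) * compound p (A v) = 1 := fun v => by
    rw [← compound_mul, hBA, compound_one]
  have hspan : s.SpannedBy 𝒰 q (fun v => compound p (A v))
      (fun j => ker (minorForm (Λ j))) (extExp p c γ) := by
    intro ε hε
    have hε' : 0 < ε / (p + 1) := by positivity
    filter_upwards [eventually_adapted hΛ hU h₁ h₂ hε', hq.eventually_ge_atTop 0, hne,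
      (hq.const_mul_atTop hε').eventually_ge_atTop (log p.factorial)] with j hj ht hne hf
    obtain ⟨M, I₀, hM, h3, h4, h5⟩ := hj
    refine (ker_minorForm_le hM h3 hne).trans (span_mono ?_)
    rintro _ ⟨J, hJ, rfl⟩
    refine ⟨minorForm_col_eq_zero h3 hJ, ?_⟩
    have := col_mem_box h4 h5 hγ.le ht
      ((log_le_iff_le_exp (by exact_mod_cast p.factorial_pos)).1 hf) hJ
    rwa [mul_div_cancel₀ _ (by positivity)] at this
  have hbox : ∀ η < γ, ∀ᶠ j in 𝒰, s.Box (fun v => compound p (A v))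
      (fun v I => extExp p c γ v I + η) (q j) ⊆ ker (minorForm (Λ j)) := by
    intro η hη
    by_contra hcon
    rw [← Ultrafilter.eventually_not] at hcon
    have hd : (0 : ℝ) < s.deg := by exact_mod_cast s.deg_pos
    have h0 := s.sum_nonneg_of_eventually hq (fun v => r * (∑ i, c v i + p * γ) + (η - γ)) _
      (Fintype.card (MinorIdx n p) * p) (fun ε hε => by
        filter_upwards [eventually_adapted hΛ hU h₁ h₂ hε, hq.eventually_ge_atTop 0, hcon]
          with j hj ht hcon
        obtain ⟨M, I₀, hM, h3, h4, h5⟩ := hj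
        obtain ⟨ω, hω, hωk⟩ := Set.not_subset.1 hcon
        refine ⟨_, det_mem fun I J => ?_, det_updateCol_ne_zero hM h3 hωk,
          abv_det_updateCol_le h4 h5 hBA hr hε.le ht hω⟩
        by_cases hJ : J = I₀
        · rw [hJ, Matrix.updateCol_self]; exact hω.1 I
        · rw [Matrix.updateCol_ne hJ]
          exact det_mem fun i k => adapted_mem h4 h5 _ _)
    have h6 : ∑ v, (s.wt v : ℝ) * (r * (∑ i, c v i + p * γ) + (η - γ)) =
        r * (∑ v, (s.wt v : ℝ) * ∑ i, c v i + p * γ * s.deg) + s.deg * (η - γ) := by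
      rw [deg, cast_sum, mul_sum, sum_mul, ← sum_add_distrib, mul_sum, ← sum_add_distrib]
      exact sum_congr rfl fun v _ => by ring
    rw [h6] at h0
    have h7 := mul_nonneg (cast_nonneg (α := ℝ) r)
      (show 0 ≤ -(∑ v, (s.wt v : ℝ) * ∑ i, c v i + p * γ * s.deg) by linarith)
    have h8 := mul_pos hd (sub_pos.2 hη)
    linarith
  set E₀ := ∑ v, (s.wt v : ℝ) * ∑ I, extExp p c γ v I with hE₀
  obtain ⟨c₃, hc₃, -, hs₃, -, hfl⟩ := flatten hq hcA (W₁ := fun j => ker (minorForm (Λ j)))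
    (W₂ := fun j => ker (minorForm (Λ j))) (c₁ := extExp p c γ) (γ := 0) (G := |E₀| + 1)
    (Filter.Eventually.of_forall fun _ => le_rfl) le_rfl (by positivity) hspan (by simpa using hspan)
  have hneg : ∑ v, (s.wt v : ℝ) * ∑ I, c₃ v I < 0 := by
    rcases hfl with ⟨v₀, I₀, h0⟩ | hmin
    · have h1 : ∑ v, (s.wt v : ℝ) * ∑ I, (extExp p c γ v I - c₃ v I) ≥ |E₀| + 1 := by
        have hnn : ∀ v I, 0 ≤ extExp p c γ v I - c₃ v I := fun v I => sub_nonneg.2 (hc₃ v I)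
        have h2 := single_le_sum (f := fun I => extExp p c γ v₀ I - c₃ v₀ I)
          (fun I _ => hnn v₀ I) (mem_univ I₀)
        have h3 := single_le_sum (f := fun v => (s.wt v : ℝ) * ∑ I, (extExp p c γ v I - c₃ v I))
          (fun v _ => mul_nonneg (cast_nonneg _) (sum_nonneg fun I _ => hnn v I))
          (mem_univ v₀)
        have hw : (1 : ℝ) ≤ s.wt v₀ := by exact_mod_cast s.wt_pos v₀
        have h4 := le_mul_of_one_le_left (sum_nonneg fun I (_ : I ∈ univ) => hnn v₀ I) hw
        rw [h0, sub_sub_cancel] at h2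
        linarith
      simp only [sum_sub_distrib, mul_sub] at h1
      have := le_abs_self E₀
      linarith
    · have h1 := count_le hq hcA (T := fun j => ker (minorForm (Λ j)))
        (τ := Fintype.card (MinorIdx n p) - 1) (hne.mono fun j hj => by
          have := Dual.finrank_ker_add_one_of_ne_zero (f := minorForm (Λ j)) hj
          rw [Module.finrank_fintype_fun_eq_card] at this
          omega) (half_pos hγ).le hmin (by
          filter_upwards [hbox _ (half_lt_self hγ), hq.eventually_ge_atTop 0] with j hj ht
          exact (Box_mono ht fun v I => by linarith [hc₃ v I]).trans hj)
      have hN : 1 ≤ Fintype.card (MinorIdx n p) := by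
        obtain ⟨j, hj⟩ := (eventually_adapted hΛ hU h₁ h₂ one_pos).exists
        obtain ⟨-, I₀, -⟩ := hj
        exact Fintype.card_pos_iff.2 ⟨I₀⟩
      have hd : (0 : ℝ) < s.deg := by exact_mod_cast s.deg_pos
      rw [Nat.cast_sub hN, Nat.cast_one, sub_sub_cancel] at h1
      have := mul_pos (half_pos hγ) hd
      linarith
  have hne' : ∃ φ : ℕ → (MinorIdx n p → K) →ₗ[K] K, (∀ j, φ j ≠ 0) ∧
      ∀ᶠ j in 𝒰, φ j = minorForm (Λ j) := by
    obtain ⟨j₀, hj₀⟩ := hne.exists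
    exact ⟨fun j => if minorForm (Λ j) = 0 then minorForm (Λ j₀) else minorForm (Λ j), fun j => by
      dsimp only; split_ifs with h <;> assumption, hne.mono fun j hj => if_neg hj⟩
  obtain ⟨φ, hφ, hφe⟩ := hne'
  obtain ⟨T, hT⟩ := eventually_const_ker hq hcA hneg hφ (by
    intro ε hε
    filter_upwards [hs₃ ε hε, hφe] with j hj h
    rwa [h])
  obtain ⟨j₀, hj₀⟩ := (hT.and (hφe.and (hR.and hΛ))).exists
  refine ⟨U j₀, ?_⟩
  filter_upwards [hT, hφe, hR, hΛ] with j hT hφe hR hΛ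
  ext u
  rw [hΛ, hj₀.2.2.2, mem_iff_of_minorForm hR, mem_iff_of_minorForm hj₀.2.2.1, ← hφe, hT,
    ← hj₀.2.1, hj₀.1]

end SInt

end

section

open Finset Filter Topology

namespace SInt

variable {K : Type*} [Field K] {S : Type*} [Fintype S] {s : SInt K S} {n : ℕ}

theorem finite_bounded (s : SInt K S) [Nonempty S] (R : ℝ) :
    {x | x ∈ s.O ∧ ∀ v, s.abv v x ≤ R}.Finite := by
  obtain ⟨C, -, h⟩ := s.exists_coloring
  choose k f _ hf using fun v => h v (1 / 2) (max R 1) one_half_pos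
    ((half_lt_self one_pos).le.trans (le_max_right _ _))
  refine Set.Finite.of_injOn (f := fun x v => f v x) (t := Set.univ) (fun _ _ => Set.mem_univ _)
    (fun x hx y hy hxy => ?_) (Set.toFinite _)
  refine sub_eq_zero.1 (s.eq_zero_of_le (s.O.sub_mem hx.1 hy.1) (ρ := fun _ => 1 / 2)
    (fun _ => one_half_pos) (fun v => hf v x y ((hx.2 v).trans (le_max_left _ _))
      ((hy.2 v).trans (le_max_left _ _)) (congrFun hxy v)) ?_)
  rw [prod_pow_eq_pow_sum]
  exact pow_lt_one₀ one_half_pos.le (half_lt_self one_pos) s.deg_pos.ne'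

theorem sum_log_eq_zero {x : K} (h : x ∈ s.O) (h' : x⁻¹ ∈ s.O) (h0 : x ≠ 0) :
    ∑ v, (s.wt v : ℝ) * log (s.abv v x) = 0 := by
  refine le_antisymm ?_ (s.sum_log_nonneg x h h0)
  have := s.sum_log_nonneg _ h' (inv_ne_zero h0)
  simp only [map_inv₀, log_inv, mul_neg, sum_neg_distrib] at this
  linarith

theorem sum_nonneg_of_spannedBy_top {𝒰 : Filter ℕ} [𝒰.NeBot] {q : ℕ → ℝ}
    (hq : Tendsto q 𝒰 atTop) {A B : S → Matrix (Fin n) (Fin n) ℤ} (hBA : ∀ v, B v * A v = 1)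
    {c : S → Fin n → ℝ} (h : s.SpannedBy 𝒰 q A (fun _ => ⊤) c) :
    0 ≤ ∑ v, (s.wt v : ℝ) * ∑ i, c v i := by
  refine s.sum_nonneg_of_eventually hq _ n.factorial n fun ε hε => ?_
  filter_upwards [h ε hε] with j hj
  obtain ⟨M, I₀, hM, h1, h2⟩ := exists_adapted_matrix (U := (⊥ : Submodule K (Fin n → K))) (p := n)
    (by rw [finrank_bot, zero_add]) (s := ∅) (Set.empty_subset _) bot_le hj
  have h3 : ∀ k, (fun i => M i k) ∈ s.Box A (fun v i => c v i + ε) (q j) := fun k => by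
    by_cases hk : k ∈ I₀.1
    · exact (h2 k hk).2
    · exact absurd (h1 k hk) (Set.notMem_empty _)
  refine ⟨M.det, det_mem fun i k => (h3 k).1 i, hM.ne_zero, fun v => ?_⟩
  rw [← abv_det_map_mul (s.abv v) (hBA v)]
  refine (abv_det_le (s.abv v) (r := fun i => exp ((c v i + ε) * q j)) (t := fun _ => 1)
    fun i k => ?_).trans (le_of_eq ?_)
  · rw [mul_one]
    refine le_trans (le_of_eq ?_) ((h3 k).2 v i)
    rw [form_apply, mul_apply]
    rfl
  · rw [← exp_sum, ← sum_mul, sum_add_distrib, sum_const, card_univ,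
      Fintype.card_fin, nsmul_eq_mul, prod_const_one, mul_one]

/-- A family of points in small boxes lies in a fixed proper subspace along the ultrafilter. -/
theorem exists_proper_subspace [Nonempty S] [CharZero K] [Algebra ℚ K] [FiniteDimensional ℚ K]
    {𝒰 : Ultrafilter ℕ} {q : ℕ → ℝ} (hq : Tendsto q 𝒰 atTop)
    {A B : S → Matrix (Fin n) (Fin n) ℤ} (hBA : ∀ v, B v * A v = 1) {c : S → Fin n → ℝ}
    (hc : ∑ v, (s.wt v : ℝ) * ∑ i, c v i < 0) {y : ℕ → Fin n → K}
    (hy : ∀ ε > 0, ∀ᶠ j in 𝒰, y j ∈ s.Box A (fun v i => c v i + ε) (q j)) :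
    ∃ T : Submodule K (Fin n → K), T ≠ ⊤ ∧ ∀ᶠ j in 𝒰, y j ∈ T := by
  classical
  let Sp : ℝ → ℕ → Submodule K (Fin n → K) := fun t j =>
    span K (s.Box A (fun v i => c v i + t) (q j))
  have hD : ∀ t, ∃ d : ℕ, d ≤ n ∧ ∀ᶠ j in 𝒰, finrank K (Sp t j) = d := by
    intro t
    have h1 : ∀ᶠ j in 𝒰, ∃ d : Fin (n + 1), finrank K (Sp t j) = d :=
      Eventually.of_forall fun j => ⟨⟨_, Nat.lt_succ_of_le
        ((Submodule.finrank_le _).trans (finrank_fin_fun K).le)⟩, rfl⟩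
    obtain ⟨d, hd⟩ := Ultrafilter.eventually_exists_iff.1 h1
    exact ⟨d, Nat.lt_succ_iff.1 d.2, hd⟩
  choose D hDn hD using hD
  have hmono : ∀ t t', t ≤ t' → ∀ᶠ j in 𝒰, Sp t j ≤ Sp t' j := fun t t' htt => by
    filter_upwards [hq.eventually_ge_atTop 0] with j hj
    exact span_mono (Box_mono hj fun v i => by linarith)
  have hDmono : ∀ t t', t ≤ t' → D t ≤ D t' := fun t t' htt => by
    obtain ⟨j, h1, h2, h3⟩ := ((hmono t t' htt).and ((hD t).and (hD t'))).exists
    rw [← h2, ← h3]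
    exact Submodule.finrank_mono h1
  have hDtop : ∀ t, D t = n → ∀ᶠ j in 𝒰, Sp t j = ⊤ := fun t ht => by
    filter_upwards [hD t] with j hj
    exact Submodule.eq_top_of_finrank_eq (by rw [hj, ht, finrank_fin_fun])
  have hd : (0 : ℝ) < s.deg := by exact_mod_cast s.deg_pos
  have hsum : ∀ (c : S → Fin n → ℝ) t, ∑ v, (s.wt v : ℝ) * ∑ i, (c v i + t) =
      ∑ v, (s.wt v : ℝ) * ∑ i, c v i + n * t * s.deg := fun c t => by
    rw [deg, cast_sum, mul_sum, ← sum_add_distrib]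
    refine sum_congr rfl fun v _ => ?_
    rw [sum_add_distrib, sum_const, card_univ, Fintype.card_fin, nsmul_eq_mul]
    ring
  obtain ⟨τ, hτ, hτD⟩ : ∃ τ > 0, ∀ t, D t = n → τ ≤ t := by
    have hn : (0 : ℝ) < n := by
      rcases Nat.eq_zero_or_pos n with h0 | h0
      · subst h0; simp at hc
      · exact_mod_cast h0
    refine ⟨-(∑ v, (s.wt v : ℝ) * ∑ i, c v i) / (n * s.deg),
      div_pos (neg_pos.2 hc) (mul_pos hn hd), fun t ht => ?_⟩
    have h1 := sum_nonneg_of_spannedBy_top hq hBA (c := fun v i => c v i + t) (s := s) (by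
      intro ε hε
      filter_upwards [hDtop t ht, hq.eventually_ge_atTop 0] with j hj hj0
      rw [← hj]
      exact span_mono fun y hy => ⟨subset_span hy, Box_mono hj0 (fun v i => by linarith) hy⟩)
    rw [hsum] at h1
    rw [div_le_iff₀ (mul_pos hn hd)]
    linarith
  obtain ⟨t₀, ht₀⟩ : ∃ t, D t = n := by
    obtain ⟨b, hb1, hbA, -⟩ := exists_intMatrix_bound A B
    obtain ⟨m, hm⟩ := (Set.finite_range fun p : S × Fin n => c p.1 p.2).bddBelow
    refine ⟨1 - m, le_antisymm (hDn _) ?_⟩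
    obtain ⟨j, h1, h2⟩ := ((hD (1 - m)).and ((hq.eventually_ge_atTop (log b)).and
      (hq.eventually_ge_atTop 0))).exists
    have : Sp (1 - m) j = ⊤ := by
      rw [eq_top_iff, ← (Pi.basisFun K (Fin n)).span_eq]
      refine span_mono ?_
      rintro _ ⟨k, rfl⟩
      refine ⟨fun i => ?_, fun v i => ?_⟩
      · rw [Pi.basisFun_apply, Pi.single_apply]
        split_ifs
        exacts [s.O.one_mem, s.O.zero_mem]
      · have h3 : form (A v i) (Pi.basisFun K (Fin n) k) = ((A v i k : ℤ) : K) := by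
          simp [form_apply, Pi.single_apply]
        rw [h3]
        refine (s.abv_intCast_le v _).trans ((hbA v i k).trans ?_)
        refine ((log_le_iff_le_exp (by linarith)).1 h2.1).trans (exp_le_exp.2 ?_)
        have h4 : m ≤ c v i := hm ⟨(v, i), rfl⟩
        exact le_mul_of_one_le_left h2.2 (by linarith)
    rw [← h1, this, finrank_top, finrank_fin_fun]
  set g := sInf {t | D t = n} with hg
  have hbdd : BddBelow {t | D t = n} := ⟨τ, fun t ht => hτD t ht⟩
  have hg0 : 0 < g := hτ.trans_le (le_csInf ⟨t₀, ht₀⟩ hτD)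
  have hglt : ∀ t < g, D t < n := fun t ht => lt_of_le_of_ne (hDn t) fun h =>
    absurd (csInf_le hbdd h) (not_le.2 ht)
  have hgt : ∀ t, g < t → D t = n := fun t ht => by
    obtain ⟨t', ht', h⟩ := exists_lt_of_csInf_lt ⟨t₀, ht₀⟩ ht
    exact le_antisymm (hDn t) (ht' ▸ hDmono t' t h.le)
  obtain ⟨t₁, ⟨ht₁, ht₁g⟩, hmax⟩ : ∃ t ∈ Set.Ioo 0 g, ∀ t' ∈ Set.Ioo 0 g, D t' ≤ D t := by
    have h1 : BddAbove (D '' Set.Ioo 0 g) := ⟨n, by rintro _ ⟨t, -, rfl⟩; exact hDn t⟩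
    obtain ⟨t, ht, h⟩ := Nat.sSup_mem ((Set.nonempty_Ioo.2 hg0).image D) h1
    exact ⟨t, ht, fun t' ht' => h ▸ le_csSup h1 ⟨t', ht', rfl⟩⟩
  have hγ : 0 < g - t₁ := sub_pos.2 ht₁g
  have hconst : ∀ η, 0 ≤ η → η < g - t₁ → ∀ᶠ j in 𝒰,
      s.Box A (fun v i => c v i + t₁ + η) (q j) ⊆ Sp t₁ j := fun η h0 hη => by
    filter_upwards [hmono t₁ (t₁ + η) (by linarith), hD t₁, hD (t₁ + η)] with j h1 h2 h3
    have h4 : Sp t₁ j = Sp (t₁ + η) j := Submodule.eq_of_le_of_finrank_le h1 (by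
      rw [h2, h3]; exact hmax _ ⟨by linarith, by linarith⟩)
    rw [h4]
    simp only [add_assoc]
    exact subset_span
  have hU : s.SpannedBy 𝒰 q A (Sp t₁) fun v i => c v i + t₁ := fun ε hε => by
    filter_upwards [hq.eventually_ge_atTop 0] with j hj
    exact span_mono fun y hy => ⟨subset_span hy, Box_mono hj (fun v i => by linarith) hy⟩
  have hT : s.SpannedBy 𝒰 q A (fun _ => ⊤) fun v i => c v i + t₁ + (g - t₁) := fun ε hε => by
    filter_upwards [hDtop (g + ε) (hgt _ (by linarith))] with j hj
    rw [← hj]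
    refine span_mono fun y hy => ⟨subset_span hy, ?_⟩
    have h1 : (fun v i => c v i + t₁ + (g - t₁) + ε) = fun v i => c v i + (g + ε) := by
      funext v i; ring
    rwa [h1]
  set E₀ := ∑ v, (s.wt v : ℝ) * ∑ i, (c v i + t₁ + (g - t₁)) with hE₀
  obtain ⟨c₂, hc₂, -, hU₂, hT₂, hfl⟩ := flatten hq hBA (G := |E₀| + 1) (W₂ := fun _ => ⊤)
    (Eventually.of_forall fun j => le_top) hγ.le (by positivity) hU hT
  have hmin : ∀ ε > 0, ∀ᶠ j in 𝒰, ∀ y ∈ Sp t₁ j,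
      y ∈ s.Box A (fun v i => c₂ v i - ε) (q j) → y = 0 := by
    refine hfl.resolve_left ?_
    rintro ⟨v₀, i₀, h0⟩
    have h1 := sum_nonneg_of_spannedBy_top hq hBA hT₂
    have h2 : ∀ v i, c₂ v i + (g - t₁) ≤ c v i + t₁ + (g - t₁) -
        if v = v₀ ∧ i = i₀ then |E₀| + 1 else 0 := fun v i => by
      split_ifs with h
      · rw [h.1, h.2, h0]; linarith
      · linarith [hc₂ v i]
    have h3 : ∀ v, (s.wt v : ℝ) * ∑ i, (c₂ v i + (g - t₁)) ≤
        (s.wt v : ℝ) * ∑ i, (c v i + t₁ + (g - t₁)) - if v = v₀ then |E₀| + 1 else 0 := fun v => by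
      refine (mul_le_mul_of_nonneg_left (sum_le_sum fun i _ => h2 v i) (cast_nonneg _)).trans ?_
      rw [sum_sub_distrib, mul_sub]
      refine sub_le_sub_left ?_ _
      by_cases hv : v = v₀
      · simp only [hv, true_and, if_true, sum_ite_eq', mem_univ]
        exact le_mul_of_one_le_left (by positivity) (by exact_mod_cast s.wt_pos v₀)
      · simp [hv]
    have h4 := h1.trans (sum_le_sum fun v _ => h3 v)
    rw [sum_sub_distrib, sum_ite_eq', if_pos (mem_univ _), ← hE₀] at h4
    linarith [le_abs_self E₀]
  have hfin : ∀ᶠ j in 𝒰, finrank K (Sp t₁ j) + (n - D t₁) = n := (hD t₁).mono fun j hj => by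
    rw [hj]; exact Nat.add_sub_cancel' (hDn t₁)
  have hcast : ((n - D t₁ : ℕ) : ℝ) = n - D t₁ := Nat.cast_sub (hDn t₁)
  have hcount : ∀ η, 0 ≤ η → η < g - t₁ →
      ∑ v, (s.wt v : ℝ) * ∑ i, c₂ v i ≤ -((n - D t₁ : ℕ) * η * s.deg) := fun η h0 hη => by
    have h1 := count_le hq hBA (hD t₁) h0 hmin (by
      filter_upwards [hconst η h0 hη, hq.eventually_ge_atTop 0] with j hj hj0
      exact (Box_mono hj0 fun v i => by linarith [hc₂ v i]).trans hj)
    rw [Fintype.card_fin] at h1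
    rw [hcast]
    linarith
  have hfinal : ∑ v, (s.wt v : ℝ) * ∑ i, c₂ v i ≤ -((n - D t₁ : ℕ) * (g - t₁) * s.deg) := by
    have h1 : Tendsto (fun η : ℝ => -(((n - D t₁ : ℕ) : ℝ) * η * s.deg)) (𝓝[<] (g - t₁))
        (𝓝 (-(((n - D t₁ : ℕ) : ℝ) * (g - t₁) * s.deg))) :=
      (Continuous.tendsto (by fun_prop) _).mono_left nhdsWithin_le_nhds
    refine ge_of_tendsto h1 ?_
    filter_upwards [Ioo_mem_nhdsLT hγ] with η hη
    exact hcount η hη.1.le hη.2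
  obtain ⟨T, hT⟩ := eventually_const_of_gap hq hBA hγ hfin hU₂ hT₂ hfinal
  refine ⟨T, fun h => ?_, ?_⟩
  · obtain ⟨j, h1, h2⟩ := (hT.and (hD t₁)).exists
    rw [h1, h, finrank_top, finrank_fin_fun] at h2
    exact (hglt t₁ ht₁g).ne h2.symm
  · filter_upwards [hT, hy t₁ ht₁] with j h1 h2
    exact h1 ▸ subset_span h2

/-- The coordinate forms, one of them replaced by minus the sum of the coordinates. -/
def unitForms (o : Option (Fin n)) : Matrix (Fin n) (Fin n) ℤ :=
  of fun i k => if o = some i then -1 else if i = k then 1 else 0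

theorem form_unitForms (o : Option (Fin n)) (i : Fin n) (y : Fin n → K) :
    form (unitForms o i) y = if o = some i then -∑ k, y k else y i := by
  rw [form_apply]
  by_cases h : o = some i <;> simp [unitForms, h]

theorem unitForms_mul_self (o : Option (Fin n)) : unitForms o * unitForms o = 1 := by
  ext i k
  rw [mul_apply]
  rcases o with _ | l
  · simp [unitForms, Matrix.one_apply]
  · have h1 : ∀ r, unitForms (some l) r k = if l = r then -1 else if r = k then 1 else 0 := fun r => by
      simp [unitForms]
    by_cases h : l = i
    · subst h
      have h2 : ∀ r, unitForms (some l) l r = -1 := fun r => by simp [unitForms]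
      simp only [h2, neg_one_mul, sum_neg_distrib, h1]
      rw [← add_sum_erase _ _ (mem_univ l), if_pos rfl, Matrix.one_apply,
        sum_congr rfl fun r hr => if_neg (ne_of_mem_erase hr).symm, sum_ite_eq']
      simp only [mem_erase, mem_univ, and_true]
      by_cases hk : k = l
      · simp [hk]
      · simp [hk, Ne.symm hk]
    · have h2 : ∀ r, unitForms (some l) i r = if i = r then 1 else 0 := fun r => by
        simp [unitForms, h]
      rw [sum_eq_single i (fun r _ hr => by simp [h2, hr.symm]) (by simp)]
      simp [h2, Matrix.one_apply, h1, h]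

theorem unit_subspace [Nonempty S] [CharZero K] [Algebra ℚ K] [FiniteDimensional ℚ K]
    {𝒰 : Ultrafilter ℕ} {y : ℕ → Fin n → K}
    (hO : ∀ᶠ j in 𝒰, ∀ i, y j i ≠ 0 ∧ y j i ∈ s.O ∧ (y j i)⁻¹ ∈ s.O)
    (hy : ∀ᶠ j in 𝒰, ∑ i, y j i = -1) :
    (∀ i, ∃ c, ∀ᶠ j in 𝒰, y j i = c) ∨
      ∃ T : Submodule K (Fin n → K), T ≠ ⊤ ∧ ∀ᶠ j in 𝒰, y j ∈ T := by
  classical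
  let ℓ : ℕ → S → Option (Fin n) → ℝ := fun j v o => o.elim 0 fun i => log (s.abv v (y j i))
  have hmax : ∀ v, ∃ o, ∀ᶠ j in 𝒰, ∀ o', ℓ j v o' ≤ ℓ j v o := fun v =>
    Ultrafilter.eventually_exists_iff.1 (Eventually.of_forall fun j => Finite.exists_max (ℓ j v))
  choose o ho using hmax
  have ho' : ∀ᶠ j in 𝒰, ∀ v o', ℓ j v o' ≤ ℓ j v (o v) := eventually_all.2 ho
  set q : ℕ → ℝ := fun j => ∑ v, (s.wt v : ℝ) * ℓ j v (o v) with hqdef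
  have hsum0 : ∀ᶠ j in 𝒰, ∀ o', ∑ v, (s.wt v : ℝ) * ℓ j v o' = 0 := by
    filter_upwards [hO] with j hj o'
    cases o' with
    | none => simp [ℓ]
    | some i => exact sum_log_eq_zero (hj i).2.1 (hj i).2.2 (hj i).1
  have hle : ∀ᶠ j in 𝒰, ∀ v, ℓ j v (o v) ≤ q j := by
    filter_upwards [ho'] with j hj v
    have h1 : ∀ w, 0 ≤ ℓ j w (o w) := fun w => hj w none
    have hw : (1 : ℝ) ≤ s.wt v := by exact_mod_cast s.wt_pos v
    refine (le_mul_of_one_le_left (h1 v) hw).trans ?_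
    exact single_le_sum (f := fun v => (s.wt v : ℝ) * ℓ j v (o v))
      (fun w _ => mul_nonneg (cast_nonneg _) (h1 w)) (mem_univ v)
  by_cases hq : Tendsto q 𝒰 atTop
  · right
    have hbd : ∀ v o', ∃ c : ℝ, Tendsto (fun j => ℓ j v o' / q j) 𝒰 (𝓝 c) := by
      intro v o'
      have h1 : ∀ᶠ j in 𝒰, ℓ j v o' / q j ∈ Set.Icc (-1 : ℝ) 1 := by
        filter_upwards [hq.eventually_gt_atTop 0, hle, ho', hsum0] with j hj h2 h3 h4
        have h5 : -q j ≤ (s.wt v : ℝ) * ℓ j v o' := by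
          have h6 := h4 o'
          rw [← add_sum_erase _ _ (mem_univ v)] at h6
          have h7 : ∑ w ∈ univ.erase v, (s.wt w : ℝ) * ℓ j w o' ≤ q j := by
            refine (sum_le_sum fun w _ => mul_le_mul_of_nonneg_left (h3 w o')
              (cast_nonneg _)).trans (sum_le_sum_of_subset_of_nonneg (subset_univ _)
                fun w _ _ => mul_nonneg (cast_nonneg _) (h3 w none))
          linarith
        have hw : (1 : ℝ) ≤ s.wt v := by exact_mod_cast s.wt_pos v
        rw [Set.mem_Icc, le_div_iff₀ hj, div_le_iff₀ hj]
        refine ⟨?_, by linarith [h3 v o', h2 v]⟩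
        by_contra! h8
        have := le_mul_of_one_le_left (a := (s.wt v : ℝ)) (b := -ℓ j v o') (by linarith) hw
        linarith
      obtain ⟨c, -, hc⟩ := isCompact_Icc.ultrafilter_le_nhds (𝒰.map fun j => ℓ j v o' / q j)
        (le_principal_iff.2 h1)
      exact ⟨c, hc⟩
    choose c hc using hbd
    have hlim : ∀ f : S → Option (Fin n),
        Tendsto (fun j => (∑ v, (s.wt v : ℝ) * ℓ j v (f v)) / q j) 𝒰
          (𝓝 (∑ v, (s.wt v : ℝ) * c v (f v))) := fun f => by
      simp only [sum_div, mul_div_assoc]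
      exact tendsto_finsetSum _ fun v _ => (hc v (f v)).const_mul _
    have hc0 : ∀ o', ∑ v, (s.wt v : ℝ) * c v o' = 0 := fun o' =>
      tendsto_nhds_unique_of_eventuallyEq (hlim fun _ => o') tendsto_const_nhds
        (hsum0.mono fun j hj => by dsimp only; rw [hj o', zero_div])
    have hc1 : ∑ v, (s.wt v : ℝ) * c v (o v) = 1 :=
      tendsto_nhds_unique_of_eventuallyEq (hlim o) tendsto_const_nhds
        ((hq.eventually_gt_atTop 0).mono fun j hj => div_self hj.ne')
    have hcn : ∀ v, c v none = 0 := fun v => tendsto_nhds_unique (hc v none) (by simp [ℓ])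
    refine exists_proper_subspace (s := s) hq (A := fun v => unitForms (o v))
      (fun v => unitForms_mul_self (o v))
      (c := fun v i => c v (if o v = some i then none else some i)) ?_ ?_
    · have h1 : ∀ v, ∑ i, c v (if o v = some i then none else some i) =
          ∑ i, c v (some i) - c v (o v) := fun v => by
        rcases h : o v with _ | l
        · simp [hcn]
        · rw [← add_sum_erase _ _ (mem_univ l), ← add_sum_erase _ (fun i => c v (some i))
            (mem_univ l), if_pos rfl, hcn, add_sub_cancel_left, zero_add]
          exact sum_congr rfl fun i hi => by
            rw [if_neg]; simpa using (ne_of_mem_erase hi).symm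
      simp only [h1, mul_sub, sum_sub_distrib, hc1, mul_sum]
      rw [sum_comm]
      simp [hc0]
    · intro ε hε
      have h1 : ∀ᶠ j in 𝒰, ∀ v o', ℓ j v o' / q j ≤ c v o' + ε :=
        eventually_all.2 fun v => eventually_all.2 fun o' =>
          (hc v o').eventually_le_const (by linarith)
      filter_upwards [h1, hO, hy, hq.eventually_gt_atTop 0] with j hj hO hy hq0
      refine ⟨fun i => (hO i).2.1, fun v i => ?_⟩
      have h2 := hj v (if o v = some i then none else some i)
      rw [div_le_iff₀ hq0] at h2
      rw [form_unitForms]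
      refine le_trans (le_of_eq ?_) (exp_le_exp.2 h2)
      split_ifs with h
      · rw [hy]; simp [ℓ]
      · exact (exp_log ((s.abv v).pos (hO i).1)).symm
  · left
    rw [tendsto_atTop] at hq
    push Not at hq
    obtain ⟨R, hR⟩ := hq
    intro i
    have h1 : ∀ᶠ j in 𝒰, ∃ c ∈ {x | x ∈ s.O ∧ ∀ v, s.abv v x ≤ exp R}, y j i = c := by
      filter_upwards [hR, hO, ho', hle] with j h1 h2 h3 h4
      refine ⟨_, ⟨(h2 i).2.1, fun v => ?_⟩, rfl⟩
      rw [← log_le_iff_le_exp ((s.abv v).pos (h2 i).1)]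
      exact (h3 v (some i)).trans ((h4 v).trans h1.le)
    obtain ⟨c, -, hc⟩ := (Ultrafilter.eventually_exists_mem_iff (s.finite_bounded _)).1 h1
    exact ⟨c, hc⟩

end SInt

end

section

open Finset NumberField

theorem exists_coloring_of_maps {α β : Type*} (P : α → Prop) (g : α → β) (T : Finset β)
    (hT : T.Nonempty) (h : ∀ x, P x → g x ∈ T) :
    ∃ f : α → Fin #T, ∀ x y, P x → P y → f x = f y → g x = g y := by
  classical
  obtain ⟨t, ht⟩ := hT
  refine ⟨fun x => T.equivFin (if hx : P x then ⟨g x, h x hx⟩ else ⟨t, ht⟩), fun x y hx hy hxy => ?_⟩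
  simpa [hx, hy] using hxy

variable {K : Type*} [Field K] [NumberField K]

theorem exists_coloring_infinitePlace (w : InfinitePlace K) {r R : ℝ} (hr : 0 < r) (hR : r ≤ R) :
    ∃ (k : ℕ) (f : K → Fin k), (k : ℝ) ≤ 49 * (R / r) ^ w.mult ∧
      ∀ x y, w x ≤ R → w y ≤ R → f x = f y → w (x - y) ≤ r := by
  have h1 : 1 ≤ R / r := (one_le_div hr).2 hR
  set M : ℤ := ⌊2 * (R / r)⌋ + 1 with hM
  have hM2 : (M : ℝ) ≤ 2 * (R / r) + 1 := by
    rw [hM]; push_cast; linarith [Int.floor_le (2 * (R / r))]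
  have hM1 : 2 * (R / r) < M := by rw [hM]; push_cast; exact Int.lt_floor_add_one _
  have hM0 : 0 < M := by exact_mod_cast (show (0 : ℝ) < M by linarith)
  have hIcc : ((Icc (-M) M).card : ℝ) ≤ 7 * (R / r) := by
    have : ((Icc (-M) M).card : ℤ) = 2 * M + 1 := by
      rw [Int.card_Icc, Int.toNat_of_nonneg (by lia)]; ring
    have h2 : ((Icc (-M) M).card : ℝ) = 2 * M + 1 := by exact_mod_cast this
    rw [h2]; linarith
  have hfl : ∀ t : ℝ, |t| ≤ R → ⌊t * (2 / r)⌋ ∈ Icc (-M) M := fun t ht => by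
    have h3 : |t * (2 / r)| ≤ 2 * (R / r) := by
      rw [abs_mul, abs_of_pos (show 0 < 2 / r by positivity)]
      calc _ ≤ R * (2 / r) := by gcongr
        _ = _ := by ring
    rw [abs_le] at h3
    rw [mem_Icc, Int.le_floor]
    refine ⟨by push_cast; linarith, ?_⟩
    have : (⌊t * (2 / r)⌋ : ℝ) ≤ M := (Int.floor_le _).trans (h3.2.trans hM1.le)
    exact_mod_cast this
  have hdiff : ∀ a b : ℝ, ⌊a * (2 / r)⌋ = ⌊b * (2 / r)⌋ → |a - b| ≤ r / 2 := fun a b h => by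
    have := (Int.abs_sub_lt_one_of_floor_eq_floor h).le
    rw [← sub_mul, abs_mul, abs_of_pos (show 0 < 2 / r by positivity), ← le_div_iff₀ (by positivity)]
      at this
    simpa using this
  have h0 : (0 : ℤ) ∈ Icc (-M) M := by rw [mem_Icc]; lia
  have key : ∀ x y, ⌊(w.embedding x).re * (2 / r)⌋ = ⌊(w.embedding y).re * (2 / r)⌋ →
      |(w.embedding x).im - (w.embedding y).im| ≤ r / 2 → w (x - y) ≤ r := fun x y h h' => by
    rw [← w.norm_embedding_eq, map_sub]
    refine (Complex.norm_le_abs_re_add_abs_im _).trans ?_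
    rw [Complex.sub_re, Complex.sub_im]
    linarith [hdiff _ _ h]
  have hre : ∀ x, w x ≤ R → |(w.embedding x).re| ≤ R := fun x hx =>
    (Complex.abs_re_le_norm _).trans ((w.norm_embedding_eq x).le.trans hx)
  by_cases hw : w.IsReal
  · obtain ⟨f, hf⟩ := exists_coloring_of_maps (fun x => w x ≤ R)
      (fun x => ⌊(w.embedding x).re * (2 / r)⌋) (Icc (-M) M) ⟨0, h0⟩ fun x hx => hfl _ (hre x hx)
    refine ⟨_, f, ?_, fun x y hx hy hxy => key x y (hf x y hx hy hxy) ?_⟩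
    · rw [hw.mult_eq_one, pow_one]; linarith
    · rw [← InfinitePlace.embedding_of_isReal_apply hw, ← InfinitePlace.embedding_of_isReal_apply hw,
        Complex.ofReal_im, Complex.ofReal_im]
      simpa using (half_pos hr).le
  · obtain ⟨f, hf⟩ := exists_coloring_of_maps (fun x => w x ≤ R)
      (fun x => (⌊(w.embedding x).re * (2 / r)⌋, ⌊(w.embedding x).im * (2 / r)⌋))
      (Icc (-M) M ×ˢ Icc (-M) M) ⟨(0, 0), mem_product.2 ⟨h0, h0⟩⟩ fun x hx =>
        mem_product.2 ⟨hfl _ (hre x hx), hfl _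
          ((Complex.abs_im_le_norm _).trans ((w.norm_embedding_eq x).le.trans hx))⟩
    refine ⟨_, f, ?_, fun x y hx hy hxy => ?_⟩
    · rw [(InfinitePlace.not_isReal_iff_isComplex.1 hw).mult_eq_two, card_product]
      push_cast
      calc _ ≤ (7 * (R / r)) * (7 * (R / r)) := by gcongr
        _ = _ := by ring
    · have := Prod.ext_iff.1 (hf x y hx hy hxy)
      exact key x y this.1 (hdiff _ _ this.2)

open IsDedekindDomain in
theorem exists_coloring_finitePlace (w : FinitePlace K) : ∃ C : ℝ, 0 < C ∧ ∀ r R : ℝ, 0 < r → r ≤ R →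
    ∃ (k : ℕ) (f : K → Fin k), (k : ℝ) ≤ C * (R / r) ∧
      ∀ x y, w x ≤ R → w y ≤ R → f x = f y → w (x - y) ≤ r := by
  classical
  set v := w.maximalIdeal with hv
  set N : ℝ := (Ideal.absNorm v.asIdeal : ℝ) with hN
  have hN1 : 1 < N := by
    rw [hN]; exact_mod_cast HeightOneSpectrum.one_lt_absNorm v
  have hN0 : 0 < N := one_pos.trans hN1
  have hw : ∀ x, w x = WithZeroMulInt.toNNReal (HeightOneSpectrum.absNorm_ne_zero v)
      (v.valuation K x) := fun x => by
    rw [← FinitePlace.norm_embedding_eq, FinitePlace.norm_embedding']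
  have hle1 : ∀ x, w x ≤ 1 ↔ v.valuation K x ≤ 1 := fun x => by
    rw [hw]
    exact_mod_cast WithZeroMulInt.toNNReal_le_one_iff (HeightOneSpectrum.one_lt_absNorm_nnreal v)
  obtain ⟨p, hp⟩ := v.valuation_exists_uniformizer K
  have hp0 : p ≠ 0 := by rintro rfl; rw [map_zero] at hp; exact WithZero.exp_ne_zero hp.symm
  have hwp : w p = N⁻¹ := by
    rw [hw, hp, WithZeroMulInt.toNNReal_neg_apply _ WithZero.exp_ne_zero]
    have h : Multiplicative.toAdd (WithZero.unzero
      (WithZero.exp_ne_zero : WithZero.exp (-1 : ℤ) ≠ 0)) = -1 := rfl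
    rw [h]
    simp [hN]
  have hpw : ∀ (x : K) (k : ℕ), w x ≤ (N ^ k)⁻¹ ↔ v.valuation K x ≤ v.valuation K p ^ k := fun x k => by
    have h0 : v.valuation K (p ^ k) ≠ 0 := by simp [hp0]
    have : x = (x / p ^ k) * p ^ k := by field_simp
    have h1 : w x ≤ (N ^ k)⁻¹ ↔ w (x / p ^ k) ≤ 1 := by
      rw [map_div₀, map_pow, hwp, inv_pow, div_le_one (by positivity)]
    rw [h1, hle1, map_div₀, map_pow, div_le_one₀ (by simpa using (zero_lt_iff.2 h0))]
  refine ⟨N ^ 2, by positivity, fun r R hr hR => ?_⟩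
  obtain ⟨m, hm, hm'⟩ := exists_mem_Ico_zpow hr hN1
  obtain ⟨l, hl, hl'⟩ := exists_mem_Ioc_zpow (hr.trans_le hR) hN1
  obtain ⟨k, hk⟩ : ∃ k : ℕ, l + 1 = m + k := Int.le.dest
    ((zpow_le_zpow_iff_right₀ hN1).1 (hm.trans (hR.trans hl'))) |>.imp fun _ => Eq.symm
  have hNl : N ^ (l + 1) = N ^ m * N ^ k := by rw [hk, zpow_add₀ hN0.ne', zpow_natCast]
  have happ : ∀ x, ∃ a : 𝓞 K, w x ≤ R → w ((a : K) - p ^ (l + 1) * x) ≤ (N ^ k)⁻¹ := fun x => by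
    by_cases hx : w x ≤ R
    · have h1 : w (p ^ (l + 1) * x) ≤ 1 := by
        rw [map_mul, map_zpow₀, hwp, inv_zpow, inv_mul_le_iff₀ (by positivity), mul_one]
        exact hx.trans hl'
      obtain ⟨a, ha⟩ := v.exists_valuation_sub_lt_of_integer ((hle1 _).1 h1)
        (Units.mk0 (v.valuation K p ^ k) (by simp [hp0]))
      exact ⟨a, fun _ => (hpw _ _).2 ha.le⟩
    · exact ⟨0, fun h => absurd h hx⟩
  choose a ha using happ
  have hcard : Nat.card (𝓞 K ⧸ v.asIdeal ^ k) = Ideal.absNorm v.asIdeal ^ k := by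
    rw [← map_pow, Ideal.absNorm_apply]; rfl
  have hfin : Finite (𝓞 K ⧸ v.asIdeal ^ k) := Nat.finite_of_card_ne_zero (by
    rw [hcard]; exact pow_ne_zero _ (HeightOneSpectrum.one_lt_absNorm v).ne_bot)
  have := Fintype.ofFinite (𝓞 K ⧸ v.asIdeal ^ k)
  obtain ⟨f, hf⟩ := exists_coloring_of_maps (fun x => w x ≤ R)
    (fun x => (Ideal.Quotient.mk (v.asIdeal ^ k) (a x))) univ ⟨0, mem_univ _⟩ fun _ _ => mem_univ _
  refine ⟨_, f, ?_, fun x y hx hy hxy => ?_⟩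
  · rw [card_univ, ← Nat.card_eq_fintype_card, hcard]
    push_cast
    rw [← hN, ← mul_div_assoc, le_div_iff₀ hr]
    calc N ^ k * r ≤ N ^ k * N ^ (m + 1) := by gcongr
      _ = N * N ^ (l + 1) := by rw [hNl, zpow_add_one₀ hN0.ne']; ring
      _ = N ^ 2 * N ^ l := by rw [zpow_add_one₀ hN0.ne']; ring
      _ ≤ _ := by gcongr
  · have h1 := Ideal.Quotient.eq.1 (hf x y hx hy hxy)
    rw [← v.intValuation_le_pow_iff_mem, ← v.valuation_of_algebraMap (K := K)] at h1
    have h2 : w ((a x : K) - a y) ≤ (N ^ k)⁻¹ := by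
      rw [hpw, hp, ← WithZero.exp_nsmul]
      simpa using h1
    have h3 : w (p ^ (l + 1) * (x - y)) ≤ (N ^ k)⁻¹ := by
      have e : p ^ (l + 1) * (x - y) = ((a x : K) - a y) + (((a y : K) - p ^ (l + 1) * y) +
        -((a x : K) - p ^ (l + 1) * x)) := by ring
      rw [e]
      refine (w.add_le _ _).trans (max_le h2 ((w.add_le _ _).trans (max_le (ha y hy) ?_)))
      rw [map_neg_eq_map]; exact ha x hx
    rw [map_mul, map_zpow₀, hwp, inv_zpow, inv_mul_le_iff₀ (by positivity), hNl,
      mul_assoc, mul_inv_cancel₀ (by positivity), mul_one] at h3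
    exact h3.trans hm

section

variable (K : Type*) [Field K] [NumberField K] (m : ℕ)

/-- The archimedean places of `K` and the finite places dividing `m`. -/
abbrev Places : Type _ := InfinitePlace K ⊕ {w : FinitePlace K // w (m : K) < 1}

namespace Places

instance [NeZero m] : Finite {w : FinitePlace K // w (m : K) < 1} :=
  ((FinitePlace.hasFiniteMulSupport (Nat.cast_ne_zero.2 (NeZero.ne m))).subset
    fun _ hw => ne_of_lt hw).to_subtype

noncomputable instance [NeZero m] : Fintype {w : FinitePlace K // w (m : K) < 1} := Fintype.ofFinite _

variable {K m}

/-- The absolute value of a place. -/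
def abv : Places K m → AbsoluteValue K ℝ := Sum.elim Subtype.val fun w => w.1.1

/-- The local degree of a place, as it enters the product formula. -/
noncomputable def wt : Places K m → ℕ := Sum.elim InfinitePlace.mult fun _ => 1

variable (K m) in
/-- The elements that are integral outside `m`. -/
def integers : Subring K where
  carrier := {x | ∀ w : FinitePlace K, ¬ w (m : K) < 1 → w x ≤ 1}
  mul_mem' {x y} hx hy w hw := by
    rw [map_mul]; exact mul_le_one₀ (hx w hw) (apply_nonneg w y) (hy w hw)
  one_mem' w _ := (map_one w).le
  add_mem' hx hy w hw := (w.add_le _ _).trans (max_le (hx w hw) (hy w hw))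
  zero_mem' w _ := by rw [map_zero]; exact zero_le_one
  neg_mem' hx w hw := by rw [map_neg_eq_map]; exact hx w hw

theorem finitePlace_le_one (w : FinitePlace K) {x : K} (hx : IsIntegral ℤ x) : w x ≤ 1 := by
  rw [← FinitePlace.norm_embedding_eq]
  exact FinitePlace.norm_le_one K w.maximalIdeal (⟨x, hx⟩ : 𝓞 K)

theorem one_le_prod [NeZero m] {x : K} (hx : x ∈ integers K m) (h0 : x ≠ 0) :
    1 ≤ ∏ v : Places K m, abv v x ^ wt v := by
  have hs := FinitePlace.hasFiniteMulSupport h0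
  classical
  set T : Finset (FinitePlace K) :=
    (univ : Finset {w : FinitePlace K // w (m : K) < 1}).map (Function.Embedding.subtype _) with hT
  have h1 : ∏ᶠ w : FinitePlace K, w x ≤ ∏ w ∈ T, w x := by
    rw [finprod_eq_prod_of_mulSupport_subset (s := hs.toFinset ∪ T) _
      (fun w hw => mem_coe.2 (mem_union_left _ (hs.mem_toFinset.2 hw))), ← prod_sdiff (subset_union_right (s₂ := T))]
    refine mul_le_of_le_one_left (prod_nonneg fun w _ => apply_nonneg w x)
      (prod_le_one (fun w _ => apply_nonneg w x) fun w hw => hx w fun h => (mem_sdiff.1 hw).2 ?_)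
    simpa [hT] using h
  rw [hT, prod_map] at h1
  rw [Fintype.prod_sum_type]
  refine (prod_abs_eq_one h0).symm.le.trans ((mul_le_mul_of_nonneg_left h1
    (prod_nonneg fun w _ => pow_nonneg (apply_nonneg w x) _)).trans (le_of_eq ?_))
  simp only [wt, Sum.elim_inr, pow_one]
  rfl

theorem exists_coloring [NeZero m] : ∃ C : ℝ, 0 < C ∧ ∀ (v : Places K m) (r R : ℝ), 0 < r → r ≤ R →
    ∃ (k : ℕ) (f : K → Fin k), (k : ℝ) ≤ C * (R / r) ^ wt v ∧
      ∀ x y, abv v x ≤ R → abv v y ≤ R → f x = f y → abv v (x - y) ≤ r := by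
  choose C hC h using fun w : FinitePlace K => exists_coloring_finitePlace w
  have hCs : ∀ w : {w : FinitePlace K // w (m : K) < 1},
      C w.1 ≤ 49 + ∑ w : {w : FinitePlace K // w (m : K) < 1}, C w.1 := fun w => by
    have := single_le_sum (f := fun w : {w : FinitePlace K // w (m : K) < 1} => C w.1)
      (fun w _ => (hC w.1).le) (mem_univ w)
    linarith
  have hs0 : 0 ≤ ∑ w : {w : FinitePlace K // w (m : K) < 1}, C w.1 := sum_nonneg fun w _ => (hC w.1).le
  refine ⟨49 + ∑ w : {w : FinitePlace K // w (m : K) < 1}, C w.1, by linarith, fun v r R hr hR => ?_⟩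
  have hRr : 0 < R / r := div_pos (hr.trans_le hR) hr
  cases v with
  | inl w =>
    obtain ⟨k, f, hk, hf⟩ := exists_coloring_infinitePlace w hr hR
    exact ⟨k, f, hk.trans (mul_le_mul_of_nonneg_right (by linarith) (pow_pos hRr _).le), hf⟩
  | inr w =>
    obtain ⟨k, f, hk, hf⟩ := h w.1 r R hr hR
    exact ⟨k, f, by
      rw [wt, Sum.elim_inr, pow_one]
      exact hk.trans (mul_le_mul_of_nonneg_right (hCs w) hRr.le), hf⟩

theorem exists_points_of_le_one [NeZero m] : ∃ c : ℝ, 0 < c ∧ ∀ R : Places K m → ℝ, (∀ v, 0 < R v) →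
    (∀ w, R (Sum.inr w) ≤ 1) → ∃ F : Finset K,
      (∀ x ∈ F, x ∈ integers K m ∧ ∀ v, abv v x ≤ R v) ∧ c * ∏ v, R v ^ wt v ≤ F.card := by
  classical
  obtain ⟨C, hC, hcol⟩ := exists_coloring (K := K) (m := m)
  set b := RingOfIntegers.basis K
  set A : ℝ := 1 + ∑ w : InfinitePlace K, ∑ i, w (b i : K) with hA
  have hA1 : 1 ≤ A := le_add_of_nonneg_right (sum_nonneg fun w _ => sum_nonneg fun i _ => apply_nonneg w _)
  set d := finrank ℚ K with hd
  have hA0 : 0 < A := by linarith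
  refine ⟨(C ^ Fintype.card (Places K m) * A ^ d)⁻¹, by positivity, fun R hR hR1 => ?_⟩
  have hsum0 : 0 ≤ ∑ v, R v := sum_nonneg fun v _ => (hR v).le
  obtain ⟨M, hM⟩ : ∃ M : ℕ, ∑ v, R v + 1 ≤ M := exists_nat_ge _
  have hM0 : (0 : ℝ) < M := by linarith
  let B : Places K m → ℝ := Sum.elim (fun _ => A * M) fun _ => 1
  have hB : ∀ v, R v ≤ B v := by
    rintro (w | w)
    · have : R (Sum.inl w) ≤ ∑ v, R v := single_le_sum (fun v _ => (hR v).le) (mem_univ _)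
      have h2 := le_mul_of_one_le_left hM0.le hA1
      change _ ≤ A * M
      linarith
    · exact hR1 w
  choose k f hk hf using fun v => hcol v (R v) (B v) (hR v) (hB v)
  let pt : (Module.Free.ChooseBasisIndex ℤ (𝓞 K) → ℕ) → 𝓞 K := fun a => ∑ i, (a i : ℤ) • b i
  have hpt : Injective pt := fun a a' h => funext fun i => by
    have := congr_arg (fun x => b.repr x i) h
    simp only [pt, Basis.repr_sum_self] at this
    exact_mod_cast this
  let P := piFinset fun _ : Module.Free.ChooseBasisIndex ℤ (𝓞 K) => range (M + 1)
  have hPB : ∀ a ∈ P, ∀ v, abv v (pt a : K) ≤ B v := fun a ha v => by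
    cases v with
    | inl w =>
      change w (pt a : K) ≤ A * M
      have h1 : w (pt a : K) ≤ ∑ i, w (b i : K) * M := by
        simp only [pt, _root_.map_sum, zsmul_eq_mul, map_mul, map_natCast, Int.cast_natCast]
        refine (w.1.sum_le _ _).trans (sum_le_sum fun i _ => ?_)
        change w (_ * _) ≤ _
        rw [map_mul, mul_comm]
        refine mul_le_mul_of_nonneg_left ?_ (apply_nonneg w _)
        rw [← w.norm_embedding_eq, map_natCast, Complex.norm_natCast]
        exact_mod_cast Nat.lt_succ_iff.1 (mem_range.1 (mem_piFinset.1 ha i))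
      rw [← sum_mul] at h1
      refine h1.trans (mul_le_mul_of_nonneg_right ?_ hM0.le)
      have : ∑ i, w (b i : K) ≤ ∑ w : InfinitePlace K, ∑ i, w (b i : K) :=
        single_le_sum (f := fun w : InfinitePlace K => ∑ i, w (b i : K))
          (fun w _ => sum_nonneg fun i _ => apply_nonneg w _) (mem_univ w)
      linarith
    | inr w => exact finitePlace_le_one w.1 (pt a).2
  have hcard : (#P : ℝ) = (M + 1) ^ d := by
    rw [Fintype.card_piFinset, prod_const, card_univ, card_range,
      ← Module.finrank_eq_card_chooseBasisIndex, RingOfIntegers.rank]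
    push_cast; rfl
  have hRpos : 0 < ∏ v, R v ^ wt v := prod_pos fun v _ => pow_pos (hR v) _
  have hk' : (∏ v, k v : ℕ) * ((C ^ Fintype.card (Places K m) * A ^ d)⁻¹ * ∏ v, R v ^ wt v) ≤ (#P : ℝ) := by
    rw [hcard]
    have h1 : ((∏ v, k v : ℕ) : ℝ) ≤ ∏ v, (C * (B v / R v) ^ wt v) := by
      push_cast
      exact prod_le_prod (fun _ _ => cast_nonneg _) fun v _ => hk v
    have h2 : ∏ v, B v ^ wt v = A ^ d * M ^ d := by
      rw [Fintype.prod_sum_type]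
      simp only [B, wt, Sum.elim_inl, Sum.elim_inr, one_pow, prod_const_one, mul_one]
      rw [prod_pow_eq_pow_sum, InfinitePlace.sum_mult_eq, mul_pow]
    simp only [div_pow] at h1
    rw [prod_mul_distrib, prod_const, card_univ, prod_div_distrib, h2] at h1
    refine (mul_le_mul_of_nonneg_right h1 (by positivity)).trans ?_
    have : (C ^ Fintype.card (Places K m) * (A ^ d * M ^ d / ∏ v, R v ^ wt v)) *
        ((C ^ Fintype.card (Places K m) * A ^ d)⁻¹ * ∏ v, R v ^ wt v) = (M : ℝ) ^ d := by
      field_simp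
    rw [this]
    gcongr
    linarith
  obtain ⟨y, -, hy⟩ := exists_le_card_fiber_of_nsmul_le_card_of_maps_to (s := P)
    (t := (univ : Finset (∀ v, Fin (k v)))) (f := fun a v => f v (pt a : K)) (fun _ _ => mem_univ _)
    ⟨fun v => f v 0, mem_univ _⟩ (b := (C ^ Fintype.card (Places K m) * A ^ d)⁻¹ * ∏ v, R v ^ wt v)
    (by simpa [Fintype.card_pi] using hk')
  set Q := P.filter fun a => (fun v => f v (pt a : K)) = y with hQ
  obtain ⟨a₀, ha₀⟩ : Q.Nonempty := by
    rw [← card_pos]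
    exact_mod_cast (show 0 < (C ^ Fintype.card (Places K m) * A ^ d)⁻¹ * ∏ v, R v ^ wt v by
      positivity).trans_le hy
  refine ⟨Q.image fun a => (pt a : K) - pt a₀, fun x hx => ?_, ?_⟩
  · obtain ⟨a, ha, rfl⟩ := mem_image.1 hx
    rw [hQ, mem_filter] at ha ha₀
    refine ⟨fun w _ => finitePlace_le_one w ((pt a).2.sub (pt a₀).2), fun v =>
      hf v _ _ (hPB a ha.1 v) (hPB a₀ ha₀.1 v) ?_⟩
    exact (congr_fun ha.2 v).trans (congr_fun ha₀.2 v).symm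
  · rw [card_image_of_injective _ fun a a' h => hpt (RingOfIntegers.ext (sub_left_injective h))]
    exact hy

theorem natCast_inv_mem [NeZero m] : (m : K)⁻¹ ∈ integers K m := fun w hw => by
  rw [map_inv₀, (finitePlace_le_one w (by simpa using isIntegral_algebraMap (R := ℤ) (x := (m : ℤ)))).antisymm
    (not_lt.1 hw), inv_one]

theorem mem_integers_of_isIntegral {x : K} (hx : IsIntegral ℤ x) : x ∈ integers K m :=
  fun w _ => finitePlace_le_one w hx

theorem exists_points [NeZero m] : ∃ c : ℝ, 0 < c ∧ ∀ R : Places K m → ℝ, (∀ v, 0 < R v) →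
    ∃ F : Finset K, (∀ x ∈ F, x ∈ integers K m ∧ ∀ v, abv v x ≤ R v) ∧
      c * ∏ v, R v ^ wt v ≤ F.card := by
  classical
  obtain ⟨c, hc, h⟩ := exists_points_of_le_one (K := K) (m := m)
  refine ⟨c, hc, fun R hR => ?_⟩
  obtain ⟨k, hk⟩ : ∃ k : ℕ, ∀ w : {w : FinitePlace K // w (m : K) < 1},
      w.1 (m : K) ^ k * R (Sum.inr w) ≤ 1 := by
    have : ∀ᶠ k : ℕ in atTop, ∀ w : {w : FinitePlace K // w (m : K) < 1},
        w.1 (m : K) ^ k * R (Sum.inr w) ≤ 1 := Filter.eventually_all.2 fun w => by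
      have := (tendsto_pow_atTop_nhds_zero_of_lt_one (apply_nonneg w.1 (m : K)) w.2).mul_const
        (R (Sum.inr w))
      rw [zero_mul] at this
      exact this.eventually (ge_mem_nhds one_pos)
    exact this.exists
  have hy0 : (m : K) ^ k ≠ 0 := pow_ne_zero _ (Nat.cast_ne_zero.2 (NeZero.ne m))
  have hyv : ∀ v : Places K m, 0 < abv v ((m : K) ^ k) := fun v => (abv v).pos hy0
  obtain ⟨F, hF, hcard⟩ := h (fun v => abv v ((m : K) ^ k) * R v) (fun v => mul_pos (hyv v) (hR v))
    fun w => by rw [map_pow]; exact hk w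
  refine ⟨F.image fun x => ((m : K) ^ k)⁻¹ * x, fun x hx => ?_, ?_⟩
  · obtain ⟨x, hx', rfl⟩ := mem_image.1 hx
    refine ⟨mul_mem (by rw [← inv_pow]; exact pow_mem natCast_inv_mem k) (hF x hx').1, fun v => ?_⟩
    rw [map_mul, map_inv₀, inv_mul_le_iff₀ (hyv v)]
    exact (hF x hx').2 v
  · rw [card_image_of_injective _ (mul_right_injective₀ (inv_ne_zero hy0))]
    refine le_trans (mul_le_mul_of_nonneg_left ?_ hc.le) hcard
    simp only [mul_pow, prod_mul_distrib]
    exact le_mul_of_one_le_left (prod_nonneg fun v _ => pow_nonneg (hR v).le _) (one_le_prod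
      (pow_mem (mem_integers_of_isIntegral (by simpa using isIntegral_algebraMap (R := ℤ) (x := (m : ℤ)))) k) hy0)

end Places

open Places

/-- The ring of `S`-integers of a number field, where `S` consists of the archimedean places and the
places dividing `m`. -/
noncomputable def sInt (m : ℕ) [NeZero m] : SInt K (Places K m) where
  abv := abv
  wt := wt
  wt_pos := by
    rintro (w | w)
    · exact w.mult_pos
    · exact one_pos
  O := integers K m
  mem_of_isIntegral _ := mem_integers_of_isIntegral
  sum_log_nonneg x hx h0 := by
    have := log_nonneg (one_le_prod hx h0)
    rw [log_prod fun v _ => pow_ne_zero _ ((abv v).ne_zero h0)] at this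
    simpa only [log_pow] using this
  exists_points := exists_points
  exists_coloring := exists_coloring

/-- The `S`-units of a number field. -/
def sUnits (m : ℕ) : Subgroup Kˣ where
  carrier := {x | (x : K) ∈ integers K m ∧ ((x⁻¹ : Kˣ) : K) ∈ integers K m}
  mul_mem' {x y} hx hy := ⟨mul_mem hx.1 hy.1, by
    rw [mul_inv, Units.val_mul]; exact mul_mem hx.2 hy.2⟩
  one_mem' := ⟨one_mem _, by rw [inv_one]; exact one_mem _⟩
  inv_mem' hx := ⟨hx.2, by rw [inv_inv]; exact hx.1⟩

theorem integers_mono {m n : ℕ} (h : m ∣ n) : integers K m ≤ integers K n := fun x hx w hw =>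
  hx w fun h' => hw (by
    obtain ⟨k, rfl⟩ := h
    rw [Nat.cast_mul, map_mul]
    exact mul_lt_one_of_nonneg_of_lt_one_left (apply_nonneg w _) h' (finitePlace_le_one w
      (by simpa using isIntegral_algebraMap (R := ℤ) (x := (k : ℤ)))))

theorem sUnits_mono {m n : ℕ} (h : m ∣ n) : sUnits K m ≤ sUnits K n :=
  fun _ hx => ⟨integers_mono K h hx.1, integers_mono K h hx.2⟩

theorem exists_mem_sUnits (x : Kˣ) : ∃ m : ℕ, m ≠ 0 ∧ x ∈ sUnits K m := by
  have key : ∀ x : K, ∃ m : ℕ, m ≠ 0 ∧ x ∈ integers K m := fun x => by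
    obtain ⟨y, hy, h⟩ := exists_integral_multiples ℤ ℚ {x}
    refine ⟨y.natAbs, Int.natAbs_ne_zero.2 hy, fun w hw => ?_⟩
    have h1 := finitePlace_le_one w (h x (mem_singleton_self x))
    have h2 : w (y : K) = w (y.natAbs : K) := by
      obtain ⟨k, rfl | rfl⟩ := y.eq_nat_or_neg <;> simp
    rw [zsmul_eq_mul, map_mul, h2] at h1
    exact (le_mul_of_one_le_left (apply_nonneg w x) (not_lt.1 hw)).trans h1
  obtain ⟨m, hm, h⟩ := key x
  obtain ⟨n, hn, h'⟩ := key (x⁻¹ : Kˣ)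
  exact ⟨m * n, mul_ne_zero hm hn, integers_mono K (dvd_mul_right m n) h,
    integers_mono K (dvd_mul_left n m) h'⟩

theorem exists_forall_mem_sUnits (s : Finset Kˣ) : ∃ m : ℕ, m ≠ 0 ∧ ∀ x ∈ s, x ∈ sUnits K m := by
  choose m hm h using exists_mem_sUnits (K := K)
  exact ⟨∏ x ∈ s, m x, prod_ne_zero_iff.2 fun x _ => hm x, fun x hx =>
    sUnits_mono K (dvd_prod_of_mem m hx) (h x)⟩

end

/-- The group `G` satisfies the theorem on unit equations: along any ultrafilter, two of the
unknowns of a linear equation solved in `G` have constant ratio. -/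
def UnitEq {K : Type*} [Field K] (G : Subgroup Kˣ) : Prop :=
  ∀ (ι : Type) [Fintype ι] [Nonempty ι] (a : ι → K) (x : ℕ → ι → Kˣ) (𝒰 : Ultrafilter ℕ),
    (∀ i, a i ≠ 0) → (∀ᶠ j in 𝒰, ∀ i, x j i ∈ G) → (∀ᶠ j in 𝒰, ∑ i, a i * x j i = 0) →
      ∃ i i', i ≠ i' ∧ ∃ c, ∀ᶠ j in 𝒰, x j i / x j i' = c

section

variable {K : Type*} [Field K]

/-- It suffices to treat equations of minimal length. -/
theorem UnitEq.of_minimal {G : Subgroup Kˣ}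
    (h : ∀ (ι : Type) [Fintype ι] [Nonempty ι] (a : ι → K) (x : ℕ → ι → Kˣ) (𝒰 : Ultrafilter ℕ),
      (∀ i, a i ≠ 0) → (∀ᶠ j in 𝒰, ∀ i, x j i ∈ G) → (∀ᶠ j in 𝒰, ∑ i, a i * x j i = 0) →
      (∀ b : ι → K, (∃ i, b i = 0) → (∀ᶠ j in 𝒰, ∑ i, b i * x j i = 0) → b = 0) →
        ∃ i i', i ≠ i' ∧ ∃ c, ∀ᶠ j in 𝒰, x j i / x j i' = c) : UnitEq G := by
  classical
  intro ι _ _ a x 𝒰 ha hx hs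
  induction hn : Fintype.card ι using Nat.strong_induction_on generalizing ι with
  | _ n ih =>
    by_cases hb : ∀ b : ι → K, (∃ i, b i = 0) → (∀ᶠ j in 𝒰, ∑ i, b i * x j i = 0) → b = 0
    · exact h ι a x 𝒰 ha hx hs hb
    push Not at hb
    obtain ⟨b, ⟨i₀, hi₀⟩, hb, hb0⟩ := hb
    obtain ⟨i₁, hi₁⟩ := ne_iff.1 hb0
    have : Nonempty {i // b i ≠ 0} := ⟨⟨i₁, hi₁⟩⟩
    obtain ⟨i, i', hii, c, hc⟩ := ih _ (by
        rw [← hn]; exact Fintype.card_subtype_lt (x := i₀) (by simpa using hi₀))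
      {i // b i ≠ 0} (fun i => b i) (fun j i => x j i) (fun i => i.2) (hx.mono fun j hj i => hj i)
      (hb.mono fun j hj => by
        refine Eq.trans ?_ hj
        rw [← sum_filter_of_ne (p := fun i => b i ≠ 0) (fun i _ h => left_ne_zero_of_mul h)]
        exact (sum_subtype _ (by simp) fun i => b i * (x j i : K)).symm) rfl
    exact ⟨i, i', fun h => hii (Subtype.ext h), c, hc⟩

end

theorem unitEq_sUnits (K : Type*) [Field K] [NumberField K] {m : ℕ} (hm : m ≠ 0) :
    UnitEq (sUnits K m) := by
  classical
  refine .of_minimal fun ι _ _ a x 𝒰 ha hx hs hb => ?_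
  obtain ⟨m', hm', ham⟩ := exists_forall_mem_sUnits K (univ.image fun i => Units.mk0 (a i) (ha i))
  have : NeZero (m * m') := ⟨mul_ne_zero hm hm'⟩
  obtain ⟨o⟩ := ‹Nonempty ι›
  let e := Fintype.equivFin {i // i ≠ o}
  let u : ι → Kˣ := fun i => Units.mk0 (a i) (ha i)
  let y : ℕ → {i // i ≠ o} → Kˣ := fun j i => u i * x j i / (u o * x j o)
  have hyG : ∀ᶠ j in 𝒰, ∀ i, y j i ∈ sUnits K (m * m') := hx.mono fun j hj i => by
    have hu : ∀ i, u i * x j i ∈ sUnits K (m * m') := fun i =>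
      mul_mem (sUnits_mono K (dvd_mul_left _ _) (ham _ (mem_image_of_mem _ (mem_univ i))))
        (sUnits_mono K (dvd_mul_right _ _) (hj i))
    exact div_mem (hu i) (hu o)
  have hysum : ∀ j (b : ι → K), ∑ i : {i // i ≠ o}, b i * (y j i : K) =
      (∑ i : {i // i ≠ o}, b i * a i * x j i) / (a o * x j o) := fun j b => by
    rw [sum_div]
    refine sum_congr rfl fun i _ => ?_
    simp only [y, u, Units.val_div_eq_div_val, Units.val_mul, Units.val_mk0]
    ring
  have hsplit : ∀ f : ι → K, ∑ i, f i = f o + ∑ i : {i // i ≠ o}, f i := fun f => by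
    rw [← add_sum_erase _ _ (mem_univ o)]
    congr 1
    exact sum_subtype _ (by simp) f
  obtain h | ⟨T, hT, h⟩ := (sInt K (m * m')).unit_subspace (𝒰 := 𝒰)
    (y := fun j i => (y j (e.symm i) : K))
    (hyG.mono fun j hj i => ⟨Units.ne_zero _, (hj _).1, by
      rw [← Units.val_inv_eq_inv_val]; exact (hj (e.symm i)).2⟩)
    (hs.mono fun j hj => by
      rw [e.symm.sum_comp fun i => (y j i : K)]
      have := hysum j 1
      simp only [Pi.one_apply, one_mul] at this
      rw [hsplit] at hj
      rw [this, eq_neg_of_add_eq_zero_right hj, neg_div,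
        div_self (mul_ne_zero (ha o) (Units.ne_zero _))])
  · obtain ⟨i, hi⟩ : ∃ i, i ≠ o := by
      by_contra! hi
      obtain ⟨j, hj⟩ := hs.exists
      rw [hsplit, sum_eq_zero fun i _ => absurd (hi i.1) i.2, add_zero] at hj
      exact mul_ne_zero (ha o) (Units.ne_zero _) hj
    obtain ⟨c, hc⟩ := h (e ⟨i, hi⟩)
    obtain ⟨j₀, hj₀⟩ := hc.exists
    refine ⟨i, o, hi, x j₀ i / x j₀ o, hc.mono fun j hj => ?_⟩
    have := Units.ext (hj.trans hj₀.symm)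
    simp only [Equiv.symm_apply_apply, y, mul_div_mul_comm] at this
    exact mul_left_cancel this
  · exfalso
    obtain ⟨f, hf0, hf⟩ := Submodule.exists_le_ker_of_lt_top T (lt_top_iff_ne_top.2 hT)
    let b : ι → K := fun i => if hi : i ≠ o then f (Pi.single (e ⟨i, hi⟩) 1) else 0
    have hb' : ∀ i : {i // i ≠ o}, b i = f (Pi.single (e i) 1) := fun i => dif_pos i.2
    have hbo : b o = 0 := dif_neg (not_not.2 rfl)
    have := hb (fun i => b i * a i) ⟨o, by simp [hbo]⟩ (h.mono fun j hj => by
      have h1 : f (fun i => (y j (e.symm i) : K)) = 0 := hf hj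
      rw [f.pi_apply_eq_sum_univ, ← e.sum_comp] at h1
      simp only [Equiv.symm_apply_apply, smul_eq_mul, mul_comm (y j _ : K)] at h1
      rw [hsplit, hbo, zero_mul, zero_mul, zero_add]
      refine (div_eq_zero_iff.1 ((hysum j b).symm.trans ?_)).resolve_right
        (mul_ne_zero (ha o) (Units.ne_zero _))
      rw [← h1]
      refine sum_congr rfl fun i _ => ?_
      rw [hb']
      congr 3
      ext k
      simp [Pi.single_apply, eq_comm])
    refine hf0 (LinearMap.pi_ext' fun i => LinearMap.ext_ring ?_)
    have h2 := congr_fun this (e.symm i)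
    simp only [Pi.zero_apply, mul_eq_zero, ha, or_false, hb', Equiv.apply_symm_apply] at h2
    simpa using h2

end

section

open Finset

section

variable {K ι : Type*} [Field K] [Fintype ι]

theorem sum_fiber_eq_zero [DecidableEq K] (b ω : ι → K)
    (h : ∀ t < Fintype.card ι, ∑ i, b i * ω i ^ t = 0) (o : ι) : ∑ i with ω i = ω o, b i = 0 := by
  classical
  let q : Polynomial K := ∏ w ∈ (univ.image ω).erase (ω o), (.X - .C w)
  have hdeg : q.natDegree < Fintype.card ι := by
    rw [Polynomial.natDegree_prod_of_monic _ _ fun w _ => Polynomial.monic_X_sub_C w]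
    simp only [Polynomial.natDegree_X_sub_C, sum_const, smul_eq_mul, mul_one]
    exact (card_erase_lt_of_mem (mem_image_of_mem ω (mem_univ o))).trans_le card_image_le
  have h1 : ∑ i, b i * q.eval (ω i) = 0 := by
    simp only [Polynomial.eval_eq_sum_range, mul_sum]
    rw [sum_comm]
    refine sum_eq_zero fun t ht => ?_
    have := congr_arg (q.coeff t * ·) (h t ((Nat.lt_succ_iff.1 (mem_range.1 ht)).trans_lt hdeg))
    simp only [mul_sum, mul_zero] at this
    rw [← this]
    exact sum_congr rfl fun i _ => by ring
  have h2 : ∀ i, ω i ≠ ω o → q.eval (ω i) = 0 := fun i hi => by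
    rw [Polynomial.eval_prod]
    exact prod_eq_zero (mem_erase.2 ⟨hi, mem_image_of_mem ω (mem_univ i)⟩) (by simp)
  have h3 : q.eval (ω o) ≠ 0 := by
    rw [Polynomial.eval_prod]
    refine prod_ne_zero_iff.2 fun w hw => ?_
    simpa [sub_eq_zero] using (mem_erase.1 hw).1.symm
  rw [← sum_filter_of_ne (p := fun i => ω i = ω o)
    (fun i _ h => not_imp_comm.1 (fun hi => by rw [h2 i hi, mul_zero]) h)] at h1
  refine (mul_eq_zero.1 (?_ : (∑ i with ω i = ω o, b i) * q.eval (ω o) = 0)).resolve_right h3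
  rw [← h1, sum_mul]
  exact sum_congr rfl fun i hi => by rw [(mem_filter.1 hi).2]

variable [CharZero K]

theorem sum_pow_coprime_eq_zero [IsAlgClosed K] {M c : ℕ} (hM : 0 < M) (hc : c.Coprime M)
    (q : ι → ℚ) (z : ι → K) (hz : ∀ i, z i ^ M = 1) (h : ∑ i, (q i : K) * z i = 0) :
    ∑ i, (q i : K) * z i ^ c = 0 := by
  have : NeZero M := ⟨hM.ne'⟩
  obtain ⟨ζ, hζ⟩ := HasEnoughRootsOfUnity.exists_primitiveRoot K M
  choose k _ hk using fun i => hζ.eq_pow_of_pow_eq_one (hz i)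
  let Q : Polynomial ℚ := ∑ i, .C (q i) * .X ^ k i
  have hQ : ∀ y : K, Polynomial.aeval y Q = ∑ i, (q i : K) * y ^ k i := fun y => by
    simp [Q]
  have h1 : Polynomial.aeval (ζ ^ c) Q = 0 := by
    refine Polynomial.aeval_eq_zero_of_dvd_aeval_eq_zero (minpoly.dvd ℚ ζ ?_) ?_
    · rw [hQ, ← h]; exact sum_congr rfl fun i _ => by rw [hk]
    · rw [← Polynomial.cyclotomic_eq_minpoly_rat hζ hM,
        Polynomial.cyclotomic_eq_minpoly_rat (hζ.pow_of_coprime c hc) hM]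
      exact minpoly.aeval _ _
  rw [hQ] at h1
  rw [← h1]
  exact sum_congr rfl fun i _ => by rw [← hk, ← pow_mul, ← pow_mul, mul_comm c]

theorem exists_coprime_run {p L k : ℕ} (hp : p.Prime) (h : p ∣ L ∨ k < p) :
    ∃ s₁, ∀ t < k, (1 + (s₁ + t) * L).Coprime (p * L) := by
  suffices ∃ s₁, ∀ t < k, ¬ p ∣ 1 + (s₁ + t) * L by
    obtain ⟨s₁, hs⟩ := this
    refine ⟨s₁, fun t ht => Nat.Coprime.mul_right
      ((Nat.Prime.coprime_iff_not_dvd hp).2 (hs t ht)).symm (by simp)⟩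
  by_cases hpL : p ∣ L
  · exact ⟨0, fun t _ h' => hp.one_lt.ne' (Nat.dvd_one.1 ((Nat.dvd_add_left (hpL.mul_left _)).1 h'))⟩
  obtain ⟨s, hs⟩ : ∃ s, p ∣ 1 + s * L := by
    have : Fact p.Prime := ⟨hp⟩
    have hL : (L : ZMod p) ≠ 0 := fun h => hpL ((ZMod.natCast_eq_zero_iff L p).1 h)
    refine ⟨(-(L : ZMod p)⁻¹).val, (ZMod.natCast_eq_zero_iff _ p).1 ?_⟩
    push_cast
    rw [ZMod.natCast_zmod_val, neg_mul, inv_mul_cancel₀ hL, add_neg_cancel]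
  refine ⟨s + 1, fun t ht h' => ?_⟩
  have h2 : 1 + (s + 1 + t) * L = 1 + s * L + (1 + t) * L := by ring
  rw [h2, Nat.dvd_add_right hs, hp.dvd_mul] at h'
  have := Nat.le_of_dvd (by lia) (h'.resolve_right hpL)
  have := h.resolve_left hpL
  lia

/-- Mann's theorem on rational linear relations between roots of unity. -/
theorem mann [IsAlgClosed K] (q : ι → ℚ) (z : ι → K) (hz : ∀ i, ∃ M : ℕ, 0 < M ∧ z i ^ M = 1)
    (h : ∑ i, (q i : K) * z i = 0)
    (hmin : ∀ s : Finset ι, s.Nonempty → s ≠ univ → ∑ i ∈ s, (q i : K) * z i ≠ 0) (i i' : ι) :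
    (z i / z i') ^ (Fintype.card ι).factorial = 1 := by
  classical
  have hz0 : ∀ i, z i ≠ 0 := fun i h0 => by
    obtain ⟨M, hM, hi⟩ := hz i
    rw [h0, zero_pow hM.ne'] at hi
    exact zero_ne_one hi
  set y : ι → K := fun i => z i / z i' with hy
  have hysum : ∀ s : Finset ι, ∑ i ∈ s, (q i : K) * y i = (∑ i ∈ s, (q i : K) * z i) / z i' :=
    fun s => by rw [sum_div]; exact sum_congr rfl fun i _ => by rw [mul_div_assoc]
  have hex : ∃ M, 0 < M ∧ ∀ i, y i ^ M = 1 := by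
    choose M hM h using hz
    refine ⟨∏ i, M i, prod_pos fun i _ => hM i, fun k => ?_⟩
    have : ∀ k, z k ^ ∏ i, M i = 1 := fun k => by
      obtain ⟨d, hd⟩ := dvd_prod_of_mem M (mem_univ k)
      rw [hd, pow_mul, h, one_pow]
    rw [hy, div_pow, this, this, div_one]
  obtain ⟨hM, hyM⟩ := Nat.find_spec hex
  set M := Nat.find hex
  have key : ∀ p, p.Prime → p ∣ M → ¬ (p * p ∣ M ∨ Fintype.card ι < p) := by
    rintro p hp ⟨L, hL⟩ hpp
    have hL0 : 0 < L := Nat.pos_of_ne_zero fun h => by simp [h] at hL; lia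
    obtain ⟨s, hs⟩ := exists_coprime_run (k := Fintype.card ι) hp (hpp.imp_left fun h =>
      Nat.dvd_of_mul_dvd_mul_left hp.pos (hL ▸ h))
    refine Nat.find_min hex (m := L) ?_ ⟨hL0, ?_⟩
    · change L < M
      rw [hL]
      exact lt_mul_left hL0 hp.one_lt
    have h1 := sum_fiber_eq_zero (fun k => (q k : K) * y k ^ (1 + s * L)) (fun k => y k ^ L)
      (fun t ht => by
        rw [← sum_pow_coprime_eq_zero hM (hL ▸ hs t ht) q y hyM (by rw [hysum, h, zero_div])]
        exact sum_congr rfl fun k _ => by ring) i'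
    have h2 : y i' ^ L = 1 := by simp [hy, div_self (hz0 i')]
    have h3 : ∑ k with y k ^ L = y i' ^ L, (q k : K) * y k = 0 := by
      rw [← h1]
      refine sum_congr rfl fun k hk => ?_
      rw [pow_add, mul_comm s, pow_mul, (mem_filter.1 hk).2, h2]
      simp
    rw [hysum, div_eq_zero_iff, or_iff_left (hz0 i')] at h3
    have h4 := not_imp_not.1 (hmin _ ⟨i', by simp⟩) h3
    intro k
    have := (mem_filter.1 (h4 ▸ mem_univ k)).2
    rw [this, h2]
  have hsq : Squarefree M := Nat.squarefree_iff_prime_squarefree.2 fun p hp h =>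
    key p hp (dvd_of_mul_left_dvd h) (Or.inl h)
  have hdvd : M ∣ (Fintype.card ι).factorial := by
    rw [← Nat.prod_primeFactors_of_squarefree hsq, ← prod_Ico_id_eq_factorial]
    refine prod_dvd_prod_of_subset _ _ _ fun p hp => mem_Ico.2 ?_
    have hp' := Nat.prime_of_mem_primeFactors hp
    exact ⟨hp'.one_le, Nat.lt_succ_iff.2 (not_lt.1 fun h =>
      key p hp' (Nat.dvd_of_mem_primeFactors hp) (Or.inr h))⟩
  obtain ⟨d, hd⟩ := hdvd
  rw [hd, pow_mul, hyM, one_pow]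

end

/-- A vanishing sum whose restriction to `B` does not vanish contains a minimal vanishing sum meeting
both `B` and its complement. -/
theorem exists_minimal_vanishing {κ K : Type*} [AddCommGroup K] [DecidableEq κ] (f : κ → K)
    {s₀ : Finset κ} (B : κ → Prop) [DecidablePred B] (h₀ : ∑ k ∈ s₀, f k = 0)
    (hB : ∑ k ∈ s₀ with B k, f k ≠ 0) :
    ∃ s ⊆ s₀, ∑ k ∈ s, f k = 0 ∧ (∃ k ∈ s, B k) ∧ (∃ k ∈ s, ¬ B k) ∧
      ∀ t ⊆ s, t.Nonempty → t ≠ s → ∑ k ∈ t, f k ≠ 0 := by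
  induction hn : #s₀ using Nat.strong_induction_on generalizing s₀ with
  | _ n ih =>
    by_cases hmin : ∀ t ⊆ s₀, t.Nonempty → t ≠ s₀ → ∑ k ∈ t, f k ≠ 0
    · refine ⟨s₀, subset_rfl, h₀, ?_, ?_, hmin⟩ <;> by_contra! h
      · exact hB (by rw [filter_false_of_mem h, sum_empty])
      · exact hB (by rw [filter_true_of_mem h, h₀])
    push Not at hmin
    obtain ⟨t, hts, htn, htne, ht⟩ := hmin
    have h1 := sum_sdiff (f := f) hts
    rw [ht, add_zero, h₀] at h1
    have h2 : ∑ k ∈ s₀ with B k, f k = ∑ k ∈ s₀ \ t with B k, f k + ∑ k ∈ t with B k, f k := by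
      simp only [sum_filter]
      exact (sum_sdiff hts).symm
    have h3 : ∑ k ∈ t with B k, f k ≠ 0 ∨ ∑ k ∈ s₀ \ t with B k, f k ≠ 0 := by
      by_contra! h; rw [h2, h.1, h.2, add_zero] at hB; exact hB rfl
    have h4 : #t < #s₀ := card_lt_card (hts.ssubset_of_ne htne)
    have h5 := card_sdiff_add_card_eq_card hts
    have h6 := card_pos.2 htn
    obtain h3 | h3 := h3
    · obtain ⟨s, hs, h⟩ := ih _ (hn ▸ h4) ht h3 rfl
      exact ⟨s, hs.trans hts, h⟩
    · obtain ⟨s, hs, h⟩ := ih _ (by lia) h1 h3 rfl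
      exact ⟨s, hs.trans sdiff_subset, h⟩

section

variable {K : Type*} [Field K] [CharZero K] [IsAlgClosed K]

theorem isTorsion_ratio_of_sum_eq_zero {κ : Type*} [Fintype κ] [DecidableEq κ] (q : κ → ℚ) (θ : κ → K)
    (hθ : ∀ i, ∃ M : ℕ, 0 < M ∧ θ i ^ M = 1) (B : κ → Prop) [DecidablePred B]
    (h : ∑ k, (q k : K) * θ k = 0) (hB : ∑ k with B k, (q k : K) * θ k ≠ 0) :
    ∃ k l, B k ∧ ¬ B l ∧ (θ k / θ l) ^ (Fintype.card κ).factorial = 1 := by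
  obtain ⟨s, -, hs, ⟨k, hk, hBk⟩, ⟨l, hl, hBl⟩, hmin⟩ := exists_minimal_vanishing _ B h hB
  have := mann (fun i : s => q i) (fun i => θ i) (fun i => hθ i)
    (by rw [← hs]; exact (sum_coe_sort s fun k => (q k : K) * θ k))
    (fun t ht ht' h' => hmin (t.map (.subtype _)) (fun i hi => by
      obtain ⟨i, -, rfl⟩ := mem_map.1 hi; exact i.2) (ht.map) (fun h => ht' (eq_univ_of_forall fun i => by
        obtain ⟨j, hj, hji⟩ := mem_map.1 (h.symm.subset i.2)
        exact Subtype.ext hji ▸ hj)) (by simpa using h')) ⟨k, hk⟩ ⟨l, hl⟩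
  obtain ⟨d, hd⟩ := Nat.factorial_dvd_factorial (Fintype.card_coe s ▸ card_le_univ s :
    Fintype.card s ≤ Fintype.card κ)
  exact ⟨k, l, hBk, hBl, by rw [hd, pow_mul, this, one_pow]⟩

theorem exists_ratio_mem {ι : Type} [Fintype ι] [DecidableEq ι] (b : ι → K) (Z : Set (ι → K))
    (hb : b ≠ 0) (htor : ∀ z ∈ Z, ∀ i, IsOfFinOrder (z i))
    (hsum : ∀ z ∈ Z, ∑ i, b i * z i = 0) :
    ∃ (i : ι) (S : Finset (ι × K)),
      #S ≤ (Fintype.card ι).factorial.factorial * (Fintype.card ι).factorial ^ 2 ∧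
      ∀ z ∈ Z, ∃ p ∈ S, p.1 ≠ i ∧ z i = p.2 * z p.1 := by
  classical
  let P : ℕ → Prop := fun r => ∃ (zs : Fin r → ι → K) (e : Fin r → ι), (∀ k, zs k ∈ Z) ∧
    (of fun k l => zs k (e l)).det ≠ 0
  have hinj : ∀ {r} (zs : Fin r → ι → K) (e : Fin r → ι),
      (of fun k l => zs k (e l)).det ≠ 0 → Injective e := fun zs e h l l' hl => by
    by_contra hne
    exact h (Matrix.det_zero_of_column_eq hne fun k => by simp [hl])
  have hP0 : P 0 := ⟨Fin.elim0, Fin.elim0, fun k => k.elim0, by simp⟩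
  have hPb : ∀ r, P r → r ≤ Fintype.card ι := fun r ⟨zs, e, _, h⟩ => by
    simpa using Fintype.card_le_of_injective e (hinj zs e h)
  set r := Nat.findGreatest P (Fintype.card ι)
  obtain ⟨zs, e, hzs, hdet⟩ : P r := Nat.findGreatest_spec (Nat.zero_le _) hP0
  have hr : ¬ P (r + 1) := fun h => by
    have := Nat.le_findGreatest (hPb _ h) h
    lia
  have he := hinj zs e hdet
  obtain ⟨i, hi⟩ : ∃ i, ∀ l, e l ≠ i := by
    by_contra! hsurj
    refine hdet (Matrix.exists_mulVec_eq_zero_iff.1 ⟨fun l => b (e l), fun h0 => hb ?_, ?_⟩)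
    · ext i; obtain ⟨l, rfl⟩ := hsurj i; exact congr_fun h0 l
    · ext k
      refine Eq.trans ?_ (hsum _ (hzs k))
      simp only [mulVec, dotProduct, of_apply, mul_comm (zs k _)]
      exact (Equiv.ofBijective e ⟨he, hsurj⟩).sum_comp fun i => b i * zs k i
  have hrn : r + 1 ≤ Fintype.card ι := by
    have := Fintype.card_lt_of_injective_of_notMem e he (b := i) (by rintro ⟨l, hl⟩; exact hi l hl)
    simpa using this
  let κ := Fin (r + 1) × Perm (Fin r)
  let e' : Fin (r + 1) → ι := Fin.snoc e i
  let w : κ → K := fun p => ∏ k, zs (p.2 k) (e' (p.1.succAbove k))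
  let q : κ → ℚ := fun p => (-1) ^ (r + p.1 : ℕ) * (Perm.sign p.2 : ℤ)
  have hκ : Fintype.card κ ≤ (Fintype.card ι).factorial := by
    rw [Fintype.card_prod, Fintype.card_perm, Fintype.card_fin, Fintype.card_fin,
      ← Nat.factorial_succ]
    exact Nat.factorial_le hrn
  have hw : ∀ p, IsOfFinOrder (w p) := fun p =>
    prod_mem (S := CommMonoid.torsion K) fun k _ => htor _ (hzs _) _
  have hne : ∀ {x : K}, IsOfFinOrder x → x ≠ 0 := fun h => h.isUnit.ne_zero
  have hrow : ∀ (z : ι → K) (l : Fin (r + 1)), ∑ ρ, (q (l, ρ) : K) * (z (e' l) * w (l, ρ)) =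
      (-1) ^ (r + l : ℕ) * z (e' l) * (of fun k k' => zs k (e' (l.succAbove k'))).det := by
    intro z l
    rw [Matrix.det_apply', mul_sum]
    refine sum_congr rfl fun ρ _ => ?_
    simp only [q, w, of_apply]
    push_cast
    ring
  refine ⟨i, ((Polynomial.nthRootsFinset (Fintype.card κ).factorial (1 : K)) ×ˢ univ).image
    fun p : K × κ × κ => (e' p.2.2.1, p.1 * w p.2.2 / w p.2.1), ?_, fun z hz => ?_⟩
  · refine card_image_le.trans ?_
    rw [card_product, card_univ, Fintype.card_prod (κ), ← sq]
    refine Nat.mul_le_mul (LE.le.trans ?_ (Nat.factorial_le hκ)) (Nat.pow_le_pow_left hκ 2)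
    exact (Multiset.toFinset_card_le _).trans (Polynomial.card_nthRoots _ _)
  have hdet0 : ∑ p, (q p : K) * (z (e' p.1) * w p) = 0 := by
    rw [sum_prod_type]
    have : (of fun k l => (Fin.snoc zs z : Fin (r + 1) → ι → K) k (e' l)).det = 0 := by
      by_contra h
      refine hr ⟨_, e', fun k => ?_, h⟩
      refine Fin.lastCases ?_ (fun k => ?_) k
      · rwa [Fin.snoc_last]
      · rw [Fin.snoc_castSucc]; exact hzs k
    rw [Matrix.det_succ_row _ (Fin.last r)] at this
    rw [← this]
    refine sum_congr rfl fun l _ => ?_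
    rw [hrow]
    congr 2
    · simp
    · ext k k'; simp
  obtain ⟨k, l, hk, hl, h⟩ := isTorsion_ratio_of_sum_eq_zero q (fun p => z (e' p.1) * w p)
    (fun p => isOfFinOrder_iff_pow_eq_one.1 ((htor z hz _).mul (hw p))) (fun p => p.1 = Fin.last r)
    hdet0 (by
      rw [sum_filter, sum_prod_type, sum_eq_single (Fin.last r) (fun l _ hl => by simp [hl])
        (by simp)]
      simp only [if_true]
      rw [hrow]
      refine mul_ne_zero (mul_ne_zero (pow_ne_zero _ (by simp)) (hne (htor z hz _))) ?_
      simpa [e', Fin.succAbove_last] using hdet)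
  refine ⟨_, mem_image_of_mem _ (mem_product (p := ((_ : K), k, l)).2 ⟨(Polynomial.mem_nthRootsFinset
    (Nat.factorial_pos _) 1).2 h, mem_univ _⟩), ?_, ?_⟩
  · refine Fin.lastCases (fun h => absurd rfl h) (fun l' _ => ?_) l.1 hl
    simpa [e'] using hi l'
  · have h1 : z (e' k.1) = z i := by rw [hk]; simp [e']
    have h2 := hne (hw k)
    have h3 := hne (hw l)
    have h4 := hne (htor z hz (e' l.1))
    rw [h1]
    field_simp

/-- For the nondegenerate solutions of a linear equation in roots of unity, the number of values of
the ratio of two unknowns is bounded in terms of the number of unknowns. -/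
theorem exists_card_ratio_le (n : ℕ) : ∃ B : ℕ, ∀ (ι : Type) [Fintype ι], Fintype.card ι = n →
    ∀ (b : ι → K) (Z : Set (ι → K)), (∀ z ∈ Z, ∀ i, IsOfFinOrder (z i)) →
    (∀ z ∈ Z, ∑ i, b i * z i = 0) →
    (∀ z ∈ Z, ∀ s : Finset ι, s.Nonempty → s ≠ univ → ∑ i ∈ s, b i * z i ≠ 0) →
    ∀ i k, ∃ C : Finset K, #C ≤ B ∧ ∀ z ∈ Z, z i / z k ∈ C := by
  classical
  induction n with
  | zero => exact ⟨0, fun ι _ h b Z _ _ _ i => ((Fintype.card_eq_zero_iff.1 h).elim i)⟩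
  | succ n ih =>
    obtain ⟨B, hB⟩ := ih
    set D := (n + 1).factorial.factorial * (n + 1).factorial ^ 2
    refine ⟨D * B + 1, fun ι _ hn b Z htor hsum hmin i k => ?_⟩
    obtain rfl | ⟨z₀, hz₀⟩ := Z.eq_empty_or_nonempty
    · exact ⟨∅, by simp, by simp⟩
    by_cases hik : i = k
    · refine ⟨{z₀ i / z₀ i}, by simp, fun z hz => ?_⟩
      have hne : ∀ z ∈ Z, z i ≠ 0 := fun z hz => (htor z hz i).isUnit.ne_zero
      rw [← hik, div_self (hne z hz), div_self (hne z₀ hz₀), mem_singleton]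
    obtain ⟨o, S, hS, h⟩ := exists_ratio_mem b Z (fun h0 => hmin z₀ hz₀ {i} (singleton_nonempty i)
      (fun h => hik (mem_singleton.1 (h.symm.subset (mem_univ k))).symm)
      (by simp [h0])) htor hsum
    rw [hn] at hS
    have key : ∀ p : ι × K, ∃ C : Finset K, #C ≤ B ∧
        ∀ z ∈ Z, p.1 ≠ o → z o = p.2 * z p.1 → z i / z k ∈ C := by
      rintro ⟨o', c⟩
      by_cases ho : o' = o
      · exact ⟨∅, by simp, fun z _ h => absurd ho h⟩
      let ρ : ι → {i // i ≠ o} := fun i => if hi : i = o then ⟨o', ho⟩ else ⟨i, hi⟩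
      let γ : ι → K := fun i => if i = o then c else 1
      have hρ : ∀ z : ι → K, z o = c * z o' → ∀ i, z i = γ i * z (ρ i) := fun z hz i => by
        by_cases hi : i = o <;> simp [ρ, γ, hi, hz]
      have hfib : ∀ z : ι → K, z o = c * z o' → ∀ s : Finset {i // i ≠ o},
          ∑ k ∈ s, (∑ i with ρ i = k, b i * γ i) * z k = ∑ i with ρ i ∈ s, b i * z i := by
        intro z hz s
        rw [← sum_fiberwise_of_maps_to (g := ρ) (t := s) (by simp)]
        refine sum_congr rfl fun k hk => ?_
        rw [sum_mul, filter_filter]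
        refine sum_congr (by ext i; simp only [mem_filter, mem_univ, true_and]; aesop) fun i hi => ?_
        rw [hρ z hz i, (mem_filter.1 hi).2.2, mul_assoc]
      obtain ⟨C, hC, h⟩ := hB {i // i ≠ o} (by simp [hn])
        (fun k => ∑ i with ρ i = k, b i * γ i) ((fun z i => z (i : ι)) '' {z ∈ Z | z o = c * z o'})
        (by rintro _ ⟨z, hz, rfl⟩ i; exact htor z hz.1 i)
        (by
          rintro _ ⟨z, hz, rfl⟩
          rw [← hsum z hz.1]
          exact (hfib z hz.2 univ).trans (by simp))
        (by
          rintro _ ⟨z, hz, rfl⟩ s hs hs'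
          rw [hfib z hz.2 s]
          have hρk : ∀ k : {i // i ≠ o}, ρ k = k := fun k => by simp [ρ, k.2]
          obtain ⟨k, hk⟩ := hs
          refine hmin z hz.1 _ ⟨k, by simpa [hρk] using hk⟩ fun h => hs' (eq_univ_of_forall fun k => ?_)
          have := h.symm.subset (mem_univ (k : ι))
          simpa [hρk] using this)
        (ρ i) (ρ k)
      refine ⟨C.image fun x => γ i / γ k * x, card_image_le.trans hC, fun z hz _ hzo => ?_⟩
      rw [hρ z hzo i, hρ z hzo k, mul_div_mul_comm]
      exact mem_image_of_mem _ (h _ ⟨z, ⟨hz, hzo⟩, rfl⟩)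
    choose C hC h' using key
    refine ⟨S.biUnion C, ?_, fun z hz => ?_⟩
    · exact (card_biUnion_le_card_mul _ _ _ fun p _ => hC p).trans
        ((Nat.mul_le_mul_right _ hS).trans (Nat.le_succ _))
    · obtain ⟨p, hp, hpo, hz'⟩ := h z hz
      exact mem_biUnion.2 ⟨p, hp, h' p z hz hpo hz'⟩

end

/-- A root of unity of degree at most `d` has order dividing `(2d)!`. -/
theorem pow_factorial_eq_one {L : Type*} [Field L] [CharZero L] {ζ : L} (hζ : IsOfFinOrder ζ) {d : ℕ}
    (hd : (minpoly ℚ ζ).natDegree ≤ d) : ζ ^ (2 * d).factorial = 1 := by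
  have h0 := hζ.orderOf_pos
  have h1 := IsPrimitiveRoot.orderOf ζ
  rw [← Polynomial.cyclotomic_eq_minpoly_rat h1 h0, Polynomial.natDegree_cyclotomic] at hd
  rw [← orderOf_dvd_iff_pow_eq_one, Nat.dvd_iff_prime_pow_dvd_dvd]
  intro p k hp hk
  cases k with
  | zero => simp
  | succ k =>
    have h2 := (Nat.le_of_dvd (Nat.totient_pos.2 h0) (Nat.totient_dvd_of_dvd hk)).trans hd
    rw [Nat.totient_prime_pow_succ hp] at h2
    refine Nat.dvd_factorial (pow_pos hp.pos _) ?_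
    have h3 : p ≤ 2 * (p - 1) := by have := hp.two_le; lia
    calc p ^ (k + 1) ≤ p ^ k * (2 * (p - 1)) := by rw [pow_succ]; exact Nat.mul_le_mul_left _ h3
      _ = 2 * (p ^ k * (p - 1)) := by ring
      _ ≤ _ := by lia

/-- An element all of whose conjugates are multiples by roots of unity has a power in the base field. -/
theorem exists_pow_mem {Ω : Type*} [Field Ω] [CharZero Ω] [IsAlgClosed Ω] [Algebra.IsAlgebraic ℚ Ω]
    (F : IntermediateField ℚ Ω) [FiniteDimensional ℚ F] (B : ℕ) : ∃ E : ℕ, 0 < E ∧ ∀ (u : Ω) (C : Finset Ω),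
      u ≠ 0 → #C ≤ B → (∀ σ : Ω ≃ₐ[F] Ω, IsOfFinOrder (σ u / u) ∧ σ u / u ∈ C) → u ^ E ∈ F := by
  classical
  refine ⟨B.factorial * (2 * (finrank ℚ F * B)).factorial, by positivity, fun u C hu hC h => ?_⟩
  have : Algebra.IsAlgebraic F Ω := Algebra.IsAlgebraic.tower_top (K := ℚ) F
  have : Normal F Ω := normal_iff.2 fun x => ⟨(Algebra.IsAlgebraic.isAlgebraic x).isIntegral, IsAlgClosed.splits _⟩
  have hi : IsIntegral F u := (Algebra.IsAlgebraic.isAlgebraic u).isIntegral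
  set s := ((minpoly F u).map (algebraMap F Ω)).roots with hs
  have hroot : ∀ v ∈ s, IsOfFinOrder (v / u) ∧ v / u ∈ C := fun v hv => by
    rw [hs, Polynomial.mem_roots', Polynomial.IsRoot, Polynomial.eval_map_algebraMap] at hv
    have : minpoly F v = minpoly F u :=
      (minpoly.eq_of_irreducible_of_monic (minpoly.irreducible hi) hv.2 (minpoly.monic hi)).symm
    obtain ⟨σ, rfl⟩ := (Normal.minpoly_eq_iff_mem_orbit Ω).1 this
    exact h σ
  have hnd : s.Nodup := Polynomial.nodup_roots (minpoly.irreducible hi).separable.map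
  have hsp := IsAlgClosed.splits ((minpoly F u).map (algebraMap F Ω))
  have hcard : s.card = (minpoly F u).natDegree := by
    rw [hs, hsp.natDegree_eq_card_roots.symm, Polynomial.natDegree_map]
  set e := (minpoly F u).natDegree
  have heB : e ≤ B := by
    rw [← hcard, ← Multiset.toFinset_card_of_nodup hnd]
    refine (card_le_card_of_injOn (· / u) (fun v hv => (hroot v (Multiset.mem_toFinset.1 hv)).2)
      fun v _ w _ hvw => ?_).trans hC
    exact (div_left_inj' hu).1 hvw
  have hprod : s.prod ∈ F := by
    have := hsp.coeff_zero_eq_prod_roots_of_monic ((minpoly.monic hi).map _)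
    rw [Polynomial.coeff_map] at this
    have h2 : s.prod = (-1) ^ e * algebraMap F Ω ((minpoly F u).coeff 0) := by
      rw [this, Polynomial.natDegree_map, ← mul_assoc, ← mul_pow]; simp [e, hs]
    rw [h2]
    exact mul_mem (pow_mem (neg_mem (one_mem F)) _) (SetLike.coe_mem _)
  set ζ := (s.map (· / u)).prod with hζ
  have hζt : IsOfFinOrder ζ := (Submonoid.multiset_prod_mem (CommMonoid.torsion Ω) _ fun z hz => by
    obtain ⟨v, hv, rfl⟩ := Multiset.mem_map.1 hz; exact (hroot v hv).1)
  have hζu : s.prod = ζ * u ^ e := by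
    rw [hζ, Multiset.prod_map_div, Multiset.map_id', Multiset.map_const', Multiset.prod_replicate, hcard,
      div_mul_cancel₀ _ (pow_ne_zero _ hu)]
  have hmem : ζ ∈ adjoin F {u} := by
    rw [eq_div_of_mul_eq (pow_ne_zero e hu) hζu.symm]
    exact div_mem (IntermediateField.algebraMap_mem _ (⟨_, hprod⟩ : F))
      (pow_mem (IntermediateField.mem_adjoin_simple_self F u) _)
  have hζ1 : ζ ^ (2 * (finrank ℚ F * B)).factorial = 1 := by
    refine pow_factorial_eq_one hζt (le_trans ?_ (Nat.mul_le_mul_left _ heB))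
    have := adjoin.finiteDimensional hi
    have := FiniteDimensional.trans ℚ F (adjoin F {u})
    rw [show e = _ from (adjoin.finrank hi).symm, Module.finrank_mul_finrank]
    exact (minpoly.algebraMap_eq (A := ℚ) (algebraMap (adjoin F {u}) Ω).injective
      ⟨ζ, hmem⟩) ▸ minpoly.natDegree_le _
  obtain ⟨q, hq⟩ := Nat.dvd_factorial (m := e) (n := B) (minpoly.natDegree_pos hi) heB
  have : u ^ (B.factorial * (2 * (finrank ℚ F * B)).factorial) =
      (s.prod ^ q) ^ (2 * (finrank ℚ F * B)).factorial := by
    rw [hζu, hq, mul_pow, mul_pow, ← pow_mul ζ, mul_comm q, pow_mul ζ, hζ1, one_pow, one_mul]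
    ring
  rw [this]
  exact pow_mem (pow_mem hprod _) _

theorem fg_of_finite_norm_le_one {G S : Type*} [CommGroup G] [Fintype S] (f : Additive G →+ (S → ℝ))
    (h : {g | ‖f g‖ ≤ 1}.Finite) : Group.FG G := by
  rw [Group.fg_iff_monoid_fg, Monoid.fg_iff_add_fg, ← AddGroup.fg_iff_addMonoid_fg,
    ← Module.Finite.iff_addGroup_fg, Module.finite_def]
  refine Submodule.fg_of_fg_map_of_fg_inf_ker f.toIntLinearMap ?_ ?_
  · rw [Submodule.map_top, ← Module.Finite.iff_fg]
    have : DiscreteTopology (LinearMap.range f.toIntLinearMap) := by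
      refine discreteTopology_of_isOpen_singleton_zero (isOpen_singleton_of_finite_mem_nhds 0
        (Metric.closedBall_mem_nhds 0 one_pos) (.of_finite_image ((h.image f).subset ?_)
          Subtype.val_injective.injOn))
      rintro _ ⟨⟨_, g, rfl⟩, hg, rfl⟩
      exact ⟨g, mem_closedBall_zero_iff.1 hg, rfl⟩
    infer_instance
  · rw [inf_of_le_right le_top]
    have h1 : (ker f.toIntLinearMap : Set (Additive G)).Finite := h.subset fun g hg => by
      have : f g = 0 := hg
      simp [this]
    exact ⟨h1.toFinset, by rw [h1.coe_toFinset]; exact Submodule.span_eq _⟩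

variable {Ω : Type*} [Field Ω] [CharZero Ω]

theorem exists_fg_of_pow_mem_sUnits (F : IntermediateField ℚ Ω) [NumberField F] {m E : ℕ} (hm : m ≠ 0)
    (hE : 0 < E) : ∃ U : Subgroup Ωˣ, U.FG ∧
      ∀ x : Ωˣ, x ^ E ∈ (sUnits F m).map (Units.map (algebraMap F Ω)) → x ∈ U := by
  classical
  have : NeZero m := ⟨hm⟩
  let P : Subgroup (Ωˣ × Fˣ) :=
    ((powMonoidHom E).comp (MonoidHom.fst _ _)).eqLocus ((Units.map (algebraMap F Ω)).comp (.snd _ _)) ⊓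
      (sUnits F m).comap (.snd _ _)
  let f : Additive P →+ (Places F m → ℝ) :=
    { toFun := fun g v => log (Places.abv v (g.toMul.1.2 : F))
      map_zero' := by ext v; simp
      map_add' := fun g h => by
        ext v
        exact (congr_arg log (map_mul _ _ _)).trans (log_mul
          ((Places.abv v).ne_zero (Units.ne_zero _)) ((Places.abv v).ne_zero (Units.ne_zero _))) }
  have : Group.FG P := fg_of_finite_norm_le_one f <| by
    have h1 := (sInt F m).finite_bounded (exp 1)
    refine .subset (Set.Finite.of_finite_fibers (fun g : Additive P => (g.toMul.1.2 : F)) (h1.subset ?_) ?_) subset_rfl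
    · rintro _ ⟨g, hg, rfl⟩
      refine ⟨g.toMul.2.2.1, fun v => ?_⟩
      have h2 := (le_abs_self _).trans ((norm_le_pi_norm (f g) v).trans hg)
      exact (log_le_iff_le_exp ((Places.abv v).pos (Units.ne_zero _))).1 h2
    · intro u _
      refine .of_finite_image (f := fun g : Additive P => (g.toMul.1.1 : Ω))
        ((Polynomial.nthRoots E (u : Ω)).toFinset.finite_toSet.subset ?_) ?_
      · rintro _ ⟨g, ⟨-, rfl⟩, rfl⟩
        rw [mem_coe, Multiset.mem_toFinset, Polynomial.mem_nthRoots hE]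
        exact congr_arg Units.val g.toMul.2.1
      · intro g hg g' hg' h
        exact Additive.toMul.injective (Subtype.ext (Prod.ext (Units.ext h) (Units.ext (hg.2.trans hg'.2.symm))))
  obtain ⟨T, hT⟩ := (Group.fg_iff_subgroup_fg P).1 this
  refine ⟨Subgroup.closure (T.image (MonoidHom.fst Ωˣ Fˣ) : Finset Ωˣ), ⟨_, rfl⟩, ?_⟩
  rintro x ⟨u, hu, h⟩
  rw [coe_image, ← MonoidHom.map_closure, hT]
  exact ⟨(x, u), ⟨h.symm, hu⟩, rfl⟩

theorem mem_sUnits_of_pow_mem {F : Type*} [Field F] [NumberField F] {m k : ℕ} (hk : k ≠ 0) {u : Fˣ}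
    (h : u ^ k ∈ sUnits F m) : u ∈ sUnits F m := by
  refine ⟨fun w hw => ?_, fun w hw => ?_⟩
  · have := h.1 w hw
    rwa [Units.val_pow_eq_pow_val, map_pow, pow_le_one_iff_of_nonneg (apply_nonneg w _) hk] at this
  · have := h.2 w hw
    rwa [← inv_pow, Units.val_pow_eq_pow_val, map_pow, pow_le_one_iff_of_nonneg (apply_nonneg w _) hk] at this

theorem exists_field_of_finset [Algebra.IsAlgebraic ℚ Ω] (T : Finset Ωˣ) :
    ∃ F : IntermediateField ℚ Ω, ∃ _ : NumberField F, ∃ m ≠ 0,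
    ∀ x ∈ T, x ∈ (sUnits F m).map (Units.map (algebraMap F Ω)) := by
  classical
  let F := adjoin ℚ (T.image Units.val : Set Ω)
  have : FiniteDimensional ℚ F := IntermediateField.finiteDimensional_adjoin fun x _ =>
    (Algebra.IsAlgebraic.isAlgebraic x).isIntegral
  have : NumberField F := ⟨⟩
  let g : T → Fˣ := fun x => Units.mk0 ⟨x.1, IntermediateField.subset_adjoin _ _ (mem_image_of_mem _ x.2)⟩
    fun h => x.1.ne_zero (congr_arg Subtype.val h)
  obtain ⟨m, hm, h⟩ := exists_forall_mem_sUnits F (univ.image g)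
  exact ⟨F, this, m, hm, fun x hx => ⟨g ⟨x, hx⟩, h _ (mem_image_of_mem _ (mem_univ _)), Units.ext rfl⟩⟩

theorem unitEq_of_fg [Algebra.IsAlgebraic ℚ Ω] {U : Subgroup Ωˣ} (hU : U.FG) : UnitEq U := by
  classical
  obtain ⟨T, rfl⟩ := hU
  intro ι _ _ a x 𝒰 ha hx hs
  obtain ⟨F, _, m, hm, h⟩ := exists_field_of_finset (T ∪ univ.image fun i => Units.mk0 (a i) (ha i))
  have hT : Subgroup.closure (T : Set Ωˣ) ≤ (sUnits F m).map (Units.map (algebraMap F Ω)) :=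
    (Subgroup.closure_le _).2 fun x hx => h x (mem_union_left _ hx)
  choose b hb hba using fun i => h _ (mem_union_right _ (mem_image_of_mem _ (mem_univ i)))
  have : ∀ j i, ∃ u : Fˣ, x j i ∈ Subgroup.closure (T : Set Ωˣ) →
      u ∈ sUnits F m ∧ Units.map (algebraMap F Ω).toMonoidHom u = x j i := fun j i => by
    by_cases hj : x j i ∈ Subgroup.closure (T : Set Ωˣ)
    · exact (hT hj).imp fun u hu _ => hu
    · exact ⟨1, fun h => absurd h hj⟩
  choose y hy using this
  obtain ⟨i, i', hii, c, hc⟩ := unitEq_sUnits F hm ι (fun i => b i) y 𝒰 (fun i => (b i).ne_zero)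
    (hx.mono fun j hj i => (hy j i (hj i)).1) (by
      filter_upwards [hx, hs] with j hj hs
      refine (algebraMap F Ω).injective (Eq.trans ?_ (hs.trans (map_zero _).symm))
      rw [_root_.map_sum]
      refine sum_congr rfl fun i _ => ?_
      rw [map_mul, ← (hy j i (hj i)).2]
      exact congr_arg (· * _) (congr_arg Units.val (hba i)))
  refine ⟨i, i', hii, Units.map (algebraMap F Ω).toMonoidHom c, ?_⟩
  filter_upwards [hx, hc] with j hj hc
  rw [← (hy j i (hj i)).2, ← (hy j i' (hj i')).2, ← map_div, hc]

theorem unitEq_of_pow_mem {Ω : Type*} [Field Ω] [CharZero Ω] [IsAlgClosed Ω] [Algebra.IsAlgebraic ℚ Ω]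
    {G Γ₀ : Subgroup Ωˣ} (hΓ₀ : Γ₀.FG) (hG : ∀ g ∈ G, ∃ k ≠ 0, g ^ k ∈ Γ₀) : UnitEq G := by
  classical
  refine .of_minimal fun ι _ _ a x 𝒰 ha hx hs hb => ?_
  obtain ⟨T, rfl⟩ := hΓ₀
  obtain ⟨o⟩ := ‹Nonempty ι›
  obtain ⟨F, _, m, hm, h⟩ := exists_field_of_finset (T ∪ univ.image fun i => Units.mk0 (a i) (ha i))
  have hT : Subgroup.closure (T : Set Ωˣ) ≤ (sUnits F m).map (Units.map (algebraMap F Ω)) :=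
    (Subgroup.closure_le _).2 fun x hx => h x (mem_union_left _ hx)
  choose b _ hba using fun i => h _ (mem_union_right _ (mem_image_of_mem _ (mem_univ i)))
  have hba : ∀ i, algebraMap F Ω (b i) = a i := fun i => congr_arg Units.val (hba i)
  obtain ⟨B, hB⟩ := exists_card_ratio_le (K := Ω) (Fintype.card ι)
  obtain ⟨E, hE, hEF⟩ := exists_pow_mem F B
  obtain ⟨U, hU, hUm⟩ := exists_fg_of_pow_mem_sUnits F hm hE
  have hnd : ∀ᶠ j in 𝒰, ∀ s : Finset ι, s.Nonempty → s ≠ univ → ∑ i ∈ s, a i * x j i ≠ 0 := by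
    refine Filter.eventually_all.2 fun s => ?_
    by_cases hs : s.Nonempty ∧ s ≠ univ
    · have : ¬ ∀ᶠ j in 𝒰, ∑ i ∈ s, a i * (x j i : Ω) = 0 := fun h0 => by
        obtain ⟨i, hi⟩ := hs.1
        obtain ⟨k, hk⟩ : ∃ k, k ∉ s := by
          by_contra! hc; exact hs.2 (eq_univ_iff_forall.2 hc)
        have := congr_fun (hb (fun i => if i ∈ s then a i else 0) ⟨k, if_neg hk⟩
          (h0.mono fun j hj => by simpa [ite_mul] using hj)) i
        exact ha i (by simpa [hi] using this)
      exact (Ultrafilter.eventually_not.2 this).mono fun j hj _ _ => hj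
    · exact .of_forall fun j h1 h2 => absurd ⟨h1, h2⟩ hs
  let y : ℕ → ι → Ωˣ := fun j i => x j i / x j o
  have hy : ∀ j (s : Finset ι), ∑ i ∈ s, a i * (y j i : Ω) = (∑ i ∈ s, a i * (x j i : Ω)) / x j o := fun j s => by
    rw [sum_div]
    exact sum_congr rfl fun i _ => by rw [Units.val_div_eq_div_val, mul_div_assoc]
  have hyU : ∀ᶠ j in 𝒰, ∀ i, y j i ∈ U := by
    filter_upwards [hx, hs, hnd] with j hx hs hnd i
    have hpow : ∀ i, ∃ k ≠ 0, ∃ v ∈ sUnits F m, Units.map (algebraMap F Ω).toMonoidHom v = y j i ^ k := fun i => by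
      obtain ⟨k, hk, h⟩ := hG _ (div_mem (hx i) (hx o))
      obtain ⟨v, hv, h⟩ := hT h
      exact ⟨k, hk, v, hv, h⟩
    have htor : ∀ (σ : Ω ≃ₐ[F] Ω) i, IsOfFinOrder (σ (y j i) / y j i) := fun σ i => by
      obtain ⟨k, hk, v, -, hv⟩ := hpow i
      have hv : algebraMap F Ω v = y j i ^ k := congr_arg Units.val hv
      refine isOfFinOrder_iff_pow_eq_one.2 ⟨k, Nat.pos_of_ne_zero hk, ?_⟩
      rw [div_pow, ← map_pow, ← hv, σ.commutes, div_self]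
      exact hv ▸ pow_ne_zero k (y j i).ne_zero
    have hsum : ∀ (σ : Ω ≃ₐ[F] Ω) (s : Finset ι), ∑ i ∈ s, a i * y j i * (σ (y j i) / y j i) =
        σ (∑ i ∈ s, a i * y j i) := fun σ s => by
      rw [_root_.map_sum]
      refine sum_congr rfl fun i _ => ?_
      rw [map_mul, ← hba, σ.commutes, mul_assoc, mul_div_cancel₀ _ (y j i).ne_zero]
    obtain ⟨C, hCB, hC⟩ := hB ι rfl (fun i => a i * y j i)
      (Set.range fun (σ : Ω ≃ₐ[F] Ω) i => σ (y j i) / y j i)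
      (by rintro _ ⟨σ, rfl⟩ i; exact htor σ i)
      (by rintro _ ⟨σ, rfl⟩; exact (hsum σ univ).trans (by rw [hy, hs, zero_div, map_zero]))
      (by
        rintro _ ⟨σ, rfl⟩ s h1 h2
        refine (hsum σ s).trans_ne ((map_ne_zero σ).2 ?_)
        rw [hy]
        exact div_ne_zero (hnd s h1 h2) (x j o).ne_zero) i o
    have hmem := hEF (y j i) C (y j i).ne_zero hCB fun σ => ⟨htor σ i, by
      have := hC _ ⟨σ, rfl⟩
      simpa [y] using this⟩
    refine hUm _ ⟨Units.mk0 ⟨_, hmem⟩ fun h => pow_ne_zero E (y j i).ne_zero (congr_arg Subtype.val h), ?_, Units.ext rfl⟩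
    obtain ⟨k, hk, v, hv, h⟩ := hpow i
    refine mem_sUnits_of_pow_mem hk ?_
    convert pow_mem hv E using 1
    refine Units.map_injective (f := (algebraMap F Ω).toMonoidHom) (algebraMap F Ω).injective ?_
    rw [map_pow, map_pow, h, ← pow_mul, mul_comm, pow_mul]
    exact congr_arg (· ^ k) (Units.ext rfl)
  obtain ⟨i, i', hii, c, hc⟩ := unitEq_of_fg hU ι a y 𝒰 ha hyU (hs.mono fun j hj => by rw [hy, hj, zero_div])
  exact ⟨i, i', hii, c, hc.mono fun j hj => by simpa [y] using hj⟩

/-- If every element of infinite order of a finitely generated abelian group has infinite order modulo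
some member of a family of subgroups, then finitely many members have finite intersection. -/
theorem exists_finset_iInf_isTorsion {M Φ : Type*} [AddCommGroup M] [Module.Finite ℤ M]
    (N : Φ → Submodule ℤ M) (hN : ∀ g : M, (∀ n : ℤ, n ≠ 0 → n • g ≠ 0) → ∃ φ, ∀ n : ℤ, n ≠ 0 → n • g ∉ N φ) :
    ∃ F : Finset Φ, ∀ g ∈ F.inf N, ∃ n : ℤ, n ≠ 0 ∧ n • g = 0 := by
  classical
  let r (F : Finset Φ) : ℕ := finrank ℤ (F.inf N : Submodule ℤ M)
  obtain ⟨F, hF⟩ : ∃ F, ∀ F', r F ≤ r F' := ⟨Function.argmin r, fun F' => Function.argmin_le r F'⟩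
  refine ⟨F, fun g hg => ?_⟩
  by_contra! h
  obtain ⟨φ, hφ⟩ := hN g h
  let e := Submodule.comapSubtypeEquivOfLe (inf_mono (subset_insert φ F) : (insert φ F).inf N ≤ F.inf N)
  have h1 := Submodule.finrank_quotient_add_finrank (((insert φ F).inf N).comap (F.inf N).subtype)
  have h2 := hF (insert φ F)
  have h3 : Module.IsTorsion ℤ (_ ⧸ ((insert φ F).inf N).comap (F.inf N).subtype) :=
    Module.finrank_eq_zero_iff_isTorsion.1 (by rw [e.finrank_eq] at h1; simp only [r] at h2; lia)
  obtain ⟨⟨n, hn⟩, h4⟩ := @h3 (Submodule.Quotient.mk ⟨g, hg⟩)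
  refine hφ n (nonZeroDivisors.ne_zero hn) ?_
  have h5 := (Submodule.Quotient.mk_eq_zero _).1 h4
  exact (inf_le (mem_insert_self φ F) : _ ≤ N φ) h5

theorem eq_one_of_map_eq_one {R Ω : Type*} [CommRing R] [IsDomain R] [Ring Ω] [CharZero Ω] (φ : R →+* Ω)
    {v : R} {n : ℕ} (hn : n ≠ 0) (hv : v ^ n = 1) (h : φ v = 1) : v = 1 := by
  have h1 := mul_geom_sum v n
  rw [hv, sub_self, mul_eq_zero, sub_eq_zero] at h1
  refine h1.resolve_right fun h2 => hn ?_
  have := congr_arg φ h2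
  simpa [_root_.map_sum, h] using this

/-- Unit equations over a domain with enough specializations of bounded degree. -/
theorem exists_ratio_eq_of_specialization {R Ω : Type*} [CommRing R] [IsDomain R] [Field Ω] [CharZero Ω]
    [IsAlgClosed Ω] [Algebra.IsAlgebraic ℚ Ω] (S : Subring R) {d : ℕ}
    (hS : ∀ f ∈ S, f ≠ 0 → ∃ φ : R →+* Ω, φ f ≠ 0 ∧ ∀ s ∈ S, (minpoly ℚ (φ s)).natDegree ≤ d)
    {G Γ₀ : Subgroup Rˣ} (hΓ₀ : Γ₀.FG) (hΓS : ∀ g ∈ Γ₀, (g : R) ∈ S) (hG : ∀ g ∈ G, ∃ k ≠ 0, g ^ k ∈ Γ₀)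
    {ι : Type} [Fintype ι] [Nonempty ι] {a : ι → R} {x : ℕ → ι → Rˣ} {𝒰 : Ultrafilter ℕ}
    (ha : ∀ i, a i ≠ 0) (haS : ∀ i, a i ∈ S) (hx : ∀ᶠ j in 𝒰, ∀ i, x j i ∈ G)
    (hs : ∀ᶠ j in 𝒰, ∑ i, a i * x j i = 0) :
    ∃ i i', i ≠ i' ∧ ∃ c, ∀ᶠ j in 𝒰, x j i / x j i' = c := by
  classical
  have key : ∃ i i', i ≠ i' ∧ ∀ f ∈ S, f ≠ 0 → ∃ φ : R →+* Ω, φ f ≠ 0 ∧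
      (∀ s ∈ S, (minpoly ℚ (φ s)).natDegree ≤ d) ∧ ∃ c, ∀ᶠ j in 𝒰, Units.map φ.toMonoidHom (x j i / x j i') = c := by
    by_contra! h
    choose! f hfS hf0 hf using h
    let D : Finset (ι × ι) := univ.filter fun p => p.1 ≠ p.2
    have hD : ∀ p ∈ D, p.1 ≠ p.2 := fun p hp => (mem_filter.1 hp).2
    obtain ⟨φ, hφ, hφd⟩ := hS ((∏ i, a i) * ∏ p ∈ D, f p.1 p.2)
      (mul_mem (prod_mem fun i _ => haS i) (prod_mem fun p hp => hfS _ _ (hD p hp)))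
      (mul_ne_zero (prod_ne_zero_iff.2 fun i _ => ha i) (prod_ne_zero_iff.2 fun p hp => hf0 _ _ (hD p hp)))
    rw [map_mul, map_prod, map_prod, mul_ne_zero_iff, prod_ne_zero_iff, prod_ne_zero_iff] at hφ
    obtain ⟨T, rfl⟩ := hΓ₀
    obtain ⟨i, i', hii, c, hc⟩ := unitEq_of_pow_mem (G := G.map (Units.map φ.toMonoidHom))
      (Γ₀ := Subgroup.closure (T.image (Units.map φ.toMonoidHom) : Finset Ωˣ)) ⟨_, rfl⟩ (by
        rintro _ ⟨g, hg, rfl⟩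
        obtain ⟨k, hk, h⟩ := hG g hg
        exact ⟨k, hk, by rw [coe_image, ← MonoidHom.map_closure]; exact ⟨_, h, map_pow _ _ _⟩⟩)
      ι (fun i => φ (a i)) (fun j i => Units.map φ.toMonoidHom (x j i)) 𝒰 (fun i => hφ.1 i (mem_univ i))
      (hx.mono fun j hj i => ⟨_, hj i, rfl⟩) (hs.mono fun j hj => by
        have := congr_arg φ hj
        simpa [_root_.map_sum] using this)
    obtain ⟨j, hj, hj'⟩ := (hc.and (hf i i' hii φ (hφ.2 (i, i') (by simpa [D] using hii)) hφd c)).exists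
    exact hj' ((map_div _ _ _).trans hj)
  obtain ⟨i, i', hii, h⟩ := key
  refine ⟨i, i', hii, ?_⟩
  let Φ := {φ : R →+* Ω // (∀ s ∈ S, (minpoly ℚ (φ s)).natDegree ≤ d) ∧
    ∃ c, ∀ᶠ j in 𝒰, Units.map φ.toMonoidHom (x j i / x j i') = c}
  obtain ⟨φ₁, -, hφ₁⟩ := h 1 S.one_mem one_ne_zero
  have : Module.Finite ℤ (Additive Γ₀) := by
    rw [Module.Finite.iff_addGroup_fg, AddGroup.fg_iff_addMonoid_fg, ← Monoid.fg_iff_add_fg,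
      ← Group.fg_iff_monoid_fg, Group.fg_iff_subgroup_fg]
    exact hΓ₀
  obtain ⟨F, hF⟩ := exists_finset_iInf_isTorsion (M := Additive Γ₀) (Φ := Φ)
    (fun φ => AddSubgroup.toIntSubmodule
      (MonoidHom.toAdditive ((Units.map φ.1.toMonoidHom).comp Γ₀.subtype)).ker) fun g hg => by
    set W := (2 * d).factorial
    have hg' : ((g.toMul.1 : Rˣ) : R) ^ W - 1 ≠ 0 := fun h => hg W (by positivity)
      (Additive.toMul.injective (Subtype.ext (Units.ext (by simpa [sub_eq_zero] using h))))
    obtain ⟨φ, hφ, h⟩ := h _ (sub_mem (pow_mem (hΓS _ g.toMul.2) W) (one_mem S)) hg'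
    refine ⟨⟨φ, h⟩, fun n hn hgn => hφ ?_⟩
    have h1 : Units.map φ.toMonoidHom g.toMul.1 ^ n = 1 := by
      rw [← map_zpow]; exact hgn
    have h2 : IsOfFinOrder (φ g.toMul.1) :=
      (Units.isOfFinOrder_val (u := Units.map φ.toMonoidHom g.toMul.1)).2 (isOfFinOrder_iff_zpow_eq_one.2 ⟨n, hn, h1⟩)
    rw [map_sub, map_pow, pow_factorial_eq_one h2 (h.1 _ (hΓS _ g.toMul.2)), map_one, sub_self]
  have hev : ∀ᶠ j in 𝒰, ∀ φ ∈ insert ⟨φ₁, hφ₁⟩ F, Units.map φ.1.toMonoidHom (x j i / x j i') = φ.2.2.choose :=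
    (eventually_all_finset _).2 fun φ _ => φ.2.2.choose_spec
  obtain ⟨j₀, hj₀, hxj₀⟩ := (hev.and hx).exists
  refine ⟨x j₀ i / x j₀ i', ?_⟩
  filter_upwards [hev, hx] with j hj hxj
  have hv : ∀ φ ∈ insert ⟨φ₁, hφ₁⟩ F, Units.map φ.1.toMonoidHom (x j i / x j i' / (x j₀ i / x j₀ i')) = 1 :=
    fun φ hφ => by rw [map_div, hj φ hφ, hj₀ φ hφ, div_self']
  obtain ⟨k, hk, hkv⟩ := hG _ (div_mem (div_mem (hxj i) (hxj i')) (div_mem (hxj₀ i) (hxj₀ i')))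
  obtain ⟨n, hn, hnv⟩ := hF (Additive.ofMul ⟨_, hkv⟩) ((Submodule.mem_finsetInf).2 fun φ hφ => by
    change Units.map φ.1.toMonoidHom (_ ^ k) = 1
    rw [map_pow, hv φ (mem_insert_of_mem hφ), one_pow])
  have hnv : ((x j i / x j i' / (x j₀ i / x j₀ i')) ^ k) ^ n = 1 := congr_arg (fun g => (Additive.toMul g).1) hnv
  obtain ⟨l, hl, h⟩ := isOfFinOrder_iff_pow_eq_one.1
    (IsOfFinOrder.of_pow (isOfFinOrder_iff_zpow_eq_one.2 ⟨n, hn, hnv⟩) hk)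
  exact div_eq_one.1 (Units.ext (eq_one_of_map_eq_one φ₁ hl.ne' (congr_arg Units.val h)
    (congr_arg Units.val (hv _ (mem_insert_self _ _)))))

end

section

variable {R Ω : Type*} [CommRing R] [Algebra ℚ R] [Field Ω] [CharZero Ω] [IsAlgClosed Ω]

theorem exists_extension {P : Type*} [CommRing P] [Algebra ℚ P] [Algebra P R] [FaithfulSMul P R]
    [IsScalarTower ℚ P R] [Algebra.IsIntegral P R] (e : P →ₐ[ℚ] ℚ) :
    ∃ φ : R →+* Ω, ∀ p, φ (algebraMap P R p) = e p := by
  have := RingHom.ker_isPrime (e : P →+* ℚ)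
  obtain ⟨Q, -, hQ, hQe⟩ := Ideal.exists_ideal_over_prime_of_isIntegral (S := R) (RingHom.ker (e : P →+* ℚ)) ⊥
    (by
      rw [← RingHom.ker_eq_comap_bot, (RingHom.injective_iff_ker_eq_bot _).1 (FaithfulSMul.algebraMap_injective P R)]
      exact bot_le)
  have key : (Ideal.Quotient.mk Q).comp (algebraMap P R) = (algebraMap ℚ (R ⧸ Q)).comp (e : P →+* ℚ) := by
    ext p
    have h1 : p - algebraMap ℚ P (e p) ∈ RingHom.ker (e : P →+* ℚ) := by simp [RingHom.mem_ker]
    rw [← hQe, Ideal.mem_comap, map_sub, ← IsScalarTower.algebraMap_apply] at h1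
    exact Ideal.Quotient.eq.2 h1
  have : Algebra.IsAlgebraic ℚ (R ⧸ Q) := ⟨fun x => by
    obtain ⟨y, rfl⟩ := Ideal.Quotient.mk_surjective x
    obtain ⟨q, hq, h⟩ := Algebra.IsIntegral.isIntegral (R := P) y
    refine IsIntegral.isAlgebraic ⟨q.map (e : P →+* ℚ), hq.map _, ?_⟩
    rw [Polynomial.eval₂_map, ← key, ← Polynomial.hom_eval₂, h, map_zero]⟩
  refine ⟨(IsAlgClosed.lift : R ⧸ Q →ₐ[ℚ] Ω).toRingHom.comp (Ideal.Quotient.mk Q), fun p => ?_⟩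
  refine (congr_arg (IsAlgClosed.lift : R ⧸ Q →ₐ[ℚ] Ω) (RingHom.congr_fun key p)).trans ?_
  simp

/-- A finitely generated domain has enough specializations of bounded degree. -/
theorem exists_specialization {A : Type*} [CommRing A] [IsDomain A] [Algebra ℚ A] [Algebra.FiniteType ℚ A] [Algebra A R]
    [FaithfulSMul A R] [IsScalarTower ℚ A R] [Algebra.IsIntegral A R] : ∃ d : ℕ, ∀ f : A, f ≠ 0 →
      ∃ φ : R →+* Ω, φ (algebraMap A R f) ≠ 0 ∧ ∀ s, (minpoly ℚ (φ (algebraMap A R s))).natDegree ≤ d := by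
  classical
  obtain ⟨n, g, hg, hfin⟩ := exists_finite_inj_algHom_of_fg ℚ A
  let _ : Algebra (MvPolynomial (Fin n) ℚ) A := g.toRingHom.toAlgebra
  let _ : Algebra (MvPolynomial (Fin n) ℚ) R := ((algebraMap A R).comp g.toRingHom).toAlgebra
  have : IsScalarTower (MvPolynomial (Fin n) ℚ) A R := .of_algebraMap_eq fun _ => rfl
  have : IsScalarTower ℚ (MvPolynomial (Fin n) ℚ) A := .of_algebraMap_eq fun x => (g.commutes x).symm
  have : IsScalarTower ℚ (MvPolynomial (Fin n) ℚ) R := .of_algebraMap_eq fun x =>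
    (IsScalarTower.algebraMap_apply ℚ A R x).trans (congr_arg _ (g.commutes x).symm)
  have : FaithfulSMul (MvPolynomial (Fin n) ℚ) R := (faithfulSMul_iff_algebraMap_injective _ _).2
    ((FaithfulSMul.algebraMap_injective A R).comp hg)
  have hfin : Module.Finite (MvPolynomial (Fin n) ℚ) A := hfin
  have : Algebra.IsIntegral (MvPolynomial (Fin n) ℚ) R := .trans A
  obtain ⟨T, hT⟩ := hfin.fg_top
  refine ⟨T.card, fun f hf => ?_⟩
  obtain ⟨r, hr, q, hq⟩ := (Algebra.IsIntegral.isIntegral (R := MvPolynomial (Fin n) ℚ) f).isAlgebraic.exists_nonzero_dvd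
    (mem_nonZeroDivisors_of_ne_zero hf)
  obtain ⟨τ, hτ⟩ : ∃ τ, MvPolynomial.eval τ r ≠ 0 := by
    by_contra! h
    exact hr (MvPolynomial.funext fun x => (h x).trans (map_zero _).symm)
  obtain ⟨φ, hφ⟩ := exists_extension (R := R) (Ω := Ω) (MvPolynomial.aeval (R := ℚ) τ)
  refine ⟨φ, fun h0 => hτ ?_, fun s => ?_⟩
  · have h1 := hφ r
    rw [IsScalarTower.algebraMap_apply _ A R, hq, map_mul, map_mul, h0, zero_mul] at h1
    exact_mod_cast h1.symm
  let ψ : A →ₐ[ℚ] Ω := (φ.comp (algebraMap A R)).toRatAlgHom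
  have hspan : Subalgebra.toSubmodule ψ.range ≤ span ℚ (T.image ψ : Finset Ω) := by
    rintro _ ⟨a, rfl⟩
    have ha : a ∈ span (MvPolynomial (Fin n) ℚ) (T : Set A) := hT ▸ Submodule.mem_top
    induction ha using span_induction with
    | mem x hx => exact subset_span (Finset.mem_image_of_mem _ hx)
    | zero => exact (map_zero ψ).symm ▸ zero_mem _
    | add x y _ _ hx hy => exact (map_add ψ x y).symm ▸ add_mem hx hy
    | smul p x _ hx =>
      have : ψ (p • x) = MvPolynomial.aeval (R := ℚ) τ p • ψ x := by
        rw [Algebra.smul_def, map_mul, Algebra.smul_def]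
        exact congr_arg (· * _) (hφ p)
      exact this ▸ smul_mem _ _ hx
  have : FiniteDimensional ℚ (Subalgebra.toSubmodule ψ.range) := Submodule.finiteDimensional_of_le hspan
  have : Module.Finite ℚ ψ.range := this
  have h1 : finrank ℚ ψ.range ≤ T.card := (Submodule.finrank_mono hspan).trans
    ((finrank_span_finset_le_card _).trans Finset.card_image_le)
  have h2 := minpoly.algebraMap_eq (A := ℚ) (B := ψ.range) (B' := Ω) Subtype.val_injective ⟨ψ s, s, rfl⟩
  exact (h2 ▸ minpoly.natDegree_le _ : (minpoly ℚ (ψ s)).natDegree ≤ _).trans h1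

end

section

open Finset

/-- **The theorem on unit equations** for groups of finite rank. -/
theorem unitEq_of_finiteRank {K : Type*} [Field K] [CharZero K] {G Γ₀ : Subgroup Kˣ} (hΓ₀ : Γ₀.FG)
    (hG : ∀ g ∈ G, ∃ k ≠ 0, g ^ k ∈ Γ₀) : UnitEq G := by
  classical
  intro ι _ _ a x 𝒰 ha hx hs
  obtain ⟨T, rfl⟩ := hΓ₀
  let X : Finset K := univ.image a ∪ T.image Units.val ∪ T.image fun g => ((g⁻¹ : Kˣ) : K)
  let A := Algebra.adjoin ℚ (X : Set K)
  have hXA : ∀ y ∈ X, y ∈ A := fun y hy => Algebra.subset_adjoin hy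
  have hΓA : Subgroup.closure (T : Set Kˣ) ≤ A.toSubmonoid.units := (Subgroup.closure_le _).2 fun g hg =>
    (Submonoid.mem_units_iff _ _).2 ⟨hXA _ (mem_union_left _ (mem_union_right _ (mem_image_of_mem _ hg))),
      hXA _ (mem_union_right _ (mem_image_of_mem _ hg))⟩
  have : Algebra.FiniteType ℚ A := A.fg_iff_finiteType.1 ⟨X, rfl⟩
  let R := integralClosure A K
  let θ : Rˣ →* Kˣ := Units.map R.val.toMonoidHom
  have hθ : Injective θ := Units.map_injective Subtype.val_injective
  have hlift : ∀ g : Kˣ, (∃ k ≠ 0, g ^ k ∈ Subgroup.closure (T : Set Kˣ)) → ∃ u, θ u = g := by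
    have hint : ∀ g : Kˣ, (∃ k ≠ 0, g ^ k ∈ Subgroup.closure (T : Set Kˣ)) → IsIntegral A (g : K) := by
      rintro g ⟨k, hk, h⟩
      exact .of_pow (Nat.pos_of_ne_zero hk)
        (isIntegral_algebraMap (x := (⟨_, ((Submonoid.mem_units_iff _ _).1 (hΓA h)).1⟩ : A)))
    intro g hg
    have hg' := hint g⁻¹ (hg.imp fun k hk => ⟨hk.1, by rw [inv_pow]; exact inv_mem hk.2⟩)
    exact ⟨⟨⟨g, hint g hg⟩, ⟨_, hg'⟩, Subtype.ext g.mul_inv, Subtype.ext g.inv_mul⟩, Units.ext rfl⟩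
  choose! u hu using hlift
  have hT : Subgroup.closure (T : Set Kˣ) = (Subgroup.closure (T.image u : Finset Rˣ)).map θ := by
    rw [MonoidHom.map_closure, coe_image, Set.image_image]
    congr 1
    refine (Set.image_id _).symm.trans (Set.image_congr fun g hg => (hu g ⟨1, one_ne_zero, ?_⟩).symm)
    rw [pow_one]; exact Subgroup.subset_closure hg
  have : FaithfulSMul A R := (faithfulSMul_iff_algebraMap_injective A R).2 fun x y h =>
    Subtype.ext (congr_arg (Subtype.val : R → K) h)
  have : Algebra.IsAlgebraic ℚ (AlgebraicClosure ℚ) := 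
    Subsingleton.elim (AlgebraicClosure.instAlgebra ℚ) DivisionRing.toRatAlgebra ▸ AlgebraicClosure.isAlgebraic ℚ
  have : Algebra.IsIntegral A R := inferInstanceAs (Algebra.IsIntegral A (integralClosure A K))
  have : IsScalarTower ℚ A R := .of_algebraMap_eq fun _ => rfl
  obtain ⟨d, hd⟩ := exists_specialization (R := R) (Ω := AlgebraicClosure ℚ) (A := A)
  have hxu : ∀ᶠ j in 𝒰, ∀ i, θ (u (x j i)) = x j i := hx.mono fun j hj i => hu _ (hG _ (hj i))
  obtain ⟨i, i', hii, c, hc⟩ := exists_ratio_eq_of_specialization (algebraMap A R).range (Ω := AlgebraicClosure ℚ) (d := d)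
    (by
      rintro _ ⟨f, rfl⟩ hf
      obtain ⟨φ, h1, h2⟩ := hd f fun h => hf (by rw [h, map_zero])
      exact ⟨φ, h1, by rintro _ ⟨s, rfl⟩; exact h2 s⟩)
    (G := G.comap θ) (Γ₀ := Subgroup.closure (T.image u : Finset Rˣ)) ⟨_, rfl⟩
    (fun g hg => ⟨⟨_, ((Submonoid.mem_units_iff _ _).1 (hΓA (hT ▸ Subgroup.mem_map_of_mem θ hg))).1⟩, rfl⟩)
    (fun g hg => by
      obtain ⟨k, hk, h⟩ := hG _ hg
      rw [hT, ← map_pow] at h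
      exact ⟨k, hk, (Subgroup.mem_map_iff_mem hθ).1 h⟩)
    (a := fun i => algebraMap A R ⟨a i, hXA _ (mem_union_left _ (mem_union_left _ (mem_image_of_mem _ (mem_univ i))))⟩)
    (x := fun j i => u (x j i)) (𝒰 := 𝒰) (fun i h => ha i (congr_arg Subtype.val h)) (fun i => ⟨_, rfl⟩)
    (by filter_upwards [hx, hxu] with j hj hj' i; rw [Subgroup.mem_comap, hj']; exact hj i)
    (by
      filter_upwards [hxu, hs] with j hj hs
      refine Subtype.val_injective (Eq.trans ?_ hs)
      rw [AddSubmonoidClass.coe_finsetSum]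
      exact sum_congr rfl fun i _ => congr_arg (a i * ·) (congr_arg Units.val (hj i)))
  refine ⟨i, i', hii, θ c, ?_⟩
  filter_upwards [hxu, hc] with j hj hc
  rw [← hc, map_div, hj, hj]

section

variable {K : Type*} [Field K]

/-- A nonempty vanishing subsum without shorter vanishing subsums. -/
def IsMinimalVanishing {α : Type*} (f : α → K) (t : Finset α) : Prop :=
  t.Nonempty ∧ ∑ i ∈ t, f i = 0 ∧ ∀ t' ⊂ t, t'.Nonempty → ∑ i ∈ t', f i ≠ 0

theorem sum_mul_eq_zero_of_isMinimalVanishing {α : Type*} [DecidableEq α] {f g : α → K} (s : Finset α)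
    (h : ∀ t ⊆ s, IsMinimalVanishing f t → ∑ i ∈ t, f i * g i = 0) (hs : ∑ i ∈ s, f i = 0) :
    ∑ i ∈ s, f i * g i = 0 := by
  induction s using strongInduction with
  | H s ih =>
    obtain rfl | hne := s.eq_empty_or_nonempty
    · simp
    obtain ⟨t, hts, ht⟩ := exists_minimal_le_of_wellFoundedLT (fun t : Finset α => t.Nonempty ∧ ∑ i ∈ t, f i = 0) s ⟨hne, hs⟩
    rw [← sum_sdiff hts] at hs ⊢
    rw [ht.prop.2, add_zero] at hs
    rw [ih _ (sdiff_ssubset hts ht.prop.1) (fun u hu => h u (hu.trans sdiff_subset)) hs, zero_add]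
    exact h t hts ⟨ht.prop.1, ht.prop.2, fun u hu hne h0 => hu.2 (ht.le_of_le ⟨hne, h0⟩ hu.1)⟩

theorem UnitEq.exists_eventually_div_eq {G : Subgroup Kˣ} (hG : UnitEq G) {ι : Type} [Fintype ι] {a : ι → K}
    {x : ℕ → ι → Kˣ} {𝒰 : Ultrafilter ℕ} (hx : ∀ᶠ j in 𝒰, ∀ i, x j i ∈ G)
    (hm : ∀ᶠ j in 𝒰, IsMinimalVanishing (fun i => a i * x j i) univ) (i i' : ι) :
    ∃ c, ∀ᶠ j in 𝒰, x j i / x j i' = c := by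
  classical
  let r : Setoid ι := ⟨fun i i' => ∃ c, ∀ᶠ j in 𝒰, x j i / x j i' = c, fun i => ⟨1, by simp⟩,
    fun ⟨c, hc⟩ => ⟨c⁻¹, hc.mono fun j hj => by rw [← hj, inv_div]⟩,
    fun ⟨c, hc⟩ ⟨d, hd⟩ => ⟨c * d, by filter_upwards [hc, hd] with j h h'; rw [← h, ← h', div_mul_div_cancel]⟩⟩
  by_contra hii
  choose c hc using fun i => r.symm (Quotient.mk_out i)
  have hc := Filter.eventually_all.2 hc
  have hsum : ∀ᶠ j in 𝒰, ∀ q : Quotient r,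
      (∑ i with ⟦i⟧ = q, a i * c i) * x j q.out = ∑ i with ⟦i⟧ = q, a i * x j i := by
    filter_upwards [hc] with j hj q
    rw [sum_mul]
    refine sum_congr rfl fun i hi => ?_
    rw [← (mem_filter.1 hi).2, ← hj i, mul_assoc, ← Units.val_mul, div_mul_cancel]
  have : Nonempty (Quotient r) := ⟨⟦i⟧⟩
  obtain ⟨q, q', hq, h⟩ := hG (Quotient r) (fun q => ∑ i with ⟦i⟧ = q, a i * c i) (fun j q => x j q.out) 𝒰
    (fun q h0 => by
      obtain ⟨j, hj, hm⟩ := (hsum.and hm).exists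
      refine hm.2.2 {i | ⟦i⟧ = q} ((filter_subset _ _).ssubset_of_ne fun h => hii ?_) ⟨q.out, by simp⟩ ?_
      · have := fun i => (mem_filter.1 (h ▸ mem_univ i)).2
        exact Quotient.exact ((this i).trans (this i').symm)
      · rw [← hj, h0, zero_mul])
    (hx.mono fun j hj q => hj _)
    (by
      filter_upwards [hsum, hm] with j hj hm
      rw [sum_congr rfl fun q _ => hj q, sum_fiberwise]
      exact hm.2.1)
  exact hq (Quotient.out_equiv_out.1 h)

/-- The value of a monomial at a point of the torus. -/
def monomialUnit {n : ℕ} (y : Fin n → Kˣ) (m : Fin n →₀ ℕ) : Kˣ := ∏ k, y k ^ m k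

/-- The exponents of the monomials which are proportional on the coset through `y` of the zero set of `F`. -/
def exponents {n : ℕ} (F : Finset (MvPolynomial (Fin n) K)) (y : Fin n → Kˣ) : Set (Fin n → ℤ) :=
  {v | ∃ p ∈ F, ∃ t ⊆ p.support, IsMinimalVanishing (fun m => p.coeff m * (monomialUnit y m : K)) t ∧
    ∃ m ∈ t, ∃ m' ∈ t, v = fun k => (m k : ℤ) - m' k}

theorem prod_zpow_eq_one {n : ℕ} {y : Fin n → Kˣ} {S : Set (Fin n → ℤ)} (h : ∀ m ∈ S, ∏ k, y k ^ m k = 1) :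
    ∀ m ∈ AddSubgroup.closure S, ∏ k, y k ^ m k = 1 := by
  intro m hm
  induction hm using AddSubgroup.closure_induction with
  | mem m hm => exact h m hm
  | zero => simp
  | add m m' _ _ h h' => simp [zpow_add, prod_mul_distrib, h, h']
  | neg m _ h => simp [h]

theorem prod_zpow_sub {n : ℕ} (y : Fin n → Kˣ) (m m' : Fin n →₀ ℕ) :
    ∏ k, y k ^ ((m k : ℤ) - m' k) = monomialUnit y m / monomialUnit y m' := by
  simp [monomialUnit, zpow_sub, div_eq_mul_inv, prod_mul_distrib]

theorem eval_mul_eq_zero {n : ℕ} {F : Finset (MvPolynomial (Fin n) K)} {y h : Fin n → Kˣ}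
    (hy : ∀ p ∈ F, MvPolynomial.eval (fun k => (y k : K)) p = 0) (hh : ∀ m ∈ exponents F y, ∏ k, h k ^ m k = 1) :
    ∀ p ∈ F, MvPolynomial.eval (fun k => ((y * h) k : K)) p = 0 := by
  classical
  intro p hp
  have hmon : ∀ y : Fin n → Kˣ, MvPolynomial.eval (fun k => (y k : K)) p =
      ∑ m ∈ p.support, p.coeff m * (monomialUnit y m : K) := fun y => by
    simp [MvPolynomial.eval_eq', monomialUnit]
  have hy := hy p hp
  rw [hmon] at hy ⊢
  refine (sum_congr rfl fun m _ => ?_).trans (sum_mul_eq_zero_of_isMinimalVanishing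
    (g := fun m => (monomialUnit h m : K)) p.support (fun t hts ht => ?_) hy)
  · simp [monomialUnit, mul_pow, prod_mul_distrib, mul_assoc]
  · obtain ⟨o, ho⟩ := ht.1
    rw [← zero_mul (monomialUnit h o : K), ← ht.2.1, sum_mul]
    refine sum_congr rfl fun m hm => ?_
    have := hh _ ⟨p, hp, t, hts, ht, m, hm, o, ho, rfl⟩
    rw [prod_zpow_sub, div_eq_one] at this
    rw [this]

theorem exists_lt_of_unitEq {n : ℕ} {G : Subgroup Kˣ} (hG : UnitEq G) (F : Finset (MvPolynomial (Fin n) K))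
    {y : ℕ → Fin n → Kˣ} (hy : ∀ j k, y j k ∈ G) :
    ∃ i j, i < j ∧ ∀ m ∈ exponents F (y i), ∏ k, ((y i)⁻¹ * y j) k ^ m k = 1 := by
  classical
  let 𝒰 : Ultrafilter ℕ := Filter.hyperfilter ℕ
  have key : ∀ p ∈ F, ∀ t ∈ p.support.powerset, ∀ m ∈ t, ∀ m' ∈ t, ∃ c : Prop × Kˣ, ∀ᶠ j in 𝒰,
      (IsMinimalVanishing (fun m => p.coeff m * (monomialUnit (y j) m : K)) t ↔ c.1) ∧
        (c.1 → monomialUnit (y j) m / monomialUnit (y j) m' = c.2) := by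
    intro p _ t _ m hm m' hm'
    by_cases h : ∀ᶠ j in 𝒰, IsMinimalVanishing (fun m => p.coeff m * (monomialUnit (y j) m : K)) t
    · obtain ⟨c, hc⟩ := hG.exists_eventually_div_eq (ι := t) (a := fun m => p.coeff m)
        (x := fun j m => monomialUnit (y j) m) (𝒰 := 𝒰)
        (.of_forall fun j m => prod_mem fun k _ => pow_mem (hy j k) _)
        (h.mono fun j hj => ⟨univ_nonempty_iff.2 hj.1.to_subtype, by
          rw [← hj.2.1]; exact sum_coe_sort t fun m => p.coeff m * (monomialUnit (y j) m : K), fun u hu hne => by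
          refine (sum_map u (.subtype _) fun m => p.coeff m * (monomialUnit (y j) m : K)) ▸ hj.2.2 _ ⟨fun m hm => ?_, fun h => hu.2 fun m _ => ?_⟩ (hne.map)
          · obtain ⟨m, -, rfl⟩ := mem_map.1 hm; exact m.2
          · obtain ⟨m', h, e⟩ := mem_map.1 (h m.2); exact Subtype.ext e ▸ h⟩) ⟨m, hm⟩ ⟨m', hm'⟩
      exact ⟨⟨True, c⟩, (h.and hc).mono fun j hj => ⟨iff_true_intro hj.1, fun _ => hj.2⟩⟩
    · exact ⟨⟨False, 1⟩, (Ultrafilter.eventually_not.2 h).mono fun j hj => ⟨iff_false_intro hj, False.elim⟩⟩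
  choose! c hc using key
  have hc := (eventually_all_finset F).2 fun p hp => (eventually_all_finset _).2 fun t ht =>
    (eventually_all_finset t).2 fun m hm => (eventually_all_finset t).2 fun m' hm' => hc p hp t ht m hm m' hm'
  obtain ⟨i, hi⟩ := hc.exists
  obtain ⟨j, hj, hij⟩ := (hc.and ((Filter.eventually_gt_atTop i).filter_mono Nat.hyperfilter_le_atTop)).exists
  refine ⟨i, j, hij, ?_⟩
  rintro _ ⟨p, hp, t, hts, ht, m, hm, m', hm', rfl⟩
  have hi := hi p hp t (mem_powerset.2 hts) m hm m' hm'
  have h := hi.1.1 ht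
  have h3 : ∏ k, ((y i)⁻¹ * y j) k ^ ((m k : ℤ) - m' k) =
      (∏ k, y i k ^ ((m k : ℤ) - m' k))⁻¹ * ∏ k, y j k ^ ((m k : ℤ) - m' k) := by
    simp only [Pi.mul_apply, Pi.inv_apply, mul_zpow, prod_mul_distrib, inv_zpow, prod_inv_distrib]
  rw [h3, prod_zpow_sub, prod_zpow_sub, hi.2 h, (hj p hp t (mem_powerset.2 hts) m hm m' hm').2 h, inv_mul_cancel]

theorem exists_unitEq_of_fg [CharZero K] {n : ℕ} {Γ Γ₀ : Subgroup (Fin n → Kˣ)} (hΓ₀ : Γ₀.FG)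
    (hΓ : ∀ g ∈ Γ, ∃ k : ℕ, 1 ≤ k ∧ g ^ k ∈ Γ₀) : ∃ G : Subgroup Kˣ, UnitEq G ∧ ∀ g ∈ Γ, ∀ i, g i ∈ G := by
  classical
  obtain ⟨T, rfl⟩ := hΓ₀
  let Δ := Subgroup.closure ((univ.biUnion fun i => T.image (· i) : Finset Kˣ) : Set Kˣ)
  have hG : ∀ g, g ∈ (CommGroup.torsion (Kˣ ⧸ Δ)).comap (QuotientGroup.mk' Δ) ↔ ∃ k, 0 < k ∧ g ^ k ∈ Δ := fun g =>
    isOfFinOrder_iff_pow_eq_one.trans <| by simp_rw [← map_pow, QuotientGroup.mk'_apply, QuotientGroup.eq_one_iff]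
  refine ⟨_, unitEq_of_finiteRank (Γ₀ := Δ) ⟨_, rfl⟩ fun g hg => ?_, fun g hg i => (hG _).2 ?_⟩
  · exact ((hG g).1 hg).imp fun k hk => ⟨hk.1.ne', hk.2⟩
  · obtain ⟨k, hk, h⟩ := hΓ g hg
    refine ⟨k, hk, (Subgroup.closure_le (Δ.comap (Pi.evalMonoidHom (fun _ : Fin n => Kˣ) i))).2 (fun t ht => ?_) h⟩
    exact Subgroup.subset_closure (mem_biUnion.2 ⟨i, mem_univ i, mem_image_of_mem _ ht⟩)

end

end

end TorusML

open Pointwise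

/-- **Laurent's theorem (Mordell–Lang for algebraic tori).**
Let `K` be an algebraically closed field of characteristic `0` and `n ≥ 1`. Let
`W ⊆ (Kˣ)ⁿ` be the zero set in the torus of a set `I` of polynomials over `K`, and let
`Γ ≤ (Kˣ)ⁿ` be a subgroup of finite rank. Then there are `N`, elements `γ₁, …, γ_N ∈ Γ` and
subgroups `Λ₁, …, Λ_N` of `ℤⁿ` such that, with `Hᵢ` the algebraic subgroup of the torus cut
out by the characters with exponents in `Λᵢ`, each coset `γᵢ·Hᵢ` is contained in `W` and
`W ∩ Γ = ⋃ᵢ (γᵢ·Hᵢ ∩ Γ)`. -/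
theorem mordell_lang_for_tori {K : Type*} [Field K] [IsAlgClosed K] [CharZero K]
    (n : ℕ) (hn : 1 ≤ n)
    (I : Set (MvPolynomial (Fin n) K)) (W : Set (Fin n → Kˣ))
    (hW : W = {y : Fin n → Kˣ | ∀ p ∈ I, MvPolynomial.eval (fun j => (y j : K)) p = 0})
    (Γ : Subgroup (Fin n → Kˣ))
    (hΓ : ∃ Γ₀ : Subgroup (Fin n → Kˣ), Γ₀ ≤ Γ ∧ Γ₀.FG ∧ ∀ g ∈ Γ, ∃ k : ℕ, 1 ≤ k ∧ g ^ k ∈ Γ₀) :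
    ∃ (N : ℕ) (γ : Fin N → (Fin n → Kˣ)) (Λ : Fin N → AddSubgroup (Fin n → ℤ)), (∀ i, γ i ∈ Γ) ∧
      (∀ i, γ i • {y : Fin n → Kˣ | ∀ m ∈ Λ i, ∏ j, (y j) ^ (m j) = 1} ⊆ W) ∧
      W ∩ (Γ : Set (Fin n → Kˣ)) = ⋃ i, (γ i • {y : Fin n → Kˣ | ∀ m ∈ Λ i, ∏ j, (y j) ^ (m j) = 1}
          ∩ (Γ : Set (Fin n → Kˣ))) := by
  classical
  obtain ⟨Γ₀, -, hfg, hΓ₀⟩ := hΓ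
  obtain ⟨G, hG, hΓG⟩ := TorusML.exists_unitEq_of_fg hfg hΓ₀
  obtain ⟨F, -, hF⟩ := (Submodule.fg_span_iff_fg_span_finset_subset I).1 (IsNoetherian.noetherian (Ideal.span I))
  have hWF : ∀ y, y ∈ W ↔ ∀ p ∈ F, MvPolynomial.eval (fun j => (y j : K)) p = 0 := fun y => by
    have h : ∀ S : Set (MvPolynomial (Fin n) K), (∀ p ∈ S, MvPolynomial.eval (fun j => (y j : K)) p = 0) ↔
        Ideal.span S ≤ RingHom.ker (MvPolynomial.eval fun j => (y j : K)) := fun S => (Ideal.span_le (I := RingHom.ker _)).symm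
    rw [hW]
    exact (h I).trans ((congr_arg (· ≤ _) hF).to_iff.trans (h F).symm)
  have hsub : ∀ y ∈ W, y • {h : Fin n → Kˣ | ∀ m ∈ AddSubgroup.closure (TorusML.exponents F y), ∏ j, h j ^ m j = 1} ⊆ W := by
    rintro y hy _ ⟨h, hh, rfl⟩
    exact (hWF _).2 (TorusML.eval_mul_eq_zero ((hWF y).1 hy) fun m hm => hh m (AddSubgroup.subset_closure hm))
  obtain ⟨s, hs, hcov⟩ : ∃ s : Finset (Fin n → Kˣ), (∀ x ∈ s, x ∈ W ∧ x ∈ Γ) ∧ ∀ y, y ∈ W ∧ y ∈ Γ →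
      ∃ x ∈ s, ∀ m ∈ TorusML.exponents F x, ∏ j, (x⁻¹ * y) j ^ m j = 1 := by
    by_contra! h
    obtain ⟨y, hy, hr⟩ := exists_seq_of_forall_finset_exists (fun y => y ∈ W ∧ y ∈ Γ)
      (fun x y => ∃ m ∈ TorusML.exponents F x, ∏ j, (x⁻¹ * y) j ^ m j ≠ 1) h
    obtain ⟨i, j, hij, h⟩ := TorusML.exists_lt_of_unitEq hG F fun j => hΓG _ (hy j).2
    obtain ⟨m, hm, hne⟩ := hr i j hij
    exact hne (h m hm)
  have hsγ := fun i => hs _ (s.equivFin.symm i).2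
  refine ⟨s.card, fun i => s.equivFin.symm i, fun i => AddSubgroup.closure (TorusML.exponents F (s.equivFin.symm i)),
    fun i => (hsγ i).2, fun i => hsub _ (hsγ i).1, Set.Subset.antisymm ?_ ?_⟩
  · rintro y ⟨hyW, hyΓ⟩
    obtain ⟨x, hx, h⟩ := hcov y ⟨hyW, hyΓ⟩
    refine Set.mem_iUnion.2 ⟨s.equivFin ⟨x, hx⟩, ?_, hyΓ⟩
    simp only [Equiv.symm_apply_apply]
    rw [Set.mem_smul_set_iff_inv_smul_mem]
    exact TorusML.prod_zpow_eq_one h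
  · rintro y hy
    obtain ⟨i, hi, hyΓ⟩ := Set.mem_iUnion.1 hy
    exact ⟨hsub _ (hsγ i).1 hi, hyΓ⟩
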